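/- Let 𝒩 be the set of positive integers expressible in the form (p₁+1)^{α₁}(p₂+1)^{α₂}⋯(p_k+1)^{α_k} for primes p₁, …, p_k and positive integer exponents α₁, …, α_k (with 1 ∈ 𝒩 as the empty product), and let N(x) be its counting function. Then for every ε > 0 there exists x₀ such that for all x ≥ x₀, (x / log x) · exp((0.8178 − ε)(log log log x)²) ≤ N(x) ≤ (x / log x) · exp((0.8179 + ε)(log log log x)²). -/

import Mathlib

/-- The set of positive integers expressible as a product
`(p₁+1)^α₁ ⋯ (p_k+1)^α_k` over primes `pᵢ` (with `1` as the empty product):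
the multiplicative closure of `{p + 1 : p prime}`. -/
def paleyMonoid : Set ℕ :=
  ↑(Submonoid.closure {m : ℕ | ∃ p : ℕ, p.Prime ∧ m = p + 1})

/-- The counting function of `paleyMonoid`. -/
noncomputable def Ncount (x : ℝ) : ℕ :=
  {n : ℕ | n ∈ paleyMonoid ∧ (n : ℝ) ≤ x}.ncard

open Finset Real

/-- The iterated logarithm, normalized so as to be nonnegative on `[1, ∞)`. -/
noncomputable def iterLog (y : ℝ) : ℝ := log (1 + log y)

/-- The primes not exceeding a real number `y`. -/
noncomputable def primesUpTo (y : ℝ) : Finset ℕ := (Finset.Icc 1 ⌊y⌋₊).filter Nat.Prime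

lemma mem_primesUpTo {y : ℝ} {p : ℕ} : p ∈ primesUpTo y ↔ p.Prime ∧ (p : ℝ) ≤ y := by
  simp only [primesUpTo, mem_filter, mem_Icc]
  constructor
  · rintro ⟨⟨h1, h2⟩, hp⟩
    exact ⟨hp, (Nat.le_floor_iff' hp.ne_zero).1 h2⟩
  · rintro ⟨hp, h⟩
    exact ⟨⟨hp.one_lt.le, (Nat.le_floor_iff' hp.ne_zero).2 h⟩, hp⟩

lemma primesUpTo_floor (y : ℝ) : primesUpTo (⌊y⌋₊ : ℝ) = primesUpTo y := by
  simp [primesUpTo]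

lemma primesUpTo_mono {y z : ℝ} (h : y ≤ z) : primesUpTo y ⊆ primesUpTo z := fun p hp => by
  rw [mem_primesUpTo] at hp ⊢
  exact ⟨hp.1, hp.2.trans h⟩

lemma primesUpTo_succ (n : ℕ) : primesUpTo ((n + 1 : ℕ) : ℝ) =
    if (n + 1).Prime then insert (n + 1) (primesUpTo (n : ℝ)) else primesUpTo (n : ℝ) := by
  ext p
  split_ifs with h
  · simp only [mem_insert, mem_primesUpTo, Nat.cast_le]
    constructor
    · rintro ⟨hp, h1⟩
      rcases Nat.lt_or_ge n p with h2 | h2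
      · left; omega
      · right; exact ⟨hp, h2⟩
    · rintro (rfl | ⟨hp, h1⟩)
      · exact ⟨h, le_rfl⟩
      · exact ⟨hp, by omega⟩
  · simp only [mem_primesUpTo, Nat.cast_le]
    constructor
    · rintro ⟨hp, h1⟩
      refine ⟨hp, ?_⟩
      rcases Nat.lt_or_ge n p with h2 | h2
      · have : p = n + 1 := by omega
        exact absurd (this ▸ hp) h
      · exact h2
    · rintro ⟨hp, h1⟩
      exact ⟨hp, by omega⟩

/-- The sum of the reciprocals of the primes up to `y`. -/
noncomputable def primeRecipSum (y : ℝ) : ℝ := ∑ p ∈ primesUpTo y, 1 / (p : ℝ)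

/-- The sum of `log p / p` over the primes up to `y`. -/
noncomputable def primeLogSum (y : ℝ) : ℝ := ∑ p ∈ primesUpTo y, log p / (p : ℝ)

lemma log_factorial_eq (n : ℕ) :
    log (n.factorial : ℝ) = ∑ p ∈ primesUpTo n, (n.factorial.factorization p : ℝ) * log p := by
  have h0 : n.factorial ≠ 0 := n.factorial_ne_zero
  have h := Nat.prod_factorization_pow_eq_self h0
  conv_lhs => rw [← h]
  rw [Finsupp.prod, Nat.cast_prod, Real.log_prod]
  · rw [Nat.support_factorization]
    have : n.factorial.primeFactors = primesUpTo n := by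
      ext p
      rw [mem_primesUpTo, Nat.mem_primeFactors]
      constructor
      · rintro ⟨hp, hd, -⟩
        exact ⟨hp, by exact_mod_cast (hp.dvd_factorial).1 hd⟩
      · rintro ⟨hp, hd⟩
        exact ⟨hp, (hp.dvd_factorial).2 (by exact_mod_cast hd), h0⟩
    rw [this]
    refine sum_congr rfl fun p hp => ?_
    push_cast
    rw [Real.log_pow]
  · intro p hp
    have : p ≠ 0 := by
      rintro rfl
      simp at hp
    positivity

lemma summable_log_div_sq : Summable fun n : ℕ => 2 * (log n / (n : ℝ) ^ 2) := by
  apply Summable.mul_left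
  have h : Summable fun n : ℕ => (2 : ℝ) * (1 / (n : ℝ) ^ (3 / 2 : ℝ)) :=
    (Real.summable_one_div_nat_rpow.2 (by norm_num)).mul_left 2
  refine Summable.of_nonneg_of_le (fun n => ?_) (fun n => ?_) h
  · have := Real.log_natCast_nonneg n
    positivity
  · rcases Nat.eq_zero_or_pos n with rfl | hn
    · simp
    have hn' : (0 : ℝ) < n := by exact_mod_cast hn
    have h1 : log n ≤ (n : ℝ) ^ (1 / 2 : ℝ) / (1 / 2) := Real.log_le_rpow_div hn'.le (by norm_num)
    have h2 : (n : ℝ) ^ 2 = (n : ℝ) ^ (1 / 2 : ℝ) * (n : ℝ) ^ (3 / 2 : ℝ) := by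
      rw [← Real.rpow_add hn', ← Real.rpow_natCast]; norm_num
    rw [h2]
    have h3 : 0 < (n : ℝ) ^ (1 / 2 : ℝ) := by positivity
    have h4 : 0 < (n : ℝ) ^ (3 / 2 : ℝ) := by positivity
    rw [div_le_iff₀ (by positivity)]
    calc log n ≤ _ := h1
      _ = _ := by field_simp

/-- Mertens' first theorem. -/
lemma exists_abs_primeLogSum_sub_log_le :
    ∃ C : ℝ, 0 < C ∧ ∀ n : ℕ, 1 ≤ n → |primeLogSum n - log n| ≤ C := by
  set K := ∑' n : ℕ, 2 * (log n / (n : ℝ) ^ 2) with hK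
  have hK0 : 0 ≤ K := tsum_nonneg fun n => by
    have := Real.log_natCast_nonneg n
    positivity
  refine ⟨K + 2, by linarith, fun n hn => ?_⟩
  have hn' : (0 : ℝ) < n := by exact_mod_cast hn
  have hfac := log_factorial_eq n
  have hup : log (n.factorial : ℝ) ≤ n * log n := by
    rw [← Real.log_pow]
    apply Real.log_le_log (by positivity)
    exact_mod_cast Nat.factorial_le_pow n
  have hlow : n * log n - n ≤ log (n.factorial : ℝ) := by
    have h1 : (n : ℝ) ^ n / n.factorial ≤ exp n := Real.pow_div_factorial_le_exp _ hn'.le n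
    have h2 := Real.log_le_log (by positivity) h1
    rw [Real.log_div (by positivity) (by positivity), Real.log_pow, Real.log_exp] at h2
    linarith
  have hval : ∀ p ∈ primesUpTo n, (n : ℝ) / p - 1 ≤ (n.factorial.factorization p : ℝ) ∧
      (n.factorial.factorization p : ℝ) ≤ n / p + n * (2 / (p : ℝ) ^ 2) := by
    intro p hp
    rw [mem_primesUpTo] at hp
    have hpp := hp.1
    have : Fact p.Prime := ⟨hpp⟩
    have hp2 : (2 : ℝ) ≤ p := by exact_mod_cast hpp.two_le
    constructor
    · have h1 : n / p ≤ n.factorial.factorization p := by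
        rw [← Nat.Prime.pow_dvd_iff_le_factorization hpp n.factorial_ne_zero]
        have h3 : p ^ (n / p) ∣ (p * (n / p)).factorial := by
          generalize n / p = k
          induction k with
          | zero => simp
          | succ k ih =>
            rw [pow_succ]
            have h5 : (p * k).factorial * (p * (k + 1)) ∣ (p * (k + 1)).factorial := by
              have : p * (k + 1) = (p * (k + 1) - 1) + 1 :=
                (Nat.succ_pred_eq_of_pos (Nat.mul_pos hpp.pos (Nat.succ_pos k))).symm
              rw [this, Nat.factorial_succ, mul_comm, ← this]
              apply Nat.mul_dvd_mul_left
              apply Nat.factorial_dvd_factorial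
              have h6 := Nat.mul_succ p k
              have h7 := hpp.pos
              simp only [Nat.succ_eq_add_one] at h6
              omega
            exact (Nat.mul_dvd_mul ih (Dvd.intro _ rfl)).trans h5
        exact h3.trans (Nat.factorial_dvd_factorial (Nat.mul_div_le n p))
      have h2 : (n : ℝ) / p < (n / p : ℕ) + 1 := by
        rw [div_lt_iff₀ (by positivity)]
        exact_mod_cast Nat.lt_mul_of_div_lt (by omega) hpp.pos
      have : ((n / p : ℕ) : ℝ) ≤ n.factorial.factorization p := by exact_mod_cast h1
      linarith
    · have h1 := sub_one_mul_padicValNat_factorial (p := p) n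
      rw [Nat.factorization_def _ hpp]
      have h2 : ((p - 1 : ℕ) : ℝ) * padicValNat p n.factorial ≤ n := by
        exact_mod_cast h1 ▸ Nat.sub_le _ _
      rw [Nat.cast_sub hpp.one_lt.le, Nat.cast_one] at h2
      have h3 : (padicValNat p n.factorial : ℝ) ≤ n / (p - 1) := by
        rw [le_div_iff₀ (by linarith)]; linarith
      refine h3.trans ?_
      rw [div_add' _ _ _ (by positivity), div_le_div_iff₀ (by linarith) (by positivity)]
      have : (n : ℝ) * (2 / (p : ℝ) ^ 2) * p = n * (2 / p) := by field_simp
      rw [this]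
      have h4 : (2 / (p : ℝ)) * p = 2 := by field_simp
      have h5 : 2 / (p : ℝ) ≤ 1 := by rw [div_le_one (by positivity)]; exact hp2
      nlinarith
  have hlogp : ∀ p ∈ primesUpTo n, 0 ≤ log (p : ℝ) := fun p _ => Real.log_natCast_nonneg p
  rw [abs_le]
  constructor
  · have h1 : log (n.factorial : ℝ) ≤ n * primeLogSum n + n * K := by
      rw [hfac]
      calc _ ≤ ∑ p ∈ primesUpTo n, (n * (log p / p) + n * (2 * (log p / (p : ℝ) ^ 2))) := by
            refine sum_le_sum fun p hp => ?_
            refine (mul_le_mul_of_nonneg_right (hval p hp).2 (hlogp p hp)).trans (le_of_eq ?_)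
            ring
        _ = n * primeLogSum n + n * ∑ p ∈ primesUpTo n, (2 * (log p / (p : ℝ) ^ 2)) := by
            rw [sum_add_distrib, ← mul_sum, ← mul_sum, primeLogSum]
        _ ≤ _ := by
            gcongr
            refine summable_log_div_sq.sum_le_tsum _ fun i _ => ?_
            have := Real.log_natCast_nonneg i
            positivity
    have h2 : (n : ℝ) * (log n - 1) ≤ n * (primeLogSum n + K) := by linarith
    have := le_of_mul_le_mul_left h2 hn'
    linarith
  · have h1 : n * primeLogSum n - log 4 * n ≤ log (n.factorial : ℝ) := by
      rw [hfac]
      have hth : ∑ p ∈ primesUpTo n, log (p : ℝ) ≤ log 4 * n := by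
        have := Chebyshev.theta_le_log4_mul_x hn'.le
        rw [Chebyshev.theta_eq_sum_Icc] at this
        refine le_trans (sum_le_sum_of_subset_of_nonneg ?_ ?_) this
        · intro p hp
          rw [mem_primesUpTo] at hp
          simp only [mem_filter, mem_Icc, Nat.floor_natCast]
          exact ⟨⟨Nat.zero_le _, by exact_mod_cast hp.2⟩, hp.1⟩
        · intro p _ _
          exact Real.log_natCast_nonneg p
      calc _ ≤ n * primeLogSum n - ∑ p ∈ primesUpTo n, log (p : ℝ) := by linarith
        _ = ∑ p ∈ primesUpTo n, ((n : ℝ) / p - 1) * log p := by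
            rw [primeLogSum, mul_sum, ← sum_sub_distrib]
            refine sum_congr rfl fun p _ => by ring
        _ ≤ _ := sum_le_sum fun p hp => mul_le_mul_of_nonneg_right (hval p hp).1 (hlogp p hp)
    have h4 : log 4 ≤ 2 := by
      have : (4 : ℝ) = 2 ^ 2 := by norm_num
      rw [this, Real.log_pow]
      have := Real.log_two_lt_d9
      push_cast; linarith
    have h2 : (n : ℝ) * (primeLogSum n - 2) ≤ n * log n := by nlinarith
    have := le_of_mul_le_mul_left h2 hn'
    linarith

lemma primeRecipSum_succ (n : ℕ) : primeRecipSum ((n + 1 : ℕ) : ℝ) = primeRecipSum n +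
    (primeLogSum ((n + 1 : ℕ) : ℝ) - primeLogSum n) / log ((n + 1 : ℕ) : ℝ) := by
  unfold primeRecipSum primeLogSum
  rw [primesUpTo_succ]
  split_ifs with h
  · have hn : n + 1 ∉ primesUpTo (n : ℝ) := by
      rw [mem_primesUpTo]; rintro ⟨-, h⟩
      have : n + 1 ≤ n := by exact_mod_cast h
      omega
    rw [sum_insert hn, sum_insert hn]
    have : 0 < log ((n + 1 : ℕ) : ℝ) := Real.log_pos (by exact_mod_cast h.one_lt)
    have : (0 : ℝ) < ((n + 1 : ℕ) : ℝ) := by positivity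
    field_simp
    ring
  · simp

lemma abs_primeRecipSum_sub_nat : ∃ C : ℝ, 0 < C ∧ ∀ n : ℕ, 2 ≤ n →
    |primeRecipSum n - iterLog n| ≤ C := by
  obtain ⟨C, hC, hR⟩ := exists_abs_primeLogSum_sub_log_le
  have hl2 : (0 : ℝ) < log 2 := Real.log_pos one_lt_two
  have key : ∀ n : ℕ, 2 ≤ n → ∃ D : ℝ,
      |primeRecipSum n - (primeLogSum n - log n) / log n - D| ≤ C / log 2 - C / log n ∧
      iterLog n ≤ D ∧ D ≤ 1 + log (log n) - log (log 2) := by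
    intro n hn
    induction n, hn using Nat.le_induction with
    | base =>
      have h2 : primesUpTo ((2 : ℕ) : ℝ) = {2} := by
        ext p; rw [mem_primesUpTo, mem_singleton, Nat.cast_le]
        exact ⟨fun h => le_antisymm h.2 h.1.two_le, by rintro rfl; exact ⟨Nat.prime_two, le_rfl⟩⟩
      refine ⟨1, ?_, ?_, by simp⟩
      · rw [primeRecipSum, primeLogSum, h2]
        simp only [sum_singleton, Nat.cast_ofNat, sub_self]
        have : 1 / (2 : ℝ) - (log 2 / 2 - log 2) / log 2 - 1 = 0 := by field_simp; ring
        rw [this]; simp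
      · rw [iterLog]
        have := Real.log_le_sub_one_of_pos (show 0 < 1 + log ((2 : ℕ) : ℝ) by positivity)
        have h3 := Real.log_two_lt_d9
        push_cast at *
        linarith
    | succ n hn ih =>
      obtain ⟨D, h1, h2, h3⟩ := ih
      have hn' : (2 : ℝ) ≤ n := by exact_mod_cast hn
      set x := log (n : ℝ) with hx
      set y := log ((n + 1 : ℕ) : ℝ) with hy
      have hx0 : 0 < x := Real.log_pos (by linarith)
      have hxy : x < y := Real.log_lt_log (by linarith) (by push_cast; linarith)
      have hyx : y ≤ 1 + x := by
        have : y - x ≤ 1 := by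
          rw [hx, hy, ← Real.log_div (by positivity) (by positivity)]
          refine (Real.log_le_sub_one_of_pos (by positivity)).trans ?_
          rw [sub_le_iff_le_add, div_le_iff₀ (by linarith)]; push_cast; linarith
        linarith
      have hy0 : 0 < y := hx0.trans hxy
      refine ⟨D + (y - x) / y, ?_, ?_, ?_⟩
      · rw [primeRecipSum_succ]
        have hRn := hR n (by omega)
        set R := primeLogSum n - x with hRdef
        set R' := primeLogSum ((n + 1 : ℕ) : ℝ)
        have e : primeRecipSum n + (R' - primeLogSum n) / y - (R' - y) / y - (D + (y - x) / y) =
            (primeRecipSum n - R / x - D) + R * (1 / x - 1 / y) := by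
          rw [hRdef]; field_simp; ring
        rw [e]
        have hxy' : 0 ≤ 1 / x - 1 / y := by
          rw [sub_nonneg]; exact one_div_le_one_div_of_le hx0 hxy.le
        calc _ ≤ |primeRecipSum n - R / x - D| + |R * (1 / x - 1 / y)| := abs_add_le _ _
          _ ≤ (C / log 2 - C / x) + C * (1 / x - 1 / y) := by
            rw [abs_mul, abs_of_nonneg hxy']
            gcongr
          _ = _ := by ring
      · have : iterLog ((n + 1 : ℕ) : ℝ) - iterLog n ≤ (y - x) / y := by
          rw [iterLog, iterLog, ← hx, ← hy, ← Real.log_div (by positivity) (by positivity)]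
          refine (Real.log_le_sub_one_of_pos (by positivity)).trans ?_
          rw [div_sub_one (by positivity), add_sub_add_left_eq_sub]
          apply div_le_div_of_nonneg_left (by linarith) hy0 hyx
        linarith
      · have : (y - x) / y ≤ log y - log x := by
          have := Real.log_le_sub_one_of_pos (show 0 < x / y by positivity)
          rw [Real.log_div hx0.ne' hy0.ne'] at this
          rw [sub_div, div_self hy0.ne']; linarith
        linarith
  refine ⟨2 * C / log 2 + 1 - log (log 2), ?_, fun n hn => ?_⟩
  · have : log (log 2) ≤ 0 := Real.log_nonpos hl2.le (by have := Real.log_two_lt_d9; linarith)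
    have : 0 < 2 * C / log 2 := by positivity
    linarith
  obtain ⟨D, h1, h2, h3⟩ := key n hn
  have hn' : (2 : ℝ) ≤ n := by exact_mod_cast hn
  have hx2 : log 2 ≤ log n := Real.log_le_log (by norm_num) hn'
  have hx0 : 0 < log (n : ℝ) := hl2.trans_le hx2
  have h4 : log (log (n : ℝ)) ≤ iterLog n := Real.log_le_log hx0 (by linarith)
  have h5 : |(primeLogSum n - log n) / log n| ≤ C / log 2 := by
    rw [abs_div, abs_of_pos hx0]
    exact div_le_div₀ hC.le (hR n (by omega)) hl2 hx2
  have h6 : 0 ≤ C / log (n : ℝ) := by positivity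
  have h7 : log (log 2) ≤ 0 :=
    Real.log_nonpos hl2.le (by have := Real.log_two_lt_d9; linarith)
  have h8 : 2 * C / log 2 = C / log 2 + C / log 2 := by ring
  rw [abs_le] at h1 h5 ⊢
  constructor <;> linarith [h1.1, h1.2, h5.1, h5.2]

/-- Mertens' second theorem. -/
lemma exists_abs_primeRecipSum_sub_iterLog_le :
    ∃ C : ℝ, 0 < C ∧ ∀ y : ℝ, 1 ≤ y → |primeRecipSum y - iterLog y| ≤ C := by
  obtain ⟨C, hC, h⟩ := abs_primeRecipSum_sub_nat
  refine ⟨C + 1, by linarith, fun y hy => ?_⟩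
  set n := ⌊y⌋₊ with hn
  have hn1 : 1 ≤ n := Nat.le_floor (by exact_mod_cast hy)
  have hny : (n : ℝ) ≤ y := Nat.floor_le (by linarith)
  have hyn : y < n + 1 := Nat.lt_floor_add_one y
  have hn1' : (1 : ℝ) ≤ n := by exact_mod_cast hn1
  have e : primeRecipSum y = primeRecipSum n := by
    rw [primeRecipSum, primeRecipSum, hn, primesUpTo_floor]
  have hlogn : 0 ≤ log (n : ℝ) := Real.log_nonneg hn1'
  have hl : log y ≤ log n + 1 := by
    have : log y - log n ≤ 1 := by
      rw [← Real.log_div (by positivity) (by positivity)]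
      refine (Real.log_le_sub_one_of_pos (by positivity)).trans ?_
      rw [sub_le_iff_le_add, div_le_iff₀ (by linarith)]; linarith
    linarith
  have hl' : log n ≤ log y := Real.log_le_log (by linarith) hny
  have h1 : iterLog n ≤ iterLog y := Real.log_le_log (by linarith) (by linarith)
  have h2 : iterLog y ≤ iterLog n + 1 := by
    have : iterLog y - iterLog n ≤ 1 := by
      rw [iterLog, iterLog, ← Real.log_div (by linarith) (by linarith)]
      refine (Real.log_le_sub_one_of_pos (div_pos (by linarith) (by linarith))).trans ?_
      rw [sub_le_iff_le_add, div_le_iff₀ (by linarith)]; linarith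
    linarith
  have h3 : |primeRecipSum n - iterLog n| ≤ C := by
    rcases hn1.eq_or_lt with h0 | h0
    · rw [← h0]
      have : primesUpTo ((1 : ℕ) : ℝ) = ∅ := by
        ext p; rw [mem_primesUpTo, Nat.cast_le]
        simp only [notMem_empty, iff_false]; rintro ⟨hp, h⟩
        have := hp.two_le; omega
      rw [primeRecipSum, this, iterLog]; simp; exact hC.le
    · exact h n h0
  rw [e]
  rw [abs_le] at h3 ⊢
  constructor <;> linarith [h3.1, h3.2]

/-- The inverse of `iterLog`. -/
noncomputable def scale (t : ℝ) : ℝ := exp (exp t - 1)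

lemma scale_pos (t : ℝ) : 0 < scale t := exp_pos _

lemma log_scale (t : ℝ) : log (scale t) = exp t - 1 := log_exp _

lemma iterLog_scale (t : ℝ) : iterLog (scale t) = t := by
  rw [iterLog, log_scale, add_sub_cancel, log_exp]

lemma scale_iterLog {y : ℝ} (hy : 1 ≤ y) : scale (iterLog y) = y := by
  have := Real.log_nonneg hy
  rw [scale, iterLog, exp_log (by linarith), add_sub_cancel_left, exp_log (by linarith)]

lemma scale_le_scale {s t : ℝ} : scale s ≤ scale t ↔ s ≤ t := by simp [scale]

lemma scale_lt_scale {s t : ℝ} : scale s < scale t ↔ s < t := by simp [scale]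

lemma one_le_scale {t : ℝ} (ht : 0 ≤ t) : 1 ≤ scale t := by
  rw [scale, one_le_exp_iff, sub_nonneg, one_le_exp_iff]; exact ht

lemma iterLog_nonneg {y : ℝ} (hy : 1 ≤ y) : 0 ≤ iterLog y :=
  Real.log_nonneg (by have := Real.log_nonneg hy; linarith)

lemma le_scale_iff {y t : ℝ} (hy : 1 ≤ y) : y ≤ scale t ↔ iterLog y ≤ t := by
  conv_rhs => rw [← scale_le_scale, scale_iterLog hy]

lemma scale_le_iff {y t : ℝ} (hy : 1 ≤ y) : scale t ≤ y ↔ t ≤ iterLog y := by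
  conv_rhs => rw [← scale_le_scale, scale_iterLog hy]

lemma scale_lt_iff {y t : ℝ} (hy : 1 ≤ y) : scale t < y ↔ t < iterLog y := by
  conv_rhs => rw [← scale_lt_scale, scale_iterLog hy]

lemma iterLog_le_iterLog {y z : ℝ} (hy : 1 ≤ y) (h : y ≤ z) : iterLog y ≤ iterLog z := by
  rw [← le_scale_iff hy, scale_iterLog (hy.trans h)]; exact h

/-- The primes `p` with `s < iterLog p ≤ t`. -/
noncomputable def primesIoc (s t : ℝ) : Finset ℕ :=
  (primesUpTo (scale t)).filter fun p => scale s < p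

lemma mem_primesIoc {s t : ℝ} {p : ℕ} :
    p ∈ primesIoc s t ↔ p.Prime ∧ scale s < p ∧ (p : ℝ) ≤ scale t := by
  rw [primesIoc, mem_filter, mem_primesUpTo]; tauto

lemma mem_primesIoc' {s t : ℝ} {p : ℕ} :
    p ∈ primesIoc s t ↔ p.Prime ∧ s < iterLog p ∧ iterLog p ≤ t := by
  rw [mem_primesIoc]
  refine and_congr_right fun hp => ?_
  have : (1 : ℝ) ≤ p := by exact_mod_cast hp.one_lt.le
  rw [scale_lt_iff this, le_scale_iff this]

lemma primesUpTo_scale_eq (s t : ℝ) (h : s ≤ t) : ∀ f : ℕ → ℝ,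
    ∑ p ∈ primesUpTo (scale t), f p =
      ∑ p ∈ primesUpTo (scale s), f p + ∑ p ∈ primesIoc s t, f p := by
  intro f
  rw [← sum_filter_not_add_sum_filter _ (fun p : ℕ => scale s < (p : ℝ)), primesIoc]
  congr 1
  refine sum_congr ?_ fun _ _ => rfl
  ext p
  simp only [mem_filter, mem_primesUpTo, not_lt]
  have := scale_le_scale.2 h
  constructor
  · rintro ⟨⟨h1, -⟩, h2⟩; exact ⟨h1, h2⟩
  · rintro ⟨h1, h2⟩; exact ⟨⟨h1, h2.trans this⟩, h2⟩

/-- The error constant in Mertens' second theorem on `iterLog` intervals. -/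
lemma exists_abs_sum_primesIoc_le : ∃ C : ℝ, 0 < C ∧
    (∀ t, 0 ≤ t → |primeRecipSum (scale t) - t| ≤ C) ∧
    ∀ s t, 0 ≤ s → s ≤ t → |∑ p ∈ primesIoc s t, 1 / (p : ℝ) - (t - s)| ≤ C := by
  obtain ⟨C, hC, h⟩ := exists_abs_primeRecipSum_sub_iterLog_le
  have h' : ∀ t, 0 ≤ t → |primeRecipSum (scale t) - t| ≤ C := fun t ht => by
    have := h _ (one_le_scale ht)
    rwa [iterLog_scale] at this
  refine ⟨2 * C, by linarith, fun t ht => (h' t ht).trans (by linarith), fun s t hs hst => ?_⟩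
  have h1 := h' s hs
  have h2 := h' t (hs.trans hst)
  rw [primeRecipSum, primesUpTo_scale_eq s t hst, ← primeRecipSum] at h2
  rw [abs_le] at *
  constructor <;> linarith [h1.1, h1.2, h2.1, h2.2]

/-- The elementary symmetric sums of `h` over the finite set `Q`. -/
noncomputable def esum (Q : Finset ℕ) (h : ℕ → ℝ) (j : ℕ) : ℝ :=
  ∑ S ∈ Q.powersetCard j, ∏ r ∈ S, h r

lemma esum_zero (Q : Finset ℕ) (h : ℕ → ℝ) : esum Q h 0 = 1 := by simp [esum]

lemma esum_empty_succ (h : ℕ → ℝ) (j : ℕ) : esum ∅ h (j + 1) = 0 := by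
  rw [esum, powersetCard_eq_empty.2 (by simp), sum_empty]

lemma esum_insert_succ {Q : Finset ℕ} {r : ℕ} (hr : r ∉ Q) (h : ℕ → ℝ) (j : ℕ) :
    esum (insert r Q) h (j + 1) = esum Q h (j + 1) + h r * esum Q h j := by
  rw [esum, powersetCard_succ_insert hr, sum_union, sum_image, esum, esum, mul_sum]
  · congr 1
    refine sum_congr rfl fun S hS => ?_
    rw [prod_insert]
    exact fun h' => hr ((mem_powersetCard.1 hS).1 h')
  · intro S hS T hT hST
    have h1 : r ∉ S := fun h' => hr ((mem_powersetCard.1 hS).1 h')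
    have h2 : r ∉ T := fun h' => hr ((mem_powersetCard.1 hT).1 h')
    rw [← erase_insert h1, ← erase_insert h2]
    exact congrArg (fun U => erase U r) hST
  · rw [disjoint_left]
    intro S hS hS'
    obtain ⟨T, hT, rfl⟩ := mem_image.1 hS'
    exact hr ((mem_powersetCard.1 hS).1 (mem_insert_self _ _))

lemma esum_le_pow_div_factorial {Q : Finset ℕ} {h : ℕ → ℝ} (h0 : ∀ r, 0 ≤ h r) (j : ℕ) :
    esum Q h j ≤ (∑ r ∈ Q, h r) ^ j / j.factorial := by
  induction Q using Finset.induction_on generalizing j with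
  | empty =>
    rcases j with _ | j
    · simp [esum]
    · simp [esum_empty_succ]
  | insert r Q hr ih =>
    rcases j with _ | j
    · simp [esum]
    rw [esum_insert_succ hr, sum_insert hr]
    set s := ∑ r ∈ Q, h r with hs
    have hs0 : 0 ≤ s := sum_nonneg fun r _ => h0 r
    have hx := h0 r
    have hpow : s ^ (j + 1) + (j + 1) * (h r * s ^ j) ≤ (h r + s) ^ (j + 1) := by
      have : ∀ m : ℕ, s ^ (m + 1) + (m + 1) * (h r * s ^ m) ≤ (h r + s) ^ (m + 1) := by
        intro m
        induction m with
        | zero => simp; linarith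
        | succ m ihm =>
          have h1 : 0 ≤ (m + 1 : ℝ) * (h r * s ^ m) * h r := by positivity
          calc _ ≤ (s ^ (m + 1) + (m + 1) * (h r * s ^ m)) * (h r + s) := by
                push_cast; ring_nf at *; linarith
            _ ≤ _ := by rw [pow_succ]; exact mul_le_mul_of_nonneg_right ihm (by positivity)
      exact this j
    calc _ ≤ s ^ (j + 1) / (j + 1).factorial + h r * (s ^ j / j.factorial) :=
          add_le_add (ih _) (mul_le_mul_of_nonneg_left (ih _) hx)
      _ = (s ^ (j + 1) + (j + 1) * (h r * s ^ j)) / (j + 1).factorial := by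
          rw [Nat.factorial_succ]; push_cast
          have : (0 : ℝ) < j.factorial := by positivity
          field_simp
      _ ≤ _ := by gcongr

/-- The Bonferroni inequalities. -/
lemma bonferroni {Q : Finset ℕ} {h : ℕ → ℝ} (h0 : ∀ r, 0 ≤ h r) (h1 : ∀ r, h r ≤ 1) (m : ℕ) :
    0 ≤ (-1) ^ m * (∑ j ∈ range (m + 1), (-1) ^ j * esum Q h j - ∏ r ∈ Q, (1 - h r)) ∧
    (-1) ^ m * (∑ j ∈ range (m + 1), (-1) ^ j * esum Q h j - ∏ r ∈ Q, (1 - h r)) ≤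
      esum Q h (m + 1) := by
  induction Q using Finset.induction_on generalizing m with
  | empty =>
    rw [sum_range_succ', esum_empty_succ]
    simp [esum_empty_succ, esum_zero]
  | insert r Q hr ih =>
    rw [prod_insert hr]
    set P := ∏ r ∈ Q, (1 - h r) with hP
    have hP0 : 0 ≤ P := prod_nonneg fun r _ => by linarith [h1 r]
    have hP1 : P ≤ 1 := prod_le_one (fun r _ => by linarith [h1 r]) fun r _ => by linarith [h0 r]
    have hr0 := h0 r
    rcases m with _ | m
    · rw [esum_insert_succ hr]
      simp only [zero_add, range_one, sum_singleton, pow_zero, esum_zero, one_mul]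
      have := ih 0
      simp only [zero_add, range_one, sum_singleton, pow_zero, esum_zero, one_mul] at this
      constructor <;> nlinarith [this.1, this.2]
    · have e : ∑ j ∈ range (m + 1 + 1), (-1) ^ j * esum (insert r Q) h j =
          ∑ j ∈ range (m + 1 + 1), (-1) ^ j * esum Q h j -
            h r * ∑ j ∈ range (m + 1), (-1) ^ j * esum Q h j := by
        rw [sum_range_succ', sum_range_succ' _ (m + 1), mul_sum, esum_zero, esum_zero,
          add_sub_right_comm, ← sum_sub_distrib]
        congr 1
        refine sum_congr rfl fun j _ => ?_
        rw [esum_insert_succ hr]; ring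
      have i1 := ih (m + 1)
      have i2 := ih m
      rw [e, esum_insert_succ hr]
      have e2 : (-1 : ℝ) ^ (m + 1) * (∑ j ∈ range (m + 1 + 1), (-1) ^ j * esum Q h j -
            h r * ∑ j ∈ range (m + 1), (-1) ^ j * esum Q h j - (1 - h r) * P) =
          (-1) ^ (m + 1) * (∑ j ∈ range (m + 1 + 1), (-1) ^ j * esum Q h j - P) +
          h r * ((-1) ^ m * (∑ j ∈ range (m + 1), (-1) ^ j * esum Q h j - P)) := by ring
      rw [e2]
      exact ⟨add_nonneg i1.1 (mul_nonneg hr0 i2.1),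
        add_le_add i1.2 (mul_le_mul_of_nonneg_left i2.2 hr0)⟩

lemma sum_Ico_periodic {H : ℕ → ℝ} {d : ℕ} (hH : Function.Periodic H d) (A : ℕ) :
    ∑ n ∈ Ico A (A + d), H n = ∑ n ∈ range d, H n := by
  rw [← Nat.Ico_zero_eq_range]
  induction A with
  | zero => simp
  | succ A ih =>
    rw [← ih]
    rcases Nat.eq_zero_or_pos d with rfl | hd
    · simp
    rw [Finset.sum_eq_sum_Ico_succ_bot (show A < A + d by omega), add_right_comm,
      Finset.sum_Ico_succ_top (by omega), hH A, add_comm]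

lemma abs_sum_Ico_periodic_sub_le {H : ℕ → ℝ} {d : ℕ} (hd : 0 < d) (hH : Function.Periodic H d)
    (h0 : ∀ n, 0 ≤ H n) (A X : ℕ) :
    |∑ n ∈ Ico A (A + X), H n - X * ((∑ n ∈ range d, H n) / d)| ≤ ∑ n ∈ range d, H n := by
  set σ := ∑ n ∈ range d, H n with hσ
  have hσ0 : 0 ≤ σ := sum_nonneg fun n _ => h0 n
  have hq : ∀ q : ℕ, ∑ n ∈ Ico A (A + q * d), H n = q * σ := by
    intro q
    induction q with
    | zero => simp
    | succ q ih =>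
      rw [← sum_Ico_consecutive H (Nat.le_add_right A (q * d))
        (show A + q * d ≤ A + (q + 1) * d by rw [add_mul]; omega), ih]
      have : A + (q + 1) * d = (A + q * d) + d := by ring
      rw [this, sum_Ico_periodic hH, ← hσ]; push_cast; ring
  have hd' : (0 : ℝ) < d := by exact_mod_cast hd
  set q := X / d
  have l1 : q * d ≤ X := Nat.div_mul_le_self X d
  have l2 : X ≤ (q + 1) * d := (Nat.lt_mul_of_div_lt (Nat.lt_succ_self _) hd).le.trans
    (by rw [mul_comm])
  have m1 : (q : ℝ) * σ ≤ ∑ n ∈ Ico A (A + X), H n := by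
    rw [← hq]
    exact sum_le_sum_of_subset_of_nonneg (Ico_subset_Ico_right (by omega)) fun i _ _ => h0 i
  have m2 : ∑ n ∈ Ico A (A + X), H n ≤ (q + 1 : ℕ) * σ := by
    rw [← hq]
    exact sum_le_sum_of_subset_of_nonneg (Ico_subset_Ico_right (by omega)) fun i _ _ => h0 i
  have l1' : (q : ℝ) * d ≤ X := by exact_mod_cast l1
  have l2' : (X : ℝ) ≤ (q + 1) * d := by exact_mod_cast l2
  have n1 : (q : ℝ) * σ ≤ X * (σ / d) := by
    rw [mul_div_assoc', le_div_iff₀ hd']; nlinarith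
  have n2 : X * (σ / d) ≤ (q + 1) * σ := by
    rw [mul_div_assoc', div_le_iff₀ hd']; nlinarith
  push_cast at m2
  rw [abs_le]; constructor <;> linarith

lemma sum_range_mul_periodic {f g : ℕ → ℝ} {a b : ℕ} (hab : a.Coprime b) (ha : 0 < a) (hb : 0 < b)
    (hf : Function.Periodic f a) (hg : Function.Periodic g b) :
    ∑ n ∈ range (a * b), f n * g n = (∑ n ∈ range a, f n) * ∑ n ∈ range b, g n := by
  rw [sum_mul_sum, ← sum_product']
  have hinj : Set.InjOn (fun n => (n % a, n % b)) (range (a * b)) := by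
    intro m hm n hn h
    simp only [coe_range, Set.mem_Iio] at hm hn
    simp only [Prod.mk.injEq] at h
    have := (Nat.modEq_and_modEq_iff_modEq_mul hab).1 ⟨h.1, h.2⟩
    exact Nat.ModEq.eq_of_lt_of_lt this hm hn
  have himg : (range (a * b)).image (fun n => (n % a, n % b)) = range a ×ˢ range b := by
    apply eq_of_subset_of_card_le
    · intro x hx
      obtain ⟨n, -, rfl⟩ := mem_image.1 hx
      simp [Nat.mod_lt _ ha, Nat.mod_lt _ hb]
    · rw [card_image_of_injOn hinj]; simp
  rw [← himg, sum_image hinj]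
  refine sum_congr rfl fun n _ => ?_
  simp only
  rw [hf.map_mod_nat, hg.map_mod_nat]

lemma periodic_prod_sum {h : ℕ → ℕ → ℝ} (S : Finset ℕ) (hS : ∀ r ∈ S, r.Prime)
    (hh : ∀ r, Function.Periodic (h r) r) :
    Function.Periodic (fun n => ∏ r ∈ S, h r n) (∏ r ∈ S, r) ∧
    ∑ n ∈ range (∏ r ∈ S, r), ∏ r ∈ S, h r n = ∏ r ∈ S, ∑ n ∈ range r, h r n := by
  induction S using Finset.induction_on with
  | empty => simp [Function.Periodic]
  | insert r S hr ih =>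
    obtain ⟨i1, i2⟩ := ih fun q hq => hS q (mem_insert_of_mem hq)
    have hrp := hS r (mem_insert_self _ _)
    simp only [prod_insert hr]
    refine ⟨?_, ?_⟩
    · intro n
      simp only
      have e1 : h r (n + r * ∏ q ∈ S, q) = h r n := by
        have := (hh r).nat_mul (∏ q ∈ S, q) n
        rwa [Nat.cast_id, mul_comm] at this
      have e2 : ∏ q ∈ S, h q (n + r * ∏ q ∈ S, q) = ∏ q ∈ S, h q n := by
        have := i1.nat_mul r n
        rwa [Nat.cast_id] at this
      rw [e1, e2]
    · rw [sum_range_mul_periodic (f := h r) (g := fun n => ∏ q ∈ S, h q n) _ hrp.pos _ (hh r) i1, i2]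
      · refine Nat.Coprime.prod_right fun q hq => ?_
        rw [Nat.coprime_primes hrp (hS q (mem_insert_of_mem hq))]
        rintro rfl; exact hr hq
      · exact prod_pos fun q hq => (hS q (mem_insert_of_mem hq)).pos

/-- The fundamental bound of Brun's pure sieve, with weights. -/
lemma brun_sieve {h : ℕ → ℕ → ℝ} (Q : Finset ℕ) (hQ : ∀ r ∈ Q, r.Prime)
    (hh : ∀ r, Function.Periodic (h r) r) (h0 : ∀ r n, 0 ≤ h r n) (h1 : ∀ r n, h r n ≤ 1)
    (h3 : ∀ r ∈ Q, ∑ n ∈ range r, h r n ≤ 3) (A X k : ℕ)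
    (hk : 8 * ∑ r ∈ Q, (∑ n ∈ range r, h r n) / r ≤ 2 * k + 1) :
    ∑ n ∈ Ico A (A + X), ∏ r ∈ Q, (1 - h r n) ≤
      2 * X * exp (-∑ r ∈ Q, (∑ n ∈ range r, h r n) / r) + (1 + 3 * (#Q : ℝ)) ^ (2 * k) := by
  set κ : ℕ → ℝ := fun r => ∑ n ∈ range r, h r n with hκ
  have hκ0 : ∀ r, 0 ≤ κ r := fun r => sum_nonneg fun n _ => h0 r n
  set g : ℕ → ℝ := fun r => κ r / r with hg
  have hg0 : ∀ r, 0 ≤ g r := fun r => by have := hκ0 r; positivity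
  have hg1 : ∀ r, g r ≤ 1 := fun r => by
    refine div_le_one_of_le₀ ?_ (by positivity)
    calc κ r ≤ ∑ n ∈ range r, (1 : ℝ) := sum_le_sum fun n _ => h1 r n
      _ = r := by simp
  set s := ∑ r ∈ Q, g r with hs
  have hs0 : 0 ≤ s := sum_nonneg fun r _ => hg0 r
  have hmain : ∀ j, ∑ n ∈ Ico A (A + X), (-1) ^ j * esum Q (fun r => h r n) j ≤
      X * ((-1) ^ j * esum Q g j) + esum Q κ j := by
    intro j
    simp only [esum, mul_sum]
    rw [sum_comm, ← sum_add_distrib]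
    refine sum_le_sum fun S hS => ?_
    rw [← mul_sum]
    have hSp : ∀ r ∈ S, r.Prime := fun r hr => hQ r ((mem_powersetCard.1 hS).1 hr)
    obtain ⟨p1, p2⟩ := periodic_prod_sum S hSp hh
    have := abs_sum_Ico_periodic_sub_le (prod_pos fun r hr => (hSp r hr).pos) p1
      (fun n => prod_nonneg fun r _ => h0 r n) A X
    rw [p2, Nat.cast_prod, ← prod_div_distrib] at this
    set M := ∑ n ∈ Ico A (A + X), ∏ r ∈ S, h r n
    have h5 : (-1 : ℝ) ^ j * (M - X * ∏ r ∈ S, g r) ≤ ∏ r ∈ S, κ r := by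
      refine (le_abs_self _).trans ?_
      rw [abs_mul, abs_pow, abs_neg, abs_one, one_pow, one_mul]
      exact this
    linarith
  have hle : ∀ n, ∏ r ∈ Q, (1 - h r n) ≤
      ∑ j ∈ range (2 * k + 1), (-1) ^ j * esum Q (fun r => h r n) j := by
    intro n
    have := (bonferroni (Q := Q) (h := fun r => h r n) (fun r => h0 r n) (fun r => h1 r n) (2 * k)).1
    rw [pow_mul, neg_one_sq, one_pow, one_mul] at this
    linarith
  have hup : ∑ j ∈ range (2 * k + 1), (-1) ^ j * esum Q g j ≤ 2 * exp (-s) := by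
    have := (bonferroni (Q := Q) (h := g) hg0 hg1 (2 * k)).2
    rw [pow_mul, neg_one_sq, one_pow, one_mul] at this
    have hprod : ∏ r ∈ Q, (1 - g r) ≤ exp (-s) := by
      rw [hs, ← sum_neg_distrib, exp_sum]
      refine prod_le_prod (fun r _ => by linarith [hg1 r]) fun r _ => ?_
      have := add_one_le_exp (-g r); linarith
    have he : esum Q g (2 * k + 1) ≤ exp (-s) := by
      refine (esum_le_pow_div_factorial hg0 _).trans ?_
      rw [← hs]
      have h4 := Real.pow_div_factorial_le_exp (4 * s) (by positivity) (2 * k + 1)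
      have h5 : (4 * s) ^ (2 * k + 1) = 4 ^ (2 * k + 1) * s ^ (2 * k + 1) := by rw [mul_pow]
      have h6 : exp (5 * s) ≤ 4 ^ (2 * k + 1) := by
        calc exp (5 * s) ≤ exp (2 * k + 1 : ℕ) := by
              apply exp_le_exp.2; push_cast; linarith
          _ = exp 1 ^ (2 * k + 1) := by rw [← exp_nat_mul, mul_one]
          _ ≤ _ := by
              gcongr
              have := exp_one_lt_d9; linarith
      have h7 : 4 ^ (2 * k + 1) * (s ^ (2 * k + 1) / (2 * k + 1).factorial) ≤ exp (4 * s) := by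
        rw [← mul_div_assoc, ← h5]; exact h4
      have h8 : exp (4 * s) = exp (5 * s) * exp (-s) := by rw [← exp_add]; ring_nf
      rw [h8] at h7
      have h9 : 4 ^ (2 * k + 1) * (s ^ (2 * k + 1) / (2 * k + 1).factorial) ≤
        4 ^ (2 * k + 1) * exp (-s) := h7.trans (mul_le_mul_of_nonneg_right h6 (exp_pos _).le)
      exact le_of_mul_le_mul_left h9 (by positivity)
    linarith
  have hrem : ∑ j ∈ range (2 * k + 1), esum Q κ j ≤ (1 + 3 * (#Q : ℝ)) ^ (2 * k) := by
    rw [add_comm (1 : ℝ), add_pow]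
    refine sum_le_sum fun j hj => ?_
    rw [one_pow, mul_one]
    refine (esum_le_pow_div_factorial hκ0 _).trans ?_
    have hT : ∑ r ∈ Q, κ r ≤ 3 * (#Q : ℝ) := by
      calc _ ≤ ∑ r ∈ Q, (3 : ℝ) := sum_le_sum fun r hr => h3 r hr
        _ = _ := by rw [sum_const, nsmul_eq_mul, mul_comm]
    have hT0 : 0 ≤ ∑ r ∈ Q, κ r := sum_nonneg fun r _ => hκ0 r
    have hc : (1 : ℝ) ≤ (2 * k).choose j := by
      exact_mod_cast Nat.choose_pos (by have := mem_range.1 hj; omega)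
    have hf : (1 : ℝ) ≤ j.factorial := by exact_mod_cast Nat.factorial_pos j
    calc _ ≤ (∑ r ∈ Q, κ r) ^ j := div_le_self (by positivity) hf
      _ ≤ (3 * (#Q : ℝ)) ^ j := by gcongr
      _ ≤ _ := le_mul_of_one_le_right (by positivity) hc
  calc _ ≤ ∑ n ∈ Ico A (A + X), ∑ j ∈ range (2 * k + 1), (-1) ^ j * esum Q (fun r => h r n) j :=
        sum_le_sum fun n _ => hle n
    _ = ∑ j ∈ range (2 * k + 1), ∑ n ∈ Ico A (A + X), (-1) ^ j * esum Q (fun r => h r n) j :=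
        sum_comm
    _ ≤ ∑ j ∈ range (2 * k + 1), (X * ((-1) ^ j * esum Q g j) + esum Q κ j) :=
        sum_le_sum fun j _ => hmain j
    _ = X * ∑ j ∈ range (2 * k + 1), (-1) ^ j * esum Q g j +
          ∑ j ∈ range (2 * k + 1), esum Q κ j := by rw [sum_add_distrib, mul_sum]
    _ ≤ X * (2 * exp (-s)) + (1 + 3 * (#Q : ℝ)) ^ (2 * k) := by gcongr
    _ = _ := by ring

/-- The completely multiplicative function with prescribed values at the primes. -/
noncomputable def cmul (F : ℕ → ℝ) : ℕ →*₀ ℝ where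
  toFun n := if n = 0 then 0 else (n.primeFactorsList.map F).prod
  map_zero' := by simp
  map_one' := by simp
  map_mul' m n := by
    rcases eq_or_ne m 0 with rfl | hm
    · simp
    rcases eq_or_ne n 0 with rfl | hn
    · simp
    rw [if_neg (mul_ne_zero hm hn), if_neg hm, if_neg hn, ← List.prod_append, ← List.map_append]
    exact ((Nat.perm_primeFactorsList_mul hm hn).map F).prod_eq

lemma cmul_apply (F : ℕ → ℝ) {n : ℕ} (hn : n ≠ 0) :
    cmul F n = (n.primeFactorsList.map F).prod := if_neg hn

lemma cmul_prime (F : ℕ → ℝ) {p : ℕ} (hp : p.Prime) : cmul F p = F p := by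
  rw [cmul_apply F hp.ne_zero, Nat.primeFactorsList_prime hp]; simp

lemma cmul_nonneg {F : ℕ → ℝ} (h0 : ∀ p, 0 ≤ F p) (n : ℕ) : 0 ≤ cmul F n := by
  rcases eq_or_ne n 0 with rfl | hn
  · simp
  rw [cmul_apply F hn]
  exact List.prod_nonneg (by simp only [List.mem_map]; rintro _ ⟨p, -, rfl⟩; exact h0 p)

lemma cmul_le_cmul {F G : ℕ → ℝ} (h0 : ∀ p, 0 ≤ F p) {n : ℕ}
    (h : ∀ p, p.Prime → p ∣ n → F p ≤ G p) : cmul F n ≤ cmul G n := by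
  induction n using Nat.recOnMul with
  | zero => simp
  | one => simp
  | prime p hp => rw [cmul_prime _ hp, cmul_prime _ hp]; exact h p hp dvd_rfl
  | mul a b ha hb =>
    rw [map_mul, map_mul]
    have h1 := ha fun p hp hd => h p hp (hd.mul_right _)
    exact mul_le_mul h1 (hb fun p hp hd => h p hp (hd.mul_left _)) (cmul_nonneg h0 _)
      ((cmul_nonneg h0 _).trans h1)

lemma cmul_one_fun {n : ℕ} (hn : n ≠ 0) : cmul (fun _ => 1) n = 1 := by
  rw [cmul_apply _ hn]; simp

lemma cmul_le_one {F : ℕ → ℝ} (h0 : ∀ p, 0 ≤ F p) (h1 : ∀ p, F p ≤ 1) (n : ℕ) :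
    cmul F n ≤ 1 := by
  rcases eq_or_ne n 0 with rfl | hn
  · simp
  rw [← cmul_one_fun hn]; exact cmul_le_cmul h0 fun p _ _ => h1 p

lemma cmul_mul_fun (F G : ℕ → ℝ) (n : ℕ) : cmul (fun p => F p * G p) n = cmul F n * cmul G n := by
  induction n using Nat.recOnMul with
  | zero => simp
  | one => simp
  | prime p hp => simp [cmul_prime _ hp]
  | mul a b ha hb => simp only [map_mul, ha, hb]; ring

lemma cmul_cast_inv (n : ℕ) : cmul (fun p => 1 / (p : ℝ)) n = 1 / (n : ℝ) := by
  induction n using Nat.recOnMul with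
  | zero => simp
  | one => simp
  | prime p hp => simp [cmul_prime _ hp]
  | mul a b ha hb => simp only [map_mul, ha, hb]; push_cast; ring

/-- A finite form of the Euler product bound. -/
lemma sum_cmul_le_prod {F : ℕ → ℝ} (h0 : ∀ p, 0 ≤ F p) (P A : Finset ℕ)
    (h1 : ∀ p ∈ P, F p < 1) (hA : ∀ n ∈ A, n ≠ 0 ∧ ∀ p, p.Prime → p ∣ n → p ∈ P) :
    ∑ n ∈ A, cmul F n ≤ ∏ p ∈ P, (1 - F p)⁻¹ := by
  classical
  set G : ℕ → ℝ := fun p => if p ∈ P then F p else 0 with hG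
  have hG0 : ∀ p, 0 ≤ G p := fun p => by simp only [hG]; split_ifs <;> simp [h0]
  have hG1 : ∀ p, G p < 1 := fun p => by
    simp only [hG]; split_ifs with h
    · exact h1 p h
    · exact one_pos
  obtain ⟨e1, e2⟩ := EulerProduct.summable_and_hasSum_factoredNumbers_prod_filter_prime_geometric
    (f := (cmul G : ℕ →* ℝ)) (fun {p} hp => by
      simp only [MonoidHom.coe_coe, cmul_prime _ hp, Real.norm_of_nonneg (hG0 p)]
      exact hG1 p) P
  have hAm : ∀ n ∈ A, n ∈ Nat.factoredNumbers P := fun n hn => by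
    rw [Nat.mem_factoredNumbers']
    exact fun p hp hd => (hA n hn).2 p hp hd
  calc ∑ n ∈ A, cmul F n = ∑ n ∈ A, cmul G n := by
        refine sum_congr rfl fun n hn => ?_
        rw [cmul_apply _ (hA n hn).1, cmul_apply _ (hA n hn).1]
        congr 1
        refine List.map_congr_left fun p hp => ?_
        rw [hG]; simp only
        rw [if_pos ((hA n hn).2 p (Nat.prime_of_mem_primeFactorsList hp)
          (Nat.dvd_of_mem_primeFactorsList hp))]
    _ = ∑ n ∈ A.attach.map ⟨fun n => (⟨n.1, hAm n.1 n.2⟩ : Nat.factoredNumbers P), fun a b hab => 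
          Subtype.ext (Subtype.mk.inj hab)⟩, cmul G n := by
        rw [sum_map, ← sum_attach]; rfl
    _ ≤ ∏ p ∈ P with p.Prime, (1 - cmul G p)⁻¹ :=
        sum_le_hasSum _ (fun n _ => cmul_nonneg hG0 _) e2
    _ ≤ ∏ p ∈ P with p.Prime, (1 - F p)⁻¹ := by
        refine le_of_eq (prod_congr rfl fun p hp => ?_)
        rw [mem_filter] at hp
        rw [cmul_prime _ hp.2, hG]; simp only [if_pos hp.1]
    _ ≤ _ := by
        rw [← prod_filter_mul_prod_filter_not P Nat.Prime]
        refine le_mul_of_one_le_right (prod_nonneg fun p hp => ?_) ?_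
        · rw [inv_nonneg]; linarith [h1 p (mem_filter.1 hp).1]
        · have : ∀ p ∈ P.filter (fun p => ¬ p.Prime), 1 ≤ (1 - F p)⁻¹ := fun p hp => by
            have := h1 p (mem_filter.1 hp).1
            exact (one_le_inv₀ (by linarith)).2 (by linarith [h0 p])
          calc (1 : ℝ) = ∏ p ∈ P.filter (fun p => ¬ p.Prime), 1 := by simp
            _ ≤ _ := prod_le_prod (fun _ _ => zero_le_one) this

lemma periodic_ite_mod (a b r : ℕ)
    (x : ℝ) : Function.Periodic (fun n => if (a * n) % r = 1 ∨ (b * n) % r = 1 then (1 : ℝ) else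
      if n % r = 0 then x else 0) r := by
  intro n
  simp only [mul_add, Nat.add_mul_mod_self_right, Nat.add_mod_right]

lemma sum_ite_mod_le {a b r : ℕ} (hr : r.Prime) {x : ℝ} (hx : x ≤ 1) :
    ∑ n ∈ range r, (if (a * n) % r = 1 ∨ (b * n) % r = 1 then (1 : ℝ) else
      if n % r = 0 then x else 0) ≤ 3 := by
  have hcard : ∀ a : ℕ, ∑ n ∈ range r, (if (a * n) % r = 1 then (1 : ℝ) else 0) ≤ 1 := by
    intro a
    rw [sum_boole]
    norm_cast
    rw [card_le_one]
    simp only [mem_filter, mem_range]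
    rintro m ⟨hm, hm'⟩ n ⟨hn, hn'⟩
    have hc : Nat.Coprime r a := by
      rw [hr.coprime_iff_not_dvd]
      intro hd
      rw [Nat.mod_eq_zero_of_dvd (hd.mul_right m)] at hm'
      omega
    have : m ≡ n [MOD r] := Nat.ModEq.cancel_left_of_coprime hc (hm'.trans hn'.symm)
    exact this.eq_of_lt_of_lt hm hn
  have h0 : ∑ n ∈ range r, (if n % r = 0 then (1 : ℝ) else 0) ≤ 1 := by
    rw [sum_boole]
    norm_cast
    rw [card_le_one]
    simp only [mem_filter, mem_range]
    rintro m ⟨hm, hm'⟩ n ⟨hn, hn'⟩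
    rw [Nat.mod_eq_of_lt hm] at hm'
    rw [Nat.mod_eq_of_lt hn] at hn'
    omega
  calc _ ≤ ∑ n ∈ range r, ((if (a * n) % r = 1 then (1 : ℝ) else 0) +
        (if (b * n) % r = 1 then (1 : ℝ) else 0) + (if n % r = 0 then (1 : ℝ) else 0)) := by
        refine sum_le_sum fun n _ => ?_
        by_cases h1 : (a * n) % r = 1 <;> by_cases h2 : (b * n) % r = 1 <;>
          by_cases h3 : n % r = 0 <;> simp [h1, h2, h3] <;> linarith
    _ ≤ 1 + 1 + 1 := by
        rw [sum_add_distrib, sum_add_distrib]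
        exact add_le_add (add_le_add (hcard a) (hcard b)) h0
    _ = 3 := by norm_num

lemma le_sum_ite_mod {a b r : ℕ} (hr : r.Prime) {x : ℝ} (ha : ¬ r ∣ a) (hb : ¬ r ∣ b)
    (hx0 : 0 ≤ x)
    (hab : a = b ∨ ¬ r ∣ Nat.dist a b) :
    (if a = b then 1 else 2) + x ≤
      ∑ n ∈ range r, (if (a * n) % r = 1 ∨ (b * n) % r = 1 then (1 : ℝ) else
      if n % r = 0 then x else 0) := by
  have key : ∀ a : ℕ, ¬ r ∣ a → ∃ n ∈ range r, (a * n) % r = 1 ∧ n ≠ 0 := by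
    intro a ha
    obtain ⟨m, -, hm⟩ := Nat.exists_mul_mod_eq_one_of_coprime
      ((hr.coprime_iff_not_dvd.2 ha).symm) hr.one_lt
    refine ⟨m % r, mem_range.2 (Nat.mod_lt _ hr.pos), ?_, ?_⟩
    · rw [Nat.mul_mod, Nat.mod_mod, ← Nat.mul_mod]; exact hm
    · intro h0
      rw [Nat.mul_mod, h0] at hm
      simp at hm
  obtain ⟨na, hna, hna1, hna0⟩ := key a ha
  obtain ⟨nb, hnb, hnb1, hnb0⟩ := key b hb
  have hf0 : ∀ n ∈ range r, 0 ≤ (if (a * n) % r = 1 ∨ (b * n) % r = 1 then (1 : ℝ) else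
      if n % r = 0 then x else 0) := fun n _ => by split_ifs <;> simp [hx0]
  have h0r : 0 ∈ range r := mem_range.2 hr.pos
  have hf00 : (if (a * 0) % r = 1 ∨ (b * 0) % r = 1 then (1 : ℝ) else
      if 0 % r = 0 then x else 0) = x := by simp
  split_ifs with h
  · calc _ = ∑ n ∈ ({na, 0} : Finset ℕ), (if (a * n) % r = 1 ∨ (b * n) % r = 1 then (1 : ℝ) else
      if n % r = 0 then x else 0) := by
          rw [sum_insert (by simp [hna0]), sum_singleton, hf00, if_pos (Or.inl hna1)]
      _ ≤ _ := by
        refine sum_le_sum_of_subset_of_nonneg ?_ fun n hn _ => hf0 n hn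
        intro n; simp only [mem_insert, mem_singleton]; rintro (rfl | rfl) <;> assumption
  · have hne : na ≠ nb := by
      rintro rfl
      have hd := hab.resolve_left h
      apply hd
      have hc : Nat.Coprime r na := by
        rw [hr.coprime_iff_not_dvd]
        intro hd
        rw [Nat.mod_eq_zero_of_dvd (hd.mul_left a)] at hna1
        omega
      have hm : a ≡ b [MOD r] := Nat.ModEq.cancel_right_of_coprime hc (hna1.trans hnb1.symm)
      rcases le_total a b with hle | hle
      · rw [Nat.dist_eq_sub_of_le hle]; exact (Nat.modEq_iff_dvd' hle).1 hm
      · rw [Nat.dist_eq_sub_of_le_right hle]; exact (Nat.modEq_iff_dvd' hle).1 hm.symm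
    calc _ = ∑ n ∈ ({na, nb, 0} : Finset ℕ), (if (a * n) % r = 1 ∨ (b * n) % r = 1 then (1 : ℝ)
          else if n % r = 0 then x else 0) := by
          rw [sum_insert (by simp [hna0, hne]), sum_insert (by simp [hnb0]), sum_singleton, hf00,
            if_pos (Or.inl hna1), if_pos (Or.inr hnb1)]
          ring
      _ ≤ _ := by
        refine sum_le_sum_of_subset_of_nonneg ?_ fun n hn _ => hf0 n hn
        intro n; simp only [mem_insert, mem_singleton]; rintro (rfl | rfl | rfl) <;> assumption

lemma cmul_le_prod_ite {F : ℕ → ℝ} (h0 : ∀ p, 0 ≤ F p) (h1 : ∀ p, F p ≤ 1) {Q : Finset ℕ}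
    (hQ : ∀ r ∈ Q, r.Prime) (n : ℕ) :
    cmul F n ≤ ∏ r ∈ Q, (if n % r = 0 then F r else 1) := by
  rw [← prod_filter]
  have hd : (∏ r ∈ Q.filter (fun r => n % r = 0), r) ∣ n := by
    refine Finset.prod_primes_dvd n (fun r hr => (hQ r (mem_filter.1 hr).1).prime) fun r hr => ?_
    exact Nat.dvd_of_mod_eq_zero (mem_filter.1 hr).2
  obtain ⟨m, hm⟩ := hd
  have e : cmul F n = (∏ r ∈ Q.filter (fun r => n % r = 0), F r) * cmul F m := by
    conv_lhs => rw [hm]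
    rw [map_mul, map_prod]
    congr 1
    exact prod_congr rfl fun r hr => cmul_prime _ (hQ r (mem_filter.1 hr).1)
  rw [e]
  exact mul_le_of_le_one_right (prod_nonneg fun r _ => h0 r) (cmul_le_one h0 h1 m)

lemma card_primeFactors_le {n : ℕ} (hn : n ≠ 0) : (#n.primeFactors : ℝ) * log 2 ≤ log n := by
  rw [← Real.log_pow]
  apply Real.log_le_log (by positivity)
  have : 2 ^ #n.primeFactors ≤ n := by
    calc 2 ^ #n.primeFactors ≤ ∏ p ∈ n.primeFactors, p :=
          Finset.pow_card_le_prod _ _ _ fun p hp => (Nat.prime_of_mem_primeFactors hp).two_le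
      _ ≤ n := Nat.le_of_dvd (Nat.pos_of_ne_zero hn) (Nat.prod_primeFactors_dvd n)
  exact_mod_cast this

lemma sum_primeFactors_inv_le {D : ℕ} {s : ℝ} (hD : D ≠ 0) (hs : 0 ≤ s)
    (h : log D ≤ 3 * exp s) (t : ℝ) :
    ∑ r ∈ (primesIoc (log (1 + s)) t).filter (fun r => r ∣ D), 1 / (r : ℝ) ≤ 6 := by
  have hsc : scale (log (1 + s)) = exp s := by
    rw [scale, exp_log (by linarith), add_sub_cancel_left]
  have h1 := card_primeFactors_le hD
  calc _ ≤ ∑ r ∈ (primesIoc (log (1 + s)) t).filter (fun r => r ∣ D), exp (-s) := by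
        refine sum_le_sum fun r hr => ?_
        rw [mem_filter, mem_primesIoc, hsc] at hr
        rw [exp_neg, ← one_div]
        exact one_div_le_one_div_of_le (exp_pos _) hr.1.2.1.le
    _ = #((primesIoc (log (1 + s)) t).filter (fun r => r ∣ D)) * exp (-s) := by
        rw [sum_const, nsmul_eq_mul]
    _ ≤ #D.primeFactors * exp (-s) := by
        gcongr
        intro r hr
        rw [mem_filter, mem_primesIoc] at hr
        exact Nat.mem_primeFactors.2 ⟨hr.1.1, hr.2, hD⟩
    _ ≤ (6 * exp s) * exp (-s) := by
        gcongr
        have := Real.log_two_gt_d9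
        have h0 : (0 : ℝ) ≤ #D.primeFactors := by positivity
        nlinarith
    _ = 6 := by rw [mul_assoc, ← exp_add]; simp

lemma sieve_weight_le {F : ℕ → ℝ} (h0 : ∀ p, 0 ≤ F p) (h1 : ∀ p, F p ≤ 1) {Q : Finset ℕ} {w : ℝ}
    (hQ : ∀ r ∈ Q, r.Prime ∧ (r : ℝ) ≤ w) {a b n N : ℕ} (ha : 1 ≤ a) (hb : 1 ≤ b) (hn : N ≤ n)
    (hN : w + 1 < N) (hap : (a * n - 1).Prime) (hbp : (b * n - 1).Prime) :
    cmul F n ≤ ∏ r ∈ Q, (1 - (if (a * n) % r = 1 ∨ (b * n) % r = 1 then (1 : ℝ) else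
      if n % r = 0 then 1 - F r else 0)) := by
  have hQp : ∀ r ∈ Q, r.Prime := fun r hr => (hQ r hr).1
  refine (cmul_le_prod_ite h0 h1 hQp n).trans (le_of_eq (prod_congr rfl fun r hr => ?_))
  obtain ⟨hrp, hrw⟩ := hQ r hr
  have hrN : r + 1 < N := by
    have : (r : ℝ) + 1 < N := by linarith
    exact_mod_cast this
  have key : ∀ a : ℕ, 1 ≤ a → (a * n - 1).Prime → (a * n) % r ≠ 1 := by
    intro a ha hp hmod
    have hd : r ∣ a * n - 1 := (Nat.modEq_iff_dvd' (by nlinarith [hrp.two_le])).1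
      (show 1 % r = (a * n) % r by rw [hmod, Nat.mod_eq_of_lt hrp.one_lt])
    have := (Nat.prime_dvd_prime_iff_eq hrp hp).1 hd
    have : n ≤ a * n := Nat.le_mul_of_pos_left n ha
    omega
  rw [if_neg (not_or.2 ⟨key a ha hap, key b hb hbp⟩)]
  split_ifs <;> ring

lemma sieve_remainder_le {q K s t : ℝ} {k : ℕ} (hq0 : 0 ≤ q) (hq : q ≤ scale t) (ht0 : 0 ≤ t)
    (hKe : K * ((1 + s) * exp t) = exp s / 4) (h2k : ((2 * k : ℕ) : ℝ) ≤ K * (1 + s)) :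
    (1 + 3 * q) ^ (2 * k) ≤ exp 4 * scale s * exp (-(3 * s)) := by
  have het1 : 1 ≤ exp t := one_le_exp ht0
  have h1 : (2 : ℝ) ≤ exp 1 := by have := add_one_le_exp (1 : ℝ); linarith
  have h2 : exp 2 = exp 1 * exp 1 := by rw [← exp_add]; norm_num
  have hbase : 1 + 3 * q ≤ exp (2 * exp t) := by
    calc 1 + 3 * q ≤ 4 * scale t := by linarith [one_le_scale ht0]
      _ ≤ exp 2 * scale t := by
          refine mul_le_mul_of_nonneg_right ?_ (scale_pos t).le
          rw [h2]; nlinarith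
      _ = exp (exp t + 1) := by rw [scale, ← exp_add]; ring_nf
      _ ≤ _ := exp_le_exp.2 (by linarith)
  calc (1 + 3 * q) ^ (2 * k) ≤ exp (2 * exp t) ^ (2 * k) :=
        pow_le_pow_left₀ (by linarith) hbase _
    _ = exp ((2 * k : ℕ) * (2 * exp t)) := by rw [← exp_nat_mul]
    _ ≤ exp (4 + (exp s - 1) + -(3 * s)) := by
        apply exp_le_exp.2
        have h6 : ((2 * k : ℕ) : ℝ) * (2 * exp t) ≤ exp s / 2 := by
          calc _ ≤ K * (1 + s) * (2 * exp t) := mul_le_mul_of_nonneg_right h2k (by positivity)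
            _ = 2 * (K * ((1 + s) * exp t)) := by ring
            _ = _ := by rw [hKe]; ring
        have h7 : 3 * s - 3 ≤ exp s / 2 := by
          have h8 := add_one_le_exp (s - 2)
          have h9 : exp s = exp (s - 2) * exp 2 := by rw [← exp_add]; ring_nf
          have h10 : (6 : ℝ) ≤ exp 2 := by
            have h11 := exp_one_gt_d9
            rw [h2]; nlinarith
          rcases le_or_gt s 1 with h13 | h13
          · have := exp_pos s; linarith
          · nlinarith
        linarith
    _ = exp 4 * scale s * exp (-(3 * s)) := by rw [exp_add, exp_add, scale]

/-- An upper bound sieve for the weighted number of `n` in a dyadic block for which `a n - 1` and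
`b n - 1` are both prime. -/
lemma sieve_dyadic : ∃ C : ℝ, 0 < C ∧ ∀ F : ℕ → ℝ, (∀ p, 0 ≤ F p) → (∀ p, F p ≤ 1) →
    ∀ (a b N : ℕ) (s s₀ : ℝ), 1 ≤ a → 1 ≤ b → 0 ≤ s₀ → (a : ℝ) ≤ scale s → (b : ℝ) ≤ scale s →
    (N : ℝ) ≤ scale s → scale s₀ ≤ N →
    ∑ n ∈ (Ico N (N + N)).filter (fun n => (a * n - 1).Prime ∧ (b * n - 1).Prime), cmul F n ≤
      C * N * (1 + s) ^ 6 * exp (-(if a = b then 2 else 3) * s₀ +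
        ∑ r ∈ primesUpTo (scale s), F r / r) := by
  obtain ⟨C₀, hC₀, hM1, hM2⟩ := exists_abs_sum_primesIoc_le
  set K := 24 * C₀ + 26 with hK
  set C₂ := log (4 * K) with hC₂
  have hK0 : 26 ≤ K := by linarith
  have hC₂0 : 0 < C₂ := Real.log_pos (by linarith)
  have hC₂e : exp C₂ = 4 * K := exp_log (by linarith)
  refine ⟨exp (3 * C₂) + 2 * exp (3 * (C₀ + 6 + C₂)) + exp 4, by positivity, ?_⟩
  intro F h0 h1 a b N s s₀ ha hb hs₀ has hbs hNs hN
  set κ : ℝ := if a = b then 2 else 3 with hκ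
  have hκ2 : 2 ≤ κ := by rw [hκ]; split_ifs <;> norm_num
  have hκ3 : κ ≤ 3 := by rw [hκ]; split_ifs <;> norm_num
  set f := ∑ r ∈ primesUpTo (scale s), F r / r with hf
  have hf0 : 0 ≤ f := sum_nonneg fun r _ => by have := h0 r; positivity
  have hs₀s : s₀ ≤ s := scale_le_scale.1 (hN.trans hNs)
  have hs : 0 ≤ s := hs₀.trans hs₀s
  have h1s : 1 ≤ (1 + s) ^ 3 := one_le_pow₀ (by linarith)
  have h1s' : (1 + s) ^ 6 = exp (3 * (log (1 + s) + log (1 + s))) := by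
    have : 3 * (log (1 + s) + log (1 + s)) = (6 : ℕ) * log (1 + s) := by push_cast; ring
    rw [this, exp_nat_mul, exp_log (by linarith)]
  have hls : 0 ≤ log (1 + s) := Real.log_nonneg (by linarith)
  have hls₀ : 0 ≤ log (1 + s₀) := Real.log_nonneg (by linarith)
  have hls₀s : log (1 + s₀) ≤ log (1 + s) := Real.log_le_log (by linarith) (by linarith)
  have hN1 : (1 : ℝ) ≤ N := (one_le_scale hs₀).trans hN
  set t := s₀ - log (1 + s₀) - C₂ with ht
  rw [neg_mul]
  rcases lt_or_ge t (log (1 + s)) with htl | htl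
  · have hsum : ∑ n ∈ (Ico N (N + N)).filter (fun n => (a * n - 1).Prime ∧ (b * n - 1).Prime),
        cmul F n ≤ N := by
      calc _ ≤ ∑ n ∈ Ico N (N + N), (1 : ℝ) :=
            (sum_le_sum_of_subset_of_nonneg (filter_subset _ _) fun n _ _ =>
              cmul_nonneg h0 n).trans (sum_le_sum fun n _ => cmul_le_one h0 h1 n)
        _ = N := by simp
    refine hsum.trans ?_
    have h5 : 1 ≤ exp (3 * C₂) * (1 + s) ^ 6 * exp (-(κ * s₀) + f) := by
      rw [h1s', ← exp_add, ← exp_add, one_le_exp_iff]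
      nlinarith
    calc (N : ℝ) ≤ N * (exp (3 * C₂) * (1 + s) ^ 6 * exp (-(κ * s₀) + f)) :=
          le_mul_of_one_le_right (by positivity) h5
      _ = exp (3 * C₂) * N * (1 + s) ^ 6 * exp (-(κ * s₀) + f) := by ring
      _ ≤ _ := by
        gcongr
        have := exp_pos (3 * (C₀ + 6 + C₂))
        have := exp_pos (4 : ℝ)
        linarith
  have ht0 : 0 ≤ t := hls.trans htl
  have het : (1 + s₀) * exp t = exp s₀ / (4 * K) := by
    rw [ht, exp_sub, exp_sub, exp_log (by linarith), hC₂e]; field_simp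
  have hes₀ : 1 + s₀ ≤ exp s₀ := by have := add_one_le_exp s₀; linarith
  have het1 : 1 ≤ exp t := one_le_exp ht0
  have hKe : K * ((1 + s₀) * exp t) = exp s₀ / 4 := by rw [het]; field_simp
  have het2 : exp t * 2 < exp s₀ := by
    have h5 : exp t ≤ (1 + s₀) * exp t := le_mul_of_one_le_left (exp_pos t).le (by linarith)
    have h6 : 26 * ((1 + s₀) * exp t) ≤ K * ((1 + s₀) * exp t) :=
      mul_le_mul_of_nonneg_right hK0 (by positivity)
    linarith
  have hwN : scale t + 1 < N := by
    refine lt_of_lt_of_le ?_ hN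
    have : scale t + 1 ≤ 2 * scale t := by linarith [one_le_scale ht0]
    refine this.trans_lt ?_
    rw [scale, scale]
    have h2 : (2 : ℝ) ≤ exp 1 := by have := add_one_le_exp (1 : ℝ); linarith
    calc 2 * exp (exp t - 1) ≤ exp 1 * exp (exp t - 1) := by gcongr
      _ = exp (exp t) := by rw [← exp_add]; ring_nf
      _ < _ := exp_lt_exp.2 (by linarith)
  set D := a * b * (if a = b then 1 else Nat.dist a b) with hD
  have hD0 : D ≠ 0 := by
    rw [hD]
    refine mul_ne_zero (mul_ne_zero (by omega) (by omega)) ?_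
    split_ifs with h
    · simp
    · exact (Nat.dist_pos_of_ne h).ne'
  have hlogD : log D ≤ 3 * exp s := by
    have hd : (((if a = b then 1 else Nat.dist a b : ℕ)) : ℝ) ≤ scale s := by
      split_ifs with h
      · simpa using one_le_scale hs
      · rcases le_total a b with hle | hle
        · rw [Nat.dist_eq_sub_of_le hle]
          exact le_trans (by exact_mod_cast Nat.sub_le _ _) hbs
        · rw [Nat.dist_eq_sub_of_le_right hle]
          exact le_trans (by exact_mod_cast Nat.sub_le _ _) has
    have h5 : (D : ℝ) ≤ scale s ^ 3 := by
      rw [hD, Nat.cast_mul, Nat.cast_mul, pow_succ, pow_two]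
      have := scale_pos s
      exact mul_le_mul (mul_le_mul has hbs (by positivity) (by positivity)) hd (by positivity)
        (by positivity)
    calc log D ≤ log (scale s ^ 3) :=
          Real.log_le_log (by exact_mod_cast Nat.pos_of_ne_zero hD0) h5
      _ = 3 * (exp s - 1) := by rw [Real.log_pow, log_scale]; norm_num
      _ ≤ _ := by linarith
  set Q := (primesIoc (log (1 + s)) t).filter (fun r => ¬ r ∣ D) with hQ
  have hQm : ∀ r ∈ Q, r.Prime ∧ (r : ℝ) ≤ scale t ∧ ¬ r ∣ D := fun r hr => by
    rw [hQ, mem_filter, mem_primesIoc] at hr; exact ⟨hr.1.1, hr.1.2.2, hr.2⟩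
  set h : ℕ → ℕ → ℝ := fun r n => if (a * n) % r = 1 ∨ (b * n) % r = 1 then (1 : ℝ) else
      if n % r = 0 then 1 - F r else 0 with hh
  set σ := ∑ r ∈ Q, (∑ n ∈ range r, h r n) / r with hσ
  have hh0 : ∀ r n, 0 ≤ h r n := fun r n => by
    rw [hh]; simp only; split_ifs <;> linarith [h1 r]
  have hh1 : ∀ r n, h r n ≤ 1 := fun r n => by
    rw [hh]; simp only; split_ifs <;> linarith [h0 r]
  have hσ0 : 0 ≤ σ := sum_nonneg fun r _ =>
    div_nonneg (sum_nonneg fun n _ => hh0 r n) (by positivity)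
  have hsub : Q ⊆ primesUpTo (scale t) := fun r hr =>
    mem_primesUpTo.2 ⟨(hQm r hr).1, (hQm r hr).2.1⟩
  have hts : t ≤ s := by linarith
  have hσup : σ ≤ 3 * (t + C₀) := by
    calc σ ≤ ∑ r ∈ Q, 3 * (1 / (r : ℝ)) := by
          refine sum_le_sum fun r hr => ?_
          rw [mul_one_div]
          gcongr
          exact sum_ite_mod_le (hQm r hr).1 (by linarith [h0 r])
      _ = 3 * ∑ r ∈ Q, 1 / (r : ℝ) := by rw [mul_sum]
      _ ≤ 3 * primeRecipSum (scale t) := by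
          refine mul_le_mul_of_nonneg_left ?_ (by norm_num)
          exact sum_le_sum_of_subset_of_nonneg hsub fun _ _ _ => by positivity
      _ ≤ _ := by
          have := (abs_le.1 (hM1 t ht0)).2
          linarith
  have hσlow : κ * s₀ - f - 3 * (C₀ + 6 + C₂) - 3 * (log (1 + s) + log (1 + s)) ≤ σ := by
    have e1 : ∑ r ∈ Q, (κ / r - F r / r) ≤ σ := by
      refine sum_le_sum fun r hr => ?_
      obtain ⟨hrp, -, hrD⟩ := hQm r hr
      rw [← sub_div]
      gcongr
      rw [hD] at hrD
      refine le_trans ?_ (le_sum_ite_mod (a := a) (b := b) hrp (x := 1 - F r)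
        (fun h => hrD ((h.mul_right _).mul_right _)) (fun h => hrD ((h.mul_left _).mul_right _))
        (by linarith [h1 r]) ?_)
      · rw [hκ]; split_ifs <;> linarith
      · by_cases hab : a = b
        · exact Or.inl hab
        · rw [if_neg hab] at hrD
          exact Or.inr fun h => hrD (h.mul_left _)
    have e2 : ∑ r ∈ Q, F r / r ≤ f :=
      sum_le_sum_of_subset_of_nonneg (hsub.trans (primesUpTo_mono (scale_le_scale.2 hts)))
        fun r _ _ => by have := h0 r; positivity
    have e3 : t - log (1 + s) - C₀ - 6 ≤ ∑ r ∈ Q, 1 / (r : ℝ) := by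
      have m1 := (abs_le.1 (hM2 _ t hls htl)).1
      have m2 := sum_primeFactors_inv_le hD0 hs hlogD t
      rw [← sum_filter_add_sum_filter_not _ (fun r => r ∣ D)] at m1
      linarith
    rw [sum_sub_distrib] at e1
    have e4 : ∑ r ∈ Q, κ / (r : ℝ) = κ * ∑ r ∈ Q, 1 / (r : ℝ) := by
      rw [mul_sum]; exact sum_congr rfl fun r _ => by ring
    have e5 : κ * (t - log (1 + s) - C₀ - 6) ≤ κ * ∑ r ∈ Q, 1 / (r : ℝ) :=
      mul_le_mul_of_nonneg_left e3 (by linarith)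
    have e6 : κ * (log (1 + s₀) + C₂ + log (1 + s) + C₀ + 6) ≤
        3 * (log (1 + s₀) + C₂ + log (1 + s) + C₀ + 6) :=
      mul_le_mul_of_nonneg_right hκ3 (by linarith)
    have e7 : κ * (t - log (1 + s) - C₀ - 6) =
      κ * s₀ - κ * (log (1 + s₀) + C₂ + log (1 + s) + C₀ + 6) := by rw [ht]; ring
    linarith
  set k := ⌈4 * σ⌉₊ with hk
  have hk1 : 4 * σ ≤ k := Nat.le_ceil _
  have hk2 : (k : ℝ) < 4 * σ + 1 := Nat.ceil_lt_add_one (by linarith)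
  have hbrun := brun_sieve (h := h) Q (fun r hr => (hQm r hr).1)
    (fun r => periodic_ite_mod a b r (1 - F r)) hh0 hh1
    (fun r hr => sum_ite_mod_le (hQm r hr).1 (by linarith [h0 r])) N N k
    (by linarith)
  have hstart : ∑ n ∈ (Ico N (N + N)).filter (fun n => (a * n - 1).Prime ∧ (b * n - 1).Prime),
      cmul F n ≤ ∑ n ∈ Ico N (N + N), ∏ r ∈ Q, (1 - h r n) := by
    calc _ ≤ ∑ n ∈ (Ico N (N + N)).filter (fun n => (a * n - 1).Prime ∧ (b * n - 1).Prime),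
          ∏ r ∈ Q, (1 - h r n) := by
          refine sum_le_sum fun n hn => ?_
          simp only [mem_filter, mem_Ico] at hn
          exact sieve_weight_le h0 h1 (fun r hr => ⟨(hQm r hr).1, (hQm r hr).2.1⟩) ha hb hn.1.1
            hwN hn.2.1 hn.2.2
      _ ≤ _ := sum_le_sum_of_subset_of_nonneg (filter_subset _ _) fun n _ _ =>
          prod_nonneg fun r _ => by linarith [hh1 r n]
  rw [← hσ] at hbrun
  clear_value σ k h Q D f κ
  have hrem : (1 + 3 * (#Q : ℝ)) ^ (2 * k) ≤ exp 4 * N * exp (-(κ * s₀) + f) := by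
    have hcard : (#Q : ℝ) ≤ scale t := by
      have : #Q ≤ ⌊scale t⌋₊ := by
        calc #Q ≤ #(Icc 1 ⌊scale t⌋₊) := card_le_card fun r hr => by
              rw [mem_Icc]
              exact ⟨(hQm r hr).1.one_lt.le, Nat.le_floor (hQm r hr).2.1⟩
          _ = _ := by simp
      exact (Nat.cast_le.2 this).trans (Nat.floor_le (scale_pos t).le)
    refine (sieve_remainder_le (Nat.cast_nonneg _) hcard ht0 hKe (k := k) ?_).trans ?_
    · have : t ≤ s₀ := by linarith
      have := mul_nonneg hC₀.le hs₀
      rw [hK]; push_cast; linarith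
    · have h5 : -(3 * s₀) ≤ -(κ * s₀) + f := by
        have := mul_le_mul_of_nonneg_right hκ3 hs₀
        linarith
      have h6 := exp_le_exp.2 h5
      exact mul_le_mul (mul_le_mul_of_nonneg_left hN (exp_pos 4).le) h6 (exp_pos _).le
        (by positivity)
  have hmain : 2 * (N : ℝ) * exp (-σ) ≤
      2 * exp (3 * (C₀ + 6 + C₂)) * N * (1 + s) ^ 6 * exp (-(κ * s₀) + f) := by
    have : exp (-σ) ≤ exp (3 * (C₀ + 6 + C₂)) * (1 + s) ^ 6 * exp (-(κ * s₀) + f) := by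
      rw [h1s', ← exp_add, ← exp_add]
      exact exp_le_exp.2 (by linarith)
    calc _ ≤ 2 * (N : ℝ) * (exp (3 * (C₀ + 6 + C₂)) * (1 + s) ^ 6 * exp (-(κ * s₀) + f)) := by
          gcongr
      _ = _ := by ring
  have h16 : 1 ≤ (1 + s) ^ 6 := one_le_pow₀ (by linarith)
  have hrem' : (1 + 3 * (#Q : ℝ)) ^ (2 * k) ≤ exp 4 * N * (1 + s) ^ 6 * exp (-(κ * s₀) + f) := by
    refine hrem.trans ?_
    rw [mul_right_comm _ ((1 + s) ^ 6)]
    exact le_mul_of_one_le_right (by positivity) h16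
  have hrest : 0 ≤ exp (3 * C₂) * N * (1 + s) ^ 6 * exp (-(κ * s₀) + f) := by positivity
  calc _ ≤ _ := hstart
    _ ≤ _ := hbrun
    _ ≤ _ := add_le_add hmain hrem'
    _ ≤ _ := by linarith

/-- The logarithmic form of the upper bound sieve. -/
lemma sieve_log : ∃ C : ℝ, 0 < C ∧ ∀ F : ℕ → ℝ, (∀ p, 0 ≤ F p) → (∀ p, F p ≤ 1) →
    ∀ (a b : ℕ) (s s₀ : ℝ) (A : Finset ℕ), 1 ≤ a → 1 ≤ b → 0 ≤ s₀ → 0 ≤ s → (a : ℝ) ≤ scale s →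
    (b : ℝ) ≤ scale s → (∀ n ∈ A, scale s₀ ≤ n ∧ (n : ℝ) ≤ scale s ∧
      (a * n - 1).Prime ∧ (b * n - 1).Prime) →
    ∑ n ∈ A, cmul F n / n ≤ C * (1 + s) ^ 6 * exp (s - (if a = b then 2 else 3) * s₀ +
        ∑ r ∈ primesUpTo (scale s), F r / r) := by
  obtain ⟨C, hC, h⟩ := sieve_dyadic
  refine ⟨3 * C, by positivity, ?_⟩
  intro F h0 h1 a b s s₀ A ha hb hs₀ hs has hbs hA
  set κ : ℝ := if a = b then 2 else 3 with hκ
  set f := ∑ r ∈ primesUpTo (scale s), F r / r with hf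
  set N₀ := ⌈scale s₀⌉₊ with hN₀
  have hN₀1 : 0 < N₀ := Nat.ceil_pos.2 (scale_pos _)
  set B := C * (1 + s) ^ 6 * exp (-κ * s₀ + f) with hB
  have hB0 : 0 ≤ B := by positivity
  have hdiv : ∀ n ∈ A, N₀ * 2 ^ Nat.log 2 (n / N₀) ≤ n ∧ n < N₀ * 2 ^ (Nat.log 2 (n / N₀) + 1) := by
    intro n hn
    have h5 : N₀ ≤ n := Nat.ceil_le.2 (hA n hn).1
    have h6 : n / N₀ ≠ 0 := (Nat.div_pos h5 hN₀1).ne'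
    constructor
    · calc _ ≤ N₀ * (n / N₀) := Nat.mul_le_mul_left _ (Nat.pow_log_le_self 2 h6)
        _ ≤ n := Nat.mul_div_le n N₀
    · have := Nat.lt_pow_succ_log_self (b := 2) (by norm_num) (n / N₀)
      rw [mul_comm]
      exact (Nat.div_lt_iff_lt_mul hN₀1).1 this
  have hmaps : ∀ n ∈ A, Nat.log 2 (n / N₀) ∈ range (⌊2 * exp s⌋₊ + 1) := by
    intro n hn
    rw [mem_range, Nat.lt_succ_iff]
    apply Nat.le_floor
    have h5 : 2 ^ Nat.log 2 (n / N₀) ≤ n :=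
      (Nat.le_mul_of_pos_left _ hN₀1).trans (hdiv n hn).1
    have h6 : (2 : ℝ) ^ Nat.log 2 (n / N₀) ≤ scale s :=
      le_trans (by exact_mod_cast h5) (hA n hn).2.1
    have h7 := Real.log_le_log (by positivity) h6
    rw [Real.log_pow, log_scale] at h7
    have h8 := Real.log_two_gt_d9
    have h9 : (0 : ℝ) ≤ Nat.log 2 (n / N₀) := Nat.cast_nonneg _
    nlinarith
  rw [← sum_fiberwise_of_maps_to hmaps]
  have hblock : ∀ i ∈ range (⌊2 * exp s⌋₊ + 1),
      ∑ n ∈ A.filter (fun n => Nat.log 2 (n / N₀) = i), cmul F n / n ≤ B := by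
    intro i _
    set N := N₀ * 2 ^ i with hN
    rcases (A.filter (fun n => Nat.log 2 (n / N₀) = i)).eq_empty_or_nonempty with he | ⟨m, hm⟩
    · rw [he]; simpa using hB0
    have hNpos : 0 < N := by positivity
    have hNpos' : (0 : ℝ) < N := by exact_mod_cast hNpos
    rw [mem_filter] at hm
    have hms : (N : ℝ) ≤ scale s := by
      have := (hdiv m hm.1).1
      rw [hm.2] at this
      exact le_trans (by exact_mod_cast this) (hA m hm.1).2.1
    have hs₀N : scale s₀ ≤ N := (Nat.le_ceil _).trans
      (by exact_mod_cast Nat.le_mul_of_pos_right _ (by positivity))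
    have hmem : ∀ n ∈ A.filter (fun n => Nat.log 2 (n / N₀) = i), N ≤ n ∧ n < N + N := by
      intro n hn
      rw [mem_filter] at hn
      have := hdiv n hn.1
      rw [hn.2, pow_succ] at this
      exact ⟨this.1, by rw [hN]; linarith [this.2]⟩
    calc _ ≤ ∑ n ∈ A.filter (fun n => Nat.log 2 (n / N₀) = i), cmul F n / N := by
          refine sum_le_sum fun n hn => ?_
          have : (N : ℝ) ≤ n := by exact_mod_cast (hmem n hn).1
          exact div_le_div_of_nonneg_left (cmul_nonneg h0 n) hNpos' this
      _ = (∑ n ∈ A.filter (fun n => Nat.log 2 (n / N₀) = i), cmul F n) / N := by rw [sum_div]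
      _ ≤ (∑ n ∈ (Ico N (N + N)).filter (fun n => (a * n - 1).Prime ∧ (b * n - 1).Prime),
            cmul F n) / N := by
          refine div_le_div_of_nonneg_right ?_ hNpos'.le
          refine sum_le_sum_of_subset_of_nonneg (fun n hn => ?_) fun n _ _ => cmul_nonneg h0 n
          rw [mem_filter, mem_Ico]
          exact ⟨hmem n hn, (hA n (mem_filter.1 hn).1).2.2⟩
      _ ≤ (C * N * (1 + s) ^ 6 * exp (-κ * s₀ + f)) / N :=
          div_le_div_of_nonneg_right (h F h0 h1 a b N s s₀ ha hb hs₀ has hbs hms hs₀N) hNpos'.le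
      _ = B := by rw [hB]; field_simp
  calc _ ≤ ∑ i ∈ range (⌊2 * exp s⌋₊ + 1), B := sum_le_sum hblock
    _ = (⌊2 * exp s⌋₊ + 1 : ℕ) * B := by rw [sum_const, card_range, nsmul_eq_mul]
    _ ≤ (3 * exp s) * B := by
        refine mul_le_mul_of_nonneg_right ?_ hB0
        have h5 := Nat.floor_le (show 0 ≤ 2 * exp s by positivity)
        have h6 := one_le_exp hs
        push_cast; linarith
    _ = 3 * C * (1 + s) ^ 6 * exp (s - κ * s₀ + f) := by
        have : exp (s - κ * s₀ + f) = exp s * exp (-κ * s₀ + f) := by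
          rw [← exp_add]; congr 1; ring
        rw [this, hB]; ring

lemma scale_add_one_le {t : ℝ} (ht : 0 ≤ t) : scale t + 1 ≤ scale (t + 1) := by
  have h1 := one_le_scale ht
  have h2 : 2 * scale t ≤ scale (t + 1) := by
    have h3 : log 2 + (exp t - 1) ≤ exp (t + 1) - 1 := by
      have h4 := Real.log_two_lt_d9
      have h5 := Real.add_one_le_exp (1 : ℝ)
      have h6 := one_le_exp ht
      rw [exp_add]; nlinarith
    calc 2 * scale t = exp (log 2 + (exp t - 1)) := by
          rw [exp_add, exp_log two_pos, scale]
      _ ≤ scale (t + 1) := exp_le_exp.2 h3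
  linarith

/-- Euler product bound for sums of `cmul f n / n`. -/
lemma euler_sum (M : ℝ) : ∃ C : ℝ, 1 ≤ C ∧ ∀ f : ℕ → ℝ, (∀ p, 0 ≤ f p) → (∀ p, f p ≤ M) →
    (∀ p : ℕ, p.Prime → f p ≤ 3 / 4 * p) → ∀ P A : Finset ℕ, (∀ p ∈ P, p.Prime) →
    (∀ n ∈ A, n ≠ 0 ∧ ∀ p, p.Prime → p ∣ n → p ∈ P) →
    ∑ n ∈ A, cmul f n / n ≤ C * exp (∑ p ∈ P, f p / p) := by
  have hs : Summable fun n : ℕ => 1 / (n : ℝ) ^ 2 := Real.summable_one_div_nat_pow.2 one_lt_two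
  set S := ∑' n : ℕ, 1 / (n : ℝ) ^ 2
  have hS : 0 ≤ S := tsum_nonneg fun n => by positivity
  refine ⟨exp (2 * M ^ 2 * S), one_le_exp (by positivity), fun f h0 hM h34 P A hP hA => ?_⟩
  have hF0 : ∀ p : ℕ, 0 ≤ f p * (1 / (p : ℝ)) := fun p => mul_nonneg (h0 p) (by positivity)
  have hF34 : ∀ p ∈ P, f p * (1 / (p : ℝ)) ≤ 3 / 4 := fun p hp => by
    have : (0 : ℝ) < p := by exact_mod_cast (hP p hp).pos
    rw [mul_one_div, div_le_iff₀ this]; exact h34 p (hP p hp)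
  calc ∑ n ∈ A, cmul f n / n = ∑ n ∈ A, cmul (fun p => f p * (1 / (p : ℝ))) n :=
        sum_congr rfl fun n _ => by rw [cmul_mul_fun, cmul_cast_inv, mul_one_div]
    _ ≤ ∏ p ∈ P, (1 - f p * (1 / (p : ℝ)))⁻¹ :=
        sum_cmul_le_prod hF0 P A (fun p hp => (hF34 p hp).trans_lt (by norm_num)) hA
    _ ≤ ∏ p ∈ P, exp (f p / p + 2 * M ^ 2 * (1 / (p : ℝ) ^ 2)) := by
        refine prod_le_prod (fun p hp => inv_nonneg.2 (by linarith [hF34 p hp])) fun p hp => ?_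
        have hx := hF34 p hp
        have hx0 := hF0 p
        have h1 : (f p * (1 / (p : ℝ))) ^ 2 ≤ M ^ 2 * (1 / (p : ℝ) ^ 2) := by
          have : (f p) ^ 2 ≤ M ^ 2 := pow_le_pow_left₀ (h0 p) (hM p) 2
          calc _ = (f p) ^ 2 * (1 / (p : ℝ) ^ 2) := by rw [mul_pow, one_div_pow]
            _ ≤ _ := mul_le_mul_of_nonneg_right this (by positivity)
        rw [div_eq_mul_one_div (f p)]
        set x := f p * (1 / (p : ℝ))
        have h2 : 1 / 4 ≤ 1 - x := by linarith
        refine le_trans ?_ (exp_le_exp.2 (show x + 2 * x ^ 2 ≤ _ by linarith))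
        rw [inv_le_comm₀ (by linarith) (exp_pos _), ← exp_neg]
        have h3 := Real.quadratic_le_exp_of_nonneg (show 0 ≤ x + 2 * x ^ 2 by positivity)
        rw [exp_neg, inv_le_comm₀ (exp_pos _) (by linarith)]
        refine le_trans ?_ h3
        rw [inv_le_iff_one_le_mul₀ (by linarith)]
        have : 0 ≤ x ^ 2 * (3 / 4 - x) := by
          apply mul_nonneg (sq_nonneg _); linarith
        nlinarith [mul_nonneg (sq_nonneg x) hx0, mul_nonneg this hx0, mul_nonneg (mul_nonneg this hx0) hx0]
    _ = exp (∑ p ∈ P, f p / p + 2 * M ^ 2 * ∑ p ∈ P, 1 / (p : ℝ) ^ 2) := by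
        rw [← exp_sum, sum_add_distrib, mul_sum]
    _ ≤ exp (∑ p ∈ P, f p / p + 2 * M ^ 2 * S) := by
        have := hs.sum_le_tsum P fun i _ => by positivity
        gcongr
    _ = _ := by rw [exp_add, mul_comm]

lemma prime_dvd_succ {p r : ℕ} {T : ℝ} (hp : p.Prime) (hpT : iterLog p ≤ T) (hT : 0 ≤ T)
    (hr : r ∣ p + 1) : (r : ℝ) ≤ scale (T + 1) := by
  have h1 : (1 : ℝ) ≤ p := by exact_mod_cast hp.one_lt.le
  have h2 : (p : ℝ) ≤ scale T := (le_scale_iff h1).2 hpT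
  have h3 : (r : ℝ) ≤ p + 1 := by exact_mod_cast Nat.le_of_dvd (by omega) hr
  linarith [scale_add_one_le hT]

/-- Sums over shifted primes in a unit window on the `iterLog` scale. -/
lemma sum_shifted_le : ∃ C : ℝ, 0 < C ∧ ∀ F : ℕ → ℝ, (∀ p, 0 ≤ F p) → (∀ p, F p ≤ 1) →
    ∀ (w : ℝ) (A : Finset ℕ), 0 ≤ w → (∀ p ∈ A, p.Prime ∧ w ≤ iterLog p ∧ iterLog p ≤ w + 1) →
    ∑ p ∈ A, cmul F (p + 1) / ((p : ℝ) + 1) ≤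
      C * (1 + w) ^ 6 * exp (-w + ∑ r ∈ primesUpTo (scale w), F r / r) := by
  obtain ⟨C, hC, h⟩ := sieve_log
  obtain ⟨C₁, hC₁, -, hI⟩ := exists_abs_sum_primesIoc_le
  refine ⟨C * 3 ^ 6 * exp (4 + C₁), by positivity, fun F h0 h1 w A hw hA => ?_⟩
  have h2 := h F h0 h1 1 1 (w + 2) w (A.image (· + 1)) le_rfl le_rfl hw (by linarith)
    (by simpa using one_le_scale (by linarith)) (by simpa using one_le_scale (by linarith)) (by
      simp only [mem_image]
      rintro _ ⟨p, hp, rfl⟩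
      obtain ⟨hp1, hp2, hp3⟩ := hA p hp
      have h1 : (1 : ℝ) ≤ p := by exact_mod_cast hp1.one_lt.le
      have h4 : scale w ≤ p := (scale_le_iff h1).2 hp2
      have h5 := prime_dvd_succ hp1 hp3 (by linarith) (dvd_refl (p + 1))
      refine ⟨by push_cast; linarith, ?_, by simpa using hp1, by simpa using hp1⟩
      rwa [show w + 2 = w + 1 + 1 by ring])
  rw [sum_image (by intro a _ b _ hab; simpa using hab), if_pos rfl] at h2
  push_cast at h2
  refine h2.trans ?_
  have h3 : (1 + (w + 2)) ^ 6 ≤ 3 ^ 6 * (1 + w) ^ 6 := by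
    rw [← mul_pow]; exact pow_le_pow_left₀ (by linarith) (by linarith) 6
  have h4 : ∑ r ∈ primesUpTo (scale (w + 2)), F r / r ≤
      ∑ r ∈ primesUpTo (scale w), F r / r + (2 + C₁) := by
    rw [primesUpTo_scale_eq w (w + 2) (by linarith)]
    have h5 := (abs_le.1 (hI w (w + 2) hw (by linarith))).2
    have h6 : ∑ r ∈ primesIoc w (w + 2), F r / r ≤ ∑ r ∈ primesIoc w (w + 2), 1 / (r : ℝ) :=
      sum_le_sum fun r _ => div_le_div_of_nonneg_right (h1 r) (Nat.cast_nonneg r)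
    linarith
  calc _ ≤ C * (3 ^ 6 * (1 + w) ^ 6) *
        exp ((4 + C₁) + (-w + ∑ r ∈ primesUpTo (scale w), F r / r)) := by
        refine mul_le_mul (mul_le_mul_of_nonneg_left h3 hC.le) (exp_le_exp.2 (by linarith))
          (exp_pos _).le (by positivity)
    _ = _ := by rw [exp_add]; ring

/-- The product of the `p + 1` over a list. -/
def shiftProd (l : List ℕ) : ℕ := (l.map (· + 1)).prod

lemma shiftProd_cons (p : ℕ) (l : List ℕ) : shiftProd (p :: l) = (p + 1) * shiftProd l := by
  simp [shiftProd]

lemma shiftProd_ne_zero (l : List ℕ) : shiftProd l ≠ 0 := by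
  simp [shiftProd, List.prod_eq_zero_iff]

lemma prod_le_shiftProd (l : List ℕ) : l.prod ≤ shiftProd l := by
  induction l with
  | nil => simp [shiftProd]
  | cons a l ih => rw [shiftProd_cons, List.prod_cons]; exact Nat.mul_le_mul (by omega) ih

lemma cmul_shiftProd (F : ℕ → ℝ) (l : List ℕ) :
    cmul F (shiftProd l) = (l.map fun p => cmul F (p + 1)).prod := by
  induction l with
  | nil => simp [shiftProd]
  | cons a l ih => rw [shiftProd_cons, map_mul, ih]; simp

lemma cmul_list_prod (F : ℕ → ℝ) {l : List ℕ} (hl : ∀ p ∈ l, p.Prime) :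
    cmul F l.prod = (l.map F).prod := by
  induction l with
  | nil => simp
  | cons a l ih =>
    rw [List.prod_cons, map_mul, ih fun p hp => hl p (List.mem_cons_of_mem _ hp),
      cmul_prime _ (hl a List.mem_cons_self)]; simp

lemma shiftProd_eq_of_prod_eq {l l' : List ℕ} (hl : ∀ p ∈ l, p.Prime) (hl' : ∀ p ∈ l', p.Prime)
    (h : l.prod = l'.prod) : shiftProd l = shiftProd l' := by
  have h1 := (Nat.primeFactorsList_unique h hl).trans (Nat.primeFactorsList_unique rfl hl').symm
  exact (h1.map _).prod_eq

lemma dvd_shiftProd {l : List ℕ} {r : ℕ} (hr : r.Prime) (h : r ∣ shiftProd l) :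
    ∃ p ∈ l, r ∣ p + 1 := by
  rw [shiftProd, hr.prime.dvd_prod_iff] at h
  obtain ⟨a, ha, hd⟩ := h
  rw [List.mem_map] at ha
  obtain ⟨p, hp, rfl⟩ := ha
  exact ⟨p, hp, hd⟩

lemma shiftProd_le_pow_length {l : List ℕ} : ∀ {q : ℕ}, (∀ p ∈ l, p ≤ q) →
    shiftProd l ≤ (q + 1) ^ l.length := by
  induction l with
  | nil => simp [shiftProd]
  | cons a l ih =>
    intro q h
    rw [shiftProd_cons, List.length_cons, pow_succ, mul_comm]
    exact Nat.mul_le_mul (ih fun p hp => h p (List.mem_cons_of_mem _ hp))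
      (by have := h a List.mem_cons_self; omega)

lemma pow_length_le_cmul_shiftProd {x : ℝ} (hx : 1 ≤ x) (l : List ℕ) (hl : ∀ p ∈ l, p.Prime) :
    x ^ l.length ≤ cmul (fun _ => x) (shiftProd l) := by
  induction l with
  | nil => simp [shiftProd]
  | cons a l ih =>
    rw [shiftProd_cons, map_mul, List.length_cons, pow_succ, mul_comm]
    refine mul_le_mul ?_ (ih fun p hp => hl p (List.mem_cons_of_mem _ hp)) (by positivity)
      (cmul_nonneg (fun _ => by linarith) _)
    rw [cmul_apply _ (by omega)]
    simp only [List.map_const', List.prod_replicate]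
    refine le_self_pow₀ hx ?_
    have := hl a List.mem_cons_self
    have : 1 < a + 1 := by have := this.one_lt; omega
    simp [Nat.primeFactorsList_eq_nil]
    omega

/-- `l` is a list of primes on scale at most `T` with `m = ∏ (p + 1)`. -/
def IsRep (T : ℝ) (l : List ℕ) (m : ℕ) : Prop :=
  (∀ p ∈ l, p.Prime ∧ iterLog p ≤ T) ∧ shiftProd l = m

lemma cmul_const (x : ℝ) {n : ℕ} (hn : n ≠ 0) :
    cmul (fun _ => x) n = x ^ n.primeFactorsList.length := by
  rw [cmul_apply _ hn]; simp

lemma sum_rep_le (M : ℝ) : ∃ C : ℝ, 1 ≤ C ∧ ∀ f : ℕ → ℝ, (∀ p, 0 ≤ f p) → (∀ p, f p ≤ M) →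
    (∀ p : ℕ, p.Prime → f p ≤ 3 / 4 * p) → ∀ T : ℝ, 0 ≤ T → ∀ A : Finset ℕ,
    (∀ m ∈ A, ∃ l, IsRep T l m) →
    ∑ m ∈ A, cmul f m / m ≤ C * exp (∑ r ∈ primesUpTo (scale (T + 1)), f r / r) := by
  obtain ⟨C, hC, h⟩ := euler_sum M
  refine ⟨C, hC, fun f h0 hM h34 T hT A hA => h f h0 hM h34 _ A
    (fun p hp => (mem_primesUpTo.1 hp).1) fun m hm => ?_⟩
  obtain ⟨l, hl, rfl⟩ := hA m hm
  refine ⟨shiftProd_ne_zero l, fun r hr hd => mem_primesUpTo.2 ⟨hr, ?_⟩⟩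
  obtain ⟨p, hp, hrp⟩ := dvd_shiftProd hr hd
  exact prime_dvd_succ (hl p hp).1 (hl p hp).2 hT hrp

lemma sum_list_le (M : ℝ) : ∃ C : ℝ, 1 ≤ C ∧ ∀ f : ℕ → ℝ, (∀ p, 0 ≤ f p) → (∀ p, f p ≤ M) →
    (∀ p : ℕ, p.Prime → f p ≤ 3 / 4 * p) → ∀ T : ℝ, ∀ A : Finset ℕ, ∀ l : ℕ → List ℕ,
    (∀ m ∈ A, IsRep T (l m) m) →
    ∑ m ∈ A, ((l m).map f).prod / m ≤ C * exp (∑ r ∈ primesUpTo (scale T), f r / r) := by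
  obtain ⟨C, hC, h⟩ := euler_sum M
  refine ⟨C, hC, fun f h0 hM h34 T A l hA => ?_⟩
  have hpr : ∀ m ∈ A, ∀ p ∈ l m, p.Prime := fun m hm p hp => ((hA m hm).1 p hp).1
  have hpos : ∀ m ∈ A, 0 < (l m).prod := fun m hm => List.prod_pos fun p hp => (hpr m hm p hp).pos
  have hinj : Set.InjOn (fun m => (l m).prod) A := by
    intro m hm m' hm' hmm'
    have := shiftProd_eq_of_prod_eq (hpr m hm) (hpr m' hm') hmm'
    rwa [(hA m hm).2, (hA m' hm').2] at this
  refine le_trans ?_ (h f h0 hM h34 (primesUpTo (scale T)) (A.image fun m => (l m).prod)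
    (fun p hp => (mem_primesUpTo.1 hp).1) ?_)
  · rw [sum_image hinj]
    refine sum_le_sum fun m hm => ?_
    rw [cmul_list_prod f (hpr m hm)]
    have h1 : ((l m).prod : ℝ) ≤ m := by
      have := prod_le_shiftProd (l m)
      rw [(hA m hm).2] at this
      exact_mod_cast this
    refine div_le_div_of_nonneg_left (List.prod_nonneg ?_) (by exact_mod_cast hpos m hm) h1
    simp only [List.mem_map]; rintro _ ⟨p, -, rfl⟩; exact h0 p
  · simp only [mem_image]
    rintro _ ⟨m, hm, rfl⟩
    refine ⟨(hpos m hm).ne', fun r hr hd => mem_primesUpTo.2 ?_⟩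
    obtain ⟨p, hp, hrp⟩ := (hr.prime.dvd_prod_iff).1 hd
    obtain ⟨hp1, hp2⟩ := (hA m hm).1 p hp
    rw [(Nat.prime_dvd_prime_iff_eq hr hp1).1 hrp]
    exact ⟨hp1, (le_scale_iff (by exact_mod_cast hp1.one_lt.le)).2 hp2⟩

/-- Splitting a sum over primes into unit windows on the `iterLog` scale. -/
lemma sum_primes_le_sum_windows {A : Finset ℕ} {g : ℕ → ℝ} {B : ℕ → ℝ} {n : ℕ}
    (hA : ∀ p ∈ A, p.Prime ∧ iterLog p ≤ n)
    (h : ∀ k : ℕ, k ≤ n → ∀ A' ⊆ A, (∀ p ∈ A', p.Prime ∧ (k : ℝ) ≤ iterLog p ∧ iterLog p ≤ k + 1) →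
      ∑ p ∈ A', g p ≤ B k) :
    ∑ p ∈ A, g p ≤ ∑ k ∈ range (n + 1), B k := by
  have h0 : ∀ p ∈ A, 0 ≤ iterLog p := fun p hp =>
    iterLog_nonneg (by exact_mod_cast (hA p hp).1.one_lt.le)
  have hmaps : ∀ p ∈ A, ⌊iterLog p⌋₊ ∈ range (n + 1) := fun p hp => by
    rw [mem_range, Nat.lt_succ_iff]; exact Nat.floor_le_of_le (hA p hp).2
  rw [← sum_fiberwise_of_maps_to hmaps]
  refine sum_le_sum fun k hk => h k (Nat.lt_succ_iff.1 (mem_range.1 hk)) _ (filter_subset _ _) ?_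
  intro p hp
  rw [mem_filter] at hp
  refine ⟨(hA p hp.1).1, ?_, ?_⟩
  · rw [← hp.2]; exact Nat.floor_le (h0 p hp.1)
  · rw [← hp.2]; exact (Nat.lt_floor_add_one _).le

lemma sum_few_factors_le (K : ℕ) : ∃ B : ℝ, 0 < B ∧ ∀ A : Finset ℕ,
    (∀ p ∈ A, p.Prime ∧ (p + 1).primeFactorsList.length ≤ K) → ∑ p ∈ A, 1 / (p : ℝ) ≤ B := by
  obtain ⟨C, hC, h⟩ := sum_shifted_le
  obtain ⟨C₁, hC₁, hM, -⟩ := exists_abs_sum_primesIoc_le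
  set D := 2 ^ (K + 1) * C * exp (C₁ / 2) with hD
  have hD0 : 0 < D := by positivity
  have hs : Summable fun k : ℕ => D * (((k + 1 : ℕ) : ℝ) ^ 6 * exp (-(1 / 2) * k)) := by
    refine Summable.mul_left _ ?_
    have h1 := (summable_nat_add_iff 1).2
      (Real.summable_pow_mul_exp_neg_nat_mul 6 (show (0 : ℝ) < 1 / 2 by norm_num))
    refine (h1.mul_left (exp (1 / 2))).congr fun k => ?_
    push_cast
    rw [show -(1 / 2) * (k : ℝ) = 1 / 2 + -(1 / 2) * ((k : ℝ) + 1) by ring, exp_add]; ring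
  refine ⟨∑' k : ℕ, D * (((k + 1 : ℕ) : ℝ) ^ 6 * exp (-(1 / 2) * k)) + 1, ?_, fun A hA => ?_⟩
  · have : 0 ≤ ∑' k : ℕ, D * (((k + 1 : ℕ) : ℝ) ^ 6 * exp (-(1 / 2) * k)) :=
      tsum_nonneg fun k => by positivity
    linarith
  obtain ⟨n, hn⟩ : ∃ n : ℕ, ∀ p ∈ A, iterLog p ≤ n := by
    obtain ⟨n, hn⟩ := exists_nat_ge (∑ p ∈ A, |iterLog p|)
    exact ⟨n, fun p hp => ((le_abs_self _).trans
      (single_le_sum (f := fun p : ℕ => |iterLog p|) (fun _ _ => abs_nonneg _) hp)).trans hn⟩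
  have h1 : ∑ p ∈ A, 1 / (p : ℝ) ≤
      ∑ k ∈ range (n + 1), D * (((k + 1 : ℕ) : ℝ) ^ 6 * exp (-(1 / 2) * k)) := by
    refine sum_primes_le_sum_windows (fun p hp => ⟨(hA p hp).1, hn p hp⟩) fun k _ A' hA' hk => ?_
    have h2 := h (fun _ => 1 / 2) (fun _ => by norm_num) (fun _ => by norm_num) k A'
      (Nat.cast_nonneg k) hk
    have h3 : ∑ p ∈ A', 1 / (p : ℝ) ≤
        2 ^ (K + 1) * ∑ p ∈ A', cmul (fun _ => 1 / 2) (p + 1) / ((p : ℝ) + 1) := by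
      rw [mul_sum]
      refine sum_le_sum fun p hp => ?_
      have hp1 : (1 : ℝ) ≤ p := by exact_mod_cast (hA p (hA' hp)).1.one_lt.le
      have h4 : 1 ≤ 2 ^ K * cmul (fun _ => 1 / 2) (p + 1) := by
        rw [cmul_const _ (by omega), one_div_pow, mul_one_div, le_div_iff₀ (by positivity), one_mul]
        exact pow_le_pow_right₀ (by norm_num) (hA p (hA' hp)).2
      calc 1 / (p : ℝ) ≤ 2 / ((p : ℝ) + 1) := by
            rw [div_le_div_iff₀ (by linarith) (by linarith)]; linarith
        _ ≤ 2 * (2 ^ K * cmul (fun _ => 1 / 2) (p + 1)) / ((p : ℝ) + 1) :=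
            div_le_div_of_nonneg_right (by linarith) (by linarith)
        _ = _ := by ring
    have h5 : ∑ r ∈ primesUpTo (scale k), (1 / 2 : ℝ) / r ≤ (k + C₁) / 2 := by
      have := (abs_le.1 (hM k (Nat.cast_nonneg k))).2
      unfold primeRecipSum at this
      have h6 : ∑ r ∈ primesUpTo (scale k), (1 / 2 : ℝ) / r =
          1 / 2 * ∑ r ∈ primesUpTo (scale k), 1 / (r : ℝ) := by
        rw [mul_sum]; exact sum_congr rfl fun r _ => by ring
      rw [h6]; linarith
    calc _ ≤ _ := h3
      _ ≤ 2 ^ (K + 1) * (C * (1 + k) ^ 6 * exp (C₁ / 2 + -(1 / 2) * k)) := by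
          refine mul_le_mul_of_nonneg_left (h2.trans ?_) (by positivity)
          exact mul_le_mul_of_nonneg_left (exp_le_exp.2 (by linarith)) (by positivity)
      _ = _ := by rw [exp_add, hD]; push_cast; ring
  have := hs.sum_le_tsum (range (n + 1)) fun i _ => by positivity
  linarith

/-- Reciprocals of the products of shifted primes of scale at most `T` (Erdős). -/
lemma sum_inv_rep_le {ε : ℝ} (hε : 0 < ε) : ∃ C : ℝ, 1 ≤ C ∧ ∀ T : ℝ, 0 ≤ T → ∀ A : Finset ℕ,
    (∀ m ∈ A, ∃ l, IsRep T l m) → ∑ m ∈ A, 1 / (m : ℝ) ≤ C * exp (ε * T) := by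
  classical
  obtain ⟨C, hC, hrep⟩ := sum_rep_le (3 / 2)
  obtain ⟨C', hC', hlist⟩ := sum_list_le 1
  obtain ⟨C₁, hC₁, hM, -⟩ := exists_abs_sum_primesIoc_le
  set L := 2 / ε with hL
  have hL0 : 0 < L := by positivity
  have hu : exp (-L) ≤ ε / 2 := by
    rw [exp_neg, inv_le_comm₀ (exp_pos _) (by positivity), inv_div]
    linarith [Real.add_one_le_exp L]
  set K := ⌈20 * L / ε⌉₊ + 1 with hK
  have hK1 : (1 : ℝ) ≤ K := by rw [hK]; push_cast; linarith [Nat.cast_nonneg (α := ℝ) ⌈20 * L / ε⌉₊]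
  have hKε : 10 * (L / K) ≤ ε / 2 := by
    have h1 : 20 * L / ε ≤ K := (Nat.le_ceil _).trans (by rw [hK]; push_cast; linarith)
    rw [div_le_iff₀ hε] at h1
    rw [mul_div_assoc', div_le_iff₀ (by linarith)]; linarith
  obtain ⟨B, hB, hweak⟩ := sum_few_factors_le K
  refine ⟨C * exp (3 / 2 * (1 + C₁)) + C' * exp (B + ε / 2 * C₁), ?_, fun T hT A hA => ?_⟩
  · have h1 := one_le_exp (show 0 ≤ 3 / 2 * (1 + C₁) by positivity)
    have h2 : 1 ≤ C * exp (3 / 2 * (1 + C₁)) := one_le_mul_of_one_le_of_one_le hC h1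
    have : 0 ≤ C' * exp (B + ε / 2 * C₁) := by positivity
    linarith
  have hne : ∀ m ∈ A, m ≠ 0 := fun m hm => by
    obtain ⟨l, -, rfl⟩ := hA m hm; exact shiftProd_ne_zero l
  rw [← sum_filter_add_sum_filter_not A (fun m => 10 * T < m.primeFactorsList.length), add_mul]
  have hmany : ∑ m ∈ A.filter (fun m => 10 * T < m.primeFactorsList.length), 1 / (m : ℝ) ≤
      C * exp (3 / 2 * (1 + C₁)) * exp (ε * T) := by
    have h1 := hrep (fun _ => 3 / 2) (fun _ => by norm_num) (fun _ => le_rfl)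
      (fun p hp => by have : (2 : ℝ) ≤ p := by exact_mod_cast hp.two_le
                      linarith) T hT (A.filter fun m => 10 * T < m.primeFactorsList.length)
      fun m hm => hA m (mem_filter.1 hm).1
    have h2 : ∑ r ∈ primesUpTo (scale (T + 1)), (3 / 2 : ℝ) / r ≤ 3 / 2 * (T + 1 + C₁) := by
      have := (abs_le.1 (hM (T + 1) (by linarith))).2
      unfold primeRecipSum at this
      have h6 : ∑ r ∈ primesUpTo (scale (T + 1)), (3 / 2 : ℝ) / r =
          3 / 2 * ∑ r ∈ primesUpTo (scale (T + 1)), 1 / (r : ℝ) := by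
        rw [mul_sum]; exact sum_congr rfl fun r _ => by ring
      rw [h6]; linarith
    have h3 : exp (3 / 2 * T) * ∑ m ∈ A.filter (fun m => 10 * T < m.primeFactorsList.length),
        1 / (m : ℝ) ≤ ∑ m ∈ A.filter (fun m => 10 * T < m.primeFactorsList.length),
        cmul (fun _ => 3 / 2) m / m := by
      rw [mul_sum]
      refine sum_le_sum fun m hm => ?_
      rw [mem_filter] at hm
      rw [mul_one_div]
      refine div_le_div_of_nonneg_right ?_ (Nat.cast_nonneg m)
      rw [cmul_const _ (hne m hm.1), ← Real.exp_log (show (0 : ℝ) < 3 / 2 by norm_num), ← exp_nat_mul]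
      refine exp_le_exp.2 ?_
      have h5 : (1 : ℝ) / 3 ≤ log (3 / 2) := by
        have := Real.one_sub_inv_le_log_of_pos (show (0 : ℝ) < 3 / 2 by norm_num)
        norm_num at this ⊢; linarith
      rw [exp_log (by norm_num)]
      nlinarith
    have h4 : exp (3 / 2 * T) * ∑ m ∈ A.filter (fun m => 10 * T < m.primeFactorsList.length),
        1 / (m : ℝ) ≤ exp (3 / 2 * T) * (C * exp (3 / 2 * (1 + C₁))) := by
      refine (h3.trans h1).trans ?_
      rw [mul_left_comm, ← exp_add]
      exact mul_le_mul_of_nonneg_left (exp_le_exp.2 (by linarith)) (by linarith)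
    refine (le_of_mul_le_mul_left h4 (exp_pos _)).trans (le_mul_of_one_le_right (by positivity) ?_)
    exact one_le_exp (by positivity)
  have hfew : ∑ m ∈ A.filter (fun m => ¬ 10 * T < m.primeFactorsList.length), 1 / (m : ℝ) ≤
      C' * exp (B + ε / 2 * C₁) * exp (ε * T) := by
    set A' := A.filter (fun m => ¬ 10 * T < m.primeFactorsList.length) with hA'
    have : ∀ m : ℕ, ∃ l, m ∈ A' → IsRep T l m := fun m => by
      by_cases hm : m ∈ A'
      · obtain ⟨l, hl⟩ := hA m (mem_filter.1 hm).1
        exact ⟨l, fun _ => hl⟩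
      · exact ⟨[], fun h => absurd h hm⟩
    choose l hl using this
    set f : ℕ → ℝ := fun p => if (p + 1).primeFactorsList.length ≤ K then 1 else exp (-L) with hf
    have he1 : exp (-L) ≤ 1 := exp_le_one_iff.2 (by linarith)
    have hf0 : ∀ p, 0 ≤ f p := fun p => by rw [hf]; dsimp only; split_ifs <;> positivity
    have hf1 : ∀ p, f p ≤ 1 := fun p => by rw [hf]; dsimp only; split_ifs <;> linarith
    have h1 := hlist f hf0 hf1 (fun p hp => by
      have : (2 : ℝ) ≤ p := by exact_mod_cast hp.two_le
      linarith [hf1 p]) T A' l hl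
    have hfp : ∀ p : ℕ, exp (-(L / K)) ^ (p + 1).primeFactorsList.length ≤ f p := by
      intro p
      rw [hf, ← exp_nat_mul]; dsimp only
      split_ifs with h
      · apply exp_le_one_iff.2
        have : 0 ≤ ((p + 1).primeFactorsList.length : ℝ) * (L / K) := by positivity
        linarith
      · apply exp_le_exp.2
        have h3 : (K : ℝ) ≤ (p + 1).primeFactorsList.length := by exact_mod_cast (not_le.1 h).le
        have h4 : (K : ℝ) * (L / K) = L := by field_simp
        have h5 := mul_le_mul_of_nonneg_right h3 (show 0 ≤ L / K by positivity)
        linarith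
    have h2 : ∀ m ∈ A', exp (-(ε / 2 * T)) ≤ ((l m).map f).prod := by
      intro m hm
      have h3 : cmul (fun _ => exp (-(L / K))) m ≤ ((l m).map f).prod := by
        have h4 := cmul_shiftProd (fun _ => exp (-(L / K))) (l m)
        rw [(hl m hm).2] at h4
        rw [h4]
        refine List.prod_map_le_prod_map₀ _ _ (fun p _ => cmul_nonneg (fun _ => (exp_pos _).le) _)
          fun p _ => ?_
        rw [cmul_const _ (by omega)]; exact hfp p
      refine le_trans ?_ h3
      have hm' := mem_filter.1 hm
      rw [cmul_const _ (hne m hm'.1), ← exp_nat_mul]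
      apply exp_le_exp.2
      have h4 := not_lt.1 hm'.2
      have h5 := mul_le_mul_of_nonneg_right h4 (show 0 ≤ L / K by positivity)
      nlinarith
    have h3 : exp (-(ε / 2 * T)) * ∑ m ∈ A', 1 / (m : ℝ) ≤
        C' * exp (∑ r ∈ primesUpTo (scale T), f r / r) := by
      rw [mul_sum]
      refine (sum_le_sum fun m hm => ?_).trans h1
      rw [mul_one_div]
      exact div_le_div_of_nonneg_right (h2 m hm) (Nat.cast_nonneg m)
    have h4 : ∑ r ∈ primesUpTo (scale T), f r / r ≤ B + ε / 2 * (T + C₁) := by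
      have h5 : ∀ r ∈ primesUpTo (scale T), f r / r ≤
          (if (r + 1).primeFactorsList.length ≤ K then 1 / (r : ℝ) else 0) +
            exp (-L) * (1 / (r : ℝ)) := by
        intro r _
        rw [hf]; dsimp only
        have : 0 ≤ exp (-L) * (1 / (r : ℝ)) := by positivity
        split_ifs
        · linarith
        · rw [zero_add, mul_one_div]
      refine (sum_le_sum h5).trans ?_
      rw [sum_add_distrib, ← sum_filter, ← mul_sum]
      have h6 := (abs_le.1 (hM T hT)).2
      unfold primeRecipSum at h6
      have h7 := hweak ((primesUpTo (scale T)).filter fun r => (r + 1).primeFactorsList.length ≤ K)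
        fun p hp => ⟨(mem_primesUpTo.1 (mem_filter.1 hp).1).1, (mem_filter.1 hp).2⟩
      have h8 : exp (-L) * ∑ r ∈ primesUpTo (scale T), 1 / (r : ℝ) ≤ ε / 2 * (T + C₁) :=
        mul_le_mul hu (by linarith) (sum_nonneg fun _ _ => by positivity) (by linarith)
      linarith
    have h5 : exp (-(ε / 2 * T)) * ∑ m ∈ A', 1 / (m : ℝ) ≤
        exp (-(ε / 2 * T)) * (C' * exp (B + ε / 2 * C₁) * exp (ε * T)) := by
      refine h3.trans ?_
      rw [mul_assoc C', ← exp_add, mul_left_comm, ← exp_add]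
      exact mul_le_mul_of_nonneg_left (exp_le_exp.2 (by linarith)) (by linarith)
    exact le_of_mul_le_mul_left h5 (exp_pos _)
  exact add_le_add hmany hfew

/-- The coefficients of the power series in Ford's theorem. -/
noncomputable def fordCoeff (k : ℕ) : ℝ := (k + 1) * log (k + 1) - k * log k - 1

lemma fordCoeff_nonneg (k : ℕ) : 0 ≤ fordCoeff (k + 1) := by
  have hk : (0 : ℝ) ≤ k := Nat.cast_nonneg k
  have h1 := Real.one_sub_inv_le_log_of_pos (show (0 : ℝ) < (k + 1 + 1) / (k + 1) by positivity)
  rw [Real.log_div (by positivity) (by positivity), inv_div] at h1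
  have h2 : (k + 1 : ℝ) * (1 - (k + 1) / (k + 1 + 1)) = (k + 1) / (k + 1 + 1) := by field_simp; ring
  have h3 : (1 : ℝ) / 2 ≤ (k + 1) / (k + 1 + 1) := by
    rw [div_le_div_iff₀ (by norm_num) (by positivity)]; linarith
  have h4 := Real.log_le_log two_pos (show (2 : ℝ) ≤ k + 1 + 1 by linarith)
  have h5 := Real.log_two_gt_d9
  have h6 := mul_le_mul_of_nonneg_left h1 (show (0 : ℝ) ≤ k + 1 by linarith)
  unfold fordCoeff; push_cast; nlinarith

lemma sum_fordCoeff (n : ℕ) :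
    ∑ j ∈ range n, fordCoeff (j + 1) = (n + 1) * log (n + 1) - n := by
  induction n with
  | zero => simp
  | succ n ih => rw [sum_range_succ, ih, fordCoeff]; push_cast; ring

/-- The number of prime factors of `n`, with multiplicity, whose scale lies in `(s, t]`. -/
noncomputable def omegaIn (s t : ℝ) (n : ℕ) : ℕ :=
  (n.primeFactorsList.filter (· ∈ primesIoc s t)).length

lemma cmul_ite_eq_pow (s t y : ℝ) {n : ℕ} (hn : n ≠ 0) :
    cmul (fun r => if r ∈ primesIoc s t then y else 1) n = y ^ omegaIn s t n := by
  rw [cmul_apply _ hn, omegaIn]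
  induction n.primeFactorsList with
  | nil => simp
  | cons a l ih =>
    rw [List.map_cons, List.prod_cons, ih, List.filter_cons]
    by_cases h : a ∈ primesIoc s t <;> simp [h, pow_succ, mul_comm]

lemma cmul_prod_fun {ι : Type*} (S : Finset ι) (F : ι → ℕ → ℝ) {n : ℕ} (hn : n ≠ 0) :
    cmul (fun p => ∏ i ∈ S, F i p) n = ∏ i ∈ S, cmul (F i) n := by
  classical
  induction S using Finset.induction_on with
  | empty => simpa using cmul_one_fun hn
  | insert a S ha ih =>
    simp only [prod_insert ha]
    rw [cmul_mul_fun, ih]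

lemma pow_le_mul_exp (n : ℕ) {δ : ℝ} (hδ : 0 < δ) :
    ∃ C : ℝ, 1 ≤ C ∧ ∀ T : ℝ, 0 ≤ T → (1 + T) ^ n ≤ C * exp (δ * T) := by
  have hn : (0 : ℝ) < n + 1 := by positivity
  have hc : 1 ≤ 1 + (n + 1) / δ := by
    have : 0 < ((n : ℝ) + 1) / δ := by positivity
    linarith
  refine ⟨(1 + (n + 1) / δ) ^ (n + 1), one_le_pow₀ hc, fun T hT => ?_⟩
  have h1 : 1 + T ≤ (1 + (n + 1) / δ) * exp (δ * T / (n + 1)) := by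
    have h2 := Real.add_one_le_exp (δ * T / (n + 1))
    have h3 := mul_le_mul_of_nonneg_left h2 (show 0 ≤ 1 + ((n : ℝ) + 1) / δ by linarith)
    have h4 : (1 + ((n : ℝ) + 1) / δ) * (δ * T / (n + 1) + 1) =
        1 + T + ((n : ℝ) + 1) / δ + δ * T / (n + 1) := by field_simp; ring
    have h5 : 0 ≤ ((n : ℝ) + 1) / δ + δ * T / (n + 1) := by positivity
    linarith
  calc (1 + T) ^ n ≤ (1 + T) ^ (n + 1) := pow_le_pow_right₀ (by linarith) (by omega)
    _ ≤ ((1 + (n + 1) / δ) * exp (δ * T / (n + 1))) ^ (n + 1) :=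
        pow_le_pow_left₀ (by linarith) h1 _
    _ = _ := by
        rw [mul_pow, ← exp_nat_mul]; congr 2; push_cast; field_simp

lemma deficient_rate_pos {ε : ℝ} (h0 : 0 < ε) (h1 : ε < 1) : 0 < ε + (1 - ε) * log (1 - ε) := by
  have h2 : 0 < 1 - ε := by linarith
  have h3 := Real.log_lt_sub_one_of_pos (inv_pos.2 h2) (by
    intro h; rw [inv_eq_one] at h; linarith)
  rw [Real.log_inv] at h3
  have h4 := mul_lt_mul_of_pos_left h3 h2
  have h5 : (1 - ε) * ((1 - ε)⁻¹ - 1) = ε := by field_simp; ring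
  linarith

/-- Primes `p` for which `p + 1` has too few prime factors in a given range are rare. -/
lemma deficient_sum {ε : ℝ} (h0 : 0 < ε) (h1 : ε < 1) : ∃ δ C : ℝ, 0 < δ ∧ 0 < C ∧
    ∀ s t T : ℝ, 0 ≤ s → s ≤ t → t ≤ T → ∀ A : Finset ℕ,
    (∀ p ∈ A, p.Prime ∧ t ≤ iterLog p ∧ iterLog p ≤ T ∧
      (omegaIn s t (p + 1) : ℝ) ≤ (1 - ε) * (t - s)) →
    ∑ p ∈ A, 1 / (p : ℝ) ≤ C * (1 + T) ^ 7 * exp (-δ * (t - s)) := by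
  obtain ⟨C, hC, h⟩ := sum_shifted_le
  obtain ⟨C₁, hC₁, hM, hI⟩ := exists_abs_sum_primesIoc_le
  set δ := ε + (1 - ε) * log (1 - ε) with hδ
  have hδ0 : 0 < δ := deficient_rate_pos h0 h1
  refine ⟨δ, 2 * C * exp (1 + C₁ + ε * C₁) * 3 ^ 7, hδ0, by positivity, ?_⟩
  intro s t T hs hst htT A hA
  have hT : 0 ≤ T := hs.trans (hst.trans htT)
  set D := 2 * C * exp (1 + C₁ + ε * C₁) with hD
  have hD0 : 0 < D := by positivity
  have hB : ∑ p ∈ A, 1 / (p : ℝ) ≤ ∑ k ∈ range (⌈T⌉₊ + 1), D * (3 * (1 + T)) ^ 6 *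
      exp (-δ * (t - s)) := by
    refine sum_primes_le_sum_windows (fun p hp => ⟨(hA p hp).1, ?_⟩) fun k hk A' hA' hAk => ?_
    · exact (hA p hp).2.2.1.trans (Nat.le_ceil T)
    rcases A'.eq_empty_or_nonempty with rfl | ⟨p₀, hp₀⟩
    · simp only [sum_empty]; positivity
    have hk0 : (0 : ℝ) ≤ k := Nat.cast_nonneg k
    have htk : t ≤ k + 1 := (hA p₀ (hA' hp₀)).2.1.trans (hAk p₀ hp₀).2.2
    have hkT : (k : ℝ) ≤ T + 1 := by
      have : (k : ℝ) ≤ ⌈T⌉₊ := by exact_mod_cast hk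
      exact this.trans (Nat.ceil_lt_add_one hT).le
    set F : ℕ → ℝ := fun r => if r ∈ primesIoc s t then 1 - ε else 1 with hF
    have hF0 : ∀ r, 0 ≤ F r := fun r => by rw [hF]; dsimp only; split_ifs <;> linarith
    have hF1 : ∀ r, F r ≤ 1 := fun r => by rw [hF]; dsimp only; split_ifs <;> linarith
    have h2 := h F hF0 hF1 k A' hk0 hAk
    have h3 : ∑ r ∈ primesUpTo (scale k), F r / r ≤ k + (1 + C₁ + ε * C₁) - ε * (t - s) := by
      have h4 : ∑ r ∈ primesUpTo (scale k), F r / r ≤ ∑ r ∈ primesUpTo (scale (k + 1)), F r / r :=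
        sum_le_sum_of_subset_of_nonneg (primesUpTo_mono (scale_le_scale.2 (by linarith)))
          fun r _ _ => div_nonneg (hF0 r) (Nat.cast_nonneg r)
      have h5 : ∑ r ∈ primesUpTo (scale (k + 1)), F r / r =
          ∑ r ∈ primesUpTo (scale (k + 1)), 1 / (r : ℝ) - ε * ∑ r ∈ primesIoc s t, 1 / (r : ℝ) := by
        have h6 : primesIoc s t = (primesUpTo (scale (k + 1))).filter (· ∈ primesIoc s t) := by
          ext r; rw [mem_filter, mem_primesUpTo]
          refine ⟨fun hr => ⟨?_, hr⟩, fun hr => hr.2⟩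
          rw [mem_primesIoc] at hr
          exact ⟨hr.1, hr.2.2.trans (scale_le_scale.2 htk)⟩
        conv_rhs => rw [h6]
        rw [sum_filter, mul_sum, ← sum_sub_distrib]
        refine sum_congr rfl fun r _ => ?_
        rw [hF]; dsimp only
        split_ifs <;> ring
      have h6 := (abs_le.1 (hM (k + 1) (by linarith))).2
      have h7 := mul_le_mul_of_nonneg_left (abs_le.1 (hI s t hs hst)).1 h0.le
      unfold primeRecipSum at h6
      rw [mul_sub] at h7
      linarith
    have h4 : ∀ p ∈ A', 1 / (p : ℝ) ≤ 2 * exp (-(1 - ε) * log (1 - ε) * (t - s)) *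
        (cmul F (p + 1) / ((p : ℝ) + 1)) := by
      intro p hp
      have hpA := hA p (hA' hp)
      have hp1 : (1 : ℝ) ≤ p := by exact_mod_cast hpA.1.one_lt.le
      have h5 : 1 ≤ exp (-(1 - ε) * log (1 - ε) * (t - s)) * cmul F (p + 1) := by
        rw [hF, cmul_ite_eq_pow _ _ _ (by omega)]
        have h8 : 0 < 1 - ε := by linarith
        have h6 : (1 - ε) ^ omegaIn s t (p + 1) = exp (omegaIn s t (p + 1) * log (1 - ε)) := by
          rw [exp_nat_mul, exp_log h8]
        rw [h6, ← exp_add]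
        apply one_le_exp
        have h7 : log (1 - ε) ≤ 0 := Real.log_nonpos (by linarith) (by linarith)
        have := mul_le_mul_of_nonpos_right hpA.2.2.2 h7
        linarith
      calc 1 / (p : ℝ) ≤ 2 * 1 / ((p : ℝ) + 1) := by
            rw [div_le_div_iff₀ (by linarith) (by linarith)]; linarith
        _ ≤ 2 * (exp (-(1 - ε) * log (1 - ε) * (t - s)) * cmul F (p + 1)) / ((p : ℝ) + 1) :=
            div_le_div_of_nonneg_right (by linarith) (by linarith)
        _ = _ := by ring
    calc ∑ p ∈ A', 1 / (p : ℝ) ≤ _ := sum_le_sum h4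
      _ = 2 * exp (-(1 - ε) * log (1 - ε) * (t - s)) *
          ∑ p ∈ A', cmul F (p + 1) / ((p : ℝ) + 1) := by rw [mul_sum]
      _ ≤ 2 * exp (-(1 - ε) * log (1 - ε) * (t - s)) * (C * (3 * (1 + T)) ^ 6 *
          exp ((1 + C₁ + ε * C₁) - ε * (t - s))) := by
          refine mul_le_mul_of_nonneg_left (h2.trans ?_) (by positivity)
          refine mul_le_mul ?_ (exp_le_exp.2 (by linarith)) (exp_pos _).le (by positivity)
          exact mul_le_mul_of_nonneg_left (pow_le_pow_left₀ (by linarith) (by linarith) 6) hC.le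
      _ = D * (3 * (1 + T)) ^ 6 * exp (-δ * (t - s)) := by
          have : exp (-δ * (t - s)) = exp (-(1 - ε) * log (1 - ε) * (t - s)) *
            exp (- ε * (t - s)) := by rw [← exp_add, hδ]; congr 1; ring
          rw [this, hD, show (1 + C₁ + ε * C₁) - ε * (t - s) =
            (1 + C₁ + ε * C₁) + - ε * (t - s) by ring, exp_add (1 + C₁ + ε * C₁)]; ring
  refine hB.trans ?_
  rw [sum_const, card_range, nsmul_eq_mul]
  have h5 : ((⌈T⌉₊ + 1 : ℕ) : ℝ) ≤ 3 * (1 + T) := by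
    have := (Nat.ceil_lt_add_one hT).le
    push_cast; linarith
  calc _ ≤ (3 * (1 + T)) * (D * (3 * (1 + T)) ^ 6 * exp (-δ * (t - s))) :=
        mul_le_mul_of_nonneg_right h5 (by positivity)
    _ = _ := by ring

lemma prod_range_getD_le {L : List ℝ} : (∀ x ∈ L, 1 ≤ x) → ∀ n : ℕ,
    ∏ j ∈ range n, L.getD j 1 ≤ L.prod := by
  induction L with
  | nil => intro _ n; simp
  | cons a L ih =>
    intro h n
    have ha := h a List.mem_cons_self
    have hL : ∀ x ∈ L, 1 ≤ x := fun x hx => h x (List.mem_cons_of_mem _ hx)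
    have hp : 1 ≤ L.prod := by simpa using ih hL 0
    rcases n with _ | n
    · simp only [range_zero, prod_empty, List.prod_cons]
      exact one_le_mul_of_one_le_of_one_le ha hp
    · rw [prod_range_succ', List.prod_cons, mul_comm]
      simp only [List.getD_cons_succ, List.getD_cons_zero]
      exact mul_le_mul_of_nonneg_left (ih hL n) (by linarith)

lemma sum_inv_split {A P B : Finset ℕ} {p q : ℕ → ℕ} (hP : ∀ r ∈ P, 0 < r)
    (h : ∀ m ∈ A, p m ∈ P ∧ q m ∈ B ∧ m = (p m + 1) * q m) :
    ∑ m ∈ A, 1 / (m : ℝ) ≤ (∑ r ∈ P, 1 / (r : ℝ)) * ∑ b ∈ B, 1 / (b : ℝ) := by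
  classical
  have hinj : Set.InjOn (fun m => (p m, q m)) A := by
    intro m hm m' hm' he
    rw [(h m hm).2.2, (h m' hm').2.2]
    simp only [Prod.mk.injEq] at he
    rw [he.1, he.2]
  rw [sum_mul_sum, ← sum_product']
  calc _ ≤ ∑ m ∈ A, 1 / (p m : ℝ) * (1 / (q m : ℝ)) := by
        refine sum_le_sum fun m hm => ?_
        obtain ⟨h1, -, h3⟩ := h m hm
        have h4 : (m : ℝ) = ((p m : ℝ) + 1) * q m := by exact_mod_cast h3
        have h5 : (0 : ℝ) < p m := by exact_mod_cast hP _ h1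
        rw [h4, ← one_div_mul_one_div]
        refine mul_le_mul_of_nonneg_right ?_ (by positivity)
        exact one_div_le_one_div_of_le h5 (by linarith)
    _ = ∑ x ∈ A.image (fun m => (p m, q m)), 1 / (x.1 : ℝ) * (1 / (x.2 : ℝ)) := by
        rw [sum_image hinj]
    _ ≤ _ := by
        refine sum_le_sum_of_subset_of_nonneg ?_ fun _ _ _ => by positivity
        simp only [subset_iff, mem_image, mem_product]
        rintro _ ⟨m, hm, rfl⟩
        exact ⟨(h m hm).1, (h m hm).2.1⟩

/-- The scale of the `j`-th entry of a list, and `0` beyond its end. -/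
noncomputable def scaleAt (l : List ℕ) (j : ℕ) : ℝ := iterLog ((l.getD j 1 : ℕ) : ℝ)

lemma scaleAt_nil (j : ℕ) : scaleAt [] j = 0 := by simp [scaleAt, iterLog]

lemma scaleAt_zero (p : ℕ) (l : List ℕ) : scaleAt (p :: l) 0 = iterLog p := by simp [scaleAt]

lemma scaleAt_succ (p : ℕ) (l : List ℕ) (j : ℕ) : scaleAt (p :: l) (j + 1) = scaleAt l j := by
  simp [scaleAt]

lemma scaleAt_of_lt {l : List ℕ} {j : ℕ} (h : j < l.length) : scaleAt l j = iterLog (l[j] : ℕ) := by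
  rw [scaleAt, List.getD_eq_getElem _ _ h]

lemma scaleAt_of_le {l : List ℕ} {j : ℕ} (h : l.length ≤ j) : scaleAt l j = 0 := by
  rw [scaleAt, List.getD_eq_default _ _ h]; simp [iterLog]

lemma scaleAt_nonneg {l : List ℕ} (hl : ∀ p ∈ l, p.Prime) (j : ℕ) : 0 ≤ scaleAt l j := by
  rcases lt_or_ge j l.length with h | h
  · rw [scaleAt_of_lt h]
    exact iterLog_nonneg (by exact_mod_cast (hl _ (List.getElem_mem h)).one_lt.le)
  · rw [scaleAt_of_le h]

lemma scaleAt_le {l : List ℕ} {T : ℝ} (hT : 0 ≤ T) (hl : ∀ p ∈ l, iterLog p ≤ T) (j : ℕ) :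
    scaleAt l j ≤ T := by
  rcases lt_or_ge j l.length with h | h
  · rw [scaleAt_of_lt h]; exact hl _ (List.getElem_mem h)
  · rwa [scaleAt_of_le h]

lemma scaleAt_antitone {l : List ℕ} (hl : ∀ p ∈ l, p.Prime) (hs : l.Pairwise (· ≥ ·)) {i j : ℕ}
    (hij : i ≤ j) : scaleAt l j ≤ scaleAt l i := by
  rcases lt_or_ge j l.length with h | h
  · rcases hij.eq_or_lt with rfl | hlt
    · exact le_rfl
    rw [scaleAt_of_lt h, scaleAt_of_lt (hij.trans_lt h)]
    refine iterLog_le_iterLog (by exact_mod_cast (hl _ (List.getElem_mem h)).one_lt.le) ?_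
    exact_mod_cast List.pairwise_iff_getElem.1 hs i j (hij.trans_lt h) h hlt
  · rw [scaleAt_of_le h]; exact scaleAt_nonneg hl i

lemma filter_range_eq_range (P : ℕ → Prop) [DecidablePred P] (n : ℕ)
    (h : ∀ i j, i ≤ j → j < n → P j → P i) :
    ∃ ν ≤ n, (range n).filter P = range ν := by
  induction n with
  | zero => exact ⟨0, le_rfl, by simp⟩
  | succ n ih =>
    by_cases hn : P n
    · refine ⟨n + 1, le_rfl, filter_true_of_mem fun i hi => h i n ?_ (by omega) hn⟩
      have := mem_range.1 hi; omega
    · obtain ⟨ν, hν, he⟩ := ih fun i j hij hj => h i j hij (by omega)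
      exact ⟨ν, by omega, by rw [range_add_one, filter_insert, if_neg hn, he]⟩

/-- The optimal Rankin exponent in a single cell. -/
lemma cell_exponent_le {J : ℕ} {ε : ℝ} (hε : 0 ≤ ε) (P : ℕ → Prop) [DecidablePred P]
    (h : ∀ i j, i ≤ j → j < J + 1 → P j → P i) :
    max 1 (#((range (J + 1)).filter P) : ℝ) - 1 - (1 - ε) * #((range (J + 1)).filter P) *
      log (max 1 (#((range (J + 1)).filter P) : ℝ)) ≤
    ε * ((J + 1) * log (J + 1)) - ∑ j ∈ range J, if P (j + 1) then fordCoeff (j + 1) else 0 := by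
  have hJ : 0 ≤ ((J : ℝ) + 1) * log (J + 1) :=
    mul_nonneg (by positivity) (Real.log_nonneg (by linarith [Nat.cast_nonneg (α := ℝ) J]))
  obtain ⟨ν, hν, he⟩ := filter_range_eq_range P (J + 1) h
  have hP : ∀ j, j < J + 1 → (P j ↔ j < ν) := fun j hj => by
    have : j ∈ (range (J + 1)).filter P ↔ j ∈ range ν := by rw [he]
    simpa [hj] using this
  rw [he, card_range]
  rcases ν with _ | ν
  · have : ∑ j ∈ range J, (if P (j + 1) then fordCoeff (j + 1) else 0) = 0 :=
      sum_eq_zero fun j hj => if_neg fun hp => by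
        have := (hP (j + 1) (by have := mem_range.1 hj; omega)).1 hp
        omega
    rw [this]; simp
    positivity
  · have h1 : ∑ j ∈ range J, (if P (j + 1) then fordCoeff (j + 1) else 0) =
        ∑ j ∈ range ν, fordCoeff (j + 1) := by
      rw [← sum_filter]
      congr 1
      ext j
      rw [mem_filter, mem_range, mem_range]
      constructor
      · rintro ⟨h1, h2⟩
        have := (hP (j + 1) (by omega)).1 h2
        omega
      · intro h1
        exact ⟨by omega, (hP (j + 1) (by omega)).2 (by omega)⟩
    have h2 : (1 : ℝ) ≤ ((ν + 1 : ℕ) : ℝ) := by push_cast; linarith [Nat.cast_nonneg (α := ℝ) ν]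
    rw [h1, sum_fordCoeff, max_eq_right h2]
    have h3 : ((ν + 1 : ℕ) : ℝ) ≤ J + 1 := by exact_mod_cast hν
    have h4 : ((ν + 1 : ℕ) : ℝ) * log ((ν + 1 : ℕ) : ℝ) ≤ (J + 1) * log (J + 1) :=
      mul_le_mul h3 (Real.log_le_log (by linarith) h3) (Real.log_nonneg h2) (by linarith)
    have h5 := mul_le_mul_of_nonneg_left h4 hε
    push_cast at h5 ⊢
    linarith

lemma mem_primesIoc_unique {h : ℝ} (hh : 0 ≤ h) {r k k' : ℕ} (hk : r ∈ primesIoc (k * h) ((k + 1) * h))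
    (hk' : r ∈ primesIoc (k' * h) ((k' + 1) * h)) : k = k' := by
  rw [mem_primesIoc'] at hk hk'
  have h1 : (k : ℝ) * h < (k' + 1) * h := hk.2.1.trans_le hk'.2.2
  have h2 : (k' : ℝ) * h < (k + 1) * h := hk'.2.1.trans_le hk.2.2
  have h3 := lt_of_mul_lt_mul_right h1 hh
  have h4 := lt_of_mul_lt_mul_right h2 hh
  have h5 : k < k' + 1 := by exact_mod_cast h3
  have h6 : k' < k + 1 := by exact_mod_cast h4
  omega

/-- The weight used in a fibre: `λ k` on the `k`-th cell. -/
noncomputable def cellWeight (h : ℝ) (N : ℕ) (lam : ℕ → ℝ) (r : ℕ) : ℝ :=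
  ∏ k ∈ Ico 1 N, if r ∈ primesIoc (k * h) ((k + 1) * h) then lam k else 1

lemma one_le_cellWeight {h : ℝ} {N : ℕ} {lam : ℕ → ℝ} (hl : ∀ k, 1 ≤ lam k) (r : ℕ) :
    1 ≤ cellWeight h N lam r := by
  refine Finset.one_le_prod fun k _ => ?_
  split_ifs
  · exact hl k
  · exact le_rfl

lemma cellWeight_le {h : ℝ} (hh : 0 ≤ h) {N : ℕ} {lam : ℕ → ℝ} (hl : ∀ k, 1 ≤ lam k) (r : ℕ) :
    cellWeight h N lam r ≤ 1 + ∑ k ∈ Ico 1 N,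
      if r ∈ primesIoc (k * h) ((k + 1) * h) then lam k - 1 else 0 := by
  have h0 : ∀ k ∈ Ico 1 N, 0 ≤ if r ∈ primesIoc (k * h) ((k + 1) * h) then lam k - 1 else 0 :=
    fun k _ => by split_ifs
                  · linarith [hl k]
                  · exact le_rfl
  by_cases hr : ∃ k ∈ Ico 1 N, r ∈ primesIoc (k * h) ((k + 1) * h)
  · obtain ⟨k, hk, hrk⟩ := hr
    rw [cellWeight, prod_eq_single_of_mem k hk fun k' _ hne =>
      if_neg fun h' => hne (mem_primesIoc_unique hh h' hrk), if_pos hrk]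
    have := single_le_sum h0 hk
    rw [if_pos hrk] at this
    linarith
  · push Not at hr
    rw [cellWeight, prod_eq_one fun k hk => if_neg (hr k hk)]
    linarith [sum_nonneg h0]

lemma cellWeight_le_const {h : ℝ} (hh : 0 ≤ h) {N : ℕ} {lam : ℕ → ℝ} {M : ℝ} (hl : ∀ k, 1 ≤ lam k)
    (hM : ∀ k, lam k ≤ M) (r : ℕ) : cellWeight h N lam r ≤ M ∧
      (cellWeight h N lam r = 1 ∨ scale h < r) := by
  by_cases hr : ∃ k ∈ Ico 1 N, r ∈ primesIoc (k * h) ((k + 1) * h)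
  · obtain ⟨k, hk, hrk⟩ := hr
    rw [cellWeight, prod_eq_single_of_mem k hk fun k' _ hne =>
      if_neg fun h' => hne (mem_primesIoc_unique hh h' hrk), if_pos hrk]
    refine ⟨hM k, Or.inr ?_⟩
    refine lt_of_le_of_lt (scale_le_scale.2 ?_) (mem_primesIoc.1 hrk).2.1
    have : (1 : ℝ) ≤ k := by exact_mod_cast (mem_Ico.1 hk).1
    nlinarith
  · push Not at hr
    rw [cellWeight, prod_eq_one fun k hk => if_neg (hr k hk)]
    exact ⟨(hl 0).trans (hM 0), Or.inl rfl⟩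

lemma add_one_le_scale (t : ℝ) : t + 1 ≤ scale t := by
  have h1 := Real.add_one_le_exp t
  have h2 := Real.add_one_le_exp (exp t - 1)
  rw [scale]; linarith

lemma sum_cellWeight_le : ∃ C : ℝ, 0 < C ∧ ∀ (N : ℕ) (h T : ℝ) (lam : ℕ → ℝ) (M : ℝ), 0 ≤ h →
    0 ≤ T → (∀ k, 1 ≤ lam k) → (∀ k, lam k ≤ M) →
    ∑ r ∈ primesUpTo (scale (T + 1)), cellWeight h N lam r / r ≤
      T + h * ∑ k ∈ Ico 1 N, (lam k - 1) + C * (1 + N * M) := by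
  obtain ⟨C₁, hC₁, hM, hI⟩ := exists_abs_sum_primesIoc_le
  refine ⟨C₁ + 1, by linarith, fun N h T lam M hh hT hl hlM => ?_⟩
  have hM1 : 1 ≤ M := (hl 0).trans (hlM 0)
  calc _ ≤ ∑ r ∈ primesUpTo (scale (T + 1)), (1 / (r : ℝ) + ∑ k ∈ Ico 1 N,
        (lam k - 1) * (if r ∈ primesIoc (k * h) ((k + 1) * h) then 1 / (r : ℝ) else 0)) := by
        refine sum_le_sum fun r _ => ?_
        refine (div_le_div_of_nonneg_right (cellWeight_le hh hl r) (Nat.cast_nonneg r)).trans_eq ?_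
        rw [add_div, sum_div]
        congr 1
        refine sum_congr rfl fun k _ => ?_
        split_ifs <;> ring
    _ = ∑ r ∈ primesUpTo (scale (T + 1)), 1 / (r : ℝ) + ∑ k ∈ Ico 1 N, (lam k - 1) *
        ∑ r ∈ primesUpTo (scale (T + 1)),
          (if r ∈ primesIoc (k * h) ((k + 1) * h) then 1 / (r : ℝ) else 0) := by
        rw [sum_add_distrib, sum_comm]
        simp only [mul_sum]
    _ ≤ (T + 1 + C₁) + ∑ k ∈ Ico 1 N, (lam k - 1) * (h + C₁) := by
        refine add_le_add ?_ (sum_le_sum fun k _ => mul_le_mul_of_nonneg_left ?_ (by linarith [hl k]))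
        · have := (abs_le.1 (hM (T + 1) (by linarith))).2
          unfold primeRecipSum at this
          linarith
        · rw [← sum_filter]
          have h1 := (abs_le.1 (hI (k * h) ((k + 1) * h) (by positivity)
            (by rw [add_mul]; linarith))).2
          refine (sum_le_sum_of_subset_of_nonneg (t := primesIoc (k * h) ((k + 1) * h)) ?_
            fun _ _ _ => by positivity).trans ?_
          · intro r hr
            exact (mem_filter.1 hr).2
          · have h2 : ((k : ℝ) + 1) * h - k * h = h := by ring
            linarith
    _ ≤ _ := by
        rw [← sum_mul]
        have h1 : ∑ k ∈ Ico 1 N, (lam k - 1) ≤ N * M := by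
          calc _ ≤ ∑ k ∈ Ico 1 N, M := sum_le_sum fun k _ => by linarith [hlM k]
            _ ≤ N * M := by
                rw [sum_const, Nat.card_Ico, nsmul_eq_mul]
                exact mul_le_mul_of_nonneg_right (by exact_mod_cast Nat.sub_le N 1) (by linarith)
        have h0 : 0 ≤ ∑ k ∈ Ico 1 N, (lam k - 1) := sum_nonneg fun k _ => by linarith [hl k]
        nlinarith

lemma cellWeight_shiftProd_ge {h ε : ℝ} {N : ℕ} {lam : ℕ → ℝ} (hl : ∀ k, 1 ≤ lam k)
    {l : List ℕ} {κ : ℕ → ℕ} (J : ℕ)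
    (hnn : ∀ p ∈ l, ∀ k ∈ Ico 1 N, ((k : ℝ) + 1) * h ≤ iterLog p →
      (1 - ε) * h ≤ omegaIn (k * h) ((k + 1) * h) (p + 1))
    (hκ : ∀ j < J + 1, ∀ k : ℕ, k + 1 ≤ κ j → ((k : ℝ) + 1) * h ≤ scaleAt l j)
    (hh : 0 < h) :
    exp ((1 - ε) * h * ∑ k ∈ Ico 1 N, #((range (J + 1)).filter fun j => k + 1 ≤ κ j) * log (lam k)) ≤
      cmul (cellWeight h N lam) (shiftProd l) := by
  have hw : ∀ p ∈ l, 1 ≤ cmul (cellWeight h N lam) (p + 1) := fun p _ => by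
    rw [← cmul_one_fun (show p + 1 ≠ 0 by omega)]
    exact cmul_le_cmul (fun _ => zero_le_one) fun r _ _ => one_le_cellWeight hl r
  rw [cmul_shiftProd]
  refine le_trans ?_ (prod_range_getD_le (by
    simp only [List.mem_map]; rintro _ ⟨p, hp, rfl⟩; exact hw p hp) (J + 1))
  have h1 : (1 - ε) * h * ∑ k ∈ Ico 1 N,
      #((range (J + 1)).filter fun j => k + 1 ≤ κ j) * log (lam k) =
      ∑ j ∈ range (J + 1), ∑ k ∈ Ico 1 N, if k + 1 ≤ κ j then (1 - ε) * h * log (lam k) else 0 := by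
    rw [sum_comm, mul_sum]
    refine sum_congr rfl fun k _ => ?_
    rw [← sum_filter, sum_const, nsmul_eq_mul]; ring
  rw [h1, exp_sum]
  refine prod_le_prod (fun _ _ => (exp_pos _).le) fun j hj => ?_
  have hjJ := mem_range.1 hj
  rcases lt_or_ge j l.length with hjl | hjl
  · rw [List.getD_eq_getElem _ _ (by simpa using hjl), List.getElem_map]
    have hmem := List.getElem_mem hjl
    unfold cellWeight
    rw [cmul_prod_fun _ _ (by omega), exp_sum]
    refine prod_le_prod (fun _ _ => (exp_pos _).le) fun k hk => ?_
    rw [cmul_ite_eq_pow _ _ _ (by omega)]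
    split_ifs with hkj
    · have h2 := hκ j hjJ k hkj
      rw [scaleAt_of_lt hjl] at h2
      have h3 := hnn _ hmem k hk h2
      have h4 := mul_le_mul_of_nonneg_right h3 (Real.log_nonneg (hl k))
      refine (exp_le_exp.2 h4).trans_eq ?_
      rw [exp_nat_mul, exp_log (by linarith [hl k])]
    · rw [exp_zero]; exact one_le_pow₀ (hl k)
  · rw [List.getD_eq_default _ _ (by simpa using hjl)]
    apply exp_le_one_iff.2
    refine (sum_eq_zero fun k _ => if_neg fun hkj => ?_).le
    have h2 := hκ j hjJ k hkj
    rw [scaleAt_of_le hjl] at h2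
    have : 0 < ((k : ℝ) + 1) * h := by positivity
    linarith

lemma fibre_sum_le (J N : ℕ) : ∃ C : ℝ, 1 ≤ C ∧ ∀ (ε h T : ℝ) (A : Finset ℕ) (l : ℕ → List ℕ)
    (κ : ℕ → ℕ), 0 < h → 4 / 3 * ((J : ℝ) + 1) ≤ scale h → 0 ≤ T →
    (∀ m ∈ A, IsRep T (l m) m) →
    (∀ m ∈ A, ∀ p ∈ l m, ∀ k ∈ Ico 1 N, ((k : ℝ) + 1) * h ≤ iterLog p →
      (1 - ε) * h ≤ omegaIn (k * h) ((k + 1) * h) (p + 1)) →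
    (∀ m ∈ A, ∀ j < J + 1, ∀ k : ℕ, k + 1 ≤ κ j → ((k : ℝ) + 1) * h ≤ scaleAt (l m) j) →
    ∑ m ∈ A, 1 / (m : ℝ) ≤ C * exp (T + h * ∑ k ∈ Ico 1 N,
      (max 1 (#((range (J + 1)).filter fun j => k + 1 ≤ κ j) : ℝ) - 1 -
        (1 - ε) * #((range (J + 1)).filter fun j => k + 1 ≤ κ j) *
          log (max 1 (#((range (J + 1)).filter fun j => k + 1 ≤ κ j) : ℝ)))) := by
  obtain ⟨C, hC, hrep⟩ := sum_rep_le (J + 1)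
  obtain ⟨C', hC', hsum⟩ := sum_cellWeight_le
  refine ⟨C * exp (C' * (1 + N * (J + 1))), one_le_mul_of_one_le_of_one_le hC
    (one_le_exp (by positivity)), fun ε h T A l κ hh hhJ hT hA hnn hκ => ?_⟩
  set ν : ℕ → ℕ := fun k => #((range (J + 1)).filter fun j => k + 1 ≤ κ j) with hν
  set lam : ℕ → ℝ := fun k => max 1 (ν k : ℝ) with hlam
  have hl1 : ∀ k, 1 ≤ lam k := fun k => le_max_left _ _
  have hlM : ∀ k, lam k ≤ J + 1 := fun k => max_le (by linarith [Nat.cast_nonneg (α := ℝ) J]) (by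
    have : ν k ≤ J + 1 := (card_filter_le _ _).trans (card_range _).le
    exact_mod_cast this)
  have h1 := hrep (cellWeight h N lam) (fun r => zero_le_one.trans (one_le_cellWeight hl1 r))
    (fun r => (cellWeight_le_const hh.le hl1 hlM r).1) (fun r hr => by
      have h2 : (2 : ℝ) ≤ r := by exact_mod_cast hr.two_le
      obtain ⟨h3, h4 | h4⟩ := cellWeight_le_const (N := N) hh.le hl1 hlM r
      · rw [h4]; linarith
      · linarith) T hT A fun m hm => ⟨l m, hA m hm⟩
  have h2 := hsum N h T lam (J + 1) hh.le hT hl1 hlM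
  set E := (1 - ε) * h * ∑ k ∈ Ico 1 N, (ν k : ℝ) * log (lam k) with hE
  have h3 : exp E * ∑ m ∈ A, 1 / (m : ℝ) ≤ ∑ m ∈ A, cmul (cellWeight h N lam) m / m := by
    rw [mul_sum]
    refine sum_le_sum fun m hm => ?_
    rw [mul_one_div]
    refine div_le_div_of_nonneg_right ?_ (Nat.cast_nonneg m)
    have h4 := cellWeight_shiftProd_ge (ε := ε) hl1 J (hnn m hm) (hκ m hm) hh
    rwa [(hA m hm).2] at h4
  have h4 := (h3.trans h1).trans (mul_le_mul_of_nonneg_left (exp_le_exp.2 h2) (by linarith))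
  refine le_of_mul_le_mul_left (h4.trans_eq ?_) (exp_pos E)
  rw [mul_assoc C, ← exp_add, mul_left_comm, ← exp_add]
  congr 2
  have key : h * ∑ k ∈ Ico 1 N, (lam k - 1) = E + h * ∑ k ∈ Ico 1 N,
      (lam k - 1 - (1 - ε) * (ν k : ℝ) * log (lam k)) := by
    rw [hE, mul_sum, mul_sum, mul_sum, ← sum_add_distrib]
    exact sum_congr rfl fun k _ => by ring
  change _ = E + (C' * (1 + N * (J + 1)) + (T + h * ∑ k ∈ Ico 1 N,
      (lam k - 1 - (1 - ε) * (ν k : ℝ) * log (lam k))))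
  linarith [key]

lemma sum_ite_succ_le_ge {N κ : ℕ} (hκ : κ ≤ N) {a : ℝ} (ha : 0 ≤ a) :
    a * ((κ : ℝ) - 1) ≤ ∑ k ∈ Ico 1 N, if k + 1 ≤ κ then a else 0 := by
  have h1 : ∑ k ∈ Ico 1 N, (if k + 1 ≤ κ then a else 0) = (κ - 1 : ℕ) * a := by
    rw [← sum_filter, sum_const, nsmul_eq_mul]
    congr 2
    have : (Ico 1 N).filter (fun k => k + 1 ≤ κ) = Ico 1 κ := by
      ext k; simp only [mem_filter, mem_Ico]; omega
    rw [this, Nat.card_Ico]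
  rw [h1, mul_comm]
  refine mul_le_mul_of_nonneg_right ?_ ha
  rw [sub_le_iff_le_add]
  have : κ ≤ κ - 1 + 1 := by omega
  exact_mod_cast this

/-- The products none of whose shifted primes are deficient, and which violate the main linear
inequality, are rare. -/
lemma bad_normal_sum_le (J N : ℕ) : ∃ C : ℝ, 1 ≤ C ∧ ∀ (ε ε₀ h T : ℝ) (A : Finset ℕ)
    (l : ℕ → List ℕ), 0 ≤ ε → 0 < h → N * h = T → 4 / 3 * ((J : ℝ) + 1) ≤ scale h →
    (∀ m ∈ A, IsRep T (l m) m ∧ (l m).Pairwise (· ≥ ·) ∧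
      (1 + ε₀) * (T - 1) ≤ ∑ j ∈ range J, fordCoeff (j + 1) * scaleAt (l m) (j + 1)) →
    (∀ m ∈ A, ∀ p ∈ l m, ∀ k ∈ Ico 1 N, ((k : ℝ) + 1) * h ≤ iterLog p →
      (1 - ε) * h ≤ omegaIn (k * h) ((k + 1) * h) (p + 1)) →
    ∑ m ∈ A, 1 / (m : ℝ) ≤ C * exp (T + T * (ε * ((J + 1) * log (J + 1))) +
      2 * h * (∑ j ∈ range J, fordCoeff (j + 1)) - (1 + ε₀) * (T - 1)) := by
  classical
  obtain ⟨C, hC, hfib⟩ := fibre_sum_le J N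
  refine ⟨Fintype.card (Fin (J + 1) → Fin (N + 1)) * C, ?_, ?_⟩
  · refine one_le_mul_of_one_le_of_one_le ?_ hC
    exact_mod_cast Fintype.card_pos
  intro ε ε₀ h T A l hε hh hNh hhJ hA hnn
  have hT : 0 ≤ T := by rw [← hNh]; positivity
  set B := C * exp (T + T * (ε * ((J + 1) * log (J + 1))) +
      2 * h * (∑ j ∈ range J, fordCoeff (j + 1)) - (1 + ε₀) * (T - 1)) with hB
  have hB0 : 0 ≤ B := by positivity
  set g : ℕ → Fin (J + 1) → Fin (N + 1) := fun m j => Fin.ofNat (N + 1) ⌊scaleAt (l m) j / h⌋₊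
    with hg
  have hpr : ∀ m ∈ A, ∀ p ∈ l m, p.Prime := fun m hm p hp => ((hA m hm).1.1 p hp).1
  have hfl : ∀ m ∈ A, ∀ j, ⌊scaleAt (l m) j / h⌋₊ ≤ N := by
    intro m hm j
    apply Nat.floor_le_of_le
    rw [div_le_iff₀ hh, hNh]
    exact scaleAt_le hT (fun p hp => ((hA m hm).1.1 p hp).2) j
  rw [← sum_fiberwise A g]
  have hkey : ∀ φ : Fin (J + 1) → Fin (N + 1), ∑ m ∈ A with g m = φ, 1 / (m : ℝ) ≤ B := by
    intro φ
    rcases (A.filter (fun m => g m = φ)).eq_empty_or_nonempty with he | ⟨m₀, hm₀⟩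
    · rw [he]; simpa using hB0
    rw [mem_filter] at hm₀
    set κ : ℕ → ℕ := fun j => ⌊scaleAt (l m₀) j / h⌋₊ with hκ
    have hκeq : ∀ m ∈ A.filter (fun m => g m = φ), ∀ j < J + 1, ⌊scaleAt (l m) j / h⌋₊ = κ j := by
      intro m hm j hj
      rw [mem_filter] at hm
      have h1 : g m ⟨j, hj⟩ = g m₀ ⟨j, hj⟩ := by rw [hm.2, hm₀.2]
      have h2 := congrArg Fin.val h1
      simp only [hg, Fin.val_ofNat] at h2
      rwa [Nat.mod_eq_of_lt (Nat.lt_succ_of_le (hfl m hm.1 j)),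
        Nat.mod_eq_of_lt (Nat.lt_succ_of_le (hfl m₀ hm₀.1 j))] at h2
    have h1 := hfib ε h T (A.filter fun m => g m = φ) l κ hh hhJ hT
      (fun m hm => (hA m (mem_filter.1 hm).1).1) (fun m hm => hnn m (mem_filter.1 hm).1) (by
        intro m hm j hj k hk
        rw [← hκeq m hm j hj] at hk
        have h3 := (Nat.le_floor_iff (div_nonneg (scaleAt_nonneg (hpr m (mem_filter.1 hm).1) j)
          hh.le)).1 hk
        rw [le_div_iff₀ hh] at h3
        exact_mod_cast h3)
    refine h1.trans (mul_le_mul_of_nonneg_left (exp_le_exp.2 ?_) (by linarith))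
    have h2 : ∀ k ∈ Ico 1 N, (max 1 (#((range (J + 1)).filter fun j => k + 1 ≤ κ j) : ℝ) - 1 -
        (1 - ε) * #((range (J + 1)).filter fun j => k + 1 ≤ κ j) *
          log (max 1 (#((range (J + 1)).filter fun j => k + 1 ≤ κ j) : ℝ))) ≤
        ε * ((J + 1) * log (J + 1)) -
          ∑ j ∈ range J, if k + 1 ≤ κ (j + 1) then fordCoeff (j + 1) else 0 := by
      intro k _
      refine cell_exponent_le hε (fun j => k + 1 ≤ κ j) fun i j hij _ hk => hk.trans ?_
      exact Nat.floor_le_floor (div_le_div_of_nonneg_right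
        (scaleAt_antitone (hpr m₀ hm₀.1) (hA m₀ hm₀.1).2.1 hij) hh.le)
    have h3 := mul_le_mul_of_nonneg_left (sum_le_sum h2) hh.le
    have h3' : ∑ k ∈ Ico 1 N, (ε * (((J : ℝ) + 1) * log (J + 1)) -
        ∑ j ∈ range J, if k + 1 ≤ κ (j + 1) then fordCoeff (j + 1) else 0) =
        ((N - 1 : ℕ) : ℝ) * (ε * ((J + 1) * log (J + 1))) - ∑ j ∈ range J, ∑ k ∈ Ico 1 N,
          if k + 1 ≤ κ (j + 1) then fordCoeff (j + 1) else 0 := by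
      rw [sum_sub_distrib, sum_const, Nat.card_Ico, nsmul_eq_mul, sum_comm]
    rw [h3', mul_sub] at h3
    have hJ : 0 ≤ ε * (((J : ℝ) + 1) * log (J + 1)) := mul_nonneg hε
      (mul_nonneg (by positivity) (Real.log_nonneg (by linarith [Nat.cast_nonneg (α := ℝ) J])))
    have h4 : h * (((N - 1 : ℕ) : ℝ) * (ε * ((J + 1) * log (J + 1)))) ≤
        T * (ε * ((J + 1) * log (J + 1))) := by
      have : ((N - 1 : ℕ) : ℝ) ≤ N := by exact_mod_cast Nat.sub_le N 1
      have h5 : h * ((N - 1 : ℕ) : ℝ) ≤ T := by rw [← hNh, mul_comm]; gcongr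
      calc _ = (h * ((N - 1 : ℕ) : ℝ)) * (ε * ((J + 1) * log (J + 1))) := by ring
        _ ≤ _ := mul_le_mul_of_nonneg_right h5 hJ
    have h5 : ∀ j ∈ range J, fordCoeff (j + 1) * scaleAt (l m₀) (j + 1) -
        2 * h * fordCoeff (j + 1) ≤
        h * ∑ k ∈ Ico 1 N, (if k + 1 ≤ κ (j + 1) then fordCoeff (j + 1) else 0) := by
      intro j _
      have h6 := sum_ite_succ_le_ge (hfl m₀ hm₀.1 (j + 1)) (fordCoeff_nonneg j)
      have h7 := (Nat.lt_floor_add_one (scaleAt (l m₀) (j + 1) / h)).le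
      rw [div_le_iff₀ hh] at h7
      have h8 := mul_le_mul_of_nonneg_left h7 (fordCoeff_nonneg j)
      have h9 := mul_le_mul_of_nonneg_left h6 hh.le
      simp only [hκ]
      linarith
    have h6 := sum_le_sum h5
    rw [sum_sub_distrib, ← mul_sum, ← mul_sum] at h6
    have h7 := (hA m₀ hm₀.1).2.2
    linarith
  calc _ ≤ ∑ φ : Fin (J + 1) → Fin (N + 1), B := sum_le_sum fun φ _ => hkey φ
    _ = _ := by rw [sum_const, card_univ, nsmul_eq_mul, hB]; ring

lemma sum_biUnion_le_sum {ι κ : Type*} [DecidableEq κ] (S : Finset ι) (t : ι → Finset κ) {f : κ → ℝ}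
    (hf : ∀ x, 0 ≤ f x) : ∑ x ∈ S.biUnion t, f x ≤ ∑ i ∈ S, ∑ x ∈ t i, f x := by
  classical
  induction S using Finset.induction_on with
  | empty => simp
  | insert a S ha ih =>
    rw [biUnion_insert, sum_insert ha]
    have h := sum_union_inter (s₁ := t a) (s₂ := S.biUnion t) (f := f)
    linarith [sum_nonneg fun x (_ : x ∈ t a ∩ S.biUnion t) => hf x]

/-- Products having a shifted prime factor which is deficient in some cell are rare. -/
lemma deficient_rep_sum_le {N : ℕ} (hN : 0 < N) {ε : ℝ} (h0 : 0 < ε) (h1 : ε < 1) :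
    ∃ δ C : ℝ, 0 < δ ∧ 0 < C ∧ ∀ T : ℝ, 0 ≤ T → ∀ (A : Finset ℕ) (l : ℕ → List ℕ),
    (∀ m ∈ A, IsRep T (l m) m ∧ ∃ p ∈ l m, ∃ k ∈ range N, ((k : ℝ) + 1) * (T / N) ≤ iterLog p ∧
      (omegaIn (k * (T / N)) ((k + 1) * (T / N)) (p + 1) : ℝ) ≤ (1 - ε) * (T / N)) →
    ∑ m ∈ A, 1 / (m : ℝ) ≤ C * exp (-δ * T) := by
  classical
  obtain ⟨δ, C, hδ, hC, hdef⟩ := deficient_sum h0 h1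
  have hN' : (0 : ℝ) < N := by exact_mod_cast hN
  have hη : 0 < δ / (4 * N) := by positivity
  obtain ⟨C₁, hC₁, hpow⟩ := pow_le_mul_exp 7 hη
  obtain ⟨C₂, hC₂, hrep⟩ := sum_inv_rep_le hη
  refine ⟨δ / (2 * N), N * (C * C₁) * C₂, by positivity, by positivity, fun T hT A l hA => ?_⟩
  choose! p hp k hk hpk using fun m hm => (hA m hm).2
  have hprime : ∀ m ∈ A, (p m).Prime ∧ iterLog (p m) ≤ T := fun m hm => (hA m hm).1.1 _ (hp m hm)
  set h := T / N with hh
  have hh0 : 0 ≤ h := by positivity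
  have hP : ∑ r ∈ A.image p, 1 / (r : ℝ) ≤ N * (C * (1 + T) ^ 7 * exp (-δ * h)) := by
    have h3 : A.image p ⊆ (range N).biUnion fun j => (A.filter fun m => k m = j).image p := by
      intro r hr
      obtain ⟨m, hm, rfl⟩ := mem_image.1 hr
      exact mem_biUnion.2 ⟨k m, hk m hm, mem_image_of_mem _ (mem_filter.2 ⟨hm, rfl⟩)⟩
    calc _ ≤ ∑ r ∈ (range N).biUnion fun j => (A.filter fun m => k m = j).image p, 1 / (r : ℝ) :=
          sum_le_sum_of_subset_of_nonneg h3 fun _ _ _ => by positivity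
      _ ≤ ∑ j ∈ range N, ∑ r ∈ (A.filter fun m => k m = j).image p, 1 / (r : ℝ) :=
          sum_biUnion_le_sum _ _ fun _ => by positivity
      _ ≤ ∑ j ∈ range N, C * (1 + T) ^ 7 * exp (-δ * h) := by
          refine sum_le_sum fun j hj => ?_
          have hj' : (j : ℝ) + 1 ≤ N := by exact_mod_cast mem_range.1 hj
          have hsub : ((j : ℝ) + 1) * h - j * h = h := by ring
          have h4 := hdef (j * h) ((j + 1) * h) T (by positivity) (by nlinarith) (by
            calc ((j : ℝ) + 1) * h ≤ N * h := mul_le_mul_of_nonneg_right hj' hh0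
              _ = T := by rw [hh]; field_simp) ((A.filter fun m => k m = j).image p) (by
            intro r hr
            obtain ⟨m, hm, rfl⟩ := mem_image.1 hr
            obtain ⟨hm1, rfl⟩ := mem_filter.1 hm
            refine ⟨(hprime m hm1).1, (hpk m hm1).1, (hprime m hm1).2, ?_⟩
            rw [hsub]
            exact (hpk m hm1).2)
          rwa [hsub] at h4
      _ = _ := by rw [sum_const, card_range, nsmul_eq_mul]
  have hB := hrep T hT (A.image fun m => m / (p m + 1)) (by
    intro b hb
    obtain ⟨m, hm, rfl⟩ := mem_image.1 hb
    refine ⟨(l m).erase (p m), fun q hq => (hA m hm).1.1 q (List.mem_of_mem_erase hq), ?_⟩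
    have h6 : m = (p m + 1) * shiftProd ((l m).erase (p m)) := by
      rw [← shiftProd_cons, shiftProd, ← ((List.perm_cons_erase (hp m hm)).map (· + 1)).prod_eq]
      exact (hA m hm).1.2.symm
    exact (Nat.div_eq_of_eq_mul_right (Nat.succ_pos _) h6).symm)
  have hsp := sum_inv_split (A := A) (P := A.image p) (B := A.image fun m => m / (p m + 1))
    (p := p) (q := fun m => m / (p m + 1)) (by
      intro r hr
      obtain ⟨m, hm, rfl⟩ := mem_image.1 hr
      exact (hprime m hm).1.pos) (fun m hm => ⟨mem_image_of_mem _ hm,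
        mem_image_of_mem (fun m => m / (p m + 1)) hm, by
        refine (Nat.mul_div_cancel' ?_).symm
        conv_rhs => rw [← (hA m hm).1.2]
        exact List.dvd_prod (List.mem_map_of_mem (hp m hm))⟩)
  have h5 : C * (1 + T) ^ 7 * exp (-δ * h) ≤ C * (C₁ * exp (δ / (4 * N) * T)) * exp (-δ * h) := by
    gcongr; exact hpow T hT
  calc _ ≤ (N * (C * (C₁ * exp (δ / (4 * N) * T)) * exp (-δ * h))) *
        (C₂ * exp (δ / (4 * N) * T)) := hsp.trans (mul_le_mul (hP.trans (by gcongr)) hB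
          (sum_nonneg fun _ _ => by positivity) (by positivity))
    _ = N * (C * C₁) * C₂ * (exp (δ / (4 * N) * T) * exp (-δ * h) * exp (δ / (4 * N) * T)) := by ring
    _ = _ := by
      rw [← exp_add, ← exp_add]
      congr 2
      rw [hh]; field_simp; ring

/-- Products violating the main linear inequality on the scales of their largest shifted primes
are rare. -/
lemma bad_sum_le (J : ℕ) {ε₀ : ℝ} (hε₀ : 0 < ε₀) : ∃ δ C : ℝ, 0 < δ ∧ 0 < C ∧ ∀ T : ℝ, 0 ≤ T →
    ∀ (A : Finset ℕ) (l : ℕ → List ℕ), (∀ m ∈ A, IsRep T (l m) m ∧ (l m).Pairwise (· ≥ ·) ∧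
      (1 + ε₀) * (T - 1) ≤ ∑ j ∈ range J, fordCoeff (j + 1) * scaleAt (l m) (j + 1)) →
    ∑ m ∈ A, 1 / (m : ℝ) ≤ C * exp (-δ * T) := by
  classical
  set S := ∑ j ∈ range J, fordCoeff (j + 1) with hS
  have hS0 : 0 ≤ S := sum_nonneg fun j _ => fordCoeff_nonneg j
  set L := ((J : ℝ) + 1) * log (J + 1) with hL
  have hL0 : 0 ≤ L := mul_nonneg (by positivity)
    (Real.log_nonneg (by linarith [Nat.cast_nonneg (α := ℝ) J]))
  set ε := ε₀ / (4 * (L + 1 + ε₀)) with hε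
  have hε0 : 0 < ε := by positivity
  have hε1 : ε < 1 := by rw [hε, div_lt_one (by positivity)]; linarith
  have hεL : ε * L ≤ ε₀ / 4 := by
    rw [hε, div_mul_eq_mul_div, div_le_div_iff₀ (by positivity) (by norm_num)]
    nlinarith [mul_nonneg hε₀.le hL0, mul_pos hε₀ hε₀]
  obtain ⟨N, hN⟩ := exists_nat_ge (8 * S / ε₀ + 1)
  have hN1 : (1 : ℝ) ≤ N := by have : 0 ≤ 8 * S / ε₀ := by positivity
                               linarith
  have hN0 : 0 < N := by exact_mod_cast zero_lt_one.trans_le hN1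
  have hNpos : (0 : ℝ) < N := by linarith
  have hNS : 2 * S / N ≤ ε₀ / 4 := by
    rw [div_le_div_iff₀ hNpos (by norm_num)]
    have : 8 * S / ε₀ ≤ N := by linarith
    rw [div_le_iff₀ hε₀] at this
    linarith
  obtain ⟨δ₁, C₁, hδ₁, hC₁, hdef⟩ := deficient_rep_sum_le hN0 hε0 hε1
  obtain ⟨C₂, hC₂, hnorm⟩ := bad_normal_sum_le J N
  obtain ⟨C₃, hC₃, hrep⟩ := sum_inv_rep_le one_pos
  set δ := min δ₁ (ε₀ / 2) with hδ
  have hδ0 : 0 < δ := lt_min hδ₁ (by positivity)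
  set T₀ := 4 / 3 * ((J : ℝ) + 1) * N with hT₀
  refine ⟨δ, C₁ + C₂ * exp (1 + ε₀) + C₃ * exp (T₀ + δ * T₀), hδ0, by positivity,
    fun T hT A l hA => ?_⟩
  rcases lt_or_ge T T₀ with hTT | hTT
  · have h1 := hrep T hT A fun m hm => ⟨l m, (hA m hm).1⟩
    have h2 : exp (1 * T) ≤ exp (T₀ + δ * T₀) * exp (-δ * T) := by
      rw [← exp_add]; apply exp_le_exp.2; nlinarith
    calc _ ≤ C₃ * exp (1 * T) := h1
      _ ≤ C₃ * (exp (T₀ + δ * T₀) * exp (-δ * T)) := by gcongr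
      _ ≤ _ := by
        rw [add_mul, mul_assoc C₃]
        have : 0 ≤ (C₁ + C₂ * exp (1 + ε₀)) * exp (-δ * T) := by positivity
        linarith
  have hT₀0 : 0 < T₀ := by positivity
  have hTpos : 0 < T := by linarith
  rw [← sum_filter_add_sum_filter_not A (fun m => ∃ p ∈ l m, ∃ k ∈ range N,
    ((k : ℝ) + 1) * (T / N) ≤ iterLog p ∧
      (omegaIn (k * (T / N)) ((k + 1) * (T / N)) (p + 1) : ℝ) ≤ (1 - ε) * (T / N))]
  have h1 := hdef T hT (A.filter (fun m => ∃ p ∈ l m, ∃ k ∈ range N,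
    ((k : ℝ) + 1) * (T / N) ≤ iterLog p ∧
      (omegaIn (k * (T / N)) ((k + 1) * (T / N)) (p + 1) : ℝ) ≤ (1 - ε) * (T / N))) l
    fun m hm => ⟨(hA m (mem_filter.1 hm).1).1, (mem_filter.1 hm).2⟩
  have hh : 4 / 3 * ((J : ℝ) + 1) ≤ T / N := by rw [le_div_iff₀ hNpos]; exact hTT
  have h2 := hnorm ε ε₀ (T / N) T (A.filter (fun m => ¬ ∃ p ∈ l m, ∃ k ∈ range N,
    ((k : ℝ) + 1) * (T / N) ≤ iterLog p ∧
      (omegaIn (k * (T / N)) ((k + 1) * (T / N)) (p + 1) : ℝ) ≤ (1 - ε) * (T / N))) l hε0.le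
    (by positivity) (by field_simp) (by linarith [add_one_le_scale (T / N)])
    (fun m hm => hA m (mem_filter.1 hm).1) (by
      intro m hm p hp k hk hpk
      have h3 := (mem_filter.1 hm).2
      by_contra hlt
      exact h3 ⟨p, hp, k, mem_range.2 (mem_Ico.1 hk).2, hpk, (not_le.1 hlt).le⟩)
  have h3 : T + T * (ε * L) + 2 * (T / N) * S - (1 + ε₀) * (T - 1) ≤ 1 + ε₀ + -δ * T := by
    have h4 : T * (ε * L) ≤ T * (ε₀ / 4) := mul_le_mul_of_nonneg_left hεL hT
    have h5 : 2 * (T / N) * S ≤ T * (ε₀ / 4) := by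
      calc _ = T * (2 * S / N) := by ring
        _ ≤ _ := mul_le_mul_of_nonneg_left hNS hT
    have h6 : δ * T ≤ ε₀ / 2 * T := mul_le_mul_of_nonneg_right (min_le_right _ _) hT
    linarith
  have h4 : C₂ * exp (T + T * (ε * L) + 2 * (T / N) * S - (1 + ε₀) * (T - 1)) ≤
      C₂ * exp (1 + ε₀) * exp (-δ * T) := by
    rw [mul_assoc C₂, ← exp_add]
    exact mul_le_mul_of_nonneg_left (exp_le_exp.2 h3) (by linarith)
  have h5 : C₁ * exp (-δ₁ * T) ≤ C₁ * exp (-δ * T) := by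
    refine mul_le_mul_of_nonneg_left (exp_le_exp.2 ?_) hC₁.le
    have : δ * T ≤ δ₁ * T := mul_le_mul_of_nonneg_right (min_le_left _ _) hT
    linarith
  have h6 : 0 ≤ C₃ * exp (T₀ + δ * T₀) * exp (-δ * T) := by positivity
  rw [add_mul, add_mul]
  linarith [h1, h2, h4, h5, h6]

/-- Coefficients of the linear potential which contracts by the factor `ρ` when the largest prime is
removed. -/
lemma exists_potential (J : ℕ) {a : ℕ → ℝ} {ρ : ℝ} (ha : ∀ j, 0 ≤ a (j + 1)) (hρ : 0 ≤ ρ)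
    (hF : 1 ≤ ∑ j ∈ range J, a (j + 1) * ρ ^ (j + 1)) :
    ∃ c : ℕ → ℝ, (∀ j, 0 ≤ c j) ∧ 1 ≤ c 0 ∧ ∀ s : ℕ → ℝ, 0 ≤ s 0 →
      ∑ j ∈ range J, a (j + 1) * s (j + 1) ≤ s 0 →
      ∑ j ∈ range J, c j * s (j + 1) ≤ ρ * ∑ j ∈ range J, c j * s j := by
  set c : ℕ → ℝ := fun j => ∑ i ∈ range (J - j), a (j + i + 1) * ρ ^ (i + 1) with hc
  refine ⟨c, fun j => sum_nonneg fun i _ => mul_nonneg (ha _) (pow_nonneg hρ _), ?_,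
    fun s hs h => ?_⟩
  · simpa [hc] using hF
  have hrec : ∀ j ∈ range J, c j = ρ * (a (j + 1) + c (j + 1)) := by
    intro j hj
    obtain ⟨d, hd⟩ : ∃ d, J - j = d + 1 := ⟨J - j - 1, by have := mem_range.1 hj; omega⟩
    have hd' : J - (j + 1) = d := by omega
    simp only [hc, hd, hd', sum_range_succ', mul_add, mul_sum]
    rw [add_comm]
    congr 1
    · simp [mul_comm]
    · refine sum_congr rfl fun i _ => ?_
      rw [show j + (i + 1) + 1 = j + 1 + i + 1 by ring]; ring
  have hJ : c J = 0 := by simp [hc]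
  have h0 : 1 ≤ c 0 := by simpa [hc] using hF
  have h1 : ∑ j ∈ range J, c j * s (j + 1) =
      ρ * (∑ j ∈ range J, a (j + 1) * s (j + 1) + ∑ j ∈ range J, c (j + 1) * s (j + 1)) := by
    rw [← sum_add_distrib, mul_sum]
    exact sum_congr rfl fun j hj => by rw [hrec j hj]; ring
  have h2 : ∑ j ∈ range J, c (j + 1) * s (j + 1) + c 0 * s 0 = ∑ j ∈ range J, c j * s j := by
    rw [← sum_range_succ' (fun j => c j * s j), sum_range_succ, hJ]; ring
  rw [h1]
  refine mul_le_mul_of_nonneg_left ?_ hρ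
  nlinarith

lemma sum_geometric_le {x : ℝ} (h0 : 0 ≤ x) (h1 : x < 1) (S : Finset ℕ) :
    ∑ k ∈ S, x ^ k ≤ (1 - x)⁻¹ := by
  rw [← tsum_geometric_of_lt_one h0 h1]
  exact (summable_geometric_of_lt_one h0 h1).sum_le_tsum S fun _ _ => pow_nonneg h0 _

lemma bad_total_le (J : ℕ) {ε₀ : ℝ} (hε₀ : 0 < ε₀) : ∃ C : ℝ, 0 < C ∧
    ∀ (A : Finset ℕ) (l : ℕ → List ℕ), (∀ m ∈ A, (∀ p ∈ l m, p.Prime) ∧ shiftProd (l m) = m ∧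
      (l m).Pairwise (· ≥ ·) ∧
      (1 + ε₀) * scaleAt (l m) 0 ≤ ∑ j ∈ range J, fordCoeff (j + 1) * scaleAt (l m) (j + 1)) →
    ∑ m ∈ A, 1 / (m : ℝ) ≤ C := by
  classical
  obtain ⟨δ, C, hδ, hC, hbad⟩ := bad_sum_le J hε₀
  have hx1 : exp (-δ) < 1 := by rw [exp_lt_one_iff]; linarith
  refine ⟨C * (1 - exp (-δ))⁻¹, mul_pos hC (inv_pos.2 (by linarith)), fun A l hA => ?_⟩
  set k : ℕ → ℕ := fun m => ⌊scaleAt (l m) 0⌋₊ with hk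
  rw [← sum_fiberwise_of_maps_to (t := A.image k) (g := k) fun m hm => mem_image_of_mem _ hm]
  calc _ ≤ ∑ j ∈ A.image k, C * exp (-δ) ^ j := ?_
    _ ≤ _ := by
      rw [← mul_sum]
      exact mul_le_mul_of_nonneg_left (sum_geometric_le (exp_pos _).le hx1 _) hC.le
  refine sum_le_sum fun j _ => ?_
  have h1 := hbad (j + 1) (by positivity) (A.filter fun m => k m = j) l (by
    intro m hm
    obtain ⟨hm1, rfl⟩ := mem_filter.1 hm
    obtain ⟨h2, h3, h4, h5⟩ := hA m hm1
    have h6 := scaleAt_nonneg h2 0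
    refine ⟨⟨fun p hp => ⟨h2 p hp, ?_⟩, h3⟩, h4, le_trans ?_ h5⟩
    · obtain ⟨i, hi, rfl⟩ := List.mem_iff_getElem.1 hp
      rw [← scaleAt_of_lt hi]
      exact (scaleAt_antitone h2 h4 (Nat.zero_le i)).trans (Nat.lt_floor_add_one _).le
    · refine mul_le_mul_of_nonneg_left ?_ (by linarith)
      rw [add_sub_cancel_right]
      exact Nat.floor_le h6)
  refine h1.trans (mul_le_mul_of_nonneg_left ?_ hC.le)
  rw [← exp_nat_mul]
  apply exp_le_exp.2
  linarith

lemma exists_sorted_rep {l : List ℕ} : ∃ l' : List ℕ, l'.Perm l ∧ l'.Pairwise (· ≥ ·) :=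
  ⟨l.insertionSort (· ≥ ·), List.perm_insertionSort _ l, List.pairwise_insertionSort _ l⟩

/-- The sum of reciprocals of products whose potential is at most `ρ⁻ⁱ`. -/
lemma sum_potential_le {J : ℕ} {ε₀ ρ : ℝ} (hε₀ : 0 < ε₀) (hρ : 0 < ρ) (hρ1 : ρ < 1) {c : ℕ → ℝ}
    (hc : ∀ j, 0 ≤ c j) (hc0 : 1 ≤ c 0) (hJ : 0 < J)
    (hW : ∀ s : ℕ → ℝ, 0 ≤ s 0 →
      ∑ j ∈ range J, fordCoeff (j + 1) * s (j + 1) ≤ (1 + ε₀) * s 0 →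
      ∑ j ∈ range J, c j * s (j + 1) ≤ ρ * ∑ j ∈ range J, c j * s j) :
    ∃ K C : ℝ, 1 ≤ K ∧ 0 < C ∧ ∀ (i : ℕ) (A : Finset ℕ) (l : ℕ → List ℕ),
    (∀ m ∈ A, (∀ p ∈ l m, p.Prime) ∧ shiftProd (l m) = m ∧
      (l m).Pairwise (· ≥ ·) ∧ ∑ j ∈ range J, c j * scaleAt (l m) j ≤ ρ⁻¹ ^ i) →
    ∑ m ∈ A, 1 / (m : ℝ) ≤ K * ∏ j ∈ range i, (ρ⁻¹ ^ (j + 1) + C) := by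
  classical
  obtain ⟨C₁, hC₁, hbad⟩ := bad_total_le J hε₀
  obtain ⟨C₂, hC₂, hM, -⟩ := exists_abs_sum_primesIoc_le
  obtain ⟨C₃, hC₃, hrep⟩ := sum_inv_rep_le one_pos
  have hK : 1 ≤ C₃ * exp (1 * 1) := one_le_mul_of_one_le_of_one_le hC₃ (one_le_exp (by norm_num))
  have hr : 1 ≤ ρ⁻¹ := (one_le_inv₀ hρ).2 hρ1.le
  refine ⟨C₃ * exp (1 * 1), 1 + C₁ + C₂, hK, by positivity, fun i => ?_⟩
  have hhead : ∀ (x : ℝ) (l : List ℕ), (∀ p ∈ l, p.Prime) →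
      ∑ j ∈ range J, c j * scaleAt l j ≤ x → scaleAt l 0 ≤ x := by
    intro x l hl h
    have h1 := single_le_sum (f := fun j => c j * scaleAt l j)
      (fun j _ => mul_nonneg (hc j) (scaleAt_nonneg hl j)) (mem_range.2 hJ)
    have h2 := scaleAt_nonneg hl 0
    have h3 : c 0 * scaleAt l 0 ≤ x := h1.trans h
    nlinarith
  induction i with
  | zero =>
    intro A l hA
    rw [prod_range_zero, mul_one]
    refine hrep 1 zero_le_one A fun m hm => ⟨l m, fun p hp => ⟨(hA m hm).1 p hp, ?_⟩, (hA m hm).2.1⟩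
    obtain ⟨h1, -, h3, h4⟩ := hA m hm
    obtain ⟨i, hi, rfl⟩ := List.mem_iff_getElem.1 hp
    rw [← scaleAt_of_lt hi]
    exact (scaleAt_antitone h1 h3 (Nat.zero_le i)).trans (hhead _ _ h1 (by simpa using h4))
  | succ i ih =>
    intro A l hA
    set G := C₃ * exp (1 * 1) * ∏ j ∈ range i, (ρ⁻¹ ^ (j + 1) + (1 + C₁ + C₂)) with hG
    have hG1 : 1 ≤ G := by
      refine one_le_mul_of_one_le_of_one_le hK ?_
      have h := prod_le_prod (s := range i) (f := fun _ => (1 : ℝ)) (fun _ _ => zero_le_one)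
        fun j _ => show 1 ≤ ρ⁻¹ ^ (j + 1) + (1 + C₁ + C₂) by
          linarith [one_le_pow₀ hr (n := j + 1)]
      simpa using h
    set V := ρ⁻¹ ^ (i + 1) with hV
    have hV1 : 1 ≤ V := one_le_pow₀ hr
    set bad : ℕ → Prop := fun m =>
      (1 + ε₀) * scaleAt (l m) 0 ≤ ∑ j ∈ range J, fordCoeff (j + 1) * scaleAt (l m) (j + 1)
    have hb := hbad (A.filter bad) l fun m hm => by
      obtain ⟨hm, h⟩ := mem_filter.1 hm
      exact ⟨(hA m hm).1, (hA m hm).2.1, (hA m hm).2.2.1, h⟩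
    have hgood : ∀ m ∈ A.filter (fun m => ¬ bad m), l m ≠ [] := by
      intro m hm h
      refine (mem_filter.1 hm).2 ?_
      simp [bad, h, scaleAt_nil]
    have hcons : ∀ m ∈ A.filter (fun m => ¬ bad m), l m = (l m).headI :: (l m).tail := by
      intro m hm
      obtain ⟨a, t, h⟩ := List.exists_cons_of_ne_nil (hgood m hm)
      rw [h]; rfl
    set P := (A.filter fun m => ¬ bad m).image fun m => (l m).headI with hP
    set B := (A.filter fun m => ¬ bad m).image fun m => shiftProd (l m).tail with hB
    have hPs : ∑ r ∈ P, 1 / (r : ℝ) ≤ V + C₂ := by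
      have h1 := hM V (by linarith)
      rw [abs_le] at h1
      refine le_trans (sum_le_sum_of_subset_of_nonneg ?_ fun _ _ _ => by positivity)
        (show primeRecipSum (scale V) ≤ V + C₂ by linarith)
      intro r hr
      obtain ⟨m, hm, rfl⟩ := mem_image.1 hr
      have h2 := hcons m hm
      obtain ⟨h3, -, -, h4⟩ := hA m (mem_filter.1 hm).1
      have h5 := hhead _ _ h3 h4
      have h6 : ((l m).headI).Prime := h3 _ (by rw [h2]; simp)
      rw [h2, scaleAt_zero] at h5
      refine mem_primesUpTo.2 ⟨h6, (le_scale_iff ?_).2 h5⟩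
      exact_mod_cast h6.one_lt.le
    have hBs : ∑ b ∈ B, 1 / (b : ℝ) ≤ G := by
      have h1 : ∀ b ∈ B, ∃ m ∈ A.filter (fun m => ¬ bad m), shiftProd (l m).tail = b :=
        fun b hb => mem_image.1 hb
      choose! g hg hgb using h1
      refine ih B (fun b => (l (g b)).tail) fun b hb => ?_
      have h2 := hcons _ (hg b hb)
      obtain ⟨h3, -, h5, h6⟩ := hA _ (mem_filter.1 (hg b hb)).1
      refine ⟨fun p hp => h3 p (List.mem_of_mem_tail hp), hgb b hb, h5.tail, ?_⟩
      have h7 := hW (scaleAt (l (g b))) (scaleAt_nonneg h3 0)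
        (not_le.1 (mem_filter.1 (hg b hb)).2).le
      have h8 : ∀ j, scaleAt (l (g b)) (j + 1) = scaleAt (l (g b)).tail j := by
        intro j; conv_lhs => rw [h2, scaleAt_succ]
      simp only [h8] at h7
      refine h7.trans ((mul_le_mul_of_nonneg_left h6 hρ.le).trans_eq ?_)
      rw [hV, pow_succ]; field_simp
    have hs := sum_inv_split (A := A.filter fun m => ¬ bad m) (P := P) (B := B)
      (p := fun m => (l m).headI) (q := fun m => shiftProd (l m).tail) (by
        intro r hr
        obtain ⟨m, hm, rfl⟩ := mem_image.1 hr
        exact ((hA m (mem_filter.1 hm).1).1 _ (by rw [hcons m hm]; simp)).pos)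
      (fun m hm => ⟨mem_image_of_mem _ hm,
        mem_image_of_mem (fun m => shiftProd (l m).tail) hm, by
          rw [← shiftProd_cons, ← hcons m hm, (hA m (mem_filter.1 hm).1).2.1]⟩)
    have h1 : (∑ r ∈ P, 1 / (r : ℝ)) * ∑ b ∈ B, 1 / (b : ℝ) ≤ (V + C₂) * G :=
      mul_le_mul hPs hBs (sum_nonneg fun _ _ => by positivity) (by linarith)
    rw [← sum_filter_add_sum_filter_not A bad, prod_range_succ, ← mul_assoc, ← hG]
    have h2 : C₁ * 1 ≤ C₁ * G := mul_le_mul_of_nonneg_left hG1 hC₁.le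
    linarith

/-- The sum of reciprocals of the monoid elements with all primes of scale at most `T`. -/
lemma sum_inv_isRep_le {J : ℕ} {ρ : ℝ} (hρ : 0 < ρ) (hρ1 : ρ < 1)
    (hF : 1 < ∑ j ∈ range J, fordCoeff (j + 1) * ρ ^ (j + 1)) :
    ∃ K c : ℝ, 0 < K ∧ 0 < c ∧ ∀ (i : ℕ) (T : ℝ), 0 ≤ T → c * T ≤ ρ⁻¹ ^ i → ∀ A : Finset ℕ,
    (∀ m ∈ A, ∃ l, IsRep T l m) →
    ∑ m ∈ A, 1 / (m : ℝ) ≤ exp (K * (i + 1) + (i * (i + 1) / 2) * log ρ⁻¹) := by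
  set F := ∑ j ∈ range J, fordCoeff (j + 1) * ρ ^ (j + 1) with hFdef
  have hJ : 0 < J := by
    rcases Nat.eq_zero_or_pos J with h | h
    · subst h; simp [hFdef] at hF; linarith
    · exact h
  set ε₀ := F - 1 with hε₀
  have h0 : 0 < ε₀ := by linarith
  obtain ⟨c, hc, hc0, hW⟩ := exists_potential J (a := fun k => fordCoeff k / (1 + ε₀)) (ρ := ρ)
    (fun j => div_nonneg (fordCoeff_nonneg j) (by linarith)) hρ.le (by
      simp only [div_mul_eq_mul_div]
      rw [← sum_div, ← hFdef, le_div_iff₀ (by linarith)]; linarith)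
  obtain ⟨K, C, hK, hC, h⟩ := sum_potential_le h0 hρ hρ1 hc hc0 hJ (fun s hs h => hW s hs (by
    simp only [div_mul_eq_mul_div]
    rw [← sum_div, div_le_iff₀ (by linarith)]; linarith))
  have hr : 1 ≤ ρ⁻¹ := (one_le_inv₀ hρ).2 hρ1.le
  have hcs : 0 < ∑ j ∈ range J, c j := zero_lt_one.trans_le (hc0.trans
    (single_le_sum (f := c) (fun j _ => hc j) (mem_range.2 hJ)))
  refine ⟨log K + log (1 + C) + 1, ∑ j ∈ range J, c j, ?_, hcs, fun i T hT hi A hA => ?_⟩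
  · have := Real.log_nonneg hK
    have := Real.log_nonneg (show 1 ≤ 1 + C by linarith)
    linarith
  have h1 : ∀ m ∈ A, ∃ l, IsRep T l m ∧ l.Pairwise (· ≥ ·) := by
    intro m hm
    obtain ⟨l, hl, hm⟩ := hA m hm
    obtain ⟨l', h2, h3⟩ := exists_sorted_rep (l := l)
    refine ⟨l', ⟨fun p hp => hl p (h2.mem_iff.1 hp), ?_⟩, h3⟩
    rw [← hm]; exact (h2.map _).prod_eq
  choose! l hl using h1
  refine (h i A l fun m hm => ⟨fun p hp => ((hl m hm).1.1 p hp).1, (hl m hm).1.2, (hl m hm).2,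
    ?_⟩).trans ?_
  · refine le_trans ?_ hi
    rw [sum_mul]
    exact sum_le_sum fun j _ => mul_le_mul_of_nonneg_left
      (scaleAt_le hT (fun p hp => ((hl m hm).1.1 p hp).2) j) (hc j)
  have h2 : ∏ j ∈ range i, (ρ⁻¹ ^ (j + 1) + C) ≤
      ∏ j ∈ range i, exp (log (1 + C) + (j + 1 : ℕ) * log ρ⁻¹) := by
    refine prod_le_prod (fun j _ => by positivity) fun j _ => ?_
    rw [exp_add, exp_log (by linarith), exp_nat_mul, exp_log (by linarith)]
    have := one_le_pow₀ hr (n := j + 1)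
    nlinarith
  have h3 : ∑ j ∈ range i, ((j + 1 : ℕ) : ℝ) = i * (i + 1) / 2 := by
    clear * -
    induction i with
    | zero => simp
    | succ i ih => rw [sum_range_succ, ih]; push_cast; ring
  rw [← exp_sum, sum_add_distrib, ← sum_mul, h3, sum_const, card_range, nsmul_eq_mul] at h2
  calc _ ≤ exp (log K) * exp (i * log (1 + C) + i * (i + 1) / 2 * log ρ⁻¹) := by
        rw [exp_log (by linarith)]; exact mul_le_mul_of_nonneg_left h2 (by linarith)
    _ ≤ _ := by
      rw [← exp_add]
      apply exp_le_exp.2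
      have := mul_nonneg (Nat.cast_nonneg (α := ℝ) i) (Real.log_nonneg hK)
      have := Real.log_nonneg (show 1 ≤ 1 + C by linarith)
      nlinarith [Nat.cast_nonneg (α := ℝ) i]

lemma mem_paleyMonoid_iff {n : ℕ} :
    n ∈ paleyMonoid ↔ ∃ l : List ℕ, (∀ p ∈ l, p.Prime) ∧ shiftProd l = n := by
  rw [paleyMonoid, SetLike.mem_coe]
  constructor
  · intro h
    induction h using Submonoid.closure_induction with
    | mem m hm =>
      obtain ⟨p, hp, rfl⟩ := hm
      exact ⟨[p], by simpa using hp, by simp [shiftProd]⟩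
    | one => exact ⟨[], by simp, by simp [shiftProd]⟩
    | mul a b _ _ ha hb =>
      obtain ⟨l, hl, rfl⟩ := ha
      obtain ⟨l', hl', rfl⟩ := hb
      refine ⟨l ++ l', fun p hp => ?_, by simp [shiftProd]⟩
      rcases List.mem_append.1 hp with h | h
      · exact hl p h
      · exact hl' p h
  · rintro ⟨l, hl, rfl⟩
    refine Submonoid.list_prod_mem _ fun m hm => ?_
    obtain ⟨p, hp, rfl⟩ := List.mem_map.1 hm
    exact Submonoid.subset_closure ⟨p, hl p hp, rfl⟩

lemma Ncount_eq_card (x : ℝ) [DecidablePred (· ∈ paleyMonoid)] :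
    Ncount x = #((Icc 1 ⌊x⌋₊).filter (· ∈ paleyMonoid)) := by
  rw [Ncount, ← Set.ncard_coe_finset]
  congr 1
  ext n
  simp only [Set.mem_ofPred_eq, coe_filter, mem_Icc]
  constructor
  · rintro ⟨h, hx⟩
    have h0 : n ≠ 0 := by
      obtain ⟨l, -, rfl⟩ := mem_paleyMonoid_iff.1 h
      exact shiftProd_ne_zero l
    exact ⟨⟨Nat.one_le_iff_ne_zero.2 h0, (Nat.le_floor_iff' h0).2 hx⟩, h⟩
  · rintro ⟨⟨h1, hx⟩, h⟩
    exact ⟨h, (Nat.le_floor_iff' (by omega)).1 hx⟩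

lemma card_primesUpTo_le {z : ℝ} (hz : 1 < z) : (#(primesUpTo z) : ℝ) ≤ 5 * z / log z := by
  have h1 := Chebyshev.pi_le_log4_mul_div hz
  have h2 : #(primesUpTo z) = Nat.primeCounting ⌊z⌋₊ := by
    rw [← Nat.primesLE_card_eq_primeCounting]
    congr 1
    ext p
    rw [mem_primesUpTo, Nat.mem_primesLE, and_comm]
    exact and_congr_left fun hp => (Nat.le_floor_iff' hp.ne_zero).symm
  have hlog : 0 < log z := log_pos hz
  have hs : 0 < √z := sqrt_pos.2 (by linarith)
  have h3 : log √z = log z / 2 := log_sqrt (by linarith)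
  have h4 : log 4 ≤ 1.5 := by
    rw [show (4 : ℝ) = 2 ^ 2 by norm_num, log_pow]
    push_cast
    linarith [log_two_lt_d9]
  have h5 : √z ≤ 2 * z / log z := by
    rw [le_div_iff₀ hlog]
    have h6 : log √z ≤ √z := (log_le_sub_one_of_pos hs).trans (by linarith)
    rw [h3] at h6
    have h7 : √z * √z = z := mul_self_sqrt (by linarith)
    nlinarith
  rw [h2]
  have h6 : log 4 * z / log √z ≤ 3 * z / log z := by
    rw [h3, div_le_div_iff₀ (by linarith) hlog]
    have : log 4 * z * log z ≤ 1.5 * z * log z := by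
      refine mul_le_mul_of_nonneg_right ?_ hlog.le
      exact mul_le_mul_of_nonneg_right h4 (by linarith)
    linarith
  have h7 : 5 * z / log z = 3 * z / log z + 2 * z / log z := by ring
  linarith

lemma isRep_of_le {x : ℝ} {l : List ℕ} (hl : ∀ p ∈ l, p.Prime) (hx : (shiftProd l : ℝ) ≤ x) :
    IsRep (iterLog x) l (shiftProd l) := by
  refine ⟨fun p hp => ⟨hl p hp, ?_⟩, rfl⟩
  have h1 : p + 1 ≤ shiftProd l :=
    Nat.le_of_dvd (Nat.pos_of_ne_zero (shiftProd_ne_zero l))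
      (List.dvd_prod (List.mem_map_of_mem hp))
  refine iterLog_le_iterLog ?_ (le_trans ?_ hx)
  · exact_mod_cast (hl p hp).one_lt.le
  · exact_mod_cast (Nat.le_succ p).trans h1

/-- Splitting the monoid elements up to `x` according to the size of their largest prime. -/
lemma count_le_split : ∃ C : ℝ, 0 < C ∧ ∀ (x y S : ℝ) (k : ℕ), 1 ≤ x → 1 < y →
    (y + 1) ^ k ≤ √x → (∀ D : Finset ℕ, (∀ m ∈ D, ∃ l, IsRep (iterLog x) l m) →
      ∑ m ∈ D, 1 / (m : ℝ) ≤ S) →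
    (Ncount x : ℝ) ≤ √x + C * x * (2 / 3) ^ k * exp (3 / 2 * iterLog x) + 5 * x / log y * S := by
  classical
  obtain ⟨C, hC, hrep⟩ := sum_rep_le (3 / 2)
  obtain ⟨C', hC', hM, -⟩ := exists_abs_sum_primesIoc_le
  refine ⟨C * exp (3 / 2 * (1 + C')), by positivity, fun x y S k hx hy hk hS => ?_⟩
  have hE : 0 ≤ iterLog x := iterLog_nonneg hx
  have hx0 : 0 < x := by linarith
  set A := (Icc 1 ⌊x⌋₊).filter (· ∈ paleyMonoid) with hA
  have hAx : ∀ n ∈ A, 0 < n ∧ (n : ℝ) ≤ x := by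
    intro n hn
    have h := mem_Icc.1 (mem_filter.1 hn).1
    exact ⟨h.1, (Nat.le_floor_iff' (by omega)).1 h.2⟩
  set A₂ := A.filter fun n : ℕ => √x < n ∧ ∃ l : List ℕ, (∀ p ∈ l, p.Prime ∧ (p : ℝ) ≤ y) ∧
    shiftProd l = n with hA₂
  set D := A.filter fun m : ℕ => (m : ℝ) * y ≤ x with hD
  have hsub : A ⊆ Icc 1 ⌊√x⌋₊ ∪ (A₂ ∪ D.biUnion fun m : ℕ =>
      (primesUpTo (x / m)).image fun p => (p + 1) * m) := by
    intro n hn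
    rw [mem_union, mem_union]
    rcases le_or_gt (n : ℝ) √x with h | h
    · left
      exact mem_Icc.2 ⟨(hAx n hn).1, Nat.le_floor h⟩
    right
    obtain ⟨l, hl, hln⟩ := mem_paleyMonoid_iff.1 (mem_filter.1 hn).2
    by_cases hly : ∀ p ∈ l, (p : ℝ) ≤ y
    · left
      exact mem_filter.2 ⟨hn, h, l, fun p hp => ⟨hl p hp, hly p hp⟩, hln⟩
    right
    push Not at hly
    obtain ⟨p, hp, hpy⟩ := hly
    have h1 : n = (p + 1) * shiftProd (l.erase p) := by
      rw [← shiftProd_cons, ← hln, shiftProd, shiftProd,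
        ((List.perm_cons_erase hp).map (· + 1)).prod_eq]
    have h2 : 0 < shiftProd (l.erase p) := Nat.pos_of_ne_zero (shiftProd_ne_zero _)
    have h2' : (0 : ℝ) < shiftProd (l.erase p) := by exact_mod_cast h2
    have h3 : ((p : ℝ) + 1) * shiftProd (l.erase p) ≤ x := by
      have := (hAx n hn).2
      rw [h1] at this
      exact_mod_cast this
    have h4 : (p : ℝ) * shiftProd (l.erase p) ≤ x := by linarith
    refine mem_biUnion.2 ⟨shiftProd (l.erase p), mem_filter.2 ⟨mem_filter.2 ⟨mem_Icc.2
      ⟨h2, Nat.le_floor ?_⟩, mem_paleyMonoid_iff.2 ⟨_, fun q hq => hl q (List.mem_of_mem_erase hq),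
        rfl⟩⟩, ?_⟩, mem_image.2 ⟨p, mem_primesUpTo.2 ⟨hl p hp, ?_⟩, h1.symm⟩⟩
    · have : (0 : ℝ) ≤ p * shiftProd (l.erase p) := by positivity
      linarith
    · nlinarith
    · rwa [le_div_iff₀ h2']
  have hcard : (#A : ℝ) ≤ √x + (#A₂ + ∑ m ∈ D, (#(primesUpTo (x / m)) : ℝ)) := by
    have h1 := (card_le_card hsub).trans ((card_union_le _ _).trans
      (Nat.add_le_add_left ((card_union_le _ _).trans (Nat.add_le_add_left (card_biUnion_le.trans
        (sum_le_sum fun m _ => card_image_le)) _)) _))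
    rw [Nat.card_Icc, Nat.add_sub_cancel] at h1
    have h2 : (#A : ℝ) ≤ ((⌊√x⌋₊ + (#A₂ + ∑ m ∈ D, #(primesUpTo (x / m))) : ℕ) : ℝ) := by
      exact_mod_cast h1
    push_cast at h2
    linarith [Nat.floor_le (sqrt_nonneg x)]
  have hA₂c : (#A₂ : ℝ) ≤ C * exp (3 / 2 * (1 + C')) * x * (2 / 3) ^ k *
      exp (3 / 2 * iterLog x) := by
    have h1 : ∀ n ∈ A₂, (1 : ℝ) ≤ x * (2 / 3) ^ k * (cmul (fun _ => 3 / 2) n / n) := by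
      intro n hn
      obtain ⟨hnA, h2, l, hl, rfl⟩ := mem_filter.1 hn
      have h3 : k ≤ l.length := by
        by_contra hlt
        push Not at hlt
        have h4 := shiftProd_le_pow_length (l := l) (q := ⌊y⌋₊) fun p hp => Nat.le_floor (hl p hp).2
        have h5 : (shiftProd l : ℝ) ≤ (y + 1) ^ l.length := by
          calc (shiftProd l : ℝ) ≤ ((⌊y⌋₊ : ℝ) + 1) ^ l.length := by exact_mod_cast h4
            _ ≤ _ := by gcongr; exact Nat.floor_le (by linarith)
        have h6 : (y + 1) ^ l.length ≤ (y + 1) ^ k := pow_le_pow_right₀ (by linarith) hlt.le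
        linarith
      have h4 := pow_length_le_cmul_shiftProd (x := 3 / 2) (by norm_num) l fun p hp => (hl p hp).1
      obtain ⟨h5, h6⟩ := hAx _ hnA
      have h5' : (0 : ℝ) < shiftProd l := by exact_mod_cast h5
      have h7 : (3 / 2 : ℝ) ^ k ≤ cmul (fun _ => 3 / 2) (shiftProd l) :=
        (pow_le_pow_right₀ (by norm_num) h3).trans h4
      rw [mul_div_assoc', le_div_iff₀ h5', one_mul, mul_assoc]
      have h8 : (1 : ℝ) ≤ (2 / 3) ^ k * cmul (fun _ => 3 / 2) (shiftProd l) := by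
        calc (1 : ℝ) = (2 / 3) ^ k * (3 / 2) ^ k := by rw [← mul_pow]; norm_num
          _ ≤ _ := by gcongr
      nlinarith
    have h2 := hrep (fun _ => 3 / 2) (fun _ => by norm_num) (fun _ => le_rfl)
      (fun p hp => by have : (2 : ℝ) ≤ p := by exact_mod_cast hp.two_le
                      linarith) (iterLog x) hE A₂ (fun n hn => by
      obtain ⟨hnA, -, l, hl, rfl⟩ := mem_filter.1 hn
      exact ⟨l, isRep_of_le (fun p hp => (hl p hp).1) (hAx _ hnA).2⟩)
    have h3 : ∑ r ∈ primesUpTo (scale (iterLog x + 1)), (3 / 2 : ℝ) / r ≤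
        3 / 2 * (iterLog x + 1 + C') := by
      have h4 := hM (iterLog x + 1) (by linarith)
      rw [abs_le] at h4
      have h5 : ∑ r ∈ primesUpTo (scale (iterLog x + 1)), (3 / 2 : ℝ) / r =
          3 / 2 * primeRecipSum (scale (iterLog x + 1)) := by
        rw [primeRecipSum, mul_sum]
        exact sum_congr rfl fun r _ => by ring
      rw [h5]
      linarith
    have hpow : (0 : ℝ) ≤ x * (2 / 3) ^ k := by positivity
    calc (#A₂ : ℝ) = ∑ n ∈ A₂, (1 : ℝ) := by simp
      _ ≤ ∑ n ∈ A₂, x * (2 / 3) ^ k * (cmul (fun _ => 3 / 2) n / n) := sum_le_sum h1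
      _ ≤ x * (2 / 3) ^ k * (C * exp (3 / 2 * (iterLog x + 1 + C'))) := by
        rw [← mul_sum]
        exact mul_le_mul_of_nonneg_left (h2.trans (mul_le_mul_of_nonneg_left (exp_le_exp.2 h3)
          (by linarith))) hpow
      _ = _ := by
        rw [show 3 / 2 * (iterLog x + 1 + C') = 3 / 2 * (1 + C') + 3 / 2 * iterLog x by ring,
          exp_add]
        ring
  have hDc : ∑ m ∈ D, (#(primesUpTo (x / m)) : ℝ) ≤ 5 * x / log y * S := by
    have h1 := hS D fun m hm => by
      obtain ⟨l, hl, rfl⟩ := mem_paleyMonoid_iff.1 (mem_filter.1 (mem_filter.1 hm).1).2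
      exact ⟨l, isRep_of_le hl (hAx _ (mem_filter.1 hm).1).2⟩
    have hly : 0 < log y := log_pos hy
    have h2 : ∀ m ∈ D, (#(primesUpTo (x / m)) : ℝ) ≤ 5 * x / log y * (1 / m) := by
      intro m hm
      obtain ⟨hmA, hmy⟩ := mem_filter.1 hm
      have hm0 : (0 : ℝ) < m := by exact_mod_cast (hAx m hmA).1
      have h3 : y ≤ x / m := by rw [le_div_iff₀ hm0]; linarith
      refine (card_primesUpTo_le (hy.trans_le h3)).trans ?_
      calc 5 * (x / m) / log (x / m) ≤ 5 * (x / m) / log y :=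
            div_le_div_of_nonneg_left (by positivity) hly (log_le_log (by linarith) h3)
        _ = _ := by ring
    calc _ ≤ ∑ m ∈ D, 5 * x / log y * (1 / (m : ℝ)) := sum_le_sum h2
      _ ≤ _ := by rw [← mul_sum]; exact mul_le_mul_of_nonneg_left h1 (by positivity)
  rw [Ncount_eq_card]
  linarith

open Filter

lemma eventually_iterLog_sq_le : ∀ᶠ x : ℝ in atTop, iterLog x ^ 2 ≤ log x := by
  have h1 : ∀ᶠ u : ℝ in atTop, log u ^ 2 ≤ 1 / 2 * u := by
    filter_upwards [(isLittleO_pow_log_id_atTop (n := 2)).bound (show (0 : ℝ) < 1 / 2 by norm_num),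
      eventually_ge_atTop 0] with u hu h0
    simpa [abs_of_nonneg h0] using hu
  have h2 := (tendsto_atTop_add_const_left atTop 1 tendsto_log_atTop).eventually h1
  filter_upwards [h2, tendsto_log_atTop.eventually_ge_atTop 1] with x hx hl
  rw [iterLog]
  linarith

lemma iterLog_le_two_mul {x : ℝ} (h : exp 1 ≤ log x) : iterLog x ≤ 2 * log (log x) := by
  have h0 : 0 < log x := (exp_pos 1).trans_le h
  have h1 : 1 ≤ log (log x) := by rw [le_log_iff_exp_le h0]; exact h
  have h2 : (2 : ℝ) ≤ exp 1 := by linarith [add_one_le_exp (1 : ℝ)]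
  have h3 : 1 + log x ≤ exp 1 * log x := by nlinarith
  have h4 := log_le_log (by linarith) h3
  rw [log_mul (exp_pos 1).ne' h0.ne', log_exp] at h4
  rw [iterLog]; linarith

lemma two_thirds_pow_mul_le {E L : ℝ} (h : exp E = 1 + L) :
    (2 / 3) ^ ⌊E ^ 2 / 4⌋₊ * exp (3 / 2 * E) * L ≤ exp 20 := by
  have h2 : (2 / 3 : ℝ) ≤ exp (-(1 / 3)) := by linarith [add_one_le_exp (-(1 / 3) : ℝ)]
  have h3 : (2 / 3 : ℝ) ^ ⌊E ^ 2 / 4⌋₊ ≤ exp (-(1 / 3) * (E ^ 2 / 4 - 1)) := by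
    calc _ ≤ exp (-(1 / 3)) ^ ⌊E ^ 2 / 4⌋₊ := pow_le_pow_left₀ (by norm_num) h2 _
      _ = exp (⌊E ^ 2 / 4⌋₊ * (-(1 / 3))) := by rw [exp_nat_mul]
      _ ≤ _ := by
        apply exp_le_exp.2
        linarith [Nat.lt_floor_add_one (E ^ 2 / 4)]
  have h5 : L ≤ exp E := by linarith
  calc _ ≤ (2 / 3) ^ ⌊E ^ 2 / 4⌋₊ * exp (3 / 2 * E) * exp E :=
        mul_le_mul_of_nonneg_left h5 (by positivity)
    _ ≤ exp (-(1 / 3) * (E ^ 2 / 4 - 1)) * exp (3 / 2 * E) * exp E :=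
        mul_le_mul_of_nonneg_right (mul_le_mul_of_nonneg_right h3 (exp_pos _).le) (exp_pos _).le
    _ = exp (-(1 / 3) * (E ^ 2 / 4 - 1) + 3 / 2 * E + E) := by rw [exp_add, exp_add]
    _ ≤ _ := by
      apply exp_le_exp.2
      nlinarith [sq_nonneg (E - 15)]

lemma ceil_exponent_le {K lam W d B i : ℝ} (hlam0 : 0 < lam) (hK : 0 ≤ K) (hW0 : 0 ≤ W)
    (hd0 : 0 ≤ d) (hB : 0 ≤ B) (hi0 : 0 ≤ i)
    (hi : i ≤ (W + d) / lam + 1) :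
    B + (2 * (W + 1) + (K * (i + 1) + (i * (i + 1) / 2) * lam)) ≤ W ^ 2 / (2 * lam) +
      (B + 2 + K / lam + K * d / lam + 2 * K + d / lam + d ^ 2 / (2 * lam) + 3 / 2 +
        3 * d / 2 + lam) * (W + 1) := by
  have h3 : i * (i + 1) / 2 * lam ≤ ((W + d) / lam + 1) * ((W + d) / lam + 1 + 1) / 2 * lam := by
    gcongr
  have h4 : ((W + d) / lam + 1) * ((W + d) / lam + 1 + 1) / 2 * lam = W ^ 2 / (2 * lam) +
      d / lam * W + d ^ 2 / (2 * lam) + 3 / 2 * W + 3 * d / 2 + lam := by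
    field_simp; ring
  have h5 : K * (i + 1) ≤ K * ((W + d) / lam + 2) := by
    refine mul_le_mul_of_nonneg_left ?_ hK; linarith
  have h6 : K * ((W + d) / lam + 2) = K / lam * W + K * d / lam + 2 * K := by
    field_simp
  have h7 : 0 ≤ (B + K * d / lam + 2 * K + d ^ 2 / (2 * lam) + 3 * d / 2 + lam) * W := by
    positivity
  have h8 : 0 ≤ K / lam + d / lam + 3 / 2 := by positivity
  linarith

/-- The upper bound for the counting function in terms of a solution of
`∑ fordCoeff k * ρ ^ k > 1`. -/
lemma Ncount_le {J : ℕ} {ρ : ℝ} (hρ : 0 < ρ) (hρ1 : ρ < 1)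
    (hF : 1 < ∑ j ∈ range J, fordCoeff (j + 1) * ρ ^ (j + 1)) :
    ∃ K : ℝ, ∀ᶠ x : ℝ in atTop, (Ncount x : ℝ) ≤ x / log x *
      exp (log (log (log x)) ^ 2 / (2 * log ρ⁻¹) + K * (log (log (log x)) + 1)) := by
  obtain ⟨K, c, hK, hc, hsum⟩ := sum_inv_isRep_le hρ hρ1 hF
  obtain ⟨C, hC, hsplit⟩ := count_le_split
  set lam := log ρ⁻¹ with hlam
  have hlam0 : 0 < lam := log_pos ((one_lt_inv₀ hρ).2 hρ1)
  set M := 7 + C * exp 20 with hM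
  have hM1 : 1 ≤ M := by have := mul_pos hC (exp_pos 20); linarith
  have hlM := Real.log_nonneg hM1
  set d := |log c| + 1 with hd
  have hd0 : 0 ≤ d := by positivity
  refine ⟨log M + 2 + K / lam + K * d / lam + 2 * K + d / lam + d ^ 2 / (2 * lam) + 3 / 2 +
    3 * d / 2 + lam, ?_⟩
  filter_upwards [eventually_iterLog_sq_le, tendsto_log_atTop.eventually_ge_atTop (exp 1),
    eventually_ge_atTop 1] with x hx1 hx2 hx3
  set L := log x with hL
  set E := iterLog x with hE
  set W := log (log L) with hW
  have hL0 : 0 < L := (exp_pos 1).trans_le hx2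
  have hx0 : 0 < x := by linarith
  have hlL : 1 ≤ log L := by rw [le_log_iff_exp_le hL0]; exact hx2
  have hW0 : 0 ≤ W := Real.log_nonneg hlL
  have hE2 : E ≤ 2 * log L := iterLog_le_two_mul hx2
  have hE1 : 1 ≤ E := hlL.trans (log_le_log hL0 (by linarith))
  have hEexp : exp E = 1 + L := exp_log (by linarith)
  have hlogE : log E ≤ W + 1 := by
    have h1 := log_le_log (by linarith) hE2
    rw [log_mul two_ne_zero (by linarith)] at h1
    linarith [log_two_lt_d9]
  set w := W + d with hw
  set i := ⌈w / lam⌉₊ with hi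
  have hi1 : (i : ℝ) ≤ w / lam + 1 := (Nat.ceil_lt_add_one (by positivity)).le
  have hi2 : w ≤ i * lam := by rw [← div_le_iff₀ hlam0]; exact Nat.le_ceil _
  have hci : c * E ≤ ρ⁻¹ ^ i := by
    have h1 : c * E = exp (log c + log E) := by
      rw [exp_add, exp_log hc, exp_log (by linarith)]
    have h2 : ρ⁻¹ ^ i = exp (i * lam) := by rw [exp_nat_mul, exp_log (inv_pos.2 hρ)]
    rw [h1, h2]
    apply exp_le_exp.2
    linarith [le_abs_self (log c)]
  set G := exp (K * (i + 1) + (i * (i + 1) / 2) * lam) with hG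
  have hG1 : 1 ≤ G := one_le_exp (by positivity)
  have hy : 1 ≤ L / E ^ 2 := by rw [le_div_iff₀ (by positivity)]; linarith
  have hsq : √x = exp (L / 2) := by
    rw [← log_sqrt hx0.le, exp_log (sqrt_pos.2 hx0)]
  have hfl : (⌊E ^ 2 / 4⌋₊ : ℝ) ≤ E ^ 2 / 4 := Nat.floor_le (by positivity)
  have h1 := hsplit x (exp (L / E ^ 2)) G ⌊E ^ 2 / 4⌋₊ hx3 (by rw [one_lt_exp_iff]; linarith) (by
    have h3 : exp (L / E ^ 2) + 1 ≤ exp (2 * (L / E ^ 2)) := by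
      have h4 : 2 ≤ exp (L / E ^ 2) := by linarith [add_one_le_exp (L / E ^ 2)]
      rw [two_mul, exp_add]; nlinarith
    calc _ ≤ exp (2 * (L / E ^ 2)) ^ ⌊E ^ 2 / 4⌋₊ := by gcongr
      _ = exp (⌊E ^ 2 / 4⌋₊ * (2 * (L / E ^ 2))) := by rw [exp_nat_mul]
      _ ≤ √x := by
        rw [hsq]
        apply exp_le_exp.2
        calc _ ≤ E ^ 2 / 4 * (2 * (L / E ^ 2)) := by gcongr
          _ = L / 2 := by field_simp; ring) (fun D hD => hsum i E (by linarith) hci D hD)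
  rw [log_exp] at h1
  have ht1 : √x ≤ 2 * (x / L) := by
    have h2 : L / 2 ≤ √x := by rw [hsq]; linarith [add_one_le_exp (L / 2)]
    rw [mul_div_assoc', le_div_iff₀ hL0]
    have h3 : √x * √x = x := mul_self_sqrt hx0.le
    have h4 := sqrt_nonneg x
    nlinarith
  have ht2 : C * x * (2 / 3) ^ ⌊E ^ 2 / 4⌋₊ * exp (3 / 2 * E) ≤ C * exp 20 * (x / L) := by
    have h2 := two_thirds_pow_mul_le (E := E) (L := L) hEexp
    rw [mul_div_assoc', le_div_iff₀ hL0]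
    have h3 := mul_le_mul_of_nonneg_left h2 (mul_pos hC hx0).le
    linarith
  have ht3 : 5 * x / (L / E ^ 2) * G = 5 * (E ^ 2 * G) * (x / L) := by field_simp
  have hEG : 1 ≤ E ^ 2 * G := one_le_mul_of_one_le_of_one_le (one_le_pow₀ hE1) hG1
  have hxL : 0 ≤ x / L := by positivity
  have htot : (Ncount x : ℝ) ≤ x / L * (M * (E ^ 2 * G)) := by
    rw [ht3] at h1
    have h2 : (2 + C * exp 20) * 1 ≤ (2 + C * exp 20) * (E ^ 2 * G) := by gcongr
    calc (Ncount x : ℝ) ≤ x / L * (2 + C * exp 20 + 5 * (E ^ 2 * G)) := by linarith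
      _ ≤ _ := mul_le_mul_of_nonneg_left (by rw [hM]; linarith) hxL
  refine htot.trans (mul_le_mul_of_nonneg_left ?_ hxL)
  have h2 : M * (E ^ 2 * G) = exp (log M + (2 * log E + (K * (i + 1) + (i * (i + 1) / 2) * lam))) := by
    rw [exp_add, exp_add, exp_log (by linarith), ← hG]
    congr 2
    rw [mul_comm, ← rpow_def_of_pos (by linarith)]
    norm_num
  rw [h2]
  apply exp_le_exp.2
  have h3 := ceil_exponent_le (W := W) hlam0 hK.le hW0 hd0 hlM (Nat.cast_nonneg i) hi1
  linarith

lemma scale_sub_one_sq_le (w : ℝ) : scale (w - 1) ^ 2 ≤ scale w := by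
  rw [scale, scale, ← exp_nat_mul]
  apply exp_le_exp.2
  have h1 : exp w = exp 1 * exp (w - 1) := by rw [← exp_add]; ring_nf
  have h2 := exp_pos (w - 1)
  have h3 : 2 ≤ exp 1 := by linarith [add_one_le_exp (1 : ℝ)]
  push_cast
  nlinarith

/-- Primes `p` in a unit window for which `d ∣ p + 1`, where `d` is not too large. -/
lemma sum_shifted_dvd_le : ∃ C : ℝ, 0 < C ∧ ∀ (w : ℝ) (d : ℕ) (A : Finset ℕ), 1 ≤ w → 1 ≤ d →
    (∀ p ∈ A, p.Prime ∧ w ≤ iterLog p ∧ iterLog p ≤ w + 1 ∧ d ∣ p + 1 ∧ d * d ≤ p + 1) →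
    ∑ p ∈ A, 1 / ((p : ℝ) + 1) ≤ C * (1 + w) ^ 6 * (1 / d) := by
  obtain ⟨C, hC, h⟩ := sieve_log
  obtain ⟨C₁, hC₁, hM, -⟩ := exists_abs_sum_primesIoc_le
  refine ⟨C * 3 ^ 6 * exp (6 + C₁), by positivity, fun w d A hw hd hA => ?_⟩
  have hd0 : (0 : ℝ) < d := by exact_mod_cast hd
  have hmul : ∀ p ∈ A, d * ((p + 1) / d) = p + 1 := fun p hp => Nat.mul_div_cancel' (hA p hp).2.2.2.1
  have hd' : ∀ p ∈ A, (d : ℝ) ≤ scale (w + 2) := fun p hp => by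
    obtain ⟨h1, -, h3, h4, -⟩ := hA p hp
    rw [show w + 2 = w + 1 + 1 by ring]
    exact prime_dvd_succ h1 h3 (by linarith) h4
  rcases A.eq_empty_or_nonempty with rfl | ⟨p₀, hp₀⟩
  · simp only [sum_empty]; positivity
  have h2 := h (fun _ => 1) (fun _ => zero_le_one) (fun _ => le_rfl) d d (w + 2) (w - 1)
    (A.image fun p => (p + 1) / d) hd hd (by linarith) (by linarith) (hd' p₀ hp₀) (hd' p₀ hp₀) (by
      simp only [mem_image]
      rintro _ ⟨p, hp, rfl⟩
      obtain ⟨hp1, hp2, hp3, hp4, hp5⟩ := hA p hp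
      have hm := hmul p hp
      set n := (p + 1) / d
      have hdn : d ≤ n := by
        by_contra! hlt
        have := Nat.mul_lt_mul_of_pos_left hlt hd
        omega
      have h1 : (1 : ℝ) ≤ p := by exact_mod_cast hp1.one_lt.le
      have h4 : scale w ≤ p := (scale_le_iff h1).2 hp2
      refine ⟨?_, ?_, ?_, ?_⟩
      · have h5 : (p + 1 : ℝ) ≤ (n : ℝ) ^ 2 := by
          have : p + 1 ≤ n ^ 2 := by rw [← hm, sq]; exact Nat.mul_le_mul_right n hdn
          exact_mod_cast this
        refine (pow_le_pow_iff_left₀ (scale_pos _).le (Nat.cast_nonneg n) two_ne_zero).1 ?_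
        linarith [scale_sub_one_sq_le w]
      · rw [show w + 2 = w + 1 + 1 by ring]
        exact prime_dvd_succ hp1 hp3 (by linarith) ⟨d, by rw [mul_comm, hm]⟩
      · rw [hm]; simpa using hp1
      · rw [hm]; simpa using hp1)
  rw [sum_image (by
    intro a ha b hb hab
    have h1 := hmul a ha
    have h2 := hmul b hb
    have hab' : (a + 1) / d = (b + 1) / d := hab
    rw [hab', h2] at h1; omega), if_pos rfl] at h2
  have h3 : (1 + (w + 2)) ^ 6 ≤ 3 ^ 6 * (1 + w) ^ 6 := by
    rw [← mul_pow]; exact pow_le_pow_left₀ (by linarith) (by linarith) 6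
  have h4 := (abs_le.1 (hM (w + 2) (by linarith))).2
  rw [primeRecipSum] at h4
  have h5 : ∑ p ∈ A, 1 / ((p : ℝ) + 1) = (∑ p ∈ A, cmul (fun _ => 1) ((p + 1) / d) / ((p + 1) / d : ℕ)) *
      (1 / d) := by
    rw [sum_mul]
    refine sum_congr rfl fun p hp => ?_
    have hm := hmul p hp
    have hn : (p + 1) / d ≠ 0 := by intro h0; rw [h0] at hm; omega
    rw [cmul_one_fun hn]
    have : (p : ℝ) + 1 = d * ((p + 1) / d : ℕ) := by exact_mod_cast hm.symm
    rw [this, mul_comm (d : ℝ), div_mul_div_comm, mul_one]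
  rw [h5]
  refine mul_le_mul_of_nonneg_right (h2.trans ?_) (by positivity)
  calc _ ≤ C * (3 ^ 6 * (1 + w) ^ 6) * exp (6 + C₁) := by
        refine mul_le_mul (mul_le_mul_of_nonneg_left h3 hC.le) (exp_le_exp.2 (by linarith))
          (exp_pos _).le (by positivity)
    _ = _ := by ring

/-- Summing `sum_shifted_dvd_le` over a set of divisors. -/
lemma sum_shifted_divisors_le : ∃ C : ℝ, 0 < C ∧ ∀ (w : ℝ) (A D : Finset ℕ), 1 ≤ w → (∀ d ∈ D, 1 ≤ d) →
    (∀ p ∈ A, p.Prime ∧ w ≤ iterLog p ∧ iterLog p ≤ w + 1) →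
    ∑ p ∈ A, (#(D.filter fun d => d ∣ p + 1 ∧ d * d ≤ p + 1) : ℝ) * (1 / ((p : ℝ) + 1)) ≤
      C * (1 + w) ^ 6 * ∑ d ∈ D, 1 / (d : ℝ) := by
  obtain ⟨C, hC, h⟩ := sum_shifted_dvd_le
  refine ⟨C, hC, fun w A D hw hD hA => ?_⟩
  have h1 : ∑ p ∈ A, (#(D.filter fun d => d ∣ p + 1 ∧ d * d ≤ p + 1) : ℝ) * (1 / ((p : ℝ) + 1)) =
      ∑ d ∈ D, ∑ p ∈ A.filter (fun p => d ∣ p + 1 ∧ d * d ≤ p + 1), 1 / ((p : ℝ) + 1) := by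
    simp only [sum_filter]
    rw [sum_comm]
    refine sum_congr rfl fun p _ => ?_
    rw [← sum_filter, sum_const, nsmul_eq_mul]
  rw [h1, mul_sum]
  refine sum_le_sum fun d hd => h w d _ hw (hD d hd) fun p hp => ?_
  obtain ⟨hp1, hp2⟩ := mem_filter.1 hp
  exact ⟨(hA p hp1).1, (hA p hp1).2.1, (hA p hp1).2.2, hp2.1, hp2.2⟩

/-- Primes `p` for which `p + 1` has many distinct prime factors in a set `I` of small primes. -/
lemma sum_shifted_card_le : ∃ C : ℝ, 0 < C ∧ ∀ (w y : ℝ) (j K : ℕ) (A I : Finset ℕ), 1 ≤ w → 1 ≤ K →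
    1 ≤ y → (∀ r ∈ I, r.Prime ∧ (r : ℝ) ≤ y) → y ^ (2 * j) ≤ scale w →
    (∀ p ∈ A, p.Prime ∧ w ≤ iterLog p ∧ iterLog p ≤ w + 1 ∧
      j + K ≤ #(I.filter fun r => r ∣ p + 1)) →
    ∑ p ∈ A, 1 / ((p : ℝ) + 1) ≤ C * (1 + w) ^ 6 * ((∑ r ∈ I, 1 / (r : ℝ)) / K) ^ j := by
  obtain ⟨C, hC, h⟩ := sum_shifted_divisors_le
  refine ⟨C, hC, fun w y j K A I hw hK hy hI hyj hA => ?_⟩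
  set D := (I.powersetCard j).image fun S => ∏ r ∈ S, r with hDdef
  have hinj : Set.InjOn (fun S : Finset ℕ => ∏ r ∈ S, r) (I.powersetCard j) := by
    intro S hS S' hS' hSS
    have hp : ∀ T ∈ I.powersetCard j, ∀ r ∈ T, r.Prime := fun T hT r hr =>
      (hI r ((mem_powersetCard.1 hT).1 hr)).1
    have h1 : ∀ T ∈ I.powersetCard j, (∏ r ∈ T, r).primeFactors = T := fun T hT =>
      Nat.primeFactors_prod (hp T hT)
    rw [← h1 S hS, ← h1 S' hS']
    exact congrArg _ hSS
  have hDsum : ∑ d ∈ D, 1 / (d : ℝ) = esum I (fun r => 1 / (r : ℝ)) j := by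
    rw [hDdef, sum_image hinj, esum]
    refine sum_congr rfl fun S _ => ?_
    push_cast
    rw [one_div, ← prod_inv_distrib]; simp [one_div]
  have h1 := h w A D hw (by
    intro d hd
    obtain ⟨S, hS, rfl⟩ := mem_image.1 hd
    exact Finset.prod_pos fun r hr => (hI r ((mem_powersetCard.1 hS).1 hr)).1.pos) fun p hp =>
      ⟨(hA p hp).1, (hA p hp).2.1, (hA p hp).2.2.1⟩
  rw [hDsum] at h1
  have hK0 : (0 : ℝ) < K := by exact_mod_cast hK
  have hf0 : (0 : ℝ) < j.factorial := by exact_mod_cast j.factorial_pos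
  have hcard : ∀ p ∈ A, (K : ℝ) ^ j / j.factorial ≤
      #(D.filter fun d => d ∣ p + 1 ∧ d * d ≤ p + 1) := by
    intro p hp
    obtain ⟨hp1, hp2, hp3, hp4⟩ := hA p hp
    have h2 : (((I.filter fun r => r ∣ p + 1).powersetCard j).image fun S => ∏ r ∈ S, r) ⊆
        D.filter fun d => d ∣ p + 1 ∧ d * d ≤ p + 1 := by
      intro d hd
      obtain ⟨S, hS, rfl⟩ := mem_image.1 hd
      obtain ⟨hS1, hS2⟩ := mem_powersetCard.1 hS
      refine mem_filter.2 ⟨mem_image.2 ⟨S, mem_powersetCard.2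
        ⟨hS1.trans (filter_subset _ _), hS2⟩, rfl⟩, ?_, ?_⟩
      · exact Finset.prod_primes_dvd _ (fun r hr => (hI r (mem_filter.1 (hS1 hr)).1).1.prime)
          fun r hr => (mem_filter.1 (hS1 hr)).2
      · have h3 : ((∏ r ∈ S, r : ℕ) : ℝ) ≤ y ^ j := by
          push_cast
          rw [← hS2, ← prod_const]
          exact prod_le_prod (fun r _ => Nat.cast_nonneg r) fun r hr =>
            (hI r (mem_filter.1 (hS1 hr)).1).2
        have h4 : scale w ≤ p :=
          (scale_le_iff (by exact_mod_cast hp1.one_lt.le)).2 hp2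
        have h5 : ((∏ r ∈ S, r : ℕ) : ℝ) * ((∏ r ∈ S, r : ℕ) : ℝ) ≤ y ^ (2 * j) := by
          rw [two_mul, pow_add]
          exact mul_le_mul h3 h3 (Nat.cast_nonneg _) (by positivity)
        have h6 : (((∏ r ∈ S, r) * (∏ r ∈ S, r) : ℕ) : ℝ) ≤ ((p + 1 : ℕ) : ℝ) := by
          push_cast at h5 ⊢; linarith
        exact_mod_cast h6
    have h3 := card_le_card h2
    rw [card_image_of_injOn (hinj.mono (by
      intro S hS
      exact mem_coe.2 (powersetCard_mono (filter_subset _ _) (mem_coe.1 hS)))), card_powersetCard] at h3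
    have h4 : K ^ j ≤ (#(I.filter fun r => r ∣ p + 1)).choose j * j.factorial := by
      rw [mul_comm, ← Nat.descFactorial_eq_factorial_mul_choose]
      refine le_trans (Nat.pow_le_pow_left ?_ j) (Nat.pow_sub_le_descFactorial _ j)
      omega
    rw [div_le_iff₀ hf0]
    have h5 : K ^ j ≤ #(D.filter fun d => d ∣ p + 1 ∧ d * d ≤ p + 1) * j.factorial :=
      h4.trans (Nat.mul_le_mul_right _ h3)
    exact_mod_cast h5
  have h2 : (K : ℝ) ^ j / j.factorial * ∑ p ∈ A, 1 / ((p : ℝ) + 1) ≤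
      C * (1 + w) ^ 6 * ((∑ r ∈ I, 1 / (r : ℝ)) ^ j / j.factorial) := by
    rw [mul_sum]
    refine le_trans (sum_le_sum fun p hp => mul_le_mul_of_nonneg_right (hcard p hp)
      (by positivity)) (h1.trans ?_)
    exact mul_le_mul_of_nonneg_left (esum_le_pow_div_factorial (fun r => by positivity) j)
      (by positivity)
  rw [div_pow]
  have hKj : (0 : ℝ) < (K : ℝ) ^ j := by positivity
  have h3 : (K : ℝ) ^ j * ∑ p ∈ A, 1 / ((p : ℝ) + 1) ≤
      C * (1 + w) ^ 6 * (∑ r ∈ I, 1 / (r : ℝ)) ^ j := by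
    have := mul_le_mul_of_nonneg_right h2 hf0.le
    calc _ = (K : ℝ) ^ j / j.factorial * (∑ p ∈ A, 1 / ((p : ℝ) + 1)) * j.factorial := by
          field_simp
      _ ≤ _ := this
      _ = _ := by field_simp
  rw [← mul_div_assoc, le_div_iff₀ hKj, mul_comm]
  exact h3

/-- The number of prime factors of `n` in `I`, counted with multiplicity. -/
def omegaFin (I : Finset ℕ) (n : ℕ) : ℕ := (n.primeFactorsList.filter (· ∈ I)).length

lemma exists_dvd_of_two_mul_le_omegaFin {I : Finset ℕ} {n j : ℕ} (hn : n ≠ 0)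
    (h : 2 * j ≤ omegaFin I n) : ∃ d, d ∣ n ∧ d * d ≤ n ∧ d ≠ 0 ∧ (∀ p, p.Prime → p ∣ d → p ∈ I) ∧
      ∀ x : ℝ, cmul (fun _ => x) d = x ^ j := by
  set l := n.primeFactorsList.filter (· ∈ I) with hl
  have hlen : 2 * j ≤ l.length := h
  have hlp : ∀ p ∈ l, p.Prime ∧ p ∈ I := fun p hp => by
    rw [hl, List.mem_filter] at hp
    exact ⟨Nat.prime_of_mem_primeFactorsList hp.1, by simpa using hp.2⟩
  have key : ∀ l' : List ℕ, l'.Sublist l → l'.length = j → l'.prod ≠ 0 ∧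
      (∀ p, p.Prime → p ∣ l'.prod → p ∈ I) ∧ ∀ x : ℝ, cmul (fun _ => x) l'.prod = x ^ j := by
    intro l' hl' hj
    have h1 : ∀ p ∈ l', p.Prime := fun p hp => (hlp p (hl'.subset hp)).1
    refine ⟨?_, fun p hp hpd => ?_, fun x => ?_⟩
    · rw [Ne, List.prod_eq_zero_iff]
      exact fun h0 => (h1 0 h0).ne_zero rfl
    · obtain ⟨q, hq, hpq⟩ := (Prime.dvd_prod_iff hp.prime).1 hpd
      rw [(Nat.prime_dvd_prime_iff_eq hp (h1 q hq)).1 hpq]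
      exact (hlp q (hl'.subset hq)).2
    · rw [cmul_list_prod _ h1]; simp [hj]
  have hprod : (l.take j).prod * ((l.drop j).take j).prod ∣ n := by
    have h1 : (l.take j).prod * (l.drop j).prod = l.prod := by
      rw [← List.prod_append, List.take_append_drop]
    have h2 : ((l.drop j).take j).prod ∣ (l.drop j).prod := (List.take_sublist _ _).prod_dvd_prod
    have h3 : l.prod ∣ n := by
      conv_rhs => rw [← Nat.prod_primeFactorsList hn]
      exact List.filter_sublist.prod_dvd_prod
    exact (mul_dvd_mul_left _ h2).trans (h1 ▸ h3)
  have hk1 := key _ (List.take_sublist j l) (by rw [List.length_take]; omega)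
  have hk2 := key _ ((List.take_sublist j (l.drop j)).trans (List.drop_sublist j l))
    (by rw [List.length_take, List.length_drop]; omega)
  have hle := Nat.le_of_dvd (Nat.pos_of_ne_zero hn) hprod
  rcases le_total (l.take j).prod ((l.drop j).take j).prod with hc | hc
  · exact ⟨_, (dvd_mul_right _ _).trans hprod, (Nat.mul_le_mul_left _ hc).trans hle, hk1⟩
  · exact ⟨_, (dvd_mul_left _ _).trans hprod, (Nat.mul_le_mul_right _ hc).trans hle, hk2⟩

/-- Primes `p` for which `p + 1` has exceptionally many prime factors in a set `I`. -/
lemma sum_shifted_omegaFin_le : ∃ C : ℝ, 0 < C ∧ ∀ (w : ℝ) (j : ℕ) (A I : Finset ℕ), 1 ≤ w →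
    (∀ r ∈ I, r.Prime) →
    (∀ p ∈ A, p.Prime ∧ w ≤ iterLog p ∧ iterLog p ≤ w + 1 ∧ 2 * j ≤ omegaFin I (p + 1)) →
    ∑ p ∈ A, 1 / ((p : ℝ) + 1) ≤
      C * (1 + w) ^ 6 * ((2 / 3) ^ j * exp (3 / 2 * ∑ r ∈ I, 1 / (r : ℝ))) := by
  obtain ⟨C, hC, h⟩ := sum_shifted_divisors_le
  obtain ⟨C₁, hC₁, hE⟩ := euler_sum (3 / 2)
  refine ⟨C * C₁, by positivity, fun w j A I hw hI hA => ?_⟩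
  have hex : ∀ p : ℕ, ∃ d : ℕ, p ∈ A → d ∣ p + 1 ∧ d * d ≤ p + 1 ∧ d ≠ 0 ∧
      (∀ r, r.Prime → r ∣ d → r ∈ I) ∧ ∀ x : ℝ, cmul (fun _ => x) d = x ^ j := fun p => by
    by_cases hp : p ∈ A
    · obtain ⟨d, hd⟩ := exists_dvd_of_two_mul_le_omegaFin (Nat.succ_ne_zero p) (hA p hp).2.2.2
      exact ⟨d, fun _ => hd⟩
    · exact ⟨0, fun h => absurd h hp⟩
  choose δ hδ using hex
  set D := A.image δ
  have hD : ∀ d ∈ D, d ≠ 0 ∧ (∀ r, r.Prime → r ∣ d → r ∈ I) ∧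
      ∀ x : ℝ, cmul (fun _ => x) d = x ^ j := fun d hd => by
    obtain ⟨p, hp, rfl⟩ := mem_image.1 hd
    exact (hδ p hp).2.2
  have h1 := h w A D hw (fun d hd => Nat.one_le_iff_ne_zero.2 (hD d hd).1)
    fun p hp => ⟨(hA p hp).1, (hA p hp).2.1, (hA p hp).2.2.1⟩
  have h2 : ∑ p ∈ A, 1 / ((p : ℝ) + 1) ≤
      ∑ p ∈ A, (#(D.filter fun d => d ∣ p + 1 ∧ d * d ≤ p + 1) : ℝ) * (1 / ((p : ℝ) + 1)) := by
    refine sum_le_sum fun p hp => le_mul_of_one_le_left (by positivity) ?_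
    have : 0 < #(D.filter fun d => d ∣ p + 1 ∧ d * d ≤ p + 1) := card_pos.2
      ⟨δ p, mem_filter.2 ⟨mem_image_of_mem _ hp, (hδ p hp).1, (hδ p hp).2.1⟩⟩
    exact_mod_cast this
  have h3 := hE (fun _ => 3 / 2) (fun _ => by norm_num) (fun _ => le_rfl) (fun p hp => by
    have : (2 : ℝ) ≤ p := by exact_mod_cast hp.two_le
    linarith) I D hI fun d hd => ⟨(hD d hd).1, (hD d hd).2.1⟩
  have h4 : ∑ d ∈ D, 1 / (d : ℝ) = (2 / 3) ^ j * ∑ d ∈ D, cmul (fun _ => 3 / 2) d / d := by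
    rw [mul_sum]
    refine sum_congr rfl fun d hd => ?_
    rw [(hD d hd).2.2, ← mul_div_assoc, ← mul_pow]
    norm_num
  have h5 : ∑ r ∈ I, (3 / 2 : ℝ) / r = 3 / 2 * ∑ r ∈ I, 1 / (r : ℝ) := by
    rw [mul_sum]; exact sum_congr rfl fun r _ => by ring
  rw [h5] at h3
  calc _ ≤ _ := h2.trans h1
    _ ≤ C * (1 + w) ^ 6 * ((2 / 3) ^ j * (C₁ * exp (3 / 2 * ∑ r ∈ I, 1 / (r : ℝ)))) := by
        rw [h4]; gcongr
    _ = _ := by ring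

/-- Numbers divisible by the square of a large integer are rare. -/
lemma sum_inv_dvd_sq_le {R X : ℕ} (hR : 1 ≤ R) {A : Finset ℕ}
    (hA : ∀ n ∈ A, n ≠ 0 ∧ n ≤ X ∧ ∃ r, R < r ∧ r ^ 2 ∣ n) :
    ∑ n ∈ A, 1 / (n : ℝ) ≤ 2 / R * (1 + log X) := by
  have hex : ∀ n : ℕ, ∃ r : ℕ, n ∈ A → R < r ∧ r ^ 2 ∣ n := fun n => by
    by_cases hn : n ∈ A
    · obtain ⟨r, hr⟩ := (hA n hn).2.2
      exact ⟨r, fun _ => hr⟩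
    · exact ⟨0, fun h => absurd h hn⟩
  choose ρ hρ using hex
  have hmul : ∀ n ∈ A, ρ n ^ 2 * (n / ρ n ^ 2) = n := fun n hn => Nat.mul_div_cancel' (hρ n hn).2
  have hinj : Set.InjOn (fun n => (ρ n, n / ρ n ^ 2)) A := by
    intro a ha b hb hab
    simp only [Prod.mk.injEq] at hab
    rw [← hmul a ha, ← hmul b hb, hab.2, hab.1]
  have hmain : ∑ n ∈ A, 1 / (n : ℝ) ≤
      (∑ r ∈ Ioo R (X + 1), ((r : ℝ) ^ 2)⁻¹) * ∑ m ∈ Icc 1 X, 1 / (m : ℝ) := by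
    rw [sum_mul_sum, ← sum_product']
    calc ∑ n ∈ A, 1 / (n : ℝ) = ∑ n ∈ A, ((ρ n : ℝ) ^ 2)⁻¹ * (1 / (n / ρ n ^ 2 : ℕ)) := by
          refine sum_congr rfl fun n hn => ?_
          have h1 : (n : ℝ) = (ρ n : ℝ) ^ 2 * (n / ρ n ^ 2 : ℕ) := by exact_mod_cast (hmul n hn).symm
          conv_lhs => rw [h1]
          rw [one_div, one_div, mul_inv]
      _ = ∑ x ∈ A.image (fun n => (ρ n, n / ρ n ^ 2)), ((x.1 : ℝ) ^ 2)⁻¹ * (1 / (x.2 : ℝ)) := by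
          rw [sum_image hinj]
      _ ≤ _ := by
          refine sum_le_sum_of_subset_of_nonneg ?_ fun _ _ _ => by positivity
          intro x hx
          obtain ⟨n, hn, rfl⟩ := mem_image.1 hx
          obtain ⟨h0, hX, -⟩ := hA n hn
          obtain ⟨h1, h2⟩ := hρ n hn
          have h3 : ρ n ^ 2 ≤ n := Nat.le_of_dvd (Nat.pos_of_ne_zero h0) h2
          have h4 : ρ n ≤ ρ n ^ 2 := Nat.le_self_pow two_ne_zero _
          refine mem_product.2 ⟨mem_Ioo.2 ⟨h1, by simp only; omega⟩, mem_Icc.2 ⟨?_, ?_⟩⟩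
          · exact Nat.div_pos h3 (pow_pos (by omega) 2)
          · exact (Nat.div_le_self _ _).trans hX
  have h1 : ∑ r ∈ Ioo R (X + 1), ((r : ℝ) ^ 2)⁻¹ ≤ 2 / R := by
    refine (sum_Ioo_inv_sq_le (α := ℝ) R (X + 1)).trans ?_
    have : (0 : ℝ) < R := by exact_mod_cast hR
    gcongr; linarith
  have h2 : ∑ m ∈ Icc 1 X, 1 / (m : ℝ) ≤ 1 + log X := by
    have := harmonic_le_one_add_log X
    rw [harmonic_eq_sum_Icc] at this
    push_cast at this
    simpa [one_div] using this
  exact hmain.trans (mul_le_mul h1 h2 (sum_nonneg fun m _ => by positivity) (by positivity))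

lemma omegaFin_eq_sum (I : Finset ℕ) (n : ℕ) : omegaFin I n = ∑ r ∈ I, n.primeFactorsList.count r := by
  rw [omegaFin]
  induction n.primeFactorsList with
  | nil => simp
  | cons a l ih =>
    simp only [List.count_cons, sum_add_distrib, List.filter_cons]
    rw [← ih]
    by_cases ha : a ∈ I <;> simp [ha]

lemma omegaFin_mono {I J : Finset ℕ} (h : I ⊆ J) (n : ℕ) : omegaFin I n ≤ omegaFin J n := by
  rw [omegaFin_eq_sum, omegaFin_eq_sum]
  exact sum_le_sum_of_subset h

lemma omegaFin_union_le (I J : Finset ℕ) (n : ℕ) :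
    omegaFin (I ∪ J) n ≤ omegaFin I n + omegaFin J n := by
  simp only [omegaFin_eq_sum]
  rw [← sum_union_inter]
  exact Nat.le_add_right _ _

lemma omegaFin_le_add_card {I J : Finset ℕ} {n : ℕ} (hn : n ≠ 0) (hJ : ∀ r ∈ J, r.Prime)
    (h : ∀ r ∈ J, r ∉ I → ¬ r ^ 2 ∣ n) :
    omegaFin J n ≤ omegaFin I n + #(J.filter fun r => r ∣ n) := by
  have h1 : ∀ r ∈ J, n.primeFactorsList.count r ≤
      (if r ∈ I then n.primeFactorsList.count r else 0) + if r ∣ n then 1 else 0 := by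
    intro r hr
    by_cases hrI : r ∈ I
    · simp [hrI]
    · rw [if_neg hrI, zero_add, Nat.primeFactorsList_count_eq]
      have h2 : n.factorization r < 2 := by
        by_contra! h2
        exact h r hr hrI (((hJ r hr).pow_dvd_iff_le_factorization hn).2 h2)
      split_ifs with hd
      · omega
      · rw [Nat.factorization_eq_zero_of_not_dvd hd]
  rw [omegaFin_eq_sum, omegaFin_eq_sum]
  refine (sum_le_sum h1).trans ?_
  rw [sum_add_distrib, ← sum_filter, sum_boole]
  have h2 : ∑ r ∈ J.filter (· ∈ I), n.primeFactorsList.count r ≤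
      ∑ r ∈ I, n.primeFactorsList.count r :=
    sum_le_sum_of_subset fun r hr => (mem_filter.1 hr).2
  simpa using h2

/-- Primes `p` for which `p + 1` does not have too many prime factors at any scale. -/
def IsNormal (ε σ : ℝ) (p : ℕ) : Prop :=
  ∀ t : ℝ, 0 ≤ t → t ≤ σ → (omegaFin (primesUpTo (scale t)) (p + 1) : ℝ) ≤ (1 + ε) * t + √σ

lemma primesUpTo_scale_union (s t : ℝ) :
    primesUpTo (scale t) ⊆ primesUpTo (scale s) ∪ primesIoc s t := by
  intro p hp
  obtain ⟨h1, h2⟩ := mem_primesUpTo.1 hp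
  rcases le_or_gt (p : ℝ) (scale s) with h3 | h3
  · exact mem_union_left _ (mem_primesUpTo.2 ⟨h1, h3⟩)
  · exact mem_union_right _ (mem_primesIoc.2 ⟨h1, h3, h2⟩)

lemma isNormal_of_forall {ε η σ θ : ℝ} {p m j₂ j₃ j₄ R : ℕ} {K : ℕ → ℕ} (hε : 0 < ε)
    (hη : 0 < η) (hηε : η ≤ ε / 320) (hη4 : η ≤ 1 / 8) (hσ : (4 + 4 * ε) ^ 2 ≤ σ) (hσ8 : 8 ≤ σ)
    (hm1 : (m : ℝ) ≤ (1 - 2 * η) * σ) (hm2 : (1 - 2 * η) * σ < m + 1)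
    (hR : (R : ℝ) ≤ scale θ) (hj₂ : (j₂ : ℝ) ≤ √σ / 16) (hj₃ : (j₃ : ℝ) ≤ √σ / 8)
    (hj₄ : (j₄ : ℝ) ≤ 20 * η * σ) (hK : ∀ n, (K n : ℝ) ≤ (1 + ε / 2) * n + √σ / 8)
    (h1 : ¬ ∃ r, R < r ∧ r ^ 2 ∣ p + 1)
    (h2 : ∀ n ≤ m, #((primesUpTo (scale n)).filter fun r => r ∣ p + 1) < j₂ + K n)
    (h3 : omegaFin (primesUpTo (scale θ)) (p + 1) < 2 * j₃)
    (h4 : omegaFin (primesIoc m σ) (p + 1) < 2 * j₄) : IsNormal ε σ p := by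
  have hσ0 : 0 ≤ σ := by linarith
  have hs : 4 + 4 * ε ≤ √σ := (le_sqrt (by linarith) hσ0).2 hσ
  have key : ∀ n ≤ m, (omegaFin (primesUpTo (scale n)) (p + 1) : ℝ) ≤ (1 + ε / 2) * n + √σ / 2 := by
    intro n hn
    have h5 := omegaFin_le_add_card (I := primesUpTo (scale θ)) (J := primesUpTo (scale n))
      (Nat.succ_ne_zero p) (fun r hr => (mem_primesUpTo.1 hr).1) (fun r hr hrI hd => by
        refine h1 ⟨r, ?_, hd⟩
        rw [mem_primesUpTo, not_and, not_le] at hrI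
        have := hrI (mem_primesUpTo.1 hr).1
        exact_mod_cast hR.trans_lt this)
    have h6 := h2 n hn
    have h7 : (omegaFin (primesUpTo (scale n)) (p + 1) : ℝ) ≤ 2 * j₃ + (j₂ + K n) := by
      have : omegaFin (primesUpTo (scale n)) (p + 1) ≤ 2 * j₃ + (j₂ + K n) := by
        rw [Nat.succ_eq_add_one] at h5; omega
      exact_mod_cast this
    linarith [hK n]
  intro t ht0 htσ
  rcases le_or_gt t m with htm | htm
  · have h5 := key ⌈t⌉₊ (Nat.ceil_le.2 htm)
    have h6 := (Nat.ceil_lt_add_one ht0).le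
    have h7 : (omegaFin (primesUpTo (scale t)) (p + 1) : ℝ) ≤
        omegaFin (primesUpTo (scale (⌈t⌉₊ : ℝ))) (p + 1) := by
      exact_mod_cast omegaFin_mono (primesUpTo_mono (scale_le_scale.2 (Nat.le_ceil t))) _
    have h8 : (1 + ε / 2) * (⌈t⌉₊ : ℝ) ≤ (1 + ε / 2) * (t + 1) := by gcongr
    nlinarith
  · have h5 := key m le_rfl
    have hmσ : (m : ℝ) ≤ σ := by linarith
    have h6 : omegaFin (primesUpTo (scale t)) (p + 1) ≤
        omegaFin (primesUpTo (scale m)) (p + 1) + omegaFin (primesIoc m σ) (p + 1) :=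
      (omegaFin_mono ((primesUpTo_mono (scale_le_scale.2 htσ)).trans
        (primesUpTo_scale_union m σ)) _).trans (omegaFin_union_le _ _ _)
    have h7 : (omegaFin (primesUpTo (scale t)) (p + 1) : ℝ) ≤
        omegaFin (primesUpTo (scale m)) (p + 1) + 2 * j₄ := by
      have : omegaFin (primesUpTo (scale t)) (p + 1) ≤
        omegaFin (primesUpTo (scale m)) (p + 1) + 2 * j₄ := by omega
      exact_mod_cast this
    have h8 : σ ≤ 4 * t := by nlinarith
    have h9 : 40 * η * σ ≤ ε / 2 * t := by nlinarith
    have h10 : (1 + ε / 2) * (m : ℝ) ≤ (1 + ε / 2) * t := by gcongr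
    have := sqrt_nonneg σ
    linarith

lemma eventually_poly_mul_exp_neg_sqrt_le (K : ℝ) (n : ℕ) {c δ : ℝ} (hc : 0 < c) (hδ : 0 < δ) :
    ∀ᶠ σ : ℝ in atTop, K * (1 + σ) ^ n * exp (-(c * √σ)) ≤ δ := by
  obtain ⟨C, hC, h⟩ := pow_le_mul_exp (2 * n) (half_pos hc)
  have h1 : Tendsto (fun σ : ℝ => |K| * C * exp (-(c / 2 * √σ))) atTop (nhds 0) := by
    rw [← mul_zero (|K| * C)]
    refine Tendsto.const_mul _ (tendsto_exp_neg_atTop_nhds_zero.comp ?_)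
    exact tendsto_sqrt_atTop.const_mul_atTop (half_pos hc)
  filter_upwards [h1.eventually_le_const hδ, eventually_ge_atTop 0] with σ h2 h3
  refine le_trans ?_ h2
  have h4 : (1 + σ) ^ n ≤ C * exp (c / 2 * √σ) := by
    refine le_trans ?_ (h (√σ) (sqrt_nonneg σ))
    rw [pow_mul]
    refine pow_le_pow_left₀ (by linarith) ?_ n
    nlinarith [sq_sqrt h3, sqrt_nonneg σ]
  calc K * (1 + σ) ^ n * exp (-(c * √σ)) ≤ |K| * (C * exp (c / 2 * √σ)) * exp (-(c * √σ)) := by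
        gcongr; exact le_abs_self K
    _ = |K| * C * (exp (c / 2 * √σ) * exp (-(c * √σ))) := by ring
    _ = |K| * C * exp (-(c / 2 * √σ)) := by rw [← exp_add]; ring_nf

lemma sum_primes_le_of_windows {A : Finset ℕ} {g : ℕ → ℝ} {a σ B : ℝ} (hσ : 0 ≤ σ) (hB : 0 ≤ B)
    (hA : ∀ p ∈ A, p.Prime ∧ a ≤ iterLog p ∧ iterLog p ≤ σ)
    (h : ∀ k : ℕ, a - 1 ≤ k → (k : ℝ) ≤ σ + 1 → ∀ A' ⊆ A,
      (∀ p ∈ A', p.Prime ∧ (k : ℝ) ≤ iterLog p ∧ iterLog p ≤ k + 1) → ∑ p ∈ A', g p ≤ B) :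
    ∑ p ∈ A, g p ≤ (2 + σ) * B := by
  have h1 := sum_primes_le_sum_windows (A := A) (g := g) (B := fun _ => B) (n := ⌈σ⌉₊)
    (fun p hp => ⟨(hA p hp).1, (hA p hp).2.2.trans (Nat.le_ceil σ)⟩) (by
      intro k hk A' hA' hw
      rcases A'.eq_empty_or_nonempty with rfl | ⟨p, hp⟩
      · simpa using hB
      · have h2 := (hA p (hA' hp)).2.1
        have h3 := (hw p hp).2.2
        have h4 : (k : ℝ) ≤ ⌈σ⌉₊ := by exact_mod_cast hk
        exact h k (by linarith) (by linarith [Nat.ceil_lt_add_one hσ]) A' hA' hw)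
  refine h1.trans ?_
  rw [sum_const, card_range, nsmul_eq_mul]
  push_cast
  exact mul_le_mul_of_nonneg_right (by linarith [Nat.ceil_lt_add_one hσ]) hB

lemma eventually_sum_dvd_sq_le {δ : ℝ} (hδ : 0 < δ) : ∀ᶠ σ : ℝ in atTop, ∀ A : Finset ℕ,
    (∀ p ∈ A, p.Prime ∧ iterLog p ≤ σ ∧ ∃ r, ⌊exp (3 * σ)⌋₊ < r ∧ r ^ 2 ∣ p + 1) →
    ∑ p ∈ A, 1 / ((p : ℝ) + 1) ≤ δ := by
  have h1 := tendsto_exp_neg_atTop_nhds_zero.const_mul (4 * exp 1)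
  rw [mul_zero] at h1
  filter_upwards [eventually_ge_atTop 1, h1.eventually_le_const hδ] with σ hσ h2 A hA
  have h0 : ∑ p ∈ A, 1 / ((p : ℝ) + 1) = ∑ n ∈ A.image Nat.succ, 1 / (n : ℝ) := by
    rw [sum_image fun _ _ _ _ h => Nat.succ_injective h]; push_cast; rfl
  have hR : exp (2 * σ) ≤ (⌊exp (3 * σ)⌋₊ : ℝ) := by
    have h3 := (Nat.lt_floor_add_one (exp (3 * σ))).le
    have h4 : exp (3 * σ) = exp σ * exp (2 * σ) := by rw [← exp_add]; ring_nf
    nlinarith [add_one_le_exp σ, add_one_le_exp (2 * σ)]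
  have hR1 : 1 ≤ ⌊exp (3 * σ)⌋₊ := by
    have h4 : (1 : ℝ) ≤ (⌊exp (3 * σ)⌋₊ : ℝ) := (one_le_exp (by linarith)).trans hR
    exact_mod_cast h4
  rw [h0]
  refine (sum_inv_dvd_sq_le (X := ⌊scale (σ + 1)⌋₊) hR1 fun n hn => ?_).trans ?_
  · obtain ⟨p, hp, rfl⟩ := mem_image.1 hn
    obtain ⟨hp1, hp2, hp3⟩ := hA p hp
    exact ⟨Nat.succ_ne_zero p, Nat.le_floor (prime_dvd_succ hp1 hp2 (by linarith) dvd_rfl), hp3⟩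
  · refine le_trans ?_ h2
    have h3 : 1 + log (⌊scale (σ + 1)⌋₊ : ℝ) ≤ exp (σ + 1) := by
      have h4 : log (⌊scale (σ + 1)⌋₊ : ℝ) ≤ log (scale (σ + 1)) :=
        log_le_log (by
          have : 0 < ⌊scale (σ + 1)⌋₊ := Nat.floor_pos.2 (one_le_scale (by linarith))
          exact_mod_cast this) (Nat.floor_le (scale_pos _).le)
      rw [log_scale] at h4; linarith
    have h5 := exp_pos (2 * σ)
    calc 2 / (⌊exp (3 * σ)⌋₊ : ℝ) * (1 + log (⌊scale (σ + 1)⌋₊ : ℝ)) ≤ 2 / exp (2 * σ) * exp (σ + 1) := by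
          gcongr
      _ = 2 * (exp 1 * exp (-σ)) := by
          rw [← exp_add, div_mul_eq_mul_div, mul_div_assoc, ← exp_sub]; ring_nf
      _ ≤ 4 * exp 1 * exp (-σ) := by
          have := mul_pos (exp_pos 1) (exp_pos (-σ)); linarith

lemma two_thirds_pow_le {j : ℕ} {x : ℝ} (h : x < j + 1) : (2 / 3 : ℝ) ^ j ≤ exp (1 / 3 - x / 3) := by
  have h1 : (2 / 3 : ℝ) ≤ exp (-(1 / 3)) := by linarith [add_one_le_exp (-(1 / 3) : ℝ)]
  refine (pow_le_pow_left₀ (by norm_num) h1 j).trans ?_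
  rw [← exp_nat_mul]
  exact exp_le_exp.2 (by linarith)

lemma eventually_sum_omegaFin_small_le {δ : ℝ} (hδ : 0 < δ) : ∀ᶠ σ : ℝ in atTop, ∀ A : Finset ℕ,
    (∀ p ∈ A, p.Prime ∧ σ / 2 ≤ iterLog p ∧ iterLog p ≤ σ ∧
      2 * ⌊√σ / 8⌋₊ ≤ omegaFin (primesUpTo (exp (3 * σ))) (p + 1)) →
    ∑ p ∈ A, 1 / ((p : ℝ) + 1) ≤ δ := by
  obtain ⟨C, hC, h⟩ := sum_shifted_omegaFin_le
  obtain ⟨C₁, hC₁, hM, -⟩ := exists_abs_sum_primesIoc_le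
  have h1 := eventually_poly_mul_exp_neg_sqrt_le (C * 2 ^ 7 * 3 ^ 2 * exp (1 / 3 + 3 / 2 * C₁)) 9
    (show (0 : ℝ) < 1 / 24 by norm_num) hδ
  filter_upwards [eventually_ge_atTop 4, h1] with σ hσ h2 A hA
  have hσ0 : 0 ≤ σ := by linarith
  refine le_trans ?_ h2
  have hE : exp (3 / 2 * ∑ r ∈ primesUpTo (exp (3 * σ)), 1 / (r : ℝ)) ≤
      exp (3 / 2 * C₁) * (3 ^ 2 * (1 + σ) ^ 2) := by
    have h3 : (1 : ℝ) ≤ 3 * σ + 1 := by linarith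
    have h4 := (abs_le.1 (hM (log (3 * σ + 1)) (log_nonneg h3))).2
    rw [primeRecipSum, scale, exp_log (by linarith), add_sub_cancel_right] at h4
    have h5 : exp (2 * log (3 * σ + 1)) = (3 * σ + 1) ^ 2 := by
      rw [mul_comm, exp_mul, exp_log (by linarith)]; norm_cast
    calc _ ≤ exp (3 / 2 * C₁ + 2 * log (3 * σ + 1)) :=
          exp_le_exp.2 (by linarith [log_nonneg h3])
      _ = exp (3 / 2 * C₁) * (3 * σ + 1) ^ 2 := by rw [exp_add, h5]
      _ ≤ _ := by rw [← mul_pow]; gcongr; linarith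
  have hj := two_thirds_pow_le (Nat.lt_floor_add_one (√σ / 8))
  refine (sum_primes_le_of_windows (a := σ / 2) (σ := σ)
    (B := C * (2 + σ) ^ 6 * (exp (1 / 3 - √σ / 8 / 3) * (exp (3 / 2 * C₁) * (3 ^ 2 * (1 + σ) ^ 2))))
    hσ0 (by positivity) (fun p hp => ⟨(hA p hp).1, (hA p hp).2.1, (hA p hp).2.2.1⟩) ?_).trans ?_
  · intro k hk1 hk2 A' hA' hw
    refine (h k ⌊√σ / 8⌋₊ A' (primesUpTo (exp (3 * σ))) (by linarith)
      (fun r hr => (mem_primesUpTo.1 hr).1)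
      fun p hp => ⟨(hw p hp).1, (hw p hp).2.1, (hw p hp).2.2, (hA p (hA' hp)).2.2.2⟩).trans ?_
    have h3 : (1 + (k : ℝ)) ^ 6 ≤ (2 + σ) ^ 6 := pow_le_pow_left₀ (by positivity) (by linarith) 6
    gcongr
  · have h3 : (2 + σ) ^ 7 ≤ 2 ^ 7 * (1 + σ) ^ 7 := by
      rw [← mul_pow]; exact pow_le_pow_left₀ (by linarith) (by linarith) 7
    calc _ = (2 + σ) ^ 7 * (C * (exp (1 / 3 - √σ / 8 / 3) * exp (3 / 2 * C₁)) * 3 ^ 2 * (1 + σ) ^ 2) := by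
          ring
      _ ≤ 2 ^ 7 * (1 + σ) ^ 7 * (C * (exp (1 / 3 - √σ / 8 / 3) * exp (3 / 2 * C₁)) * 3 ^ 2 * (1 + σ) ^ 2) := by
          gcongr
      _ = C * 2 ^ 7 * 3 ^ 2 * (1 + σ) ^ 9 * (exp (1 / 3 - √σ / 8 / 3) * exp (3 / 2 * C₁)) := by ring
      _ = C * 2 ^ 7 * 3 ^ 2 * (1 + σ) ^ 9 * (exp (1 / 3 + 3 / 2 * C₁) * exp (-(1 / 24 * √σ))) := by
          rw [← exp_add, ← exp_add]; ring_nf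
      _ = _ := by ring

lemma eventually_sum_omegaFin_large_le {δ η : ℝ} (hδ : 0 < δ) (hη : 0 < η) (hη1 : η ≤ 1 / 8) :
    ∀ᶠ σ : ℝ in atTop, ∀ (m : ℕ) (A : Finset ℕ), (m : ℝ) ≤ σ → (1 - 2 * η) * σ < m + 1 →
    (∀ p ∈ A, p.Prime ∧ σ / 2 ≤ iterLog p ∧ iterLog p ≤ σ ∧
      2 * ⌊20 * η * σ⌋₊ ≤ omegaFin (primesIoc m σ) (p + 1)) →
    ∑ p ∈ A, 1 / ((p : ℝ) + 1) ≤ δ := by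
  obtain ⟨C, hC, h⟩ := sum_shifted_omegaFin_le
  obtain ⟨C₁, hC₁, -, hM⟩ := exists_abs_sum_primesIoc_le
  have h1 := eventually_poly_mul_exp_neg_sqrt_le (C * 2 ^ 7 * exp (2 + 3 / 2 * C₁)) 7 hη hδ
  filter_upwards [eventually_ge_atTop 4, h1] with σ hσ h2 m A hm1 hm2 hA
  have hσ0 : 0 ≤ σ := by linarith
  refine le_trans ?_ h2
  have hs : √σ ≤ σ := sqrt_le_iff.2 ⟨hσ0, by nlinarith⟩
  have hs' : η * √σ ≤ η * σ := by gcongr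
  have hησ : 0 ≤ η * σ := by positivity
  have h4 := (abs_le.1 (hM m σ (Nat.cast_nonneg m) hm1)).2
  have hj := two_thirds_pow_le (Nat.lt_floor_add_one (20 * η * σ))
  have hE : (2 / 3 : ℝ) ^ ⌊20 * η * σ⌋₊ * exp (3 / 2 * ∑ r ∈ primesIoc m σ, 1 / (r : ℝ)) ≤
      exp (2 + 3 / 2 * C₁) * exp (-(η * √σ)) := by
    calc _ ≤ exp (1 / 3 - 20 * η * σ / 3) * exp (3 / 2 * ∑ r ∈ primesIoc m σ, 1 / (r : ℝ)) := by gcongr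
      _ ≤ _ := by rw [← exp_add, ← exp_add]; exact exp_le_exp.2 (by linarith)
  refine (sum_primes_le_of_windows (a := σ / 2) (σ := σ)
    (B := C * (2 + σ) ^ 6 * (exp (2 + 3 / 2 * C₁) * exp (-(η * √σ))))
    hσ0 (by positivity) (fun p hp => ⟨(hA p hp).1, (hA p hp).2.1, (hA p hp).2.2.1⟩) ?_).trans ?_
  · intro k hk1 hk2 A' hA' hw
    refine (h k ⌊20 * η * σ⌋₊ A' (primesIoc m σ) (by linarith)
      (fun r hr => (mem_primesIoc.1 hr).1)
      fun p hp => ⟨(hw p hp).1, (hw p hp).2.1, (hw p hp).2.2, (hA p (hA' hp)).2.2.2⟩).trans ?_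
    have h3 : (1 + (k : ℝ)) ^ 6 ≤ (2 + σ) ^ 6 := pow_le_pow_left₀ (by positivity) (by linarith) 6
    gcongr
  · have h3 : (2 + σ) ^ 7 ≤ 2 ^ 7 * (1 + σ) ^ 7 := by
      rw [← mul_pow]; exact pow_le_pow_left₀ (by linarith) (by linarith) 7
    calc _ = (2 + σ) ^ 7 * (C * (exp (2 + 3 / 2 * C₁) * exp (-(η * √σ)))) := by ring
      _ ≤ 2 ^ 7 * (1 + σ) ^ 7 * (C * (exp (2 + 3 / 2 * C₁) * exp (-(η * √σ)))) := by gcongr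
      _ = _ := by ring

lemma eventually_sum_card_le {δ η ε : ℝ} (hδ : 0 < δ) (hη : 0 < η) (hη1 : η ≤ 1 / 8) (hε : 0 < ε) :
    ∀ᶠ σ : ℝ in atTop, ∀ (m : ℕ) (A : Finset ℕ), (m : ℝ) ≤ (1 - 2 * η) * σ →
    (∀ p ∈ A, p.Prime ∧ (1 - η) * σ ≤ iterLog p ∧ iterLog p ≤ σ ∧ ∃ n ≤ m,
      ⌊√σ / 16⌋₊ + ⌊(1 + ε / 2) * n + √σ / 8⌋₊ ≤ #((primesUpTo (scale n)).filter fun r => r ∣ p + 1)) →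
    ∑ p ∈ A, 1 / ((p : ℝ) + 1) ≤ δ := by
  obtain ⟨C, hC, h⟩ := sum_shifted_card_le
  obtain ⟨C₁, hC₁, hM, -⟩ := exists_abs_sum_primesIoc_le
  set c := log (1 + ε / 4) with hc
  have hc0 : 0 < c := log_pos (by linarith)
  have h1 := eventually_poly_mul_exp_neg_sqrt_le (C * 2 ^ 8 * exp c) 8
    (show (0 : ℝ) < c / 16 by positivity) hδ
  have h1' : ∀ᶠ σ : ℝ in atTop, 8 * (1 + (1 + ε / 4) * C₁) ≤ √σ :=
    tendsto_sqrt_atTop.eventually_ge_atTop _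
  have h1'' := eventually_poly_mul_exp_neg_sqrt_le 1 1 hη (exp_pos (-1))
  filter_upwards [eventually_ge_atTop 16, h1, h1', h1''] with σ hσ h2 h3 h4 m A hm hA
  have hσ0 : 0 ≤ σ := by linarith
  have hησ : 0 ≤ η * σ := by positivity
  have hs : √σ ≤ σ := sqrt_le_iff.2 ⟨hσ0, by nlinarith⟩
  have hs' : η * √σ ≤ η * σ := by gcongr
  have hj : (2 * ⌊√σ / 16⌋₊ + 1 : ℝ) ≤ exp (η * σ - 1) := by
    have h5 := Nat.floor_le (show 0 ≤ √σ / 16 by positivity)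
    have h6 : (1 + σ) * exp (-(η * √σ)) ≤ exp (-1) := by simpa using h4
    have h7 : 1 + σ ≤ exp (η * √σ - 1) := by
      have h8 := mul_le_mul_of_nonneg_right h6 (exp_pos (η * √σ)).le
      rw [mul_assoc, ← exp_add, ← exp_add, neg_add_cancel, exp_zero, mul_one] at h8
      rwa [sub_eq_neg_add]
    have h8 : exp (η * √σ - 1) ≤ exp (η * σ - 1) := exp_le_exp.2 (by linarith)
    linarith
  refine le_trans ?_ h2
  set B := (2 + σ) * (C * (2 + σ) ^ 6 * (exp c * exp (-(c / 16 * √σ)))) with hB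
  have hn : ∀ n ≤ m, ∑ p ∈ A.filter (fun p : ℕ => ⌊√σ / 16⌋₊ + ⌊(1 + ε / 2) * n + √σ / 8⌋₊ ≤
      #((primesUpTo (scale n)).filter fun r => r ∣ p + 1)), 1 / ((p : ℝ) + 1) ≤ B := by
    intro n hnm
    have hnσ : (n : ℝ) ≤ (1 - 2 * η) * σ := le_trans (by exact_mod_cast hnm) hm
    have hK : (1 + ε / 4) * (n + C₁) ≤ (⌊(1 + ε / 2) * n + √σ / 8⌋₊ : ℝ) := by
      have h5 := (Nat.lt_floor_add_one ((1 + ε / 2) * n + √σ / 8)).le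
      have h6 : 0 ≤ ε / 4 * n := by positivity
      linarith
    have hK0 : 0 < (⌊(1 + ε / 2) * n + √σ / 8⌋₊ : ℝ) := lt_of_lt_of_le (by positivity) hK
    have hrat : (∑ r ∈ primesUpTo (scale n), 1 / (r : ℝ)) / (⌊(1 + ε / 2) * n + √σ / 8⌋₊ : ℝ) ≤
        exp (-c) := by
      have h5 := (abs_le.1 (hM n (Nat.cast_nonneg n))).2
      rw [primeRecipSum] at h5
      rw [exp_neg, hc, exp_log (by linarith), div_le_iff₀ hK0]
      rw [← mul_le_mul_iff_right₀ (show 0 < 1 + ε / 4 by linarith), mul_inv_cancel_left₀ (by linarith)]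
      exact (mul_le_mul_of_nonneg_left (by linarith) (by linarith)).trans hK
    have hpow : ((∑ r ∈ primesUpTo (scale n), 1 / (r : ℝ)) /
        (⌊(1 + ε / 2) * n + √σ / 8⌋₊ : ℝ)) ^ ⌊√σ / 16⌋₊ ≤ exp c * exp (-(c / 16 * √σ)) := by
      refine (pow_le_pow_left₀ (div_nonneg (sum_nonneg fun _ _ => by positivity) hK0.le) hrat _).trans ?_
      rw [← exp_nat_mul, ← exp_add]
      have h5 := (Nat.lt_floor_add_one (√σ / 16)).le
      have h6 := mul_le_mul_of_nonneg_left h5 hc0.le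
      exact exp_le_exp.2 (by linarith)
    refine sum_primes_le_of_windows (a := (1 - η) * σ) (σ := σ) hσ0 (by positivity)
      (fun p hp => ?_) ?_
    · have := hA p (mem_filter.1 hp).1
      exact ⟨this.1, this.2.1, this.2.2.1⟩
    · intro k hk1 hk2 A' hA' hw
      have hησ8 : η * σ ≤ 1 / 8 * σ := by gcongr
      refine (h k (scale n) ⌊√σ / 16⌋₊ ⌊(1 + ε / 2) * n + √σ / 8⌋₊ A' (primesUpTo (scale n))
        (by linarith) (by exact_mod_cast hK0) (one_le_scale (Nat.cast_nonneg n))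
        (fun r hr => mem_primesUpTo.1 hr) ?_
        fun p hp => ⟨(hw p hp).1, (hw p hp).2.1, (hw p hp).2.2, (mem_filter.1 (hA' hp)).2⟩).trans ?_
      · rw [scale, scale, ← exp_nat_mul]
        refine exp_le_exp.2 ?_
        push_cast
        have h5 := one_le_exp (Nat.cast_nonneg (α := ℝ) n)
        have h6 : exp (η * σ - 1) * exp n ≤ exp k := by
          rw [← exp_add]; exact exp_le_exp.2 (by linarith)
        have h7 := mul_le_mul_of_nonneg_right hj (exp_pos (n : ℝ)).le
        have h8 : (0 : ℝ) ≤ ⌊√σ / 16⌋₊ := Nat.cast_nonneg _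
        linarith
      · have h3 : (1 + (k : ℝ)) ^ 6 ≤ (2 + σ) ^ 6 := pow_le_pow_left₀ (by positivity) (by linarith) 6
        gcongr
  have hsub : ∑ p ∈ A, 1 / ((p : ℝ) + 1) ≤ ∑ p ∈ (range (m + 1)).biUnion (fun n : ℕ =>
      A.filter (fun p : ℕ => ⌊√σ / 16⌋₊ + ⌊(1 + ε / 2) * n + √σ / 8⌋₊ ≤
      #((primesUpTo (scale n)).filter fun r => r ∣ p + 1))), 1 / ((p : ℝ) + 1) := by
    refine sum_le_sum_of_subset_of_nonneg ?_ fun _ _ _ => by positivity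
    intro p hp
    obtain ⟨n, hn1, hn2⟩ := (hA p hp).2.2.2
    exact mem_biUnion.2 ⟨n, mem_range.2 (by omega), mem_filter.2 ⟨hp, hn2⟩⟩
  refine hsub.trans ((sum_biUnion_le_sum _ _ fun _ => by positivity).trans ?_)
  refine (sum_le_sum (g := fun _ => B) fun n hn' => hn n (by
    have := mem_range.1 hn'; omega)).trans ?_
  rw [sum_const, card_range, nsmul_eq_mul]
  have h5 : (2 + σ) ^ 8 ≤ 2 ^ 8 * (1 + σ) ^ 8 := by
    rw [← mul_pow]; exact pow_le_pow_left₀ (by linarith) (by linarith) 8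
  have h6 : ((m + 1 : ℕ) : ℝ) ≤ 2 + σ := by push_cast; linarith
  calc ((m + 1 : ℕ) : ℝ) * B ≤ (2 + σ) * B := mul_le_mul_of_nonneg_right h6 (by positivity)
    _ = (2 + σ) ^ 8 * (C * (exp c * exp (-(c / 16 * √σ)))) := by rw [hB]; ring
    _ ≤ 2 ^ 8 * (1 + σ) ^ 8 * (C * (exp c * exp (-(c / 16 * √σ)))) := by gcongr
    _ = _ := by ring

/-- Most primes are normal. -/
lemma eventually_sum_not_isNormal_le {ε η : ℝ} (hε : 0 < ε) (hη : 0 < η) (hηε : η ≤ ε / 320)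
    (hη1 : η ≤ 1 / 8) : ∀ᶠ σ : ℝ in atTop, ∀ A : Finset ℕ,
    (∀ p ∈ A, p.Prime ∧ (1 - η) * σ ≤ iterLog p ∧ iterLog p ≤ σ ∧ ¬ IsNormal ε σ p) →
    ∑ p ∈ A, 1 / ((p : ℝ) + 1) ≤ 1 := by
  classical
  have h4 : (0 : ℝ) < 1 / 4 := by norm_num
  filter_upwards [eventually_sum_dvd_sq_le h4, eventually_sum_omegaFin_small_le h4,
    eventually_sum_omegaFin_large_le h4 hη hη1, eventually_sum_card_le h4 hη hη1 hε,
    eventually_ge_atTop 8, eventually_ge_atTop ((4 + 4 * ε) ^ 2)]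
    with σ hb1 hb2 hb3 hb4 hσ8 hσ A hA
  have hσ0 : 0 ≤ σ := by linarith
  have h0 : 0 ≤ (1 - 2 * η) * σ := mul_nonneg (by linarith) hσ0
  have hησ : 0 ≤ η * σ := by positivity
  have hησ8 : η * σ ≤ 1 / 8 * σ := by gcongr
  set m := ⌊(1 - 2 * η) * σ⌋₊
  have hm1 : (m : ℝ) ≤ (1 - 2 * η) * σ := Nat.floor_le h0
  have hm2 : (1 - 2 * η) * σ < m + 1 := Nat.lt_floor_add_one _
  set A₁ := A.filter fun p => ∃ r, ⌊exp (3 * σ)⌋₊ < r ∧ r ^ 2 ∣ p + 1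
  set A₂ := A.filter fun p : ℕ => 2 * ⌊√σ / 8⌋₊ ≤ omegaFin (primesUpTo (exp (3 * σ))) (p + 1)
  set A₃ := A.filter fun p : ℕ => 2 * ⌊20 * η * σ⌋₊ ≤ omegaFin (primesIoc m σ) (p + 1)
  set A₄ := A.filter fun p : ℕ => ∃ n ≤ m, ⌊√σ / 16⌋₊ + ⌊(1 + ε / 2) * n + √σ / 8⌋₊ ≤
    #((primesUpTo (scale n)).filter fun r => r ∣ p + 1)
  have hA2 : ∀ p ∈ A, σ / 2 ≤ iterLog p := fun p hp => by linarith [(hA p hp).2.1]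
  have hs1 : ∑ p ∈ A₁, 1 / ((p : ℝ) + 1) ≤ 1 / 4 := hb1 A₁ fun p hp => by
    obtain ⟨h1, h2⟩ := mem_filter.1 hp
    exact ⟨(hA p h1).1, (hA p h1).2.2.1, h2⟩
  have hs2 : ∑ p ∈ A₂, 1 / ((p : ℝ) + 1) ≤ 1 / 4 := hb2 A₂ fun p hp => by
    obtain ⟨h1, h2⟩ := mem_filter.1 hp
    exact ⟨(hA p h1).1, hA2 p h1, (hA p h1).2.2.1, h2⟩
  have hs3 : ∑ p ∈ A₃, 1 / ((p : ℝ) + 1) ≤ 1 / 4 := hb3 m A₃ (by linarith) hm2 fun p hp => by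
    obtain ⟨h1, h2⟩ := mem_filter.1 hp
    exact ⟨(hA p h1).1, hA2 p h1, (hA p h1).2.2.1, h2⟩
  have hs4 : ∑ p ∈ A₄, 1 / ((p : ℝ) + 1) ≤ 1 / 4 := hb4 m A₄ hm1 fun p hp => by
    obtain ⟨h1, h2⟩ := mem_filter.1 hp
    exact ⟨(hA p h1).1, (hA p h1).2.1, (hA p h1).2.2.1, h2⟩
  have hcov : A ⊆ (A₁ ∪ A₂) ∪ (A₃ ∪ A₄) := by
    intro p hp
    by_contra hcon
    simp only [mem_union, A₁, A₂, A₃, A₄, mem_filter, hp, true_and, not_or, not_le] at hcon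
    obtain ⟨⟨c1, c2⟩, c3, c4⟩ := hcon
    refine (hA p hp).2.2.2 (isNormal_of_forall (θ := log (3 * σ + 1)) (m := m) (j₂ := ⌊√σ / 16⌋₊)
      (K := fun n : ℕ => ⌊(1 + ε / 2) * n + √σ / 8⌋₊) (R := ⌊exp (3 * σ)⌋₊) hε hη hηε hη1 hσ hσ8
      hm1 hm2 ?_ (Nat.floor_le (by positivity)) (Nat.floor_le (by positivity))
      (Nat.floor_le (by positivity)) (fun n => Nat.floor_le (by positivity)) c1 ?_ ?_ c3)
    · rw [scale, exp_log (by linarith), add_sub_cancel_right]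
      exact Nat.floor_le (exp_pos _).le
    · intro n hn
      by_contra! hle
      exact c4 ⟨n, hn, hle⟩
    · rw [scale, exp_log (by linarith), add_sub_cancel_right]
      exact c2
  have hU : ∀ S S' : Finset ℕ, ∑ p ∈ S ∪ S', 1 / ((p : ℝ) + 1) ≤
      ∑ p ∈ S, 1 / ((p : ℝ) + 1) + ∑ p ∈ S', 1 / ((p : ℝ) + 1) := fun S S' => by
    rw [← sum_union_inter]
    exact le_add_of_nonneg_right (sum_nonneg fun _ _ => by positivity)
  have h5 : ∑ p ∈ A, 1 / ((p : ℝ) + 1) ≤ ∑ p ∈ (A₁ ∪ A₂) ∪ (A₃ ∪ A₄), 1 / ((p : ℝ) + 1) :=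
    sum_le_sum_of_subset_of_nonneg hcov fun _ _ _ => by positivity
  linarith [hU (A₁ ∪ A₂) (A₃ ∪ A₄), hU A₁ A₂, hU A₃ A₄]

lemma prime_le_of_dvd_succ {p r : ℕ} (hp : p.Prime) (hp2 : 2 < p) (hr : r.Prime) (h : r ∣ p + 1) :
    r ≤ p := by
  have h1 := Nat.le_of_dvd (Nat.succ_pos p) h
  rcases Nat.lt_or_ge r (p + 1) with h2 | h2
  · omega
  · have h3 := hp.eq_two_or_odd
    have h4 := hr.eq_two_or_odd
    omega

/-- The triple `(a, b, k)` parametrizes a pair of distinct primes `p = aαk - 1`, `q = bβk - 1`. -/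
def IsLinked (σ : ℝ) (α β : ℕ) (x : ℕ × ℕ × ℕ) : Prop :=
  ∃ p q : ℕ, p.Prime ∧ q.Prime ∧ p ≠ q ∧ 2 < p ∧ 2 < q ∧ iterLog p ≤ σ ∧ iterLog q ≤ σ ∧
    x.1 * α * x.2.2 = p + 1 ∧ x.2.1 * β * x.2.2 = q + 1

lemma IsLinked.facts {σ : ℝ} {α β a b k : ℕ} (hσ : 0 ≤ σ) (h : IsLinked σ α β (a, b, k)) :
    (a ≠ 0 ∧ b ≠ 0 ∧ k ≠ 0) ∧ a * α ≠ b * β ∧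
    ((a * α * k - 1).Prime ∧ (b * β * k - 1).Prime) ∧
    (∀ r : ℕ, r.Prime → (r ∣ a ∨ r ∣ b ∨ r ∣ k) → r ∈ primesUpTo (scale σ)) ∧
    ∀ d : ℕ, (d ∣ a * α * k ∨ d ∣ b * β * k) → (d : ℝ) ≤ scale (σ + 1) := by
  obtain ⟨p, q, hp, hq, hpq, hp2, hq2, hpσ, hqσ, h1, h2⟩ := h
  dsimp only at h1 h2
  refine ⟨⟨?_, ?_, ?_⟩, ?_, ⟨?_, ?_⟩, ?_, ?_⟩
  · rintro rfl; simp at h1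
  · rintro rfl; simp at h2
  · rintro rfl; simp at h1
  · intro h3; rw [h3, h2] at h1; omega
  · rw [h1]; simpa using hp
  · rw [h2]; simpa using hq
  · have hle : ∀ s : ℕ, s.Prime → 2 < s → iterLog s ≤ σ → ∀ r : ℕ, r.Prime → r ∣ s + 1 →
        r ∈ primesUpTo (scale σ) := fun s hs hs2 hsσ r hr hd => by
      refine mem_primesUpTo.2 ⟨hr, le_trans ?_ ((le_scale_iff (by exact_mod_cast hs.one_lt.le)).2 hsσ)⟩
      exact_mod_cast prime_le_of_dvd_succ hs hs2 hr hd
    rintro r hr (hd | hd | hd)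
    · exact hle p hp hp2 hpσ r hr (h1 ▸ (hd.mul_right α).mul_right k)
    · exact hle q hq hq2 hqσ r hr (h2 ▸ (hd.mul_right β).mul_right k)
    · exact hle p hp hp2 hpσ r hr (h1 ▸ hd.mul_left (a * α))
  · rintro d (hd | hd)
    · exact prime_dvd_succ hp hpσ hσ (h1 ▸ hd)
    · exact prime_dvd_succ hq hqσ hσ (h2 ▸ hd)

lemma sum_primesUpTo_succ_le : ∃ C : ℝ, 0 < C ∧ ∀ (F : ℕ → ℝ) (σ : ℝ), (∀ p, 0 ≤ F p) → (∀ p, F p ≤ 1) →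
    0 ≤ σ → ∑ r ∈ primesUpTo (scale (σ + 1)), F r / r ≤ ∑ r ∈ primesUpTo (scale σ), F r / r + C := by
  obtain ⟨C₁, hC₁, -, hI⟩ := exists_abs_sum_primesIoc_le
  refine ⟨1 + C₁, by positivity, fun F σ h0 h1 hσ => ?_⟩
  rw [primesUpTo_scale_eq σ (σ + 1) (by linarith)]
  have h2 := (abs_le.1 (hI σ (σ + 1) hσ (by linarith))).2
  have h3 : ∑ r ∈ primesIoc σ (σ + 1), F r / (r : ℝ) ≤ ∑ r ∈ primesIoc σ (σ + 1), 1 / (r : ℝ) :=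
    sum_le_sum fun r _ => by gcongr; exact h1 r
  linarith

lemma sum_le_sum_sum_sum {τ : Type*} {S : Finset τ} {u v w : τ → ℕ} {A : Finset ℕ} {B : ℕ → Finset ℕ}
    {K : ℕ → ℕ → Finset ℕ} {f : ℕ → ℕ → ℕ → ℝ} (hf : ∀ a b k, 0 ≤ f a b k)
    (hinj : ∀ x ∈ S, ∀ y ∈ S, u x = u y → v x = v y → w x = w y → x = y)
    (h : ∀ x ∈ S, u x ∈ A ∧ v x ∈ B (u x) ∧ w x ∈ K (u x) (v x)) :
    ∑ x ∈ S, f (u x) (v x) (w x) ≤ ∑ a ∈ A, ∑ b ∈ B a, ∑ k ∈ K a b, f a b k := by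
  classical
  simp only [sum_sigma']
  rw [← sum_image (s := S) (g := fun x => (⟨u x, ⟨v x, w x⟩⟩ : Σ _ : ℕ, Σ _ : ℕ, ℕ))
    (f := fun x => f x.1 x.2.1 x.2.2)]
  · refine sum_le_sum_of_subset_of_nonneg ?_ fun y _ _ => hf y.1 y.2.1 y.2.2
    intro y hy
    obtain ⟨x, hx, rfl⟩ := mem_image.1 hy
    exact mem_sigma.2 ⟨(h x hx).1, mem_sigma.2 ⟨(h x hx).2.1, (h x hx).2.2⟩⟩
  · intro x hx y hy hxy
    simp only [Sigma.mk.injEq, heq_eq_eq] at hxy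
    exact hinj x hx y hy hxy.1 hxy.2.1 hxy.2.2

lemma sum_linked_large_le : ∃ C : ℝ, 0 < C ∧ ∀ (F G : ℕ → ℝ), (∀ p, 0 ≤ F p) → (∀ p, F p ≤ 1) →
    (∀ p, 0 ≤ G p) → (∀ p, G p ≤ 1) → ∀ (σ s₀ : ℝ) (α β : ℕ) (S : Finset (ℕ × ℕ × ℕ)), 0 ≤ σ →
    0 ≤ s₀ → (∀ x ∈ S, IsLinked σ α β x ∧ scale s₀ ≤ x.2.2) →
    ∑ x ∈ S, cmul F x.1 / x.1 * (cmul F x.2.1 / x.2.1 * (cmul G x.2.2 / x.2.2)) ≤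
      C * (2 + σ) ^ 6 * exp (σ - 3 * s₀ + ∑ r ∈ primesUpTo (scale σ), G r / r +
        2 * ∑ r ∈ primesUpTo (scale σ), F r / r) := by
  obtain ⟨C, hC, h⟩ := sieve_log
  obtain ⟨C₁, hC₁, hE⟩ := euler_sum 1
  obtain ⟨C₂, hC₂, hS⟩ := sum_primesUpTo_succ_le
  refine ⟨C * exp (1 + C₂) * C₁ ^ 2, by positivity, ?_⟩
  intro F G hF0 hF1 hG0 hG1 σ s₀ α β S hσ hs₀ hS'
  have hfac : ∀ a b k, (a, b, k) ∈ S → _ := fun a b k hx => IsLinked.facts hσ (hS' (a, b, k) hx).1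
  set A := S.image fun x => x.1
  set B := S.image fun x => x.2.1
  set Zf := ∑ r ∈ primesUpTo (scale σ), F r / r
  set Zg := ∑ r ∈ primesUpTo (scale σ), G r / r
  have hA : ∑ a ∈ A, cmul F a / a ≤ C₁ * exp Zf := by
    refine hE F hF0 hF1 (fun p hp => ?_) _ A (fun p hp => (mem_primesUpTo.1 hp).1) fun a ha => ?_
    · have : (2 : ℝ) ≤ p := by exact_mod_cast hp.two_le
      linarith [hF1 p]
    · obtain ⟨⟨a, b, k⟩, hx, rfl⟩ := mem_image.1 ha
      exact ⟨(hfac a b k hx).1.1, fun r hr hd => (hfac a b k hx).2.2.2.1 r hr (Or.inl hd)⟩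
  have hB : ∑ b ∈ B, cmul F b / b ≤ C₁ * exp Zf := by
    refine hE F hF0 hF1 (fun p hp => ?_) _ B (fun p hp => (mem_primesUpTo.1 hp).1) fun a ha => ?_
    · have : (2 : ℝ) ≤ p := by exact_mod_cast hp.two_le
      linarith [hF1 p]
    · obtain ⟨⟨a, b, k⟩, hx, rfl⟩ := mem_image.1 ha
      exact ⟨(hfac a b k hx).1.2.1, fun r hr hd => (hfac a b k hx).2.2.2.1 r hr (Or.inr (Or.inl hd))⟩
  set K : ℕ → ℕ → Finset ℕ := fun a b => (S.filter fun x => x.1 = a ∧ x.2.1 = b).image fun x => x.2.2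
  have hKmem : ∀ a b k, k ∈ K a b → (a, b, k) ∈ S := by
    intro a b k hk
    obtain ⟨⟨a', b', k'⟩, hx, rfl⟩ := mem_image.1 hk
    obtain ⟨hx1, rfl, rfl⟩ := mem_filter.1 hx
    exact hx1
  have hK : ∀ a b, ∑ k ∈ K a b, cmul G k / k ≤
      C * (2 + σ) ^ 6 * exp (1 + C₂) * exp (σ - 3 * s₀ + Zg) := by
    intro a b
    rcases (K a b).eq_empty_or_nonempty with he | ⟨k₀, hk₀⟩
    · rw [he, sum_empty]; positivity
    · obtain ⟨⟨ha, hb, hk⟩, hne, ⟨hp, hq⟩, -, hd⟩ := hfac a b k₀ (hKmem a b k₀ hk₀)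
      have hα : a * α ≠ 0 := by rintro h0; rw [h0] at hp; simp at hp; exact Nat.not_prime_zero hp
      have hβ : b * β ≠ 0 := by rintro h0; rw [h0] at hq; simp at hq; exact Nat.not_prime_zero hq
      have h2 := h G hG0 hG1 (a * α) (b * β) (σ + 1) s₀ (K a b) (Nat.one_le_iff_ne_zero.2 hα)
        (Nat.one_le_iff_ne_zero.2 hβ) hs₀ (by linarith) (hd _ (Or.inl (dvd_mul_right _ _)))
        (hd _ (Or.inr (dvd_mul_right _ _))) fun k hk => by
          have h3 := hKmem a b k hk
          have h4 := hfac a b k h3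
          exact ⟨(hS' _ h3).2, h4.2.2.2.2 _ (Or.inl (dvd_mul_left _ _)), h4.2.2.1⟩
      rw [if_neg hne] at h2
      refine h2.trans ?_
      rw [mul_assoc (C * (2 + σ) ^ 6), ← exp_add, show 1 + (σ + 1) = 2 + σ by ring]
      refine mul_le_mul_of_nonneg_left (exp_le_exp.2 ?_) (by positivity)
      linarith [hS G σ hG0 hG1 hσ]
  have hsum : ∑ x ∈ S, cmul F x.1 / x.1 * (cmul F x.2.1 / x.2.1 * (cmul G x.2.2 / x.2.2)) ≤
      ∑ a ∈ A, ∑ b ∈ B, ∑ k ∈ K a b, cmul F a / a * (cmul F b / b * (cmul G k / k)) := by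
    have hnn : ∀ a b k : ℕ, 0 ≤ cmul F a / a * (cmul F b / b * (cmul G k / k)) := fun a b k => by
      have := cmul_nonneg hF0 a
      have := cmul_nonneg hF0 b
      have := cmul_nonneg hG0 k
      positivity
    refine sum_le_sum_sum_sum (S := S) (u := fun x => x.1) (v := fun x => x.2.1)
      (w := fun x => x.2.2) (A := A) (B := fun _ => B) (K := K)
      (f := fun a b k => cmul F a / a * (cmul F b / b * (cmul G k / k))) hnn ?_ ?_
    · rintro ⟨a, b, k⟩ _ ⟨a', b', k'⟩ _ h1 h2 h3
      simp only at h1 h2 h3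
      rw [h1, h2, h3]
    · exact fun x hx => ⟨mem_image_of_mem _ hx, mem_image_of_mem _ hx,
        mem_image.2 ⟨x, mem_filter.2 ⟨hx, rfl, rfl⟩, rfl⟩⟩
  refine hsum.trans ?_
  calc ∑ a ∈ A, ∑ b ∈ B, ∑ k ∈ K a b, cmul F a / a * (cmul F b / b * (cmul G k / k))
      = ∑ a ∈ A, cmul F a / a * ∑ b ∈ B, (cmul F b / b * ∑ k ∈ K a b, cmul G k / k) := by
        simp only [mul_sum]
    _ ≤ ∑ a ∈ A, cmul F a / a * ∑ b ∈ B, (cmul F b / b *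
        (C * (2 + σ) ^ 6 * exp (1 + C₂) * exp (σ - 3 * s₀ + Zg))) := by
        gcongr with a _ b _
        · have := cmul_nonneg hF0 a; positivity
        · have := cmul_nonneg hF0 b; positivity
        · exact hK a b
    _ = (∑ a ∈ A, cmul F a / a) * ((∑ b ∈ B, cmul F b / b) *
        (C * (2 + σ) ^ 6 * exp (1 + C₂) * exp (σ - 3 * s₀ + Zg))) := by
        rw [← sum_mul, ← sum_mul]
    _ ≤ (C₁ * exp Zf) * ((C₁ * exp Zf) *
        (C * (2 + σ) ^ 6 * exp (1 + C₂) * exp (σ - 3 * s₀ + Zg))) := by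
        have hnn : 0 ≤ ∑ b ∈ B, cmul F b / (b : ℝ) :=
          sum_nonneg fun b _ => div_nonneg (cmul_nonneg hF0 b) (Nat.cast_nonneg b)
        refine mul_le_mul hA (mul_le_mul_of_nonneg_right hB (by positivity)) ?_ (by positivity)
        exact mul_nonneg hnn (by positivity)
    _ = _ := by
        rw [exp_add _ (2 * Zf), two_mul Zf, exp_add Zf]; ring

lemma sum_linked_small_le : ∃ C : ℝ, 0 < C ∧ ∀ (F G : ℕ → ℝ), (∀ p, 0 ≤ F p) → (∀ p, F p ≤ 1) →
    (∀ p, 0 ≤ G p) → (∀ p, G p ≤ 1) → ∀ (σ s₀ : ℝ) (α β : ℕ) (S : Finset (ℕ × ℕ × ℕ)), 0 ≤ σ →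
    0 ≤ s₀ → (∀ x ∈ S, IsLinked σ α β x ∧ scale s₀ ≤ x.1 ∧ scale s₀ ≤ x.2.1) →
    ∑ x ∈ S, cmul F x.1 / x.1 * (cmul F x.2.1 / x.2.1 * (cmul G x.2.2 / x.2.2)) ≤
      C * (2 + σ) ^ 12 * exp (2 * σ - 4 * s₀ + ∑ r ∈ primesUpTo (scale σ), G r / r +
        2 * ∑ r ∈ primesUpTo (scale σ), F r / r) := by
  obtain ⟨C, hC, h⟩ := sieve_log
  obtain ⟨C₁, hC₁, hE⟩ := euler_sum 1
  obtain ⟨C₂, hC₂, hS⟩ := sum_primesUpTo_succ_le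
  refine ⟨(C * exp (1 + C₂)) ^ 2 * C₁, by positivity, ?_⟩
  intro F G hF0 hF1 hG0 hG1 σ s₀ α β S hσ hs₀ hS'
  have hfac : ∀ a b k, (a, b, k) ∈ S → _ := fun a b k hx => IsLinked.facts hσ (hS' (a, b, k) hx).1
  set D := S.image fun x => x.2.2
  set Zf := ∑ r ∈ primesUpTo (scale σ), F r / r
  set Zg := ∑ r ∈ primesUpTo (scale σ), G r / r
  have hD : ∑ k ∈ D, cmul G k / k ≤ C₁ * exp Zg := by
    refine hE G hG0 hG1 (fun p hp => ?_) _ D (fun p hp => (mem_primesUpTo.1 hp).1) fun a ha => ?_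
    · have : (2 : ℝ) ≤ p := by exact_mod_cast hp.two_le
      linarith [hG1 p]
    · obtain ⟨⟨a, b, k⟩, hx, rfl⟩ := mem_image.1 ha
      exact ⟨(hfac a b k hx).1.2.2, fun r hr hd => (hfac a b k hx).2.2.2.1 r hr (Or.inr (Or.inr hd))⟩
  set A : ℕ → Finset ℕ := fun k => (S.filter fun x => x.2.2 = k).image fun x => x.1
  set B : ℕ → Finset ℕ := fun k => (S.filter fun x => x.2.2 = k).image fun x => x.2.1
  have hbound : ∀ (c : ℕ) (N : Finset ℕ), (∀ n ∈ N, scale s₀ ≤ n ∧ (n : ℝ) ≤ scale (σ + 1) ∧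
      (c : ℝ) ≤ scale (σ + 1) ∧ (c * n - 1).Prime) → ∑ n ∈ N, cmul F n / n ≤
      C * (2 + σ) ^ 6 * exp (1 + C₂) * exp (σ - 2 * s₀ + Zf) := by
    intro c N hN
    rcases N.eq_empty_or_nonempty with he | ⟨n₀, hn₀⟩
    · rw [he, sum_empty]; positivity
    · obtain ⟨-, -, h3, h4⟩ := hN n₀ hn₀
      have hc : 1 ≤ c := by
        rw [Nat.one_le_iff_ne_zero]; rintro rfl; simp at h4; exact Nat.not_prime_zero h4
      have h2 := h F hF0 hF1 c c (σ + 1) s₀ N hc hc hs₀ (by linarith) h3 h3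
        fun n hn => ⟨(hN n hn).1, (hN n hn).2.1, (hN n hn).2.2.2, (hN n hn).2.2.2⟩
      rw [if_pos rfl] at h2
      refine h2.trans ?_
      rw [mul_assoc (C * (2 + σ) ^ 6), ← exp_add, show 1 + (σ + 1) = 2 + σ by ring]
      refine mul_le_mul_of_nonneg_left (exp_le_exp.2 ?_) (by positivity)
      linarith [hS F σ hF0 hF1 hσ]
  have hA : ∀ k, ∑ a ∈ A k, cmul F a / a ≤ C * (2 + σ) ^ 6 * exp (1 + C₂) * exp (σ - 2 * s₀ + Zf) := by
    refine fun k => hbound (α * k) _ fun n hn => ?_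
    obtain ⟨⟨a, b, k'⟩, hx, rfl⟩ := mem_image.1 hn
    obtain ⟨hx1, rfl⟩ := mem_filter.1 hx
    have h4 := hfac a b k' hx1
    refine ⟨(hS' _ hx1).2.1, h4.2.2.2.2 _ (Or.inl ((dvd_mul_right a α).mul_right k')),
      h4.2.2.2.2 _ (Or.inl (mul_dvd_mul_right (dvd_mul_left α a) k')), ?_⟩
    have := h4.2.2.1.1
    rwa [mul_assoc, mul_comm] at this
  have hB : ∀ k, ∑ a ∈ B k, cmul F a / a ≤ C * (2 + σ) ^ 6 * exp (1 + C₂) * exp (σ - 2 * s₀ + Zf) := by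
    refine fun k => hbound (β * k) _ fun n hn => ?_
    obtain ⟨⟨a, b, k'⟩, hx, rfl⟩ := mem_image.1 hn
    obtain ⟨hx1, rfl⟩ := mem_filter.1 hx
    have h4 := hfac a b k' hx1
    refine ⟨(hS' _ hx1).2.2, h4.2.2.2.2 _ (Or.inr ((dvd_mul_right b β).mul_right k')),
      h4.2.2.2.2 _ (Or.inr (mul_dvd_mul_right (dvd_mul_left β b) k')), ?_⟩
    have := h4.2.2.1.2
    rwa [mul_assoc, mul_comm] at this
  have hsum : ∑ x ∈ S, cmul F x.1 / x.1 * (cmul F x.2.1 / x.2.1 * (cmul G x.2.2 / x.2.2)) ≤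
      ∑ k ∈ D, ∑ a ∈ A k, ∑ b ∈ B k, cmul F a / a * (cmul F b / b * (cmul G k / k)) := by
    have hnn : ∀ k a b : ℕ, 0 ≤ cmul F a / a * (cmul F b / b * (cmul G k / k)) := fun k a b => by
      have := cmul_nonneg hF0 a
      have := cmul_nonneg hF0 b
      have := cmul_nonneg hG0 k
      positivity
    refine sum_le_sum_sum_sum (S := S) (u := fun x => x.2.2) (v := fun x => x.1)
      (w := fun x => x.2.1) (A := D) (B := A) (K := fun k _ => B k)
      (f := fun k a b => cmul F a / a * (cmul F b / b * (cmul G k / k))) hnn ?_ ?_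
    · rintro ⟨a, b, k⟩ _ ⟨a', b', k'⟩ _ h1 h2 h3
      simp only at h1 h2 h3
      rw [h1, h2, h3]
    · exact fun x hx => ⟨mem_image_of_mem _ hx, mem_image.2 ⟨x, mem_filter.2 ⟨hx, rfl⟩, rfl⟩,
        mem_image.2 ⟨x, mem_filter.2 ⟨hx, rfl⟩, rfl⟩⟩
  refine hsum.trans ?_
  set Q := C * (2 + σ) ^ 6 * exp (1 + C₂) * exp (σ - 2 * s₀ + Zf) with hQ
  have hQ0 : 0 ≤ Q := by positivity
  calc ∑ k ∈ D, ∑ a ∈ A k, ∑ b ∈ B k, cmul F a / a * (cmul F b / b * (cmul G k / k))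
      = ∑ k ∈ D, cmul G k / k * ((∑ a ∈ A k, cmul F a / a) * ∑ b ∈ B k, cmul F b / b) := by
        refine sum_congr rfl fun k _ => ?_
        rw [sum_mul_sum, mul_sum]
        refine sum_congr rfl fun a _ => ?_
        rw [mul_sum]
        exact sum_congr rfl fun b _ => by ring
    _ ≤ ∑ k ∈ D, cmul G k / k * (Q * Q) := by
        refine sum_le_sum fun k _ => mul_le_mul_of_nonneg_left ?_
          (div_nonneg (cmul_nonneg hG0 k) (Nat.cast_nonneg k))
        exact mul_le_mul (hA k) (hB k) (sum_nonneg fun b _ =>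
          div_nonneg (cmul_nonneg hF0 b) (Nat.cast_nonneg b)) hQ0
    _ = (∑ k ∈ D, cmul G k / k) * (Q * Q) := by rw [← sum_mul]
    _ ≤ (C₁ * exp Zg) * (Q * Q) := mul_le_mul_of_nonneg_right hD (by positivity)
    _ = _ := by
        have h1 : exp (2 * σ - 4 * s₀ + Zg + 2 * Zf) =
            exp Zg * (exp (σ - 2 * s₀ + Zf) * exp (σ - 2 * s₀ + Zf)) := by
          rw [← exp_add, ← exp_add]; ring_nf
        rw [h1, hQ]; ring

lemma scale_pow_four_le (t : ℝ) : scale t ^ 4 ≤ scale (t + 2) := by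
  have h1 := scale_sub_one_sq_le (t + 1)
  have h2 := scale_sub_one_sq_le (t + 2)
  rw [add_sub_cancel_right] at h1
  rw [show t + 2 - 1 = t + 1 by ring] at h2
  calc scale t ^ 4 = (scale t ^ 2) ^ 2 := by ring
    _ ≤ scale (t + 1) ^ 2 := by gcongr
    _ ≤ _ := h2

lemma scale_le_of_mul {s t c : ℝ} {a α k : ℕ} (hs : s ≤ t) (hc : c ≤ t) (hα : (α : ℝ) ≤ scale c)
    (hk : (k : ℝ) ≤ scale s) (h : scale (t + 2) ≤ (a * α * k : ℕ)) : scale t ≤ a := by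
  by_contra! hlt
  have h1 := scale_pow_four_le t
  have h0 := scale_pos t
  have hα' : (α : ℝ) ≤ scale t := hα.trans (scale_le_scale.2 hc)
  have hk' : (k : ℝ) ≤ scale t := hk.trans (scale_le_scale.2 hs)
  push_cast at h
  have h2 : (a : ℝ) * α * k ≤ a * scale t * scale t := by gcongr
  have h3 : (a : ℝ) * scale t * scale t < scale t * scale t * scale t := by gcongr
  rcases le_or_gt 1 (scale t) with h4 | h4
  · have h5 : scale t ^ 3 ≤ scale t ^ 4 := pow_le_pow_right₀ h4 (by norm_num)
    nlinarith
  · have ha : (a : ℝ) < 1 := hlt.trans h4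
    have ha0 : a = 0 := by
      have : a < 1 := by exact_mod_cast ha
      omega
    rw [ha0] at h
    simp only [Nat.cast_zero, zero_mul] at h
    linarith [scale_pos (t + 2)]

lemma eventually_poly_mul_exp_neg_le (K : ℝ) (n : ℕ) {c δ : ℝ} (hc : 0 < c) (hδ : 0 < δ) :
    ∀ᶠ σ : ℝ in atTop, K * (1 + σ) ^ n * exp (-(c * σ)) ≤ δ := by
  filter_upwards [eventually_poly_mul_exp_neg_sqrt_le |K| n hc hδ, eventually_ge_atTop 1] with σ h hσ
  have h1 : √σ ≤ σ := sqrt_le_iff.2 ⟨by linarith, by nlinarith⟩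
  have h2 : K * (1 + σ) ^ n ≤ |K| * (1 + σ) ^ n := by gcongr; exact le_abs_self K
  calc _ ≤ |K| * (1 + σ) ^ n * exp (-(c * σ)) := by gcongr
    _ ≤ |K| * (1 + σ) ^ n * exp (-(c * √σ)) := by gcongr
    _ ≤ δ := h

/-- The weighted count of linked pairs of primes close to `scale σ`. -/
lemma eventually_sum_linked_le {ρ η : ℝ} (hη : 0 < η) (hρ : ρ < 1 - 3 * η) (hρ0 : 0 < ρ) :
    ∀ᶠ σ : ℝ in atTop, ∀ (i : ℕ) (z : ℕ → ℝ), (∀ r, 0 ≤ z r) → (∀ r, z r ≤ 1) →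
    (∀ r ∈ primesUpTo (scale σ), i * z r ≤ 1) → ∀ (α β : ℕ), (α : ℝ) ≤ scale (ρ * σ + 2) →
    (β : ℝ) ≤ scale (ρ * σ + 2) → ∀ S : Finset (ℕ × ℕ × ℕ), (∀ x ∈ S, IsLinked σ α β x ∧
      scale ((1 - η) * σ) ≤ (x.1 * α * x.2.2 : ℕ) ∧ scale ((1 - η) * σ) ≤ (x.2.1 * β * x.2.2 : ℕ)) →
    ∑ x ∈ S, cmul (fun _ => (i : ℝ)) x.1 * cmul (fun _ => (i : ℝ)) x.2.1 *
      (cmul z (x.1 * x.2.1 * x.2.2) / (x.1 * x.2.1 * x.2.2 : ℕ)) ≤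
      exp (-2 * σ + 9 * η * σ + (2 * i + 1) * ∑ r ∈ primesUpTo (scale σ), z r / r) := by
  classical
  obtain ⟨C, hC, h⟩ := sum_linked_large_le
  obtain ⟨C', hC', h'⟩ := sum_linked_small_le
  have hη2 : (0 : ℝ) < 1 / 2 := by norm_num
  filter_upwards [eventually_poly_mul_exp_neg_le (C * 2 ^ 6) 6 hη hη2,
    eventually_poly_mul_exp_neg_le (C' * 2 ^ 12) 12 hη hη2, eventually_ge_atTop 1,
    eventually_ge_atTop (4 / η)] with σ hb1 hb2 hσ1 hση
  intro i z hz0 hz1 hiz α β hα hβ S hS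
  have hσ0 : 0 ≤ σ := by linarith
  have hησ : 4 ≤ η * σ := by rwa [div_le_iff₀' hη] at hση
  have hρσ : ρ * σ ≤ (1 - 3 * η) * σ := by gcongr
  have hs₀ : 0 ≤ (1 - 2 * η) * σ := mul_nonneg (by linarith) hσ0
  set s₀ := (1 - 2 * η) * σ with hs₀def
  set F : ℕ → ℝ := fun r => min 1 (i * z r)
  have hF0 : ∀ r, 0 ≤ F r := fun r => le_min zero_le_one (mul_nonneg (Nat.cast_nonneg i) (hz0 r))
  have hF1 : ∀ r, F r ≤ 1 := fun r => min_le_left _ _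
  set Z := ∑ r ∈ primesUpTo (scale σ), z r / r with hZ
  have hZF : ∑ r ∈ primesUpTo (scale σ), F r / r ≤ i * Z := by
    rw [hZ, mul_sum]
    refine sum_le_sum fun r _ => ?_
    rw [← mul_div_assoc]
    gcongr
    exact min_le_right _ _
  have hcF : ∀ n : ℕ, (∀ r : ℕ, r.Prime → r ∣ n → r ∈ primesUpTo (scale σ)) →
      cmul (fun _ => (i : ℝ)) n * cmul z n ≤ cmul F n := by
    intro n hn
    rw [← cmul_mul_fun]
    exact cmul_le_cmul (fun r => mul_nonneg (Nat.cast_nonneg i) (hz0 r))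
      fun r hr hd => le_min (hiz r (hn r hr hd)) le_rfl
  have hterm : ∀ x ∈ S, cmul (fun _ => (i : ℝ)) x.1 * cmul (fun _ => (i : ℝ)) x.2.1 *
      (cmul z (x.1 * x.2.1 * x.2.2) / (x.1 * x.2.1 * x.2.2 : ℕ)) ≤
      cmul F x.1 / x.1 * (cmul F x.2.1 / x.2.1 * (cmul z x.2.2 / x.2.2)) := by
    rintro ⟨a, b, k⟩ hx
    have hf := (IsLinked.facts hσ0 (hS _ hx).1).2.2.2.1
    have h1 := hcF a fun r hr hd => hf r hr (Or.inl hd)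
    have h2 := hcF b fun r hr hd => hf r hr (Or.inr (Or.inl hd))
    have hi : ∀ n, 0 ≤ cmul (fun _ => (i : ℝ)) n := cmul_nonneg fun _ => Nat.cast_nonneg i
    dsimp only
    rw [map_mul, map_mul]
    push_cast
    calc _ = (cmul (fun _ => (i : ℝ)) a * cmul z a) / a *
          ((cmul (fun _ => (i : ℝ)) b * cmul z b) / b * (cmul z k / k)) := by
          rw [div_mul_div_comm, div_mul_div_comm, mul_div_assoc']
          ring_nf
      _ ≤ _ := by
          have e1 := hi a
          have e2 := hi b
          have e3 := cmul_nonneg hz0 a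
          have e4 := cmul_nonneg hz0 b
          have e5 := cmul_nonneg hz0 k
          have e6 := cmul_nonneg hF0 a
          gcongr
  refine (sum_le_sum hterm).trans ?_
  rw [← sum_filter_add_sum_filter_not S (fun x => scale s₀ ≤ x.2.2)]
  have hL := h F z hF0 hF1 hz0 hz1 σ s₀ α β (S.filter fun x => scale s₀ ≤ x.2.2) hσ0 hs₀
    fun x hx => ⟨(hS x (mem_filter.1 hx).1).1, (mem_filter.1 hx).2⟩
  have hR := h' F z hF0 hF1 hz0 hz1 σ s₀ α β (S.filter fun x => ¬ scale s₀ ≤ x.2.2) hσ0 hs₀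
    fun x hx => by
      obtain ⟨hx1, hx2⟩ := mem_filter.1 hx
      have hk := (not_le.1 hx2).le
      obtain ⟨e1, e2, e3⟩ := hS x hx1
      have hle : scale (s₀ + 2) ≤ scale ((1 - η) * σ) := scale_le_scale.2 (by rw [hs₀def]; linarith)
      have hc : ρ * σ + 2 ≤ s₀ := by rw [hs₀def]; linarith
      exact ⟨e1, scale_le_of_mul le_rfl hc hα hk (hle.trans e2),
        scale_le_of_mul le_rfl hc hβ hk (hle.trans e3)⟩
  set E := -2 * σ + 9 * η * σ + (2 * i + 1) * Z with hE
  have hp6 : (2 + σ) ^ 6 ≤ 2 ^ 6 * (1 + σ) ^ 6 := by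
    rw [← mul_pow]; exact pow_le_pow_left₀ (by linarith) (by linarith) 6
  have hp12 : (2 + σ) ^ 12 ≤ 2 ^ 12 * (1 + σ) ^ 12 := by
    rw [← mul_pow]; exact pow_le_pow_left₀ (by linarith) (by linarith) 12
  have hhalf : ∀ (D B : ℝ) (n : ℕ) (e : ℝ), D * 2 ^ n * (1 + σ) ^ n * exp (-(η * σ)) ≤ 1 / 2 → 0 ≤ D →
      (2 + σ) ^ n ≤ 2 ^ n * (1 + σ) ^ n → e ≤ E - η * σ → B ≤ D * (2 + σ) ^ n * exp e →
      B ≤ 1 / 2 * exp E := by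
    intro D B n e g1 g2 g3 g4 g5
    calc B ≤ D * (2 ^ n * (1 + σ) ^ n) * exp (E - η * σ) := by
          refine g5.trans ?_
          gcongr
      _ = D * 2 ^ n * (1 + σ) ^ n * exp (-(η * σ)) * exp E := by
          rw [sub_eq_add_neg, exp_add]; ring
      _ ≤ _ := by gcongr
  have hL' := hhalf C _ 6 _ hb1 hC.le hp6 (by rw [hE, hs₀def]; linarith) hL
  have hR' := hhalf C' _ 12 _ hb2 hC'.le hp12 (by rw [hE, hs₀def]; linarith) hR
  linarith

/-- Lists whose entries are drawn from the given finite sets. -/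
def tuples {ι : Type*} [DecidableEq ι] : List (Finset ι) → Finset (List ι)
  | [] => {[]}
  | P :: Ps => (P ×ˢ tuples Ps).image fun x => x.1 :: x.2

lemma sum_tuples_cons {ι : Type*} [DecidableEq ι] (P : Finset ι) (Ps : List (Finset ι))
    (f : List ι → ℝ) : ∑ l ∈ tuples (P :: Ps), f l = ∑ x ∈ P, ∑ l ∈ tuples Ps, f (x :: l) := by
  rw [tuples, sum_image, sum_product]
  rintro ⟨a, b⟩ - ⟨c, d⟩ - h
  simpa using h

lemma mem_tuples_cons {ι : Type*} [DecidableEq ι] {P : Finset ι} {Ps : List (Finset ι)} {l : List ι} :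
    l ∈ tuples (P :: Ps) ↔ ∃ x ∈ P, ∃ l' ∈ tuples Ps, x :: l' = l := by
  simp only [tuples, mem_image, mem_product, Prod.exists]
  constructor
  · rintro ⟨a, b, ⟨ha, hb⟩, rfl⟩; exact ⟨a, ha, b, hb, rfl⟩
  · rintro ⟨a, ha, b, hb, rfl⟩; exact ⟨a, b, ⟨ha, hb⟩, rfl⟩

lemma sum_divisors_cmul_le {F : ℕ → ℝ} (h0 : ∀ p, 0 ≤ F p) {n : ℕ} (hn : n ≠ 0) :
    ∑ d ∈ n.divisors, cmul F d ≤ cmul (fun p => F p + 1) n := by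
  classical
  induction n using induction_on_primes with
  | zero => exact absurd rfl hn
  | one => simp
  | prime_mul p n hp ih =>
    have hn0 : n ≠ 0 := by rintro rfl; simp at hn
    have h1 : (p * n).divisors ⊆ n.divisors ∪ n.divisors.image (p * ·) := by
      intro d hd
      have hd' := Nat.dvd_of_mem_divisors hd
      rcases (Nat.coprime_or_dvd_of_prime hp d) with hc | ⟨e, rfl⟩
      · exact mem_union_left _ (Nat.mem_divisors.2 ⟨hc.symm.dvd_of_dvd_mul_left hd', hn0⟩)
      · exact mem_union_right _ (mem_image.2 ⟨e, Nat.mem_divisors.2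
          ⟨Nat.dvd_of_mul_dvd_mul_left hp.pos hd', hn0⟩, rfl⟩)
    have hnn := cmul_nonneg h0
    calc ∑ d ∈ (p * n).divisors, cmul F d ≤ ∑ d ∈ n.divisors ∪ n.divisors.image (p * ·), cmul F d :=
          sum_le_sum_of_subset_of_nonneg h1 fun d _ _ => hnn d
      _ ≤ ∑ d ∈ n.divisors, cmul F d + ∑ d ∈ n.divisors.image (p * ·), cmul F d := by
          rw [← sum_union_inter]
          exact le_add_of_nonneg_right (sum_nonneg fun d _ => hnn d)
      _ = (F p + 1) * ∑ d ∈ n.divisors, cmul F d := by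
          rw [sum_image fun a _ b _ h => Nat.eq_of_mul_eq_mul_left hp.pos h]
          simp only [map_mul, cmul_prime F hp, ← mul_sum]
          ring
      _ ≤ (F p + 1) * cmul (fun p => F p + 1) n := by
          have := h0 p
          gcongr
          exact ih hn0
      _ = _ := by rw [map_mul, cmul_prime _ hp]

/-- `linkDiv X Y u` is the common factor of `X / gcd X Y` and `u`. -/
def linkDiv (X Y u : ℕ) : ℕ := (X / X.gcd Y).gcd u

/-- The part of `X` that is new relative to `Y` and `u`. -/
def linkNew (X Y u : ℕ) : ℕ := X / X.gcd Y / linkDiv X Y u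

/-- For a list of pairs with `A = ∏ (p + 1)` and `B = ∏ (q + 1)`, the triple of `lcm A B / A`,
`lcm A B / B` and `lcm A B`. -/
def pairState : List (ℕ × ℕ) → ℕ × ℕ × ℕ
  | [] => (1, 1, 1)
  | x :: l =>
    (linkNew (x.2 + 1) (x.1 + 1) (pairState l).2.1 *
        ((pairState l).1 / linkDiv (x.1 + 1) (x.2 + 1) (pairState l).1),
      linkNew (x.1 + 1) (x.2 + 1) (pairState l).1 *
        ((pairState l).2.1 / linkDiv (x.2 + 1) (x.1 + 1) (pairState l).2.1),
      linkNew (x.1 + 1) (x.2 + 1) (pairState l).1 * linkNew (x.2 + 1) (x.1 + 1) (pairState l).2.1 *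
        (x.1 + 1).gcd (x.2 + 1) * (pairState l).2.2)

lemma linkNew_mul_linkDiv_mul_gcd (X Y u : ℕ) :
    linkNew X Y u * linkDiv X Y u * X.gcd Y = X := by
  rw [linkNew, linkDiv, Nat.div_mul_cancel (Nat.gcd_dvd_left _ _), Nat.div_mul_cancel (Nat.gcd_dvd_left _ _)]

lemma linkDiv_dvd (X Y u : ℕ) : linkDiv X Y u ∣ u := Nat.gcd_dvd_right _ _

lemma linkDiv_pos (X Y : ℕ) {u : ℕ} (hu : 0 < u) : 0 < linkDiv X Y u := Nat.gcd_pos_of_pos_right _ hu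

lemma pairState_facts (l : List (ℕ × ℕ)) : (pairState l).1.Coprime (pairState l).2.1 ∧
    0 < (pairState l).2.2 ∧ (pairState l).1 * shiftProd (l.map Prod.fst) = (pairState l).2.2 ∧
    (pairState l).2.1 * shiftProd (l.map Prod.snd) = (pairState l).2.2 := by
  induction l with
  | nil => simp [pairState, shiftProd]
  | cons x l ih =>
    obtain ⟨hc, hm, h1, h2⟩ := ih
    simp only [pairState, List.map_cons, shiftProd_cons]
    set u := (pairState l).1
    set v := (pairState l).2.1
    set m := (pairState l).2.2
    set A := shiftProd (l.map Prod.fst)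
    set B := shiftProd (l.map Prod.snd)
    have hu : 0 < u := Nat.pos_of_ne_zero fun h => by rw [h, zero_mul] at h1; omega
    have hv : 0 < v := Nat.pos_of_ne_zero fun h => by rw [h, zero_mul] at h2; omega
    set X := x.1 + 1 with hX
    set Y := x.2 + 1 with hY
    have hXY : Y.gcd X = X.gcd Y := Nat.gcd_comm Y X
    have e1 := linkNew_mul_linkDiv_mul_gcd X Y u
    have e2 := linkNew_mul_linkDiv_mul_gcd Y X v
    have hg : 0 < X.gcd Y := Nat.gcd_pos_of_pos_left _ (Nat.succ_pos _)
    have hα := linkDiv_pos X Y hu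
    have hβ := linkDiv_pos Y X hv
    have c0 : (X / X.gcd Y).Coprime (Y / X.gcd Y) := Nat.coprime_div_gcd_div_gcd hg
    have c1 : (linkNew X Y u).Coprime (linkNew Y X v) := by
      refine Nat.Coprime.of_dvd (Nat.div_dvd_of_dvd (Nat.gcd_dvd_left _ _))
        (Nat.div_dvd_of_dvd (Nat.gcd_dvd_left _ _)) ?_
      rw [hXY]; exact c0
    have c2 : (linkNew X Y u).Coprime (u / linkDiv X Y u) := Nat.coprime_div_gcd_div_gcd hα
    have c3 : (linkNew Y X v).Coprime (v / linkDiv Y X v) := Nat.coprime_div_gcd_div_gcd hβ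
    have c4 : (u / linkDiv X Y u).Coprime (v / linkDiv Y X v) :=
      Nat.Coprime.of_dvd (Nat.div_dvd_of_dvd (linkDiv_dvd _ _ _))
        (Nat.div_dvd_of_dvd (linkDiv_dvd _ _ _)) hc
    have d1 : u / linkDiv X Y u * linkDiv X Y u = u := Nat.div_mul_cancel (linkDiv_dvd _ _ _)
    have d2 : v / linkDiv Y X v * linkDiv Y X v = v := Nat.div_mul_cancel (linkDiv_dvd _ _ _)
    rw [hXY] at e2
    have hpos : 0 < linkNew X Y u ∧ 0 < linkNew Y X v := by
      constructor
      · refine Nat.pos_of_ne_zero fun h => ?_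
        rw [h] at e1; simp at e1
      · refine Nat.pos_of_ne_zero fun h => ?_
        rw [h] at e2; simp at e2
    refine ⟨Nat.Coprime.mul_left (Nat.Coprime.mul_right c1.symm c3) (Nat.Coprime.mul_right c2.symm c4),
      Nat.mul_pos (Nat.mul_pos (Nat.mul_pos hpos.1 hpos.2) hg) hm, ?_, ?_⟩
    · calc linkNew Y X v * (u / linkDiv X Y u) * (X * A)
          = linkNew Y X v * (u / linkDiv X Y u) *
            ((linkNew X Y u * linkDiv X Y u * X.gcd Y) * A) := by rw [e1]
        _ = linkNew X Y u * linkNew Y X v * X.gcd Y *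
            ((u / linkDiv X Y u * linkDiv X Y u) * A) := by ring
        _ = _ := by rw [d1, h1]
    · calc linkNew X Y u * (v / linkDiv Y X v) * (Y * B)
          = linkNew X Y u * (v / linkDiv Y X v) *
            ((linkNew Y X v * linkDiv Y X v * X.gcd Y) * B) := by rw [e2]
        _ = linkNew X Y u * linkNew Y X v * X.gcd Y *
            ((v / linkDiv Y X v * linkDiv Y X v) * B) := by ring
        _ = _ := by rw [d2, h2]

lemma pairState_dvd (l : List (ℕ × ℕ)) : (pairState l).1 ∣ shiftProd (l.map Prod.snd) ∧
    (pairState l).2.1 ∣ shiftProd (l.map Prod.fst) := by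
  obtain ⟨hc, -, h1, h2⟩ := pairState_facts l
  exact ⟨hc.dvd_of_dvd_mul_left ⟨_, by rw [h1, h2]⟩, hc.symm.dvd_of_dvd_mul_left ⟨_, by rw [h1, h2]⟩⟩

lemma pairState_of_eq {l : List (ℕ × ℕ)} (h : shiftProd (l.map Prod.fst) = shiftProd (l.map Prod.snd)) :
    pairState l = (1, 1, shiftProd (l.map Prod.fst)) := by
  obtain ⟨hc, hm, h1, h2⟩ := pairState_facts l
  have hA : 0 < shiftProd (l.map Prod.fst) := Nat.pos_of_ne_zero (shiftProd_ne_zero _)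
  have huv : (pairState l).1 = (pairState l).2.1 := by
    rw [← h2, ← h] at h1
    exact Nat.eq_of_mul_eq_mul_right hA h1
  rw [huv, Nat.coprime_self] at hc
  rw [huv, hc, one_mul] at h1
  ext
  · rw [huv, hc]
  · exact hc
  · exact h1.symm

/-- The triple of `linkNew`s and the gcd of a pair of shifted primes. -/
def linkTriple (u v : ℕ) (x : ℕ × ℕ) : ℕ × ℕ × ℕ :=
  (linkNew (x.1 + 1) (x.2 + 1) u, linkNew (x.2 + 1) (x.1 + 1) v, (x.1 + 1).gcd (x.2 + 1))

/-- The pair of `linkDiv`s of a pair of shifted primes. -/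
def linkDivs (u v : ℕ) (x : ℕ × ℕ) : ℕ × ℕ :=
  (linkDiv (x.1 + 1) (x.2 + 1) u, linkDiv (x.2 + 1) (x.1 + 1) v)

lemma linkTriple_mul (u v : ℕ) (x : ℕ × ℕ) :
    (linkTriple u v x).1 * (linkDivs u v x).1 * (linkTriple u v x).2.2 = x.1 + 1 ∧
    (linkTriple u v x).2.1 * (linkDivs u v x).2 * (linkTriple u v x).2.2 = x.2 + 1 := by
  refine ⟨linkNew_mul_linkDiv_mul_gcd _ _ _, ?_⟩
  have := linkNew_mul_linkDiv_mul_gcd (x.2 + 1) (x.1 + 1) v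
  rw [Nat.gcd_comm] at this
  exact this

/-- The summand attached to a triple `(a, b, k)`. -/
noncomputable def linkTerm (z : ℕ → ℝ) (i : ℕ) (x : ℕ × ℕ × ℕ) : ℝ :=
  cmul (fun _ => (i : ℝ)) x.1 * cmul (fun _ => (i : ℝ)) x.2.1 *
    (cmul z (x.1 * x.2.1 * x.2.2) / (x.1 * x.2.1 * x.2.2 : ℕ))

/-- The summand attached to a state `(u, v, m)`. -/
noncomputable def stateTerm (z : ℕ → ℝ) (i : ℕ) (s : ℕ × ℕ × ℕ) : ℝ :=
  cmul (fun _ => (i : ℝ)) s.1 * cmul (fun _ => (i : ℝ)) s.2.1 * (cmul z s.2.2 / (s.2.2 : ℕ))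

lemma stateTerm_nonneg {z : ℕ → ℝ} (hz : ∀ r, 0 ≤ z r) (i : ℕ) (s : ℕ × ℕ × ℕ) :
    0 ≤ stateTerm z i s := by
  have h1 := cmul_nonneg (F := fun _ => (i : ℝ)) fun _ => Nat.cast_nonneg i
  exact mul_nonneg (mul_nonneg (h1 _) (h1 _)) (div_nonneg (cmul_nonneg hz _) (Nat.cast_nonneg _))

lemma stateTerm_pairState_cons (z : ℕ → ℝ) (i : ℕ) (x : ℕ × ℕ) (l : List (ℕ × ℕ)) :
    stateTerm z i (pairState (x :: l)) =
    linkTerm z i (linkTriple (pairState l).1 (pairState l).2.1 x) *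
      (cmul (fun _ => (i : ℝ)) ((pairState l).1 / (linkDivs (pairState l).1 (pairState l).2.1 x).1) *
        cmul (fun _ => (i : ℝ)) ((pairState l).2.1 / (linkDivs (pairState l).1 (pairState l).2.1 x).2)) *
      (cmul z (pairState l).2.2 / ((pairState l).2.2 : ℕ)) := by
  simp only [pairState, stateTerm, linkTerm, linkTriple, linkDivs, map_mul, Nat.cast_mul]
  ring

lemma sum_link_le (z : ℕ → ℝ) (i : ℕ) {B : ℝ} (hB0 : 0 ≤ B) {u v : ℕ} (hu : u ≠ 0)
    (hv : v ≠ 0) (P : Finset (ℕ × ℕ))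
    (hB : ∀ α β : ℕ, α ∣ u → β ∣ v → ∀ S : Finset (ℕ × ℕ), S ⊆ P →
      (∀ x ∈ S, linkDivs u v x = (α, β)) → ∑ x ∈ S, linkTerm z i (linkTriple u v x) ≤ B) :
    ∑ x ∈ P, linkTerm z i (linkTriple u v x) *
      (cmul (fun _ => (i : ℝ)) (u / (linkDivs u v x).1) *
        cmul (fun _ => (i : ℝ)) (v / (linkDivs u v x).2)) ≤
      B * (cmul (fun _ => ((i + 1 : ℕ) : ℝ)) u * cmul (fun _ => ((i + 1 : ℕ) : ℝ)) v) := by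
  classical
  have h1 := cmul_nonneg (F := fun _ => (i : ℝ)) fun _ => Nat.cast_nonneg i
  have hdiv : ∀ w : ℕ, w ≠ 0 → ∑ d ∈ w.divisors, cmul (fun _ => (i : ℝ)) (w / d) ≤
      cmul (fun _ => ((i + 1 : ℕ) : ℝ)) w := by
    intro w hw
    rw [Nat.sum_div_divisors w (cmul fun _ => (i : ℝ))]
    refine (sum_divisors_cmul_le (fun _ => Nat.cast_nonneg i) hw).trans_eq ?_
    congr 2
    push_cast
    rfl
  have hmaps : ∀ x ∈ P, linkDivs u v x ∈ u.divisors ×ˢ v.divisors := fun x _ =>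
    mem_product.2 ⟨Nat.mem_divisors.2 ⟨linkDiv_dvd _ _ _, hu⟩, Nat.mem_divisors.2 ⟨linkDiv_dvd _ _ _, hv⟩⟩
  rw [← sum_fiberwise_of_maps_to hmaps]
  calc _ ≤ ∑ y ∈ u.divisors ×ˢ v.divisors, B * (cmul (fun _ => (i : ℝ)) (u / y.1) *
        cmul (fun _ => (i : ℝ)) (v / y.2)) := by
        refine sum_le_sum fun y hy => ?_
        have hy' := mem_product.1 hy
        have := hB y.1 y.2 (Nat.dvd_of_mem_divisors hy'.1) (Nat.dvd_of_mem_divisors hy'.2)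
          (P.filter fun x => linkDivs u v x = y) (filter_subset _ _) fun x hx => (mem_filter.1 hx).2
        calc _ = (∑ x ∈ P.filter fun x => linkDivs u v x = y, linkTerm z i (linkTriple u v x)) *
              (cmul (fun _ => (i : ℝ)) (u / y.1) * cmul (fun _ => (i : ℝ)) (v / y.2)) := by
              rw [sum_mul]
              refine sum_congr rfl fun x hx => ?_
              rw [(mem_filter.1 hx).2]
          _ ≤ _ := mul_le_mul_of_nonneg_right this (mul_nonneg (h1 _) (h1 _))
    _ = B * ((∑ d ∈ u.divisors, cmul (fun _ => (i : ℝ)) (u / d)) *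
        ∑ d ∈ v.divisors, cmul (fun _ => (i : ℝ)) (v / d)) := by
        rw [← mul_sum, sum_product, sum_mul_sum]
    _ ≤ _ := by
        refine mul_le_mul_of_nonneg_left (mul_le_mul (hdiv u hu) (hdiv v hv) ?_ ?_) hB0
        · exact sum_nonneg fun d _ => h1 _
        · exact cmul_nonneg (fun _ => Nat.cast_nonneg _) _

/-- The bound for sums over linked triples at the height `σ`. -/
def LinkBound (ρ η σ : ℝ) : Prop :=
  ∀ (i : ℕ) (z : ℕ → ℝ), (∀ r, 0 ≤ z r) → (∀ r, z r ≤ 1) →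
    (∀ r ∈ primesUpTo (scale σ), i * z r ≤ 1) → ∀ (α β : ℕ), (α : ℝ) ≤ scale (ρ * σ + 2) →
    (β : ℝ) ≤ scale (ρ * σ + 2) → ∀ S : Finset (ℕ × ℕ × ℕ), (∀ x ∈ S, IsLinked σ α β x ∧
      scale ((1 - η) * σ) ≤ (x.1 * α * x.2.2 : ℕ) ∧ scale ((1 - η) * σ) ≤ (x.2.1 * β * x.2.2 : ℕ)) →
    ∑ x ∈ S, linkTerm z i x ≤
      exp (-2 * σ + 9 * η * σ + (2 * i + 1) * ∑ r ∈ primesUpTo (scale σ), z r / r)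

/-- The primes near `scale σ`, for the exponent `η`. -/
def IsNear (η σ : ℝ) (p : ℕ) : Prop := p.Prime ∧ 2 < p ∧ (1 - η) * σ ≤ iterLog p ∧ iterLog p ≤ σ

lemma stateSum_cons_le {ρ η σ : ℝ} (hL : LinkBound ρ η σ) {i : ℕ} {z : ℕ → ℝ}
    (hz0 : ∀ r, 0 ≤ z r) (hz1 : ∀ r, z r ≤ 1) (hiz : ∀ r ∈ primesUpTo (scale σ), i * z r ≤ 1)
    {P : Finset (ℕ × ℕ)} (hP : ∀ x ∈ P, IsNear η σ x.1 ∧ IsNear η σ x.2 ∧ x.1 ≠ x.2)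
    {Ps : List (Finset (ℕ × ℕ))} (hPs : ∀ l ∈ tuples Ps,
      (shiftProd (l.map Prod.fst) : ℝ) ≤ scale (ρ * σ + 2) ∧
      (shiftProd (l.map Prod.snd) : ℝ) ≤ scale (ρ * σ + 2)) :
    ∑ l ∈ tuples (P :: Ps), stateTerm z i (pairState l) ≤
      exp (-2 * σ + 9 * η * σ + (2 * i + 1) * ∑ r ∈ primesUpTo (scale σ), z r / r) *
        ∑ l ∈ tuples Ps, stateTerm z (i + 1) (pairState l) := by
  classical
  rw [sum_tuples_cons, sum_comm, mul_sum]
  refine sum_le_sum fun l hl => ?_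
  obtain ⟨-, hm, h1, h2⟩ := pairState_facts l
  obtain ⟨hd1, hd2⟩ := pairState_dvd l
  obtain ⟨hs1, hs2⟩ := hPs l hl
  have hu : (pairState l).1 ≠ 0 := fun h => by rw [h, zero_mul] at h1; omega
  have hv : (pairState l).2.1 ≠ 0 := fun h => by rw [h, zero_mul] at h2; omega
  have hle : ∀ a d w : ℕ, a ∣ d → d ∣ w → w ≠ 0 → (w : ℝ) ≤ scale (ρ * σ + 2) →
      (a : ℝ) ≤ scale (ρ * σ + 2) := fun a d w had hdw hw hws =>
    le_trans (by exact_mod_cast Nat.le_of_dvd (Nat.pos_of_ne_zero hw) (had.trans hdw)) hws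
  simp_rw [stateTerm_pairState_cons]
  rw [← sum_mul]
  have key := sum_link_le z i (exp_pos (-2 * σ + 9 * η * σ + (2 * i + 1) *
    ∑ r ∈ primesUpTo (scale σ), z r / r)).le hu hv P ?_
  · refine (mul_le_mul_of_nonneg_right key
      (div_nonneg (cmul_nonneg hz0 _) (Nat.cast_nonneg _))).trans_eq ?_
    rw [stateTerm]
    ring
  · intro α β hα hβ S hSP hS
    have hinj : Set.InjOn (linkTriple (pairState l).1 (pairState l).2.1) S := by
      intro x hx y hy hxy
      have ex := linkTriple_mul (pairState l).1 (pairState l).2.1 x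
      have ey := linkTriple_mul (pairState l).1 (pairState l).2.1 y
      rw [hS x hx, hxy] at ex
      rw [hS y hy] at ey
      ext
      · have := ex.1.symm.trans ey.1; omega
      · have := ex.2.symm.trans ey.2; omega
    rw [← sum_image (f := linkTerm z i) hinj]
    refine hL i z hz0 hz1 hiz α β (hle α _ _ hα hd1 (shiftProd_ne_zero _) hs2)
      (hle β _ _ hβ hd2 (shiftProd_ne_zero _) hs1) _ fun t ht => ?_
    obtain ⟨x, hx, rfl⟩ := mem_image.1 ht
    obtain ⟨⟨hp, hp2, hpl, hpu⟩, ⟨hq, hq2, hql, hqu⟩, hne⟩ := hP x (hSP hx)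
    have ex := linkTriple_mul (pairState l).1 (pairState l).2.1 x
    rw [hS x hx] at ex
    have hsc : ∀ p : ℕ, 2 < p → (1 - η) * σ ≤ iterLog p → scale ((1 - η) * σ) ≤ (p + 1 : ℕ) := by
      intro p hp hle
      have hp1 : (1 : ℝ) ≤ p := by exact_mod_cast (by omega : 1 ≤ p)
      have := (scale_le_iff hp1).2 hle
      push_cast
      linarith
    refine ⟨⟨x.1, x.2, hp, hq, hne, hp2, hq2, hpu, hqu, ex.1, ex.2⟩, ?_, ?_⟩
    · rw [ex.1]; exact hsc _ hp2 hpl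
    · rw [ex.2]; exact hsc _ hq2 hql

/-- The number of entries `s` of the list with `r` a prime up to `scale s`. -/
noncomputable def level : List ℝ → ℕ → ℕ
  | [], _ => 0
  | s :: ss, r => level ss r + if r ∈ primesUpTo (scale s) then 1 else 0

/-- A list of heights, all at least `A`, decreasing by factors at most `ρ`. -/
def IsLadder (ρ A : ℝ) (ss : List ℝ) : Prop := ss.Pairwise (fun s t => t ≤ ρ * s) ∧ ∀ s ∈ ss, A ≤ s

lemma isLadder_cons {ρ A s : ℝ} {ss : List ℝ} :
    IsLadder ρ A (s :: ss) ↔ (A ≤ s ∧ ∀ t ∈ ss, t ≤ ρ * s) ∧ IsLadder ρ A ss := by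
  simp only [IsLadder, List.pairwise_cons, List.mem_cons, forall_eq_or_imp]
  tauto

lemma exists_of_level_ne_zero {ss : List ℝ} {r : ℕ} (h : level ss r ≠ 0) :
    ∃ s ∈ ss, r ∈ primesUpTo (scale s) := by
  induction ss with
  | nil => exact absurd rfl h
  | cons s ss ih =>
    by_cases hr : r ∈ primesUpTo (scale s)
    · exact ⟨s, by simp, hr⟩
    · rw [level, if_neg hr, add_zero] at h
      obtain ⟨t, ht, hr'⟩ := ih h
      exact ⟨t, by simp [ht], hr'⟩

lemma level_eq_zero {ss : List ℝ} {s : ℝ} {r : ℕ} (hss : ∀ t ∈ ss, t ≤ s)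
    (hr : r ∉ primesUpTo (scale s)) : level ss r = 0 := by
  by_contra h
  obtain ⟨t, ht, hr'⟩ := exists_of_level_ne_zero h
  exact hr (primesUpTo_mono (scale_le_scale.2 (hss t ht)) hr')

/-- A cell of pairs of distinct primes near `scale s`, normal up to `ε`. -/
def IsCell (η ε : ℝ) (P : Finset (ℕ × ℕ)) (s : ℝ) : Prop :=
  ∀ x ∈ P, (IsNear η s x.1 ∧ IsNear η s x.2 ∧ x.1 ≠ x.2) ∧ IsNormal ε s x.1 ∧ IsNormal ε s x.2

lemma forall₂_of_mem_tuples {η ε : ℝ} {Ps : List (Finset (ℕ × ℕ))} {ss : List ℝ}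
    (hPs : List.Forall₂ (IsCell η ε) Ps ss) : ∀ l ∈ tuples Ps,
    List.Forall₂ (fun p s => IsNormal ε s p ∧ IsNear η s p) (l.map Prod.fst) ss ∧
    List.Forall₂ (fun p s => IsNormal ε s p ∧ IsNear η s p) (l.map Prod.snd) ss := by
  induction hPs with
  | nil => intro l hl; rw [tuples, mem_singleton] at hl; subst hl; exact ⟨.nil, .nil⟩
  | @cons P s Ps ss hP hPs ih =>
    intro l hl
    obtain ⟨x, hx, l', hl', rfl⟩ := mem_tuples_cons.1 hl
    exact ⟨.cons ⟨(hP x hx).2.1, (hP x hx).1.1⟩ (ih l' hl').1,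
      .cons ⟨(hP x hx).2.2, (hP x hx).1.2.1⟩ (ih l' hl').2⟩

lemma shiftProd_le_scale {η ε : ℝ} {ps : List ℕ} {ss : List ℝ}
    (h : List.Forall₂ (fun p s => IsNormal ε s p ∧ IsNear η s p) ps ss) : ∀ {u : ℝ}, 0 ≤ u →
    ss.Pairwise (fun s t => t + 2 ≤ s) → (∀ s ∈ ss, 0 ≤ s ∧ s + 2 ≤ u) →
    (shiftProd ps : ℝ) ≤ scale u := by
  induction h with
  | nil => intro u hu _ _; simpa [shiftProd] using one_le_scale hu
  | @cons p s ps ss hp hps ih =>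
    intro u hu hw hss
    rw [List.pairwise_cons] at hw
    have hs := hss s (by simp)
    have hM := ih hs.1 hw.2 fun t ht => ⟨(hss t (by simp [ht])).1, hw.1 t ht⟩
    have hp1 : (1 : ℝ) ≤ p := by exact_mod_cast hp.2.1.one_le
    have h3 : (p : ℝ) ≤ scale s := (le_scale_iff hp1).2 hp.2.2.2.2
    have h4 := scale_add_one_le hs.1
    have h5 : scale s ≤ scale (s + 1) := by linarith
    have h6 := scale_sub_one_sq_le (s + 2)
    rw [show s + 2 - 1 = s + 1 by ring] at h6
    rw [shiftProd_cons]
    push_cast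
    calc ((p : ℝ) + 1) * shiftProd ps ≤ scale (s + 1) * scale (s + 1) :=
          (mul_le_mul_of_nonneg_left hM (by linarith)).trans (mul_le_mul (by linarith) h5
            (scale_pos s).le (scale_pos _).le)
      _ ≤ scale (s + 2) := by rw [← sq]; exact h6
      _ ≤ _ := scale_le_scale.2 hs.2

lemma IsLadder.pairwise_add_two_le {ρ A : ℝ} {ss : List ℝ} (h : IsLadder ρ A ss) (hρ : ρ < 1)
    (hA : 2 ≤ (1 - ρ) * A) : ss.Pairwise (fun s t => t + 2 ≤ s) := by
  refine h.1.imp_of_mem fun {s t} hs _ hst => ?_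
  have h1 := h.2 s hs
  have h2 : (1 - ρ) * A ≤ (1 - ρ) * s := mul_le_mul_of_nonneg_left h1 (by linarith)
  linarith

lemma sum_stateTerm_le {ρ η ε A : ℝ} (hρ0 : 0 < ρ) (hρ : ρ < 1) (hA0 : 0 ≤ A) (hA : 2 ≤ (1 - ρ) * A)
    (hL : ∀ s, A ≤ s → LinkBound ρ η s) {z : ℕ → ℝ} (hz0 : ∀ r, 0 ≤ z r) (hz1 : ∀ r, z r ≤ 1)
    (R : Finset ℕ) {Ps : List (Finset (ℕ × ℕ))} {ss : List ℝ}
    (hPs : List.Forall₂ (IsCell η ε) Ps ss) : ∀ i : ℕ, IsLadder ρ A ss →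
    (∀ r, level ss r ≠ 0 → (i + level ss r) * z r ≤ 1) → (∀ s ∈ ss, primesUpTo (scale s) ⊆ R) →
    ∑ l ∈ tuples Ps, stateTerm z i (pairState l) ≤ exp ((ss.map fun s => -2 * s + 9 * η * s).sum +
      ∑ r ∈ R, level ss r * (level ss r + 2 * i) * (z r / r)) := by
  induction hPs with
  | nil => intro i _ _ _; simp [tuples, pairState, stateTerm, level]
  | @cons P s Ps ss hP hPs ih =>
    intro i hss hlev hR
    obtain ⟨⟨hs, hts⟩, hss'⟩ := isLadder_cons.1 hss
    have hs0 : 0 ≤ s := hA0.trans hs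
    have hts' : ∀ t ∈ ss, t ≤ s := fun t ht => (hts t ht).trans (mul_le_of_le_one_left hs0 hρ.le)
    have hmono : ∀ r, level ss r ≠ 0 → r ∈ primesUpTo (scale s) := by
      intro r hr
      by_contra h
      exact hr (level_eq_zero hts' h)
    have hsr : primesUpTo (scale s) ⊆ R := hR s (by simp)
    have step := stateSum_cons_le (hL s hs) (i := i) hz0 hz1 (fun r hr => ?_)
      (fun x hx => (hP x hx).1) (Ps := Ps) fun l hl => ?_
    · have hi := ih (i + 1) hss' (fun r hr => ?_) fun t ht => hR t (by simp [ht])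
      · refine step.trans ((mul_le_mul_of_nonneg_left hi (exp_pos _).le).trans_eq ?_)
        rw [← exp_add, List.map_cons, List.sum_cons]
        congr 1
        have h1 : ∑ r ∈ primesUpTo (scale s), z r / r =
            ∑ r ∈ R, if r ∈ primesUpTo (scale s) then z r / r else 0 := by
          rw [← sum_filter]
          refine sum_congr ?_ fun _ _ => rfl
          ext r
          simp only [mem_filter]
          exact ⟨fun h => ⟨hsr h, h⟩, fun h => h.2⟩
        have h2 : (2 * (i : ℝ) + 1) * ∑ r ∈ primesUpTo (scale s), z r / r +
            ∑ r ∈ R, level ss r * (level ss r + 2 * ((i + 1 : ℕ) : ℝ)) * (z r / r) =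
            ∑ r ∈ R, level (s :: ss) r * (level (s :: ss) r + 2 * (i : ℝ)) * (z r / r) := by
          rw [h1, mul_sum, ← sum_add_distrib]
          refine sum_congr rfl fun r _ => ?_
          rw [level]
          split_ifs with h
          · push_cast; ring
          · rw [level_eq_zero hts' h]; simp
        linarith
      · have := hlev r
        rw [level, if_pos (hmono r hr)] at this
        have := this (by omega)
        push_cast at this ⊢
        linarith
    · have := hlev r
      rw [level, if_pos hr] at this
      have := this (by omega)
      push_cast at this
      have h3 : 0 ≤ ((level ss r : ℝ) + 1) * z r := mul_nonneg (by positivity) (hz0 r)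
      linarith
    · have hu : 0 ≤ ρ * s + 2 := by have := mul_nonneg hρ0.le hs0; linarith
      have hss2 : ∀ t ∈ ss, 0 ≤ t ∧ t + 2 ≤ ρ * s + 2 := fun t ht =>
        ⟨hA0.trans (hss'.2 t ht), by linarith [hts t ht]⟩
      have hp := hss'.pairwise_add_two_le hρ hA
      have hf := forall₂_of_mem_tuples hPs l hl
      exact ⟨shiftProd_le_scale hf.1 hu hp hss2, shiftProd_le_scale hf.2 hu hp hss2⟩

lemma sum_level_div (R : Finset ℕ) {ss : List ℝ} (hR : ∀ s ∈ ss, primesUpTo (scale s) ⊆ R) :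
    ∑ r ∈ R, (level ss r : ℝ) / r = (ss.map fun s => primeRecipSum (scale s)).sum := by
  induction ss with
  | nil => simp [level]
  | cons s ss ih =>
    rw [List.map_cons, List.sum_cons, ← ih fun t ht => hR t (by simp [ht])]
    have h1 : primeRecipSum (scale s) = ∑ r ∈ R, if r ∈ primesUpTo (scale s) then 1 / (r : ℝ) else 0 := by
      rw [primeRecipSum, ← sum_filter]
      refine sum_congr ?_ fun _ _ => rfl
      ext r
      simp only [mem_filter]
      exact ⟨fun h => ⟨hR s (by simp) h, h⟩, fun h => h.2⟩
    rw [h1, ← sum_add_distrib]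
    refine sum_congr rfl fun r _ => ?_
    rw [level]
    split_ifs
    · push_cast; ring
    · simp

lemma exists_sum_stateTerm_level_le : ∃ C : ℝ, 0 < C ∧ ∀ {ρ η ε A : ℝ}, 0 < ρ → ρ < 1 → 0 ≤ A →
    2 ≤ (1 - ρ) * A → (∀ s, A ≤ s → LinkBound ρ η s) → ∀ {Ps : List (Finset (ℕ × ℕ))} {ss : List ℝ},
    List.Forall₂ (IsCell η ε) Ps ss → IsLadder ρ A ss →
    ∑ l ∈ tuples Ps, stateTerm (fun r => 1 / (level ss r : ℝ)) 0 (pairState l) ≤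
      exp (ss.map fun s => -s + 9 * η * s + C).sum := by
  obtain ⟨C, hC, hM, -⟩ := exists_abs_sum_primesIoc_le
  refine ⟨C, hC, fun {ρ η ε A} hρ0 hρ hA0 hA hL {Ps ss} hPs hss => ?_⟩
  classical
  set R := ss.toFinset.biUnion fun s => primesUpTo (scale s)
  have hR : ∀ s ∈ ss, primesUpTo (scale s) ⊆ R := fun s hs r hr =>
    mem_biUnion.2 ⟨s, List.mem_toFinset.2 hs, hr⟩
  have h := sum_stateTerm_le hρ0 hρ hA0 hA hL (z := fun r => 1 / (level ss r : ℝ))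
    (fun r => by positivity) (fun r => ?_) R hPs 0 hss (fun r hr => ?_) hR
  · refine h.trans (exp_le_exp.2 ?_)
    have h1 : ∑ r ∈ R, (level ss r : ℝ) * (level ss r + 2 * ((0 : ℕ) : ℝ)) * (1 / (level ss r : ℝ) / r) =
        ∑ r ∈ R, (level ss r : ℝ) / r := by
      refine sum_congr rfl fun r _ => ?_
      rcases eq_or_ne (level ss r : ℝ) 0 with h0 | h0
      · rw [h0]; simp
      · field_simp; simp
    rw [h1, sum_level_div R hR]
    clear h h1 hR hPs
    induction ss with
    | nil => simp
    | cons s ss ih =>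
      have hs := isLadder_cons.1 hss
      have := ih hs.2
      have h2 := (abs_le.1 (hM s (hA0.trans hs.1.1))).2
      simp only [List.map_cons, List.sum_cons]
      linarith
  · rcases Nat.eq_zero_or_pos (level ss r) with h0 | h0
    · rw [h0]; simp
    · exact div_le_one_of_le₀ (by exact_mod_cast h0) (by positivity)
  · have : (level ss r : ℝ) ≠ 0 := by exact_mod_cast hr
    simp [this]

/-- The sum of the entries of a list, the `m`-th one weighted by `w m`. -/
def wsum : (ℕ → ℝ) → List ℝ → ℝ
  | _, [] => 0
  | w, s :: ss => w 0 * s + wsum (fun m => w (m + 1)) ss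

lemma wsum_add (v w : ℕ → ℝ) (ss : List ℝ) : wsum (fun m => v m + w m) ss = wsum v ss + wsum w ss := by
  induction ss generalizing v w with
  | nil => simp [wsum]
  | cons s ss ih => rw [wsum, wsum, wsum, ih]; ring

lemma wsum_const (c : ℝ) (ss : List ℝ) : wsum (fun _ => c) ss = c * ss.sum := by
  induction ss with
  | nil => simp [wsum]
  | cons s ss ih => rw [wsum, ih, List.sum_cons]; ring

lemma wsum_map_affine (w : ℕ → ℝ) (a b : ℝ) (ss : List ℝ) :
    wsum w (ss.map fun s => a * s + b) = a * wsum w ss + b * ∑ m ∈ range ss.length, w m := by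
  induction ss generalizing w with
  | nil => simp [wsum]
  | cons s ss ih =>
    rw [List.map_cons, wsum, wsum, ih, List.length_cons, sum_range_succ']
    ring

lemma wsum_le {ρ A : ℝ} (hρ : 0 ≤ ρ) {ss : List ℝ} (w : ℕ → ℝ) (hw : ∀ m, 0 ≤ w m) {σ : ℝ}
    (hss : IsLadder ρ A ss) (hσ : ∀ s ∈ ss, s ≤ σ) :
    wsum w ss ≤ σ * ∑ m ∈ range ss.length, w m * ρ ^ m := by
  induction ss generalizing w σ with
  | nil => simp [wsum]
  | cons s ss ih =>
    have h := isLadder_cons.1 hss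
    have hs := hσ s (by simp)
    have := ih (fun m => w (m + 1)) (fun m => hw _) h.2 (σ := ρ * σ) fun t ht =>
      (h.1.2 t ht).trans (mul_le_mul_of_nonneg_left hs hρ)
    rw [wsum, List.length_cons, sum_range_succ']
    calc w 0 * s + wsum (fun m => w (m + 1)) ss
        ≤ w 0 * σ + ρ * σ * ∑ m ∈ range ss.length, w (m + 1) * ρ ^ m :=
          add_le_add (mul_le_mul_of_nonneg_left hs (hw 0)) this
      _ = _ := by
          simp only [mul_add, mul_sum]
          rw [add_comm]
          congr 1
          · exact sum_congr rfl fun m _ => by ring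
          · ring

/-- The increments of the logarithm. -/
noncomputable def logStep (k : ℕ) : ℝ := log (k + 1) - log k

lemma logStep_nonneg (k : ℕ) : 0 ≤ logStep k := by
  rcases Nat.eq_zero_or_pos k with rfl | hk
  · simp [logStep]
  · have : (0 : ℝ) < k := by exact_mod_cast hk
    exact sub_nonneg.2 (log_le_log this (by linarith))

/-- A logarithm of a shifted level, as a sum of logarithmic steps. -/
noncomputable def logLevel : ℕ → List ℝ → ℕ → ℝ
  | _, [], _ => 0
  | i, s :: ss, n => logStep i * omegaFin (primesUpTo (scale s)) n + logLevel (i + 1) ss n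

lemma omegaFin_mul (I : Finset ℕ) {m n : ℕ} (hm : m ≠ 0) (hn : n ≠ 0) :
    omegaFin I (m * n) = omegaFin I m + omegaFin I n := by
  rw [omegaFin, omegaFin, omegaFin, ← List.length_append, ← List.filter_append]
  exact ((Nat.perm_primeFactorsList_mul hm hn).filter _).length_eq

lemma omegaFin_prime (I : Finset ℕ) {p : ℕ} (hp : p.Prime) : omegaFin I p = if p ∈ I then 1 else 0 := by
  rw [omegaFin, Nat.primeFactorsList_prime hp, List.filter_singleton]
  split_ifs <;> simp_all

lemma logLevel_mul (i : ℕ) (ss : List ℝ) {m n : ℕ} (hm : m ≠ 0) (hn : n ≠ 0) :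
    logLevel i ss (m * n) = logLevel i ss m + logLevel i ss n := by
  induction ss generalizing i with
  | nil => simp [logLevel]
  | cons s ss ih => rw [logLevel, logLevel, logLevel, ih, omegaFin_mul _ hm hn]; push_cast; ring

lemma logLevel_one (i : ℕ) (ss : List ℝ) : logLevel i ss 1 = 0 := by
  induction ss generalizing i with
  | nil => rfl
  | cons s ss ih => simp [logLevel, ih, omegaFin]

lemma logLevel_prime (i : ℕ) {ss : List ℝ} (hss : ss.Pairwise fun s t => t ≤ s) {p : ℕ} (hp : p.Prime) :
    logLevel i ss p = log ((i + level ss p : ℕ) : ℝ) - log i := by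
  induction ss generalizing i with
  | nil => simp [logLevel, level]
  | cons s ss ih =>
    rw [List.pairwise_cons] at hss
    rw [logLevel, level, ih _ hss.2, omegaFin_prime _ hp, logStep]
    split_ifs with h
    · rw [show i + (level ss p + 1) = i + 1 + level ss p by ring]
      push_cast
      ring
    · rw [level_eq_zero hss.1 h]
      simp

lemma cmul_inv_level {ss : List ℝ} (hss : ss.Pairwise fun s t => t ≤ s) {n : ℕ} (hn : n ≠ 0)
    (h : ∀ p, p.Prime → p ∣ n → level ss p ≠ 0) :
    cmul (fun r => 1 / (level ss r : ℝ)) n = exp (-logLevel 0 ss n) := by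
  induction n using Nat.recOnMul with
  | zero => exact absurd rfl hn
  | one => simp [logLevel_one]
  | prime p hp =>
    have h0 := h p hp dvd_rfl
    have h1 : (0 : ℝ) < level ss p := by exact_mod_cast Nat.pos_of_ne_zero h0
    rw [cmul_prime _ hp, logLevel_prime 0 hss hp]
    simp [exp_neg, exp_log h1]
  | mul a b ha hb =>
    have ha0 : a ≠ 0 := left_ne_zero_of_mul hn
    have hb0 : b ≠ 0 := right_ne_zero_of_mul hn
    rw [map_mul, ha ha0 fun p hp hd => h p hp (hd.mul_right _),
      hb hb0 fun p hp hd => h p hp (hd.mul_left _), logLevel_mul 0 ss ha0 hb0, ← exp_add]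
    congr 1
    ring

lemma IsNormal.omegaFin_le {ε η s : ℝ} {p : ℕ} (h : IsNormal ε s p) (hp : IsNear η s p) (hs : 0 ≤ s)
    (I : Finset ℕ) : (omegaFin I (p + 1) : ℝ) ≤ (1 + ε) * s + √s := by
  refine le_trans ?_ (h s hs le_rfl)
  norm_cast
  rw [omegaFin, omegaFin, ← List.countP_eq_length_filter, ← List.countP_eq_length_filter]
  refine List.countP_mono_left fun r hr _ => ?_
  have hr' := Nat.prime_of_mem_primeFactorsList hr
  have h1 := prime_le_of_dvd_succ hp.1 hp.2.1 hr' (Nat.dvd_of_mem_primeFactorsList hr)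
  have h2 := (le_scale_iff (t := s) (by exact_mod_cast hp.1.one_le)).2 hp.2.2.2
  simp only [decide_eq_true_eq]
  exact mem_primesUpTo.2 ⟨hr', le_trans (by exact_mod_cast h1) h2⟩

/-- The weights of the total logarithmic level of a ladder of normal primes. -/
noncomputable def stepWeight (i m : ℕ) : ℝ := (m + 1) * logStep (i + m) + log (i + m : ℕ) - log i

lemma stepWeight_zero (m : ℕ) : stepWeight 0 m = fordCoeff m + 1 := by
  simp only [stepWeight, logStep, fordCoeff, zero_add, Nat.cast_zero, log_zero]
  ring

lemma logLevel_le {ε σ s : ℝ} {p : ℕ} (h : IsNormal ε s p) (hsσ : s ≤ σ) (i : ℕ) {ss : List ℝ}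
    (hss : ∀ t ∈ ss, 0 ≤ t ∧ t ≤ s) :
    logLevel i ss (p + 1) ≤ wsum (fun m => logStep (i + m)) (ss.map fun s => (1 + ε) * s + √σ) := by
  induction ss generalizing i with
  | nil => simp [logLevel, wsum]
  | cons t ss ih =>
    have ht := hss t (by simp)
    have h1 := (h t ht.1 ht.2).trans (add_le_add_right (sqrt_le_sqrt hsσ) _)
    have h2 := ih (i + 1) fun t ht => hss t (by simp [ht])
    rw [logLevel, List.map_cons, wsum]
    refine add_le_add (mul_le_mul_of_nonneg_left h1 (logStep_nonneg i)) (h2.trans_eq ?_)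
    congr 1
    funext m
    congr 1
    ring

lemma sum_logLevel_le {ε η σ : ℝ} {ps : List ℕ} {ss : List ℝ}
    (h : List.Forall₂ (fun p s => IsNormal ε s p ∧ IsNear η s p) ps ss) : ∀ i : ℕ,
    ss.Pairwise (fun s t => t ≤ s) → (∀ s ∈ ss, 0 ≤ s ∧ s ≤ σ) →
    (ps.map fun p => logLevel i ss (p + 1)).sum ≤
      wsum (stepWeight i) (ss.map fun s => (1 + ε) * s + √σ) := by
  induction h with
  | nil => simp [wsum]
  | @cons p s ps ss hp hps ih =>
    intro i hdec hss
    rw [List.pairwise_cons] at hdec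
    have hs := hss s (by simp)
    have h1 := (hp.1.omegaFin_le hp.2 hs.1 (primesUpTo (scale s))).trans (add_le_add_right (sqrt_le_sqrt hs.2) _)
    have h2 := logLevel_le hp.1 hs.2 (i + 1) (ss := ss) fun t ht => ⟨(hss t (by simp [ht])).1, hdec.1 t ht⟩
    have h3 := ih (i + 1) hdec.2 fun t ht => hss t (by simp [ht])
    have h4 : (ps.map fun p => logStep i * (omegaFin (primesUpTo (scale s)) (p + 1) : ℝ)).sum ≤
        wsum (fun _ => logStep i) (ss.map fun s => (1 + ε) * s + √σ) := by
      have hss' : ∀ t ∈ ss, 0 ≤ t ∧ t ≤ σ := fun t ht => hss t (by simp [ht])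
      clear ih h3 h2 hdec hss
      induction hps with
      | nil => simp [wsum]
      | @cons q t ps ss hq hqs ih =>
        have ht := hss' t (by simp)
        have h5 := (hq.1.omegaFin_le hq.2 ht.1 (primesUpTo (scale s))).trans (add_le_add_right (sqrt_le_sqrt ht.2) _)
        rw [List.map_cons, List.sum_cons, List.map_cons, wsum]
        exact add_le_add (mul_le_mul_of_nonneg_left h5 (logStep_nonneg i))
          (ih fun t ht => hss' t (by simp [ht]))
    have h6 : (ps.map fun p => logLevel i (s :: ss) (p + 1)).sum =
        (ps.map fun p => logStep i * (omegaFin (primesUpTo (scale s)) (p + 1) : ℝ)).sum +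
        (ps.map fun p => logLevel (i + 1) ss (p + 1)).sum := by
      rw [← List.sum_map_add]
      rfl
    rw [List.map_cons, List.sum_cons, h6, logLevel, List.map_cons, wsum]
    have h7 : wsum (fun m => stepWeight i (m + 1)) (ss.map fun s => (1 + ε) * s + √σ) =
        wsum (fun m => logStep (i + 1 + m)) (ss.map fun s => (1 + ε) * s + √σ) +
        (wsum (fun _ => logStep i) (ss.map fun s => (1 + ε) * s + √σ) +
        wsum (stepWeight (i + 1)) (ss.map fun s => (1 + ε) * s + √σ)) := by
      rw [← wsum_add, ← wsum_add]
      congr 1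
      funext m
      rw [stepWeight, stepWeight, show i + (m + 1) = i + 1 + m by ring]
      simp only [logStep]
      push_cast
      ring
    have h8 : stepWeight i 0 = logStep i := by simp [stepWeight]
    have h9 := mul_le_mul_of_nonneg_left h1 (logStep_nonneg i)
    rw [h7, h8]
    linarith

lemma sum_fordCoeff_add_one (n : ℕ) : ∑ m ∈ range n, (fordCoeff m + 1) = n * log n := by
  induction n with
  | zero => simp
  | succ n ih => rw [sum_range_succ, ih, fordCoeff]; push_cast; ring

lemma IsLadder.one_le {ρ A s : ℝ} (hρ : 0 ≤ ρ) {ss : List ℝ} (h : IsLadder ρ A (s :: ss)) (hA : 1 ≤ A) :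
    1 ≤ ρ ^ ss.length * s := by
  induction ss generalizing s with
  | nil => simpa using hA.trans (isLadder_cons.1 h).1.1
  | cons t ss ih =>
    have h' := isLadder_cons.1 h
    have := ih h'.2
    have h2 := h'.1.2 t (by simp)
    rw [List.length_cons, pow_succ, mul_assoc]
    exact this.trans (mul_le_mul_of_nonneg_left h2 (pow_nonneg hρ _))

lemma exists_length_sq_le {ρ c : ℝ} (hρ0 : 0 < ρ) (hρ : ρ < 1) (hc : 0 < c) : ∃ A : ℝ, 1 ≤ A ∧
    ∀ s ss, IsLadder ρ A (s :: ss) → ((ss.length : ℝ) + 1) ^ 2 ≤ c * √s := by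
  have hl : 0 < log ρ⁻¹ := log_pos ((one_lt_inv₀ hρ0).2 hρ)
  obtain ⟨C, hC, h⟩ := pow_le_mul_exp 6 hl
  refine ⟨max 1 (C ^ 2 / c ^ 6), le_max_left _ _, fun s ss hss => ?_⟩
  have h1 := hss.one_le hρ0.le (le_max_left _ _)
  have hs := (le_max_right _ _).trans (isLadder_cons.1 hss).1.1
  have hs1 := (le_max_left _ _).trans (isLadder_cons.1 hss).1.1
  have h2 := h ss.length (Nat.cast_nonneg _)
  rw [mul_comm (log ρ⁻¹), exp_nat_mul, exp_log (inv_pos.2 hρ0), inv_pow] at h2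
  have h3 : (ρ ^ ss.length)⁻¹ ≤ s := (inv_le_iff_one_le_mul₀' (pow_pos hρ0 _)).2 h1
  have h4 : (1 + (ss.length : ℝ)) ^ 6 ≤ C * s := h2.trans (mul_le_mul_of_nonneg_left h3 (by linarith))
  have hsq : √s ^ 2 = s := sq_sqrt (by linarith)
  refine le_of_pow_le_pow_left₀ (n := 6) (by norm_num) (by positivity) ?_
  calc (((ss.length : ℝ) + 1) ^ 2) ^ 6 = ((1 + (ss.length : ℝ)) ^ 6) ^ 2 := by ring
    _ ≤ (C * s) ^ 2 := pow_le_pow_left₀ (by positivity) h4 2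
    _ = C ^ 2 * s ^ 2 := by ring
    _ ≤ (c ^ 6 * s) * s ^ 2 := by
        rw [div_le_iff₀ (by positivity)] at hs
        gcongr
        linarith
    _ = c ^ 6 * (√s ^ 2) ^ 3 := by rw [hsq]; ring
    _ = _ := by ring

lemma logLevel_shiftProd (i : ℕ) (ss : List ℝ) (ps : List ℕ) :
    logLevel i ss (shiftProd ps) = (ps.map fun p => logLevel i ss (p + 1)).sum := by
  induction ps with
  | nil => exact logLevel_one i ss
  | cons p ps ih =>
    rw [shiftProd_cons, logLevel_mul i ss (Nat.succ_ne_zero p) (shiftProd_ne_zero ps), ih, List.map_cons,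
      List.sum_cons]

lemma level_ne_zero_of_dvd {ε η : ℝ} {ps : List ℕ} {ss : List ℝ}
    (h : List.Forall₂ (fun p s => IsNormal ε s p ∧ IsNear η s p) ps ss) {r : ℕ} (hr : r.Prime)
    (hd : r ∣ shiftProd ps) : level ss r ≠ 0 := by
  induction h with
  | nil => simp [shiftProd] at hd; exact absurd hd hr.ne_one
  | @cons p s ps ss hp hps ih =>
    rw [shiftProd_cons, hr.dvd_mul] at hd
    rw [level]
    rcases hd with hd | hd
    · have h1 := prime_le_of_dvd_succ hp.2.1 hp.2.2.1 hr hd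
      have h2 := (le_scale_iff (t := s) (by exact_mod_cast hp.2.1.one_le)).2 hp.2.2.2.2
      rw [if_pos (mem_primesUpTo.2 ⟨hr, le_trans (by exact_mod_cast h1) h2⟩)]
      omega
    · have := ih hd
      omega

/-- The sum of the reciprocals of the common values of pairs of products. -/
noncomputable def coincSum (Ps : List (Finset (ℕ × ℕ))) : ℝ :=
  ∑ l ∈ tuples Ps, if shiftProd (l.map Prod.fst) = shiftProd (l.map Prod.snd) then
    1 / (shiftProd (l.map Prod.fst) : ℝ) else 0

lemma exponent_le {ρ δ ε η C A s : ℝ} (hρ0 : 0 < ρ) (hρ : ρ < 1) (hε : 0 < ε) (hη : 0 < η)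
    (hF : ∀ n, ∑ m ∈ range n, fordCoeff (m + 1) * ρ ^ (m + 1) ≤ 1 - δ)
    (hδ : (9 * η + ε) * (1 + 1 / (1 - ρ)) ≤ δ / 2) (hδ0 : 0 < δ) (hs : 0 < s) {ss : List ℝ}
    (hss : IsLadder ρ A (s :: ss)) (hlen : ((ss.length : ℝ) + 1) ^ 2 ≤ δ / 4 * √s) (hCs : C ≤ √s) :
    wsum (stepWeight 0) ((s :: ss).map fun t => (1 + ε) * t + √s) +
      ((s :: ss).map fun t => -t + 9 * η * t + C).sum ≤ 0 := by
  have hsum : ∀ l : List ℝ, (l.map fun t => -t + 9 * η * t + C).sum = (9 * η - 1) * l.sum + C * l.length := by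
    intro l
    induction l with
    | nil => simp
    | cons t l ih => rw [List.map_cons, List.sum_cons, ih, List.sum_cons, List.length_cons]; push_cast; ring
  have hw : stepWeight 0 = fun m => fordCoeff m + 1 := funext stepWeight_zero
  rw [hsum, wsum_map_affine, hw, sum_fordCoeff_add_one, List.length_cons, wsum, List.sum_cons]
  have h0 : fordCoeff 0 = -1 := by simp [fordCoeff]
  have hl := isLadder_cons.1 hss
  have h1 : (1 + ε) * wsum (fun m => fordCoeff (m + 1) + 1) ss + (9 * η - 1) * ss.sum =
      wsum (fun m => (1 + ε) * fordCoeff (m + 1) + (ε + 9 * η)) ss := by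
    rw [wsum_add, wsum_add, wsum_const, wsum_const]
    have : ∀ l : List ℝ, ∀ w : ℕ → ℝ, wsum (fun m => (1 + ε) * w m) l = (1 + ε) * wsum w l := by
      intro l
      induction l with
      | nil => simp [wsum]
      | cons t l ih => intro w; rw [wsum, wsum, ih]; ring
    rw [this]
    ring
  have h2 := wsum_le hρ0.le (fun m => (1 + ε) * fordCoeff (m + 1) + (ε + 9 * η))
    (fun m => add_nonneg (mul_nonneg (by linarith) (fordCoeff_nonneg m)) (by linarith)) hl.2 hl.1.2
  have h3 : ρ * s * ∑ m ∈ range ss.length, ((1 + ε) * fordCoeff (m + 1) + (ε + 9 * η)) * ρ ^ m =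
      s * ((1 + ε) * ∑ m ∈ range ss.length, fordCoeff (m + 1) * ρ ^ (m + 1) +
        (ε + 9 * η) * (ρ * ∑ m ∈ range ss.length, ρ ^ m)) := by
    simp only [mul_sum, ← sum_add_distrib]
    exact sum_congr rfl fun m _ => by ring
  have hgeo : ρ * ∑ m ∈ range ss.length, ρ ^ m ≤ 1 / (1 - ρ) := by
    have h4 : ∑ m ∈ range ss.length, ρ ^ m ≤ 1 / (1 - ρ) := by
      rw [geom_sum_eq hρ.ne, le_div_iff₀ (by linarith), div_mul_eq_mul_div, div_le_iff_of_neg (by linarith)]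
      have := pow_pos hρ0 ss.length
      nlinarith
    have h5 : 0 ≤ ∑ m ∈ range ss.length, ρ ^ m := sum_nonneg fun m _ => (pow_pos hρ0 m).le
    nlinarith
  have h6 : (1 + ε) * ∑ m ∈ range ss.length, fordCoeff (m + 1) * ρ ^ (m + 1) +
      (ε + 9 * η) * (ρ * ∑ m ∈ range ss.length, ρ ^ m) ≤ (1 + ε) * (1 - δ) + (ε + 9 * η) * (1 / (1 - ρ)) :=
    add_le_add (mul_le_mul_of_nonneg_left (hF _) (by linarith))
      (mul_le_mul_of_nonneg_left hgeo (by linarith))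
  have h7 : (1 + ε) * (1 - δ) + (ε + 9 * η) * (1 / (1 - ρ)) + (9 * η - 1) ≤ -(δ / 2) := by
    have : 0 < ε * δ := mul_pos hε hδ0
    nlinarith
  have hsq : √s * √s = s := mul_self_sqrt hs.le
  have hn1 : (1 : ℝ) ≤ ss.length + 1 := by linarith [Nat.cast_nonneg (α := ℝ) ss.length]
  have hlog : log ((ss.length + 1 : ℕ) : ℝ) ≤ ss.length + 1 := by
    push_cast; linarith [log_le_sub_one_of_pos (show (0 : ℝ) < ss.length + 1 by linarith)]
  have hs0 := sqrt_nonneg s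
  have h8 : √s * (((ss.length + 1 : ℕ) : ℝ) * log ((ss.length + 1 : ℕ) : ℝ)) ≤ δ / 4 * s := by
    calc _ ≤ √s * (((ss.length : ℝ) + 1) ^ 2) := by
          refine mul_le_mul_of_nonneg_left ?_ hs0
          rw [sq]
          push_cast at hlog ⊢
          exact mul_le_mul_of_nonneg_left hlog (by linarith)
      _ ≤ √s * (δ / 4 * √s) := mul_le_mul_of_nonneg_left hlen hs0
      _ = _ := by rw [mul_left_comm, hsq]
  have h9 : C * ((ss.length + 1 : ℕ) : ℝ) ≤ δ / 4 * s := by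
    calc _ ≤ √s * (((ss.length : ℝ) + 1) ^ 2) := by
          push_cast
          exact mul_le_mul hCs (by nlinarith) (by linarith) hs0
      _ ≤ √s * (δ / 4 * √s) := mul_le_mul_of_nonneg_left hlen hs0
      _ = _ := by rw [mul_left_comm, hsq]
  have h10 := mul_le_mul_of_nonneg_left (show (1 + ε) * ∑ m ∈ range ss.length, fordCoeff (m + 1) * ρ ^ (m + 1) +
      (ε + 9 * η) * (ρ * ∑ m ∈ range ss.length, ρ ^ m) ≤ -(δ / 2) - (9 * η - 1) by linarith) hs.le
  rw [h0]
  linarith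

/-- Products of shifted normal primes in widely spaced cells rarely coincide off the diagonal. -/
lemma exists_coincSum_le {ρ δ ε η : ℝ} (hρ0 : 0 < ρ) (hρ : ρ < 1 - 3 * η) (hε : 0 < ε) (hη : 0 < η)
    (hF : ∀ n, ∑ m ∈ range n, fordCoeff (m + 1) * ρ ^ (m + 1) ≤ 1 - δ) (hδ0 : 0 < δ)
    (hδ : (9 * η + ε) * (1 + 1 / (1 - ρ)) ≤ δ / 2) : ∃ A₀ : ℝ, ∀ A, A₀ ≤ A →
    ∀ (Ps : List (Finset (ℕ × ℕ))) (ss : List ℝ),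
    List.Forall₂ (IsCell η ε) Ps ss → IsLadder ρ A ss → coincSum Ps ≤ 1 := by
  have hρ1 : ρ < 1 := by linarith
  obtain ⟨C, hC, h⟩ := exists_sum_stateTerm_level_le
  obtain ⟨A₁, hA₁, hlen⟩ := exists_length_sq_le hρ0 hρ1 (show 0 < δ / 4 by linarith)
  obtain ⟨A₂, hA₂⟩ := eventually_atTop.1 (eventually_sum_linked_le hη hρ hρ0)
  refine ⟨A₁ + |A₂| + 2 / (1 - ρ) + C ^ 2, fun A hA Ps ss hPs hss => ?_⟩
  have hq : 0 < 2 / (1 - ρ) := div_pos two_pos (by linarith)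
  have a2 := abs_nonneg A₂
  have a2' := le_abs_self A₂
  have hC2 := sq_nonneg C
  rcases ss with - | ⟨s, ss⟩
  · cases hPs
    simp [coincSum, tuples, shiftProd]
  have hl := isLadder_cons.1 hss
  have hAA : A₁ ≤ A := by linarith
  have hss' : IsLadder ρ A₁ (s :: ss) := ⟨hss.1, fun t ht => hAA.trans (hss.2 t ht)⟩
  have hs : 0 < s := by linarith [hl.1.1]
  have hexp := exponent_le hρ0 hρ1 hε hη hF hδ hδ0 hs hss' (hlen s ss hss')
    (C := C) (le_sqrt_of_sq_le (by linarith [hl.1.1]))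
  have hstate := h (ε := ε) (η := η) (A := A) hρ0 hρ1 (by linarith) (by
    have : 2 / (1 - ρ) ≤ A := by linarith
    rw [div_le_iff₀ (by linarith)] at this
    linarith) (fun t ht => hA₂ t (by linarith)) hPs hss
  have hdec : (s :: ss).Pairwise fun s t => t ≤ s :=
    (hss.pairwise_add_two_le hρ1 (by
      have : 2 / (1 - ρ) ≤ A := by linarith
      rw [div_le_iff₀ (by linarith)] at this
      linarith)).imp fun h => by linarith
  have hbd : ∀ t ∈ s :: ss, 0 ≤ t ∧ t ≤ s := by
    intro t ht
    refine ⟨by linarith [hss.2 t ht], ?_⟩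
    rcases List.mem_cons.1 ht with rfl | ht
    · exact le_rfl
    · exact (List.pairwise_cons.1 hdec).1 t ht
  have hz0 : ∀ r, 0 ≤ 1 / (level (s :: ss) r : ℝ) := fun r => by positivity
  have hterm : coincSum Ps ≤ exp (wsum (stepWeight 0) ((s :: ss).map fun t => (1 + ε) * t + √s)) *
      ∑ l ∈ tuples Ps, stateTerm (fun r => 1 / (level (s :: ss) r : ℝ)) 0 (pairState l) := by
    rw [coincSum, mul_sum]
    refine sum_le_sum fun l hl => ?_
    split_ifs with heq
    · rw [pairState_of_eq heq]
      have hf := (forall₂_of_mem_tuples hPs l hl).1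
      have h1 := sum_logLevel_le hf 0 hdec hbd
      rw [← logLevel_shiftProd] at h1
      have h2 := cmul_inv_level hdec (shiftProd_ne_zero (l.map Prod.fst))
        fun p hp hd => level_ne_zero_of_dvd hf hp hd
      simp only [stateTerm, map_one, one_mul]
      rw [h2, ← mul_div_assoc, ← exp_add]
      refine div_le_div_of_nonneg_right (one_le_exp (by linarith)) (Nat.cast_nonneg _)
    · exact mul_nonneg (exp_pos _).le (stateTerm_nonneg hz0 _ _)
  calc coincSum Ps ≤ _ := hterm
    _ ≤ exp (wsum (stepWeight 0) ((s :: ss).map fun t => (1 + ε) * t + √s)) *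
        exp ((s :: ss).map fun s => -s + 9 * η * s + C).sum := mul_le_mul_of_nonneg_left hstate (exp_pos _).le
    _ ≤ 1 := by rw [← exp_add]; exact exp_le_one_iff.2 hexp

lemma sum_tuples_le_prod {Qs : List (Finset ℕ)} : ∀ G : List (ℕ × ℕ) → ℝ,
    (∀ (l₁ l₂ : List (ℕ × ℕ)) (p : ℕ), G (l₁ ++ (p, p) :: l₂) = 1 / ((p : ℝ) + 1) * G (l₁ ++ l₂)) →
    (∀ Qs' : List (Finset ℕ), Qs'.Sublist Qs → ∑ l ∈ tuples (Qs'.map fun Q : Finset ℕ => Q.offDiag), G l ≤ 1) →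
    ∑ l ∈ tuples (Qs.map fun Q => Q ×ˢ Q), G l ≤
      (Qs.map fun Q : Finset ℕ => (∑ p ∈ Q, 1 / ((p : ℝ) + 1)) + 1).prod := by
  induction Qs with
  | nil => intro G _ h; simpa using h [] (List.Sublist.refl _)
  | cons Q Qs ih =>
    intro G hG h
    have h1 := ih G hG fun Qs' hs => h Qs' (hs.cons Q)
    have h2 := ih (fun l => ∑ x ∈ Q.offDiag, G (x :: l))
      (fun l₁ l₂ p => by
        rw [mul_sum]
        exact sum_congr rfl fun x _ => hG (x :: l₁) l₂ p) fun Qs' hs => by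
        have := h (Q :: Qs') (hs.cons_cons Q)
        rw [List.map_cons, sum_tuples_cons, sum_comm] at this
        exact this
    rw [List.map_cons, sum_tuples_cons, ← diag_union_offDiag, sum_union (disjoint_diag_offDiag Q),
      List.map_cons, List.prod_cons, add_mul, one_mul]
    refine add_le_add ?_ ?_
    · have h3 : ∑ x ∈ Q.diag, ∑ l ∈ tuples (Qs.map fun Q => Q ×ˢ Q), G (x :: l) =
          (∑ p ∈ Q, 1 / ((p : ℝ) + 1)) * ∑ l ∈ tuples (Qs.map fun Q => Q ×ˢ Q), G l := by
        rw [sum_mul, sum_diag]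
        refine sum_congr rfl fun p _ => ?_
        rw [mul_sum]
        exact sum_congr rfl fun l _ => hG [] l p
      rw [h3]
      exact mul_le_mul_of_nonneg_left h1 (sum_nonneg fun p _ => by positivity)
    · rw [sum_comm]
      exact h2

lemma coincSum_le_prod {Qs : List (Finset ℕ)}
    (h : ∀ Qs' : List (Finset ℕ), Qs'.Sublist Qs → coincSum (Qs'.map fun Q : Finset ℕ => Q.offDiag) ≤ 1) :
    coincSum (Qs.map fun Q => Q ×ˢ Q) ≤ (Qs.map fun Q : Finset ℕ => (∑ p ∈ Q, 1 / ((p : ℝ) + 1)) + 1).prod := by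
  refine sum_tuples_le_prod _ (fun l₁ l₂ p => ?_) h
  have hsp : ∀ a b : List ℕ, shiftProd (a ++ p :: b) = (p + 1) * shiftProd (a ++ b) := by
    intro a b
    simp [shiftProd]
    ring
  simp only [List.map_append, List.map_cons, hsp, Nat.mul_right_inj (Nat.succ_ne_zero p)]
  split_ifs
  · push_cast
    rw [one_div_mul_one_div]
  · simp

lemma sum_tuples_product (Qs : List (Finset ℕ)) : ∀ f : List ℕ → List ℕ → ℝ,
    ∑ l ∈ tuples (Qs.map fun Q => Q ×ˢ Q), f (l.map Prod.fst) (l.map Prod.snd) =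
      ∑ l ∈ tuples Qs, ∑ l' ∈ tuples Qs, f l l' := by
  induction Qs with
  | nil => intro f; simp [tuples]
  | cons Q Qs ih =>
    intro f
    rw [List.map_cons, sum_tuples_cons, sum_product, sum_tuples_cons]
    refine sum_congr rfl fun p _ => ?_
    simp_rw [sum_tuples_cons, List.map_cons]
    simp_rw [fun q => ih fun a b => f (p :: a) (q :: b)]
    rw [sum_comm]

lemma sum_inv_shiftProd (Qs : List (Finset ℕ)) :
    ∑ l ∈ tuples Qs, 1 / (shiftProd l : ℝ) = (Qs.map fun Q : Finset ℕ => ∑ p ∈ Q, 1 / ((p : ℝ) + 1)).prod := by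
  induction Qs with
  | nil => simp [tuples, shiftProd]
  | cons Q Qs ih =>
    rw [sum_tuples_cons, List.map_cons, List.prod_cons, ← ih, sum_mul_sum]
    refine sum_congr rfl fun p _ => sum_congr rfl fun l _ => ?_
    rw [shiftProd_cons]
    push_cast
    rw [one_div_mul_one_div]

lemma sq_sum_inv_shiftProd_le (Qs : List (Finset ℕ)) :
    (∑ l ∈ tuples Qs, 1 / (shiftProd l : ℝ)) ^ 2 ≤
      (∑ m ∈ (tuples Qs).image shiftProd, 1 / (m : ℝ)) * coincSum (Qs.map fun Q => Q ×ˢ Q) := by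
  set c : ℕ → ℝ := fun m => #{l ∈ tuples Qs | shiftProd l = m}
  have h1 : ∀ f : ℕ → ℝ, ∑ l ∈ tuples Qs, f (shiftProd l) = ∑ m ∈ (tuples Qs).image shiftProd, c m * f m := by
    intro f
    rw [sum_comp f shiftProd]
    simp [c, nsmul_eq_mul]
  have h2 : coincSum (Qs.map fun Q => Q ×ˢ Q) =
      ∑ m ∈ (tuples Qs).image shiftProd, c m * (c m * (1 / (m : ℝ))) := by
    rw [coincSum, sum_tuples_product Qs fun a b => if shiftProd a = shiftProd b then
      1 / (shiftProd a : ℝ) else 0, ← h1 fun m => c m * (1 / (m : ℝ))]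
    refine sum_congr rfl fun l _ => ?_
    rw [← sum_filter, sum_const, nsmul_eq_mul]
    congr 3
    ext l'
    simp [eq_comm]
  rw [h2, h1 fun m => 1 / (m : ℝ)]
  refine sum_sq_le_sum_mul_sum_of_sq_le_mul _ (fun m _ => by positivity) (fun m _ => ?_) fun m _ => ?_
  · exact mul_nonneg (Nat.cast_nonneg _) (mul_nonneg (Nat.cast_nonneg _) (by positivity))
  · exact le_of_eq (by ring)

open Classical in
/-- The normal primes near `scale s`. -/
noncomputable def cell (η ε s : ℝ) : Finset ℕ :=
  (primesUpTo (scale s)).filter fun p => IsNear η s p ∧ IsNormal ε s p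

lemma mem_cell {η ε s : ℝ} {p : ℕ} :
    p ∈ cell η ε s ↔ p ∈ primesUpTo (scale s) ∧ IsNear η s p ∧ IsNormal ε s p := by
  classical exact mem_filter

lemma isCell_offDiag (η ε s : ℝ) : IsCell η ε (cell η ε s).offDiag s := by
  intro x hx
  rw [mem_offDiag, mem_cell, mem_cell] at hx
  exact ⟨⟨hx.1.2.1, hx.2.1.2.1, hx.2.2⟩, hx.1.2.2, hx.2.1.2.2⟩

lemma eventually_sum_cell_ge {ε η : ℝ} (hε : 0 < ε) (hη : 0 < η) (hηε : η ≤ ε / 320)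
    (hη1 : η ≤ 1 / 8) : ∀ᶠ s : ℝ in atTop, η * s / 4 ≤ ∑ p ∈ cell η ε s, 1 / ((p : ℝ) + 1) := by
  classical
  obtain ⟨C, hC, -, hM⟩ := exists_abs_sum_primesIoc_le
  filter_upwards [eventually_sum_not_isNormal_le hε hη hηε hη1, eventually_ge_atTop 2,
    eventually_ge_atTop ((C / 2 + 1) * 4 / η)] with s hs hs2 hsC
  rw [div_le_iff₀ hη] at hsC
  have hs0 : 0 ≤ (1 - η) * s := mul_nonneg (by linarith) (by linarith)
  have hs1 : 1 ≤ (1 - η) * s := by nlinarith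
  have h1 := (abs_le.1 (hM ((1 - η) * s) s hs0 (by nlinarith))).1
  set W := primesIoc ((1 - η) * s) s with hW
  have hmem : ∀ p ∈ W, p ∈ primesUpTo (scale s) ∧ IsNear η s p := fun p hp => by
    have hp1 := mem_primesIoc.1 hp
    have hp2 := mem_primesIoc'.1 hp
    have h2 := add_one_le_scale ((1 - η) * s)
    exact ⟨mem_primesUpTo.2 ⟨hp1.1, hp1.2.2⟩, hp1.1, by exact_mod_cast (show (2 : ℝ) < p by linarith),
      hp2.2.1.le, hp2.2.2⟩
  have h2 : (∑ p ∈ W, 1 / (p : ℝ)) / 2 ≤ ∑ p ∈ W, 1 / ((p : ℝ) + 1) := by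
    rw [sum_div]
    refine sum_le_sum fun p hp => ?_
    have : (1 : ℝ) ≤ p := by exact_mod_cast (mem_primesIoc.1 hp).1.one_le
    rw [div_div]
    exact one_div_le_one_div_of_le (by linarith) (by linarith)
  have h3 := hs (W.filter fun p => ¬ IsNormal ε s p) fun p hp => by
    have h := (hmem p (mem_filter.1 hp).1).2
    exact ⟨h.1, h.2.2.1, h.2.2.2, (mem_filter.1 hp).2⟩
  have h4 : ∑ p ∈ W.filter (IsNormal ε s), 1 / ((p : ℝ) + 1) ≤ ∑ p ∈ cell η ε s, 1 / ((p : ℝ) + 1) := by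
    refine sum_le_sum_of_subset_of_nonneg (fun p hp => ?_) fun p _ _ => by positivity
    have h := hmem p (mem_filter.1 hp).1
    exact mem_cell.2 ⟨h.1, h.2, (mem_filter.1 hp).2⟩
  have h5 := sum_filter_add_sum_filter_not W (IsNormal ε s) fun p => 1 / ((p : ℝ) + 1)
  linarith

lemma prod_le_sum_inv_image {η ε : ℝ} {ss : List ℝ}
    (hs : ∀ s ∈ ss, 4 ≤ η * s ∧ η * s / 4 ≤ ∑ p ∈ cell η ε s, 1 / ((p : ℝ) + 1))
    (hc : coincSum ((ss.map (cell η ε)).map fun Q => Q ×ˢ Q) ≤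
      ((ss.map (cell η ε)).map fun Q : Finset ℕ => (∑ p ∈ Q, 1 / ((p : ℝ) + 1)) + 1).prod) :
    (ss.map fun s => η * s / 8).prod ≤
      ∑ m ∈ (tuples (ss.map (cell η ε))).image shiftProd, 1 / (m : ℝ) := by
  have h1 := sq_sum_inv_shiftProd_le (ss.map (cell η ε))
  rw [sum_inv_shiftProd] at h1
  set X := ∑ m ∈ (tuples (ss.map (cell η ε))).image shiftProd, 1 / (m : ℝ)
  have hX : 0 ≤ X := sum_nonneg fun m _ => by positivity
  have h2 := h1.trans (mul_le_mul_of_nonneg_left hc hX)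
  rw [List.map_map, List.map_map] at h2
  clear h1 hc
  have h3 : 0 < (ss.map ((fun Q : Finset ℕ => (∑ p ∈ Q, 1 / ((p : ℝ) + 1)) + 1) ∘ cell η ε)).prod ∧
      (ss.map fun s => η * s / 8).prod *
        (ss.map ((fun Q : Finset ℕ => (∑ p ∈ Q, 1 / ((p : ℝ) + 1)) + 1) ∘ cell η ε)).prod ≤
      (ss.map ((fun Q : Finset ℕ => ∑ p ∈ Q, 1 / ((p : ℝ) + 1)) ∘ cell η ε)).prod ^ 2 := by
    clear h2 hX X
    induction ss with
    | nil => simp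
    | cons s ss ih =>
      obtain ⟨i1, i2⟩ := ih fun t ht => hs t (by simp [ht])
      obtain ⟨g1, g2⟩ := hs s (by simp)
      simp only [List.map_cons, List.prod_cons, Function.comp_apply] at *
      set S := ∑ p ∈ cell η ε s, 1 / ((p : ℝ) + 1)
      refine ⟨mul_pos (by linarith) i1, ?_⟩
      rw [mul_mul_mul_comm, mul_pow]
      refine mul_le_mul ?_ i2 (mul_nonneg (List.prod_nonneg fun a ha => ?_) i1.le) (sq_nonneg _)
      · have h1 : η * s / 8 ≤ S / 2 := by linarith
        calc η * s / 8 * (S + 1) ≤ S / 2 * (S + 1) := mul_le_mul_of_nonneg_right h1 (by linarith)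
          _ ≤ S ^ 2 := by nlinarith
      · obtain ⟨t, ht, rfl⟩ := List.mem_map.1 ha
        linarith [(hs t (by simp [ht])).1]
  exact le_of_mul_le_mul_right (h3.2.trans h2) h3.1

lemma cardFactors_shiftProd_le {ε η : ℝ} (hε : ε ≤ 1) {ps : List ℕ} {ss : List ℝ}
    (h : List.Forall₂ (fun p s => IsNormal ε s p ∧ IsNear η s p) ps ss) (hs : ∀ s ∈ ss, 1 ≤ s) :
    ((shiftProd ps).primeFactorsList.length : ℝ) ≤ 3 * ss.sum := by
  induction h with
  | nil => simp [shiftProd]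
  | @cons p s ps ss hp hps ih =>
    have h0 := ih fun t ht => hs t (by simp [ht])
    have h1 := hs s (by simp)
    have h2 := hp.1.omegaFin_le hp.2 (by linarith) (p + 1).primeFactors
    have h3 : omegaFin (p + 1).primeFactors (p + 1) = (p + 1).primeFactorsList.length := by
      rw [omegaFin, List.filter_eq_self.2]
      intro r hr
      simpa [Nat.mem_primeFactors] using ⟨Nat.prime_of_mem_primeFactorsList hr, Nat.dvd_of_mem_primeFactorsList hr⟩
    have h4 : √s ≤ s := by
      rw [sqrt_le_left (by linarith)]
      nlinarith
    have h5 : ε * s ≤ 1 * s := mul_le_mul_of_nonneg_right hε (by linarith)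
    have h6 := (Nat.perm_primeFactorsList_mul (Nat.succ_ne_zero p) (shiftProd_ne_zero ps)).length_eq
    rw [shiftProd_cons, List.sum_cons]
    rw [List.length_append] at h6
    rw [h3] at h2
    have h7 : (((p + 1) * shiftProd ps).primeFactorsList.length : ℝ) =
        (p + 1).primeFactorsList.length + (shiftProd ps).primeFactorsList.length := by exact_mod_cast h6
    rw [h7]
    linarith

lemma forall₂_cell {η ε : ℝ} {ss : List ℝ} : ∀ l ∈ tuples (ss.map (cell η ε)),
    List.Forall₂ (fun p s => IsNormal ε s p ∧ IsNear η s p) l ss := by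
  induction ss with
  | nil => intro l hl; rw [List.map_nil, tuples, mem_singleton] at hl; subst hl; exact .nil
  | cons s ss ih =>
    intro l hl
    obtain ⟨p, hp, l', hl', rfl⟩ := mem_tuples_cons.1 hl
    exact .cons (mem_cell.1 hp).2.symm (ih l' hl')

/-- Geometric ladders of normal primes give many integers without repetition. -/
lemma exists_sum_inv_image_ge {ρ δ : ℝ} (hρ0 : 0 < ρ) (hρ1 : ρ < 1) (hδ0 : 0 < δ)
    (hF : ∀ n, ∑ m ∈ range n, fordCoeff (m + 1) * ρ ^ (m + 1) ≤ 1 - δ) : ∃ A₀ : ℝ, 1 ≤ A₀ ∧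
    ∃ b : ℝ, 0 < b ∧ ∀ ss T, IsLadder ρ A₀ ss → 0 ≤ T → (∀ s ∈ ss, s ≤ T) → ∃ D : Finset ℕ, (∀ m ∈ D,
      (∃ l : List ℕ, (∀ p ∈ l, p.Prime) ∧ shiftProd l = m) ∧ (m : ℝ) ≤ scale (T + 2) ∧
      (m.primeFactorsList.length : ℝ) ≤ 3 / (1 - ρ) * T) ∧
    (ss.map fun s => b * s).prod ≤ ∑ m ∈ D, 1 / (m : ℝ) := by
  have hq : 0 < 1 + 1 / (1 - ρ) := add_pos one_pos (one_div_pos.2 (by linarith))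
  obtain ⟨ε, hε0, hε1, hε2⟩ : ∃ ε : ℝ, 0 < ε ∧ ε ≤ 1 ∧ ε * (1 + 1 / (1 - ρ)) ≤ δ / 4 :=
    ⟨min 1 (δ / 4 / (1 + 1 / (1 - ρ))), lt_min one_pos (div_pos (by linarith) hq), min_le_left _ _,
      (le_div_iff₀ hq).1 (min_le_right _ _)⟩
  obtain ⟨η, hη0, hη1, hη2⟩ : ∃ η : ℝ, 0 < η ∧ η ≤ ε / 320 ∧ η ≤ (1 - ρ) / 6 :=
    ⟨min (ε / 320) ((1 - ρ) / 6), lt_min (by linarith) (by linarith), min_le_left _ _, min_le_right _ _⟩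
  obtain ⟨A₁, hA₁⟩ := exists_coincSum_le hρ0 (by linarith) hε0 hη0 hF hδ0
    (show (9 * η + ε) * (1 + 1 / (1 - ρ)) ≤ δ / 2 from
      (mul_le_mul_of_nonneg_right (by linarith : 9 * η + ε ≤ 2 * ε) hq.le).trans (by linarith))
  obtain ⟨A₂, hA₂⟩ := eventually_atTop.1 (eventually_sum_cell_ge hε0 hη0 hη1 (by linarith))
  set A₀ := max A₁ (max A₂ (max 1 (max (4 / η) (2 / (1 - ρ)))))
  have g1 : A₁ ≤ A₀ := le_max_left _ _
  have g2 : A₂ ≤ A₀ := (le_max_left _ _).trans (le_max_right _ _)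
  have g3 : 1 ≤ A₀ := (le_max_left _ _).trans ((le_max_right _ _).trans (le_max_right _ _))
  have g4 : 4 / η ≤ A₀ := (le_max_left _ _).trans ((le_max_right _ _).trans
    ((le_max_right _ _).trans (le_max_right _ _)))
  have g5 : 2 / (1 - ρ) ≤ A₀ := (le_max_right _ _).trans ((le_max_right _ _).trans
    ((le_max_right _ _).trans (le_max_right _ _)))
  rw [div_le_iff₀ (by linarith)] at g4 g5
  refine ⟨A₀, g3, η / 8, by linarith, fun ss T hss hT hsT =>
    ⟨(tuples (ss.map (cell η ε))).image shiftProd, fun m hm => ?_, ?_⟩⟩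
  · obtain ⟨l, hl, rfl⟩ := mem_image.1 hm
    have h1 := forall₂_cell l hl
    have hs1 : ∀ s ∈ ss, 1 ≤ s := fun s hs => g3.trans (hss.2 s hs)
    refine ⟨⟨l, fun p hp => ?_, rfl⟩, shiftProd_le_scale h1 (by linarith)
      (hss.pairwise_add_two_le hρ1 (by linarith)) fun s hs => ⟨by linarith [hs1 s hs], by linarith [hsT s hs]⟩,
      (cardFactors_shiftProd_le hε1 h1 hs1).trans ?_⟩
    · obtain ⟨i, hi, rfl⟩ := List.mem_iff_getElem.1 hp
      exact (List.Forall₂.get h1 hi (h1.length_eq ▸ hi)).2.1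
    · have h2 := wsum_le hρ0.le (σ := T) (fun _ => 1) (fun _ => zero_le_one) hss hsT
      rw [wsum_const, one_mul] at h2
      have h3 : ∑ m ∈ range ss.length, 1 * ρ ^ m ≤ 1 / (1 - ρ) := by
        simp only [one_mul]
        rw [geom_sum_eq hρ1.ne, ← neg_div_neg_eq, neg_sub, neg_sub]
        exact div_le_div_of_nonneg_right (by linarith [pow_pos hρ0 ss.length]) (by linarith)
      calc 3 * ss.sum ≤ 3 * (T * (1 / (1 - ρ))) :=
            mul_le_mul_of_nonneg_left (h2.trans (mul_le_mul_of_nonneg_left h3 hT)) (by norm_num)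
        _ = _ := by ring
  · have h1 := prod_le_sum_inv_image (ε := ε) (ss := ss) (fun s hs => by
      have h := hss.2 s hs
      have h' : η * A₀ ≤ η * s := mul_le_mul_of_nonneg_left h hη0.le
      exact ⟨by linarith, hA₂ s (g2.trans h)⟩) (coincSum_le_prod fun Qs' hQ => ?_)
    · refine le_trans (le_of_eq ?_) h1
      congr 1
      exact List.map_congr_left fun s _ => by ring
    · obtain ⟨ss', hss', rfl⟩ := List.sublist_map_iff.1 hQ
      refine hA₁ A₀ g1 _ ss' ?_ ⟨hss.1.sublist hss', fun s hs => hss.2 s (hss'.subset hs)⟩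
      rw [List.map_map, List.forall₂_map_left_iff, List.forall₂_same]
      exact fun s _ => isCell_offDiag η ε s

lemma prod_geometric_ladder {b ρ T : ℝ} (hb : 0 < b) (hρ : 0 < ρ) (hT : 0 < T) (L : ℕ) :
    exp (L * (log T + log b) - log ρ⁻¹ * (L : ℝ) ^ 2 / 2) ≤
      (((List.range L).map fun i => ρ ^ i * T).map fun s => b * s).prod * exp (-log ρ⁻¹ * L / 2) := by
  refine le_of_eq ?_
  induction L with
  | zero => simp
  | succ L ih =>
    have h1 : b * (ρ ^ L * T) = exp (log T + log b - L * log ρ⁻¹) := by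
      rw [log_inv, exp_sub, exp_add, exp_log hT, exp_log hb, mul_neg, exp_neg, exp_nat_mul, exp_log hρ]
      field_simp
    rw [List.range_succ, List.map_append, List.map_append, List.prod_append, List.map_singleton,
      List.map_singleton, List.prod_singleton, h1,
      show (((L + 1 : ℕ) : ℝ) * (log T + log b) - log ρ⁻¹ * ((L + 1 : ℕ) : ℝ) ^ 2 / 2) =
        (L * (log T + log b) - log ρ⁻¹ * (L : ℝ) ^ 2 / 2) +
          (log T + log b - L * log ρ⁻¹ - log ρ⁻¹ / 2) by push_cast; ring, exp_add, ih]
    rw [mul_assoc, mul_assoc, ← exp_add, ← exp_add]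
    congr 2
    push_cast
    ring

lemma exists_structured_set {ρ δ : ℝ} (hρ0 : 0 < ρ) (hρ1 : ρ < 1) (hδ0 : 0 < δ)
    (hF : ∀ n, ∑ m ∈ range n, fordCoeff (m + 1) * ρ ^ (m + 1) ≤ 1 - δ) : ∃ K : ℝ, 0 < K ∧
    ∀ᶠ T : ℝ in atTop, ∃ D : Finset ℕ, (∀ m ∈ D,
      (∃ l : List ℕ, (∀ p ∈ l, p.Prime) ∧ shiftProd l = m) ∧ (m : ℝ) ≤ scale (T + 2) ∧
      (m.primeFactorsList.length : ℝ) ≤ K * T) ∧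
    exp (log T ^ 2 / (2 * log ρ⁻¹) - K * (log T + 1)) ≤ ∑ m ∈ D, 1 / (m : ℝ) := by
  obtain ⟨A, hA, b, hb, h⟩ := exists_sum_inv_image_ge hρ0 hρ1 hδ0 hF
  have hl : 0 < log ρ⁻¹ := log_pos ((one_lt_inv₀ hρ0).2 hρ1)
  have ha : 0 ≤ log A := log_nonneg hA
  set l := log ρ⁻¹ with hl'
  have h3 : 0 < 3 / (1 - ρ) := div_pos (by norm_num) (by linarith)
  have hB : 0 ≤ ((log A + l) ^ 2 / 2 + |log b|) / l :=
    div_nonneg (add_nonneg (by positivity) (abs_nonneg _)) hl.le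
  refine ⟨3 / (1 - ρ) + ((log A + l) ^ 2 / 2 + |log b|) / l, by linarith, ?_⟩
  filter_upwards [eventually_ge_atTop A] with T hT
  have hT0 : 0 < T := by linarith
  have hw : log A ≤ log T := log_le_log (by linarith) hT
  set L := ⌊(log T - log A) / l⌋₊ with hL
  have hL1 : (L : ℝ) * l ≤ log T - log A :=
    (le_div_iff₀ hl).1 (Nat.floor_le (div_nonneg (by linarith) hl.le))
  have hL2 : log T - log A ≤ (L + 1) * l := ((div_lt_iff₀ hl).1 (Nat.lt_floor_add_one _)).le
  have hρL : A ≤ ρ ^ L * T := by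
    have h1 : ρ ^ L * T = exp (log T - L * l) := by
      rw [exp_sub, exp_log hT0, exp_nat_mul, hl', exp_log (inv_pos.2 hρ0), inv_pow]
      field_simp
    rw [h1, ← log_le_iff_le_exp (by linarith)]
    linarith
  set ss := (List.range L).map fun i => ρ ^ i * T with hss
  have c1 : ss.Pairwise fun s t => t ≤ ρ * s := by
    rw [hss, List.pairwise_map]
    refine List.pairwise_lt_range.imp fun {i j} hij => ?_
    rw [← mul_assoc, ← pow_succ']
    exact mul_le_mul_of_nonneg_right (pow_le_pow_of_le_one hρ0.le hρ1.le hij) hT0.le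
  have c2 : ∀ s ∈ ss, A ≤ s := by
    intro s hs
    obtain ⟨i, hi, rfl⟩ := List.mem_map.1 hs
    exact hρL.trans (mul_le_mul_of_nonneg_right
      (pow_le_pow_of_le_one hρ0.le hρ1.le (List.mem_range.1 hi).le) hT0.le)
  have c3 : ∀ s ∈ ss, s ≤ T := by
    intro s hs
    obtain ⟨i, hi, rfl⟩ := List.mem_map.1 hs
    exact mul_le_of_le_one_left hT0.le (pow_le_one₀ hρ0.le hρ1.le)
  obtain ⟨D, hD, hD'⟩ := h ss T ⟨c1, c2⟩ hT0.le c3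
  refine ⟨D, fun m hm => ⟨(hD m hm).1, (hD m hm).2.1, (hD m hm).2.2.trans ?_⟩, le_trans ?_ hD'⟩
  · exact mul_le_mul_of_nonneg_right (by linarith) hT0.le
  · have h1 := prod_geometric_ladder hb hρ0 hT0 L
    have h2 : exp (-log ρ⁻¹ * L / 2) ≤ 1 := by
      rw [exp_le_one_iff]
      have : 0 ≤ l * L := mul_nonneg hl.le (Nat.cast_nonneg _)
      linarith
    refine le_trans (exp_le_exp.2 ?_) (h1.trans (mul_le_of_le_one_right (List.prod_nonneg fun a ha => ?_) h2))
    · rw [← hl']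
      set w := log T
      have e1 : -(|log b|) ≤ log b := neg_abs_le _
      have e2 : (w - L * l) ^ 2 ≤ (log A + l) ^ 2 := by
        apply pow_le_pow_left₀ <;> linarith
      have hc : 0 ≤ |log b| := abs_nonneg _
      have e3 : (L * l) * -|log b| ≤ (L * l) * log b := mul_le_mul_of_nonneg_left e1 (mul_nonneg (Nat.cast_nonneg _) hl.le)
      have e4 : (L * l) * |log b| ≤ w * |log b| := mul_le_mul_of_nonneg_right (by linarith) hc
      have e5 : 0 ≤ (log A + l) ^ 2 / 2 * w := mul_nonneg (by positivity) (by linarith)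
      have e6 : w ^ 2 / (2 * l) - ((log A + l) ^ 2 / 2 + |log b|) / l * (w + 1) ≤
          L * (w + log b) - l * (L : ℝ) ^ 2 / 2 := by
        rw [← mul_le_mul_iff_of_pos_left hl]
        have : l * (w ^ 2 / (2 * l) - ((log A + l) ^ 2 / 2 + |log b|) / l * (w + 1)) =
            w ^ 2 / 2 - ((log A + l) ^ 2 / 2 + |log b|) * (w + 1) := by field_simp
        rw [this]
        linarith
      have e7 : 0 ≤ 3 / (1 - ρ) * (w + 1) := mul_nonneg h3.le (by linarith)
      linarith
    · obtain ⟨s, hs, rfl⟩ := List.mem_map.1 ha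
      obtain ⟨i, -, rfl⟩ := List.mem_map.1 hs
      positivity

lemma exists_card_primes_ge : ∃ B : ℕ, 2 ≤ B ∧ ∀ k : ℕ, 1 ≤ k →
    (k : ℝ) ≤ log (B * k : ℕ) * #((Ioc k (B * k)).filter Nat.Prime) := by
  obtain ⟨C, hC, h⟩ := exists_abs_primeLogSum_sub_log_le
  obtain ⟨B, hB⟩ := exists_nat_ge (exp (2 * C + 1))
  have hB1 : (1 : ℝ) < B := lt_of_lt_of_le (one_lt_exp_iff.2 (by linarith)) hB
  have hB2 : 2 ≤ B := by exact_mod_cast hB1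
  refine ⟨B, hB2, fun k hk => ?_⟩
  have hk0 : (0 : ℝ) < k := by exact_mod_cast hk
  have hkB : k ≤ B * k := Nat.le_mul_of_pos_left k (by omega)
  have h1 := (abs_le.1 (h k hk)).2
  have h2 := (abs_le.1 (h (B * k) (hk.trans hkB))).1
  have h3 : log (B * k : ℕ) = log B + log k := by
    rw [Nat.cast_mul, log_mul (by linarith) hk0.ne']
  have h4 : 2 * C + 1 ≤ log B := (le_log_iff_exp_le (by linarith)).2 hB
  have h5 : primeLogSum (B * k : ℕ) = primeLogSum k +
      ∑ p ∈ (Ioc k (B * k)).filter Nat.Prime, log p / (p : ℝ) := by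
    rw [primeLogSum, primeLogSum, ← sum_union]
    · refine sum_congr ?_ fun _ _ => rfl
      ext p
      simp only [mem_union, mem_filter, mem_Ioc, mem_primesUpTo, Nat.cast_le]
      constructor
      · intro hp
        rcases le_or_gt p k with hpk | hpk
        · exact Or.inl ⟨hp.1, hpk⟩
        · exact Or.inr ⟨⟨hpk, hp.2⟩, hp.1⟩
      · rintro (hp | hp)
        · exact ⟨hp.1, hp.2.trans hkB⟩
        · exact ⟨hp.2, hp.1.2⟩
    · rw [disjoint_left]
      intro p hp hp'
      have := Nat.cast_le.1 (mem_primesUpTo.1 hp).2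
      have := (mem_Ioc.1 (mem_filter.1 hp').1).1
      omega
  have h6 : ∑ p ∈ (Ioc k (B * k)).filter Nat.Prime, log p / (p : ℝ) ≤
      #((Ioc k (B * k)).filter Nat.Prime) • (log (B * k : ℕ) / k) := by
    refine sum_le_card_nsmul _ _ _ fun p hp => ?_
    obtain ⟨h7, h8⟩ := mem_Ioc.1 (mem_filter.1 hp).1
    have hp0 : (0 : ℝ) < p := by exact_mod_cast (by omega : 0 < p)
    refine div_le_div₀ (log_natCast_nonneg _) (log_le_log hp0 (by exact_mod_cast h8)) hk0 ?_
    exact_mod_cast h7.le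
  rw [nsmul_eq_mul, ← mul_div_assoc] at h6
  have h7 := le_trans (show (1 : ℝ) ≤ _ by linarith) h6
  rw [le_div_iff₀ hk0] at h7
  linarith

lemma card_le_two_pow {m : ℕ} (hm : m ≠ 0) : (#m.divisors : ℝ) ≤ 2 ^ m.primeFactorsList.length := by
  have h1 := sum_divisors_cmul_le (F := fun _ => 1) (fun _ => zero_le_one) hm
  rw [cmul_const _ hm] at h1
  rw [sum_congr rfl fun d hd => cmul_one_fun (Nat.pos_of_mem_divisors hd).ne'] at h1
  norm_num at h1
  exact h1

lemma sum_gcd_div_le {m N : ℕ} (hm : m ≠ 0) {D : Finset ℕ} (hD : ∀ m' ∈ D, 1 ≤ m' ∧ m' ≤ N) :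
    ∑ m' ∈ D, (m.gcd m' : ℝ) / m' ≤ #m.divisors * (1 + log N) := by
  have h1 : ∑ k ∈ Icc 1 N, 1 / (k : ℝ) ≤ 1 + log N := by
    refine le_trans (le_of_eq ?_) (harmonic_le_one_add_log N)
    rw [harmonic_eq_sum_Icc]
    push_cast
    exact sum_congr rfl fun k _ => one_div _
  rw [← sum_fiberwise_of_maps_to (g := fun m' => m.gcd m') (t := m.divisors)
    fun m' _ => Nat.mem_divisors.2 ⟨Nat.gcd_dvd_left _ _, hm⟩, ← nsmul_eq_mul]
  refine sum_le_card_nsmul _ _ _ fun d hd => le_trans ?_ h1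
  have hd0 := Nat.pos_of_mem_divisors hd
  have hmem : ∀ m' ∈ D.filter (fun m' => m.gcd m' = d), 1 ≤ m' ∧ m' ≤ N ∧ m.gcd m' = d ∧ d * (m' / d) = m' :=
    fun m' hm' => by
      obtain ⟨h, h'⟩ := mem_filter.1 hm'
      exact ⟨(hD m' h).1, (hD m' h).2, h', Nat.mul_div_cancel' (h' ▸ Nat.gcd_dvd_right _ _)⟩
  have h2 : ∑ m' ∈ D.filter (fun m' => m.gcd m' = d), (m.gcd m' : ℝ) / m' =
      ∑ k ∈ (D.filter fun m' => m.gcd m' = d).image (· / d), 1 / (k : ℝ) := by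
    rw [sum_image fun x hx y hy hxy => ?_]
    · refine sum_congr rfl fun m' hm' => ?_
      obtain ⟨h3, -, h4, h5⟩ := hmem m' hm'
      have h6 : (m' / d : ℕ) ≠ 0 := fun h => by rw [h] at h5; omega
      have h7 : (m' : ℝ) = d * (m' / d : ℕ) := by exact_mod_cast h5.symm
      have h8 : (d : ℝ) ≠ 0 := by exact_mod_cast hd0.ne'
      have h9 : ((m' / d : ℕ) : ℝ) ≠ 0 := by exact_mod_cast h6
      rw [h4, h7]
      field_simp
    · rw [← (hmem x hx).2.2.2, hxy, (hmem y hy).2.2.2]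
  rw [h2]
  refine sum_le_sum_of_subset_of_nonneg (fun k hk => ?_) fun k _ _ => by positivity
  obtain ⟨m', hm', rfl⟩ := mem_image.1 hk
  obtain ⟨h3, h4, -, h5⟩ := hmem m' hm'
  have h6 : (m' / d : ℕ) ≠ 0 := fun h => by rw [h] at h5; omega
  exact mem_Icc.2 ⟨Nat.one_le_iff_ne_zero.2 h6, (Nat.div_le_self _ _).trans h4⟩

lemma sum_card_le_card_biUnion {D : Finset ℕ} (V : ℕ → Finset ℕ) :
    ∑ m ∈ D, (#(V m) : ℝ) ≤ #(D.biUnion V) + ∑ m ∈ D, ∑ m' ∈ D.erase m, (#(V m ∩ V m') : ℝ) := by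
  have h1 : ∀ m ∈ D, (#(V m) : ℝ) ≤ #(V m \ (D.erase m).biUnion V) + ∑ m' ∈ D.erase m, (#(V m ∩ V m') : ℝ) := by
    intro m _
    have h2 : #(V m) ≤ #(V m \ (D.erase m).biUnion V) + ∑ m' ∈ D.erase m, #(V m ∩ V m') := by
      rw [← card_sdiff_add_card_inter (V m) ((D.erase m).biUnion V), inter_biUnion]
      exact Nat.add_le_add_left card_biUnion_le _
    exact_mod_cast h2
  refine (sum_le_sum h1).trans ?_
  rw [sum_add_distrib]
  refine add_le_add_left ?_ _
  have h3 : ∑ m ∈ D, #(V m \ (D.erase m).biUnion V) ≤ #(D.biUnion V) := by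
    rw [← card_biUnion]
    · exact card_le_card (biUnion_mono fun m _ => sdiff_subset)
    · intro m hm m' hm' hne
      refine disjoint_left.2 fun v hv hv' => ?_
      exact (mem_sdiff.1 hv').2 (mem_biUnion.2 ⟨m, mem_erase.2 ⟨hne, hm⟩, (mem_sdiff.1 hv).1⟩)
  exact_mod_cast h3

lemma exists_card_shifted_pairs_le (B : ℕ) : ∃ C : ℝ, 0 < C ∧ ∀ (a b k : ℕ) (E : ℝ) (A : Finset ℕ),
    1 ≤ E → 1 ≤ a → 1 ≤ b → a ≠ b → (a : ℝ) ≤ scale E → b ≤ k → (k : ℝ) ≤ scale E →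
    (2 : ℝ) ^ (B + 2) ≤ scale E → scale (E - 1) ≤ k / b →
    (∀ n ∈ A, k < b * n ∧ b * n ≤ B * k + 1 ∧ (a * n - 1).Prime ∧ (b * n - 1).Prime) →
    (#A : ℝ) ≤ C * (k / b) * ((2 + E) ^ 6 * exp (-2 * E)) := by
  obtain ⟨C₀, hC₀, hM, -⟩ := exists_abs_sum_primesIoc_le
  obtain ⟨C, hC, h⟩ := sieve_dyadic
  refine ⟨(B + 1 : ℕ) * (2 ^ (B + 2) * C * exp (4 + C₀)), by positivity,
    fun a b k E A hE ha hb hab haE hbk hkE hBE hkb hA => ?_⟩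
  set N := k / b + 1 with hN
  have hb0 : (0 : ℝ) < b := by exact_mod_cast hb
  have hN1 : (k : ℝ) / b ≤ N := by
    rw [div_le_iff₀ hb0]
    have := Nat.lt_mul_div_succ k (show 0 < b by omega)
    exact_mod_cast (by rw [mul_comm]; exact this.le : k ≤ N * b)
  have hN2 : (N : ℝ) ≤ 2 * (k / b) := by
    have h1 : ((k / b : ℕ) : ℝ) ≤ k / b := Nat.cast_div_le
    have h2 : (1 : ℝ) ≤ k / b := by rw [le_div_iff₀ hb0, one_mul]; exact_mod_cast hbk
    rw [hN, Nat.cast_add, Nat.cast_one]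
    linarith
  have hE1 : scale E ≤ scale (E + 1) := scale_le_scale.2 (by linarith)
  have hE2 := scale_sub_one_sq_le (E + 1)
  rw [add_sub_cancel_right] at hE2
  have hsE := scale_pos E
  have hkk : (k : ℝ) / b ≤ k := div_le_self (Nat.cast_nonneg _) (by exact_mod_cast hb)
  have hNN : 1 ≤ N := Nat.succ_pos _
  have hsub : A ⊆ (range (B + 1)).biUnion fun j => (Ico (2 ^ j * N) (2 ^ j * N + 2 ^ j * N)).filter
      fun n => (a * n - 1).Prime ∧ (b * n - 1).Prime := by
    intro n hn
    obtain ⟨h1, h2, h3, h4⟩ := hA n hn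
    have hNn : N ≤ n := by
      rw [hN, Nat.succ_le_iff]
      exact Nat.div_lt_of_lt_mul h1
    have hnN : n < 2 ^ (B + 1) * N := by
      have h5 : b * n < b * ((B + 1) * N) := by
        have h6 := Nat.lt_mul_div_succ k (show 0 < b by omega)
        have h7 : (B + 1) * k < (B + 1) * (b * N) := Nat.mul_lt_mul_of_pos_left h6 (by omega)
        have h8 : B * k + 1 ≤ (B + 1) * k := by nlinarith
        calc b * n ≤ (B + 1) * k := h2.trans h8
          _ < (B + 1) * (b * N) := h7
          _ = _ := by ring
      have h9 : B + 1 ≤ 2 ^ (B + 1) := Nat.lt_two_pow_self.le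
      exact (Nat.lt_of_mul_lt_mul_left h5).trans_le (Nat.mul_le_mul_right _ h9)
    have hnN' : n / N ≠ 0 := (Nat.div_pos hNn hNN).ne'
    have h5 : 2 ^ Nat.log 2 (n / N) * N ≤ n :=
      (Nat.mul_le_mul_right _ (Nat.pow_log_le_self 2 hnN')).trans (Nat.div_mul_le_self _ _)
    have h6 : n < 2 ^ (Nat.log 2 (n / N) + 1) * N :=
      (Nat.div_lt_iff_lt_mul hNN).1 (Nat.lt_pow_succ_log_self one_lt_two _)
    refine mem_biUnion.2 ⟨Nat.log 2 (n / N), mem_range.2 ?_, mem_filter.2 ⟨mem_Ico.2 ⟨h5, ?_⟩, h3, h4⟩⟩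
    · exact (Nat.pow_lt_pow_iff_right one_lt_two).1 (Nat.lt_of_mul_lt_mul_right (h5.trans_lt hnN))
    · rw [pow_succ] at h6; linarith
  have hj : ∀ j ∈ range (B + 1), #((Ico (2 ^ j * N) (2 ^ j * N + 2 ^ j * N)).filter
      fun n => (a * n - 1).Prime ∧ (b * n - 1).Prime) ≤
      2 ^ (B + 2) * C * exp (4 + C₀) * ((k / b) * ((2 + E) ^ 6 * exp (-2 * E))) := by
    intro j hj
    have hj1 : (2 : ℝ) ^ j ≤ 2 ^ (B + 1) :=
      pow_le_pow_right₀ one_le_two (mem_range.1 hj).le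
    have hjN : ((2 ^ j * N : ℕ) : ℝ) ≤ 2 ^ (B + 2) * (k / b) := by
      push_cast
      calc (2 : ℝ) ^ j * N ≤ 2 ^ (B + 1) * (2 * (k / b)) :=
            mul_le_mul hj1 hN2 (Nat.cast_nonneg _) (by positivity)
        _ = _ := by ring
    have h1 := h (fun _ => 1) (fun _ => zero_le_one) (fun _ => le_rfl) a b (2 ^ j * N) (E + 1) (E - 1) ha hb
      (by linarith) (haE.trans hE1) ((Nat.cast_le.2 hbk).trans (hkE.trans hE1))
      (hjN.trans (le_trans ?_ hE2)) (hkb.trans (hN1.trans ?_))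
    · rw [if_neg hab, sum_congr rfl fun n hn => cmul_one_fun ?_, sum_const, nsmul_eq_mul, mul_one] at h1
      · refine h1.trans ?_
        have h2 := (abs_le.1 (hM (E + 1) (by linarith))).2
        rw [primeRecipSum] at h2
        have h3 : exp (-3 * (E - 1) + ∑ r ∈ primesUpTo (scale (E + 1)), (1 : ℝ) / r) ≤
            exp (4 + C₀) * exp (-2 * E) := by
          rw [← exp_add]
          exact exp_le_exp.2 (by linarith)
        calc C * (2 ^ j * N : ℕ) * (1 + (E + 1)) ^ 6 *
              exp (-3 * (E - 1) + ∑ r ∈ primesUpTo (scale (E + 1)), (1 : ℝ) / r)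
            ≤ C * (2 ^ (B + 2) * (k / b)) * (1 + (E + 1)) ^ 6 * (exp (4 + C₀) * exp (-2 * E)) := by
              gcongr
          _ = _ := by ring
      · rintro rfl
        have h2 := (mem_Ico.1 (mem_filter.1 hn).1).1
        have : 0 < 2 ^ j * N := by positivity
        omega
    · rw [sq]
      exact mul_le_mul hBE (hkk.trans hkE) (by positivity) hsE.le
    · exact_mod_cast Nat.le_mul_of_pos_left N (by positivity)
  have h1 : (#A : ℝ) ≤ ∑ j ∈ range (B + 1), (#((Ico (2 ^ j * N) (2 ^ j * N + 2 ^ j * N)).filter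
      fun n => (a * n - 1).Prime ∧ (b * n - 1).Prime) : ℝ) := by
    exact_mod_cast (card_le_card hsub).trans card_biUnion_le
  refine (h1.trans (sum_le_card_nsmul _ _ _ hj)).trans (le_of_eq ?_)
  rw [card_range, nsmul_eq_mul]
  ring

/-- Multiples of `m` by shifted primes in a fixed multiplicative window. -/
def shiftedMultiples (B k m : ℕ) : Finset ℕ :=
  ((Ioc k (B * k)).filter Nat.Prime).image fun p => m * (p + 1)

lemma card_shiftedMultiples {B k m : ℕ} (hm : 1 ≤ m) :
    #(shiftedMultiples B k m) = #((Ioc k (B * k)).filter Nat.Prime) :=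
  card_image_of_injective _ fun p q h => by
    simpa using Nat.eq_of_mul_eq_mul_left hm h

lemma exists_card_inter_le (B : ℕ) : ∃ C : ℝ, 0 < C ∧ ∀ (k m : ℕ) (K : ℕ → ℕ) (D : Finset ℕ) (E : ℝ), 1 ≤ E →
    m ∈ D → (∀ b ∈ D, 1 ≤ b ∧ (b : ℝ) ≤ scale E ∧ scale (E - 1) * b ≤ k) → (k : ℝ) ≤ scale E →
    (2 : ℝ) ^ (B + 2) ≤ scale E → ∀ m' ∈ D, m ≠ m' →
    (#(shiftedMultiples B k m ∩ shiftedMultiples B (K m') m') : ℝ) ≤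
      C * k * ((2 + E) ^ 6 * exp (-2 * E)) * ((m.gcd m' : ℝ) / m') := by
  obtain ⟨C, hC, h⟩ := exists_card_shifted_pairs_le B
  refine ⟨C, hC, fun k m K D E hE hm hD hk hB m' hm' hne => ?_⟩
  obtain ⟨g1, g2, g3⟩ := hD m hm
  obtain ⟨f1, f2, f3⟩ := hD m' hm'
  set g := m.gcd m' with hg
  have hg0 : 0 < g := Nat.gcd_pos_of_pos_left _ g1
  obtain ⟨a, b, hco, ha, hb⟩ : ∃ a b, Nat.Coprime a b ∧ m = g * a ∧ m' = g * b := by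
    obtain ⟨a, b, hco, ha, hb⟩ := Nat.exists_coprime m m'
    exact ⟨a, b, hco, by rw [mul_comm]; exact ha, by rw [mul_comm]; exact hb⟩
  have ha1 : 1 ≤ a := Nat.pos_of_ne_zero fun h => by rw [h, mul_zero] at ha; omega
  have hb1 : 1 ≤ b := Nat.pos_of_ne_zero fun h => by rw [h, mul_zero] at hb; omega
  have ham : a ≤ m := ha ▸ Nat.le_mul_of_pos_left a hg0
  have hbm : b ≤ m' := hb ▸ Nat.le_mul_of_pos_left b hg0
  have hb0 : (0 : ℝ) < b := by exact_mod_cast hb1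
  have hbs : scale (E - 1) * b ≤ k :=
    (mul_le_mul_of_nonneg_left (Nat.cast_le.2 hbm) (scale_pos _).le).trans f3
  set A := (range (B * k + 2)).filter fun n => k < b * n ∧ b * n ≤ B * k + 1 ∧
    (a * n - 1).Prime ∧ (b * n - 1).Prime with hA
  have h1 := h a b k E A hE ha1 hb1 (fun hab => hne (by rw [ha, hb, hab]))
    ((Nat.cast_le.2 ham).trans g2) ?_ hk hB ((le_div_iff₀ hb0).2 hbs) fun n hn => (mem_filter.1 hn).2
  · have h2 : #(shiftedMultiples B k m ∩ shiftedMultiples B (K m') m') ≤ #A := by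
      refine (card_le_card fun v hv => ?_).trans (card_image_le (f := fun n => m * b * n))
      obtain ⟨hv1, hv2⟩ := mem_inter.1 hv
      obtain ⟨p, hp, hpv⟩ := mem_image.1 hv1
      obtain ⟨q, hq, hqv⟩ := mem_image.1 hv2
      have hpq : a * (p + 1) = b * (q + 1) := by
        have h3 : m * (p + 1) = m' * (q + 1) := hpv.trans hqv.symm
        rw [ha, hb, mul_assoc, mul_assoc] at h3
        exact Nat.eq_of_mul_eq_mul_left hg0 h3
      obtain ⟨n, hn⟩ := hco.symm.dvd_of_dvd_mul_left (Dvd.intro _ hpq.symm)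
      have hqn : q + 1 = a * n := by
        rw [hn, mul_left_comm] at hpq
        exact (Nat.eq_of_mul_eq_mul_left hb1 hpq).symm
      have hp' := mem_Ioc.1 (mem_filter.1 hp).1
      have hnp : n ≤ b * n := Nat.le_mul_of_pos_left n hb1
      refine mem_image.2 ⟨n, mem_filter.2 ⟨mem_range.2 (by omega), by omega, by omega, ?_, ?_⟩, ?_⟩
      · rw [← hqn]; exact (mem_filter.1 hq).2
      · rw [← hn]; exact (mem_filter.1 hp).2
      · rw [← hpv, hn, mul_assoc]
    refine (Nat.cast_le.2 h2).trans (h1.trans (le_of_eq ?_))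
    have h3 : (m' : ℝ) = g * b := by exact_mod_cast hb
    have h4 : (g : ℝ) ≠ 0 := by exact_mod_cast hg0.ne'
    rw [h3]
    field_simp
  · have h2 : (1 : ℝ) * b ≤ scale (E - 1) * b :=
      mul_le_mul_of_nonneg_right (one_le_scale (by linarith)) hb0.le
    rw [one_mul] at h2
    exact_mod_cast h2.trans hbs

lemma exists_sum_inv_le_Ncount : ∃ B : ℕ, 2 ≤ B ∧ ∃ C : ℝ, 0 < C ∧ ∀ (E t τ : ℝ) (D : Finset ℕ), 3 ≤ E →
    (2 : ℝ) ^ (B + 2) ≤ scale (E - 2) → 0 ≤ t → t ≤ E - 3 →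
    (∀ m ∈ D, 1 ≤ m ∧ m ∈ paleyMonoid ∧ (m : ℝ) ≤ scale t ∧ (#m.divisors : ℝ) ≤ τ) →
    C * (2 + E) ^ 6 * exp (-E) * τ * exp t ≤ 1 →
    scale E / log (scale E) * ((∑ m ∈ D, 1 / (m : ℝ)) / (8 * B)) ≤ Ncount (scale E) := by
  classical
  obtain ⟨B, hB, hpr⟩ := exists_card_primes_ge
  obtain ⟨C, hC, hI⟩ := exists_card_inter_le B
  refine ⟨B, hB, 2 * C, by positivity, fun E t τ D hE hBE ht0 ht hD hτ => ?_⟩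
  set x := scale E with hx
  set M := scale (E - 3) with hM
  set k : ℕ → ℕ := fun m => ⌊x / (2 * m * B)⌋₊ with hk
  have hB0 : (2 : ℝ) ≤ B := by exact_mod_cast hB
  have e1 := scale_sub_one_sq_le E
  have e2 := scale_sub_one_sq_le (E - 1)
  have e3 := scale_sub_one_sq_le (E - 2)
  rw [show E - 1 - 1 = E - 2 by ring] at e2
  rw [show E - 2 - 1 = E - 3 by ring] at e3
  have p1 := scale_pos (E - 1)
  have p2 := scale_pos (E - 2)
  have p3 := scale_pos (E - 3)
  have hx0 : 0 < x := scale_pos E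
  have hB4 : 4 * (B : ℝ) ≤ scale (E - 2) := by
    refine le_trans ?_ hBE
    have : B ≤ 2 ^ B := Nat.lt_two_pow_self.le
    have : (B : ℝ) ≤ 2 ^ B := by exact_mod_cast this
    rw [pow_add]
    linarith
  have hsc : scale t ≤ M := scale_le_scale.2 ht
  have hMx : M ≤ x := scale_le_scale.2 (by linarith)
  have hk1 : ∀ m ∈ D, ∀ b ∈ D, scale (E - 1) * b + 1 ≤ x / (2 * m * B) := by
    intro m hm b hb
    have hm1 : (1 : ℝ) ≤ m := by exact_mod_cast (hD m hm).1
    have hb1 : (1 : ℝ) ≤ b := by exact_mod_cast (hD b hb).1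
    have hmM := (hD m hm).2.2.1.trans hsc
    have hbM := (hD b hb).2.2.1.trans hsc
    have hs1 : 1 ≤ scale (E - 1) := one_le_scale (by linarith)
    rw [le_div_iff₀ (by positivity)]
    have h1 : scale (E - 1) * b + 1 ≤ 2 * (scale (E - 1) * M) := by
      have h2 : scale (E - 1) * b ≤ scale (E - 1) * M := mul_le_mul_of_nonneg_left hbM p1.le
      have h3 : 1 * 1 ≤ scale (E - 1) * b := mul_le_mul hs1 hb1 zero_le_one p1.le
      linarith
    calc (scale (E - 1) * b + 1) * (2 * m * B) ≤ 2 * (scale (E - 1) * M) * (2 * M * B) := by gcongr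
      _ = scale (E - 1) * ((4 * B) * M ^ 2) := by ring
      _ ≤ scale (E - 1) * (scale (E - 2) * scale (E - 2)) := by gcongr
      _ ≤ scale (E - 1) * scale (E - 1) := by rw [← sq (scale (E - 2))]; gcongr
      _ ≤ x := by rw [← sq]; exact e1
  have hk2 : ∀ m ∈ D, ∀ b ∈ D, scale (E - 1) * b ≤ k m := fun m hm b hb => by
    have h1 := hk1 m hm b hb
    have h2 := Nat.lt_floor_add_one (x / (2 * m * B))
    change _ < (k m : ℝ) + 1 at h2
    linarith
  have hk3 : ∀ m ∈ D, (k m : ℝ) * (2 * m * B) ≤ x := fun m hm => by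
    have hm1 : (1 : ℝ) ≤ m := by exact_mod_cast (hD m hm).1
    rw [← le_div_iff₀ (by positivity)]
    exact Nat.floor_le (by positivity)
  have hk4 : ∀ m ∈ D, 1 ≤ k m := fun m hm => by
    have h1 := hk2 m hm m hm
    have hm1 : (1 : ℝ) ≤ m := by exact_mod_cast (hD m hm).1
    have h2 : 1 * 1 ≤ scale (E - 1) * m := mul_le_mul (one_le_scale (by linarith)) hm1 zero_le_one p1.le
    exact_mod_cast (by linarith : (1 : ℝ) ≤ k m)
  have hkB : ∀ m ∈ D, ((B * k m : ℕ) : ℝ) ≤ x := fun m hm => by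
    have hm1 : (1 : ℝ) ≤ m := by exact_mod_cast (hD m hm).1
    have h1 : (0 : ℝ) ≤ k m * B := by positivity
    have h2 : (k m * B : ℝ) * 1 ≤ k m * B * (2 * m) := mul_le_mul_of_nonneg_left (by linarith) h1
    have h3 := hk3 m hm
    push_cast
    linarith
  have hkx : ∀ m ∈ D, (k m : ℝ) ≤ x := fun m hm =>
    le_trans (by exact_mod_cast Nat.le_mul_of_pos_left (k m) (by omega)) (hkB m hm)
  have hlog : log x = exp E - 1 := log_scale E
  have hlog0 : 0 < log x := by rw [hlog]; linarith [add_one_le_exp E]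
  set U := D.biUnion fun m => shiftedMultiples B (k m) m with hU
  have hUN : (#U : ℝ) ≤ Ncount x := by
    rw [Ncount_eq_card, Nat.cast_le]
    refine card_le_card fun v hv => ?_
    obtain ⟨m, hm, hv⟩ := mem_biUnion.1 hv
    obtain ⟨p, hp, rfl⟩ := mem_image.1 hv
    have hp' := mem_Ioc.1 (mem_filter.1 hp).1
    refine mem_filter.2 ⟨mem_Icc.2 ⟨Nat.mul_pos (hD m hm).1 p.succ_pos, Nat.le_floor ?_⟩, ?_⟩
    · refine le_trans ?_ (hk3 m hm)
      have h1 : m * (p + 1) ≤ k m * (2 * m * B) := by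
        have h2 : 1 ≤ B * k m := Nat.mul_pos (by omega) (hk4 m hm)
        calc m * (p + 1) ≤ m * (2 * (B * k m)) := Nat.mul_le_mul_left _ (by omega)
          _ = _ := by ring
      exact_mod_cast h1
    · exact mul_mem (S := Submonoid ℕ) (hD m hm).2.1 (Submonoid.subset_closure ⟨p, (mem_filter.1 hp).2, rfl⟩)
  have hV : ∀ m ∈ D, (k m : ℝ) / log x ≤ #(shiftedMultiples B (k m) m) := fun m hm => by
    rw [card_shiftedMultiples (hD m hm).1, div_le_iff₀ hlog0]
    refine (hpr (k m) (hk4 m hm)).trans ?_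
    rw [mul_comm]
    refine mul_le_mul_of_nonneg_left (log_le_log ?_ (hkB m hm)) (Nat.cast_nonneg _)
    exact_mod_cast Nat.mul_pos (by omega) (hk4 m hm)
  have hcol : ∀ m ∈ D, ∑ m' ∈ D.erase m, (#(shiftedMultiples B (k m) m ∩ shiftedMultiples B (k m') m') : ℝ) ≤
      k m / log x / 2 := by
    intro m hm
    have h1 : ∀ m' ∈ D.erase m, (#(shiftedMultiples B (k m) m ∩ shiftedMultiples B (k m') m') : ℝ) ≤
        C * k m * ((2 + E) ^ 6 * exp (-2 * E)) * ((m.gcd m' : ℝ) / m') := fun m' hm' =>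
      hI (k m) m k D E (by linarith) hm (fun b hb => ⟨(hD b hb).1, (hD b hb).2.2.1.trans (hsc.trans hMx),
        hk2 m hm b hb⟩) (hkx m hm) (hBE.trans (scale_le_scale.2 (by linarith))) m' (mem_of_mem_erase hm')
        (ne_of_mem_erase hm').symm
    refine (sum_le_sum h1).trans ?_
    rw [← mul_sum]
    have h2 := sum_gcd_div_le (N := ⌊scale t⌋₊) (D := D.erase m) (Nat.one_le_iff_ne_zero.1 (hD m hm).1)
      fun m' hm' => ⟨(hD m' (mem_of_mem_erase hm')).1, Nat.le_floor (hD m' (mem_of_mem_erase hm')).2.2.1⟩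
    have h3 : 1 + log (⌊scale t⌋₊ : ℝ) ≤ exp t := by
      have h4 := log_le_log (y := scale t) (by exact_mod_cast Nat.floor_pos.2 (one_le_scale ht0))
        (Nat.floor_le (scale_pos t).le)
      rw [log_scale] at h4
      linarith
    have h4 : ∑ m' ∈ D.erase m, (m.gcd m' : ℝ) / m' ≤ τ * exp t :=
      h2.trans (mul_le_mul (hD m hm).2.2.2 h3
        (add_nonneg zero_le_one (log_natCast_nonneg _)) ((Nat.cast_nonneg _).trans (hD m hm).2.2.2))
    have h5 : exp (-E) * log x ≤ 1 := by
      rw [hlog, mul_sub, ← exp_add, neg_add_cancel, exp_zero]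
      linarith [exp_pos (-E)]
    rw [div_div, le_div_iff₀ (by positivity)]
    have h6 : exp (-2 * E) = exp (-E) * exp (-E) := by rw [← exp_add]; ring_nf
    calc C * k m * ((2 + E) ^ 6 * exp (-2 * E)) * (∑ m' ∈ D.erase m, (m.gcd m' : ℝ) / m') * (log x * 2)
        ≤ C * k m * ((2 + E) ^ 6 * exp (-2 * E)) * (τ * exp t) * (log x * 2) := by gcongr
      _ = k m * (2 * C * (2 + E) ^ 6 * exp (-E) * τ * exp t) * (exp (-E) * log x) := by rw [h6]; ring
      _ ≤ k m * 1 * 1 := by gcongr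
      _ = k m := by ring
  have h1 := sum_card_le_card_biUnion (D := D) fun m => shiftedMultiples B (k m) m
  have h2 := (sum_le_sum hV).trans (h1.trans (add_le_add hUN (sum_le_sum hcol)))
  have h3 : ∑ m ∈ D, (k m : ℝ) / log x = 2 * ∑ m ∈ D, (k m : ℝ) / log x / 2 := by
    rw [mul_sum]; exact sum_congr rfl fun m _ => by ring
  have h4 : ∑ m ∈ D, (k m : ℝ) / log x / 2 ≤ Ncount x := by
    linarith
  refine le_trans ?_ h4
  rw [sum_div, mul_sum]
  refine sum_le_sum fun m hm => ?_
  have hm1 : (1 : ℝ) ≤ m := by exact_mod_cast (hD m hm).1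
  have h5 : x / (4 * m * B) ≤ k m := by
    have h6 := Nat.lt_floor_add_one (x / (2 * m * B))
    change _ < (k m : ℝ) + 1 at h6
    have h7 : (1 : ℝ) ≤ k m := by exact_mod_cast hk4 m hm
    have h8 : x / (4 * m * B) = x / (2 * m * B) / 2 := by field_simp; ring
    rw [h8]
    linarith
  calc x / log x * (1 / (m : ℝ) / (8 * B)) = x / (4 * m * B) / log x / 2 := by field_simp; ring
    _ ≤ _ := by gcongr

lemma tendsto_iterLog : Tendsto iterLog atTop atTop :=
  tendsto_log_atTop.comp (tendsto_atTop_add_const_left _ 1 tendsto_log_atTop)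

/-- The lower bound for the counting function in terms of a subsolution of
`∑ fordCoeff k * ρ ^ k < 1`. -/
lemma le_Ncount {ρ δ : ℝ} (hρ0 : 0 < ρ) (hρ1 : ρ < 1) (hδ0 : 0 < δ)
    (hF : ∀ n, ∑ m ∈ range n, fordCoeff (m + 1) * ρ ^ (m + 1) ≤ 1 - δ) :
    ∃ K : ℝ, ∀ᶠ x : ℝ in atTop, x / log x *
      exp (log (log (log x)) ^ 2 / (2 * log ρ⁻¹) - K * (log (log (log x)) + 1)) ≤ Ncount x := by
  obtain ⟨K, hK, hD⟩ := exists_structured_set hρ0 hρ1 hδ0 hF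
  obtain ⟨B, hB, C, hC, hN⟩ := exists_sum_inv_le_Ncount
  have hl : 0 < log ρ⁻¹ := log_pos ((one_lt_inv₀ hρ0).2 hρ1)
  set l := log ρ⁻¹
  set κ := 1 / (2 * (K + 1)) with hκ
  have hκ0 : 0 < κ := by positivity
  have hκ1 : κ ≤ 1 / 2 := one_div_le_one_div_of_le two_pos (by linarith)
  have hκK : (K + 1) * κ = 1 / 2 := by rw [hκ]; field_simp
  set d := |log κ| with hd
  have hd0 : 0 ≤ d := abs_nonneg _
  have hB0 : (2 : ℝ) ≤ B := by exact_mod_cast hB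
  have hlB : 0 ≤ log (8 * B) := log_nonneg (by linarith)
  have h8 : (8 * B : ℝ) = exp (log (8 * B)) := (exp_log (by linarith)).symm
  set lb := log (8 * B : ℝ)
  refine ⟨d / l + (d + 1) * K + K + lb, ?_⟩
  have hT : Tendsto (fun x => κ * iterLog x) atTop atTop := tendsto_iterLog.const_mul_atTop hκ0
  filter_upwards [hT.eventually hD, tendsto_iterLog.eventually_ge_atTop 12,
    tendsto_iterLog.eventually_ge_atTop (2 + iterLog (2 ^ (B + 2))),
    tendsto_iterLog.eventually (eventually_poly_mul_exp_neg_le (C * 2 ^ 6 * exp 2) 6 (c := 1 / 2) (δ := 1)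
      (by norm_num) one_pos),
    tendsto_log_atTop.eventually_ge_atTop (exp 1), eventually_ge_atTop 1,
    (tendsto_log_atTop.comp (tendsto_log_atTop.comp tendsto_log_atTop)).eventually_ge_atTop d]
    with x hx1 hx2 hx3 hx4 hx5 hx6 hx7
  obtain ⟨D, hD1, hD2⟩ := hx1
  change d ≤ log (log (log x)) at hx7
  set E := iterLog x with hE
  set W := log (log (log x)) with hW
  have hL0 : 0 < log x := (exp_pos 1).trans_le hx5
  have hlL : 1 ≤ log (log x) := by rw [le_log_iff_exp_le hL0]; exact hx5
  have hE2 : E ≤ 2 * log (log x) := iterLog_le_two_mul hx5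
  have hE1 : log (log x) ≤ E := log_le_log hL0 (by linarith)
  have hE0 : 0 < E := by linarith
  have hsx : scale E = x := scale_iterLog hx6
  have hκE : κ * E ≤ 1 / 2 * E := mul_le_mul_of_nonneg_right hκ1 hE0.le
  have h1 := hN E (κ * E + 2) (exp (K * (κ * E))) D (by linarith)
    ((le_scale_iff (one_le_pow₀ one_le_two)).2 (by linarith)) (by positivity) (by linarith) ?_ ?_
  · rw [hsx] at h1
    refine le_trans (mul_le_mul_of_nonneg_left ?_ (div_nonneg (by linarith) hL0.le)) h1
    rw [le_div_iff₀ (by linarith)]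
    refine le_trans ?_ hD2
    rw [h8, ← exp_add]
    refine exp_le_exp.2 ?_
    have hw : log (κ * E) = log κ + log E := log_mul hκ0.ne' hE0.ne'
    have hw1 : W - d ≤ log (κ * E) := by
      have h2 : W ≤ log E := log_le_log (by linarith) hE1
      linarith [neg_abs_le (log κ)]
    have hw2 : log (κ * E) ≤ W + d + 1 := by
      have h2 : log E ≤ log 2 + W := by
        rw [hW, ← log_mul two_ne_zero (by linarith)]; exact log_le_log hE0 hE2
      linarith [le_abs_self (log κ), log_two_lt_d9]
    set w := log (κ * E)
    have h2 : (W ^ 2 - 2 * W * d) / (2 * l) ≤ w ^ 2 / (2 * l) :=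
      div_le_div_of_nonneg_right (by nlinarith) (by linarith)
    have h3 : (W ^ 2 - 2 * W * d) / (2 * l) = W ^ 2 / (2 * l) - d / l * W := by field_simp
    have h4 : K * (w + 1) ≤ K * (W + d + 1 + 1) := mul_le_mul_of_nonneg_left (by linarith) hK.le
    have hW0 : 0 ≤ W := hd0.trans hx7
    have h5 : 0 ≤ d / l := by positivity
    have h6 : 0 ≤ (d + 1) * K * W := by positivity
    have h7 : 0 ≤ lb * W := by positivity
    linarith
  · intro m hm
    obtain ⟨⟨l, hl1, hl2⟩, h3, h4⟩ := hD1 m hm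
    have hm0 : m ≠ 0 := hl2 ▸ shiftProd_ne_zero l
    refine ⟨Nat.one_le_iff_ne_zero.2 hm0, mem_paleyMonoid_iff.2 ⟨l, hl1, hl2⟩, h3,
      (card_le_two_pow hm0).trans ?_⟩
    have h5 : (2 : ℝ) ≤ exp 1 := by linarith [add_one_le_exp (1 : ℝ)]
    calc (2 : ℝ) ^ m.primeFactorsList.length ≤ exp 1 ^ m.primeFactorsList.length :=
          pow_le_pow_left₀ zero_le_two h5 _
      _ = exp (m.primeFactorsList.length) := by rw [← exp_nat_mul, mul_one]
      _ ≤ _ := exp_le_exp.2 h4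
  · have h2 : exp (-E) * exp (K * (κ * E)) * exp (κ * E + 2) = exp 2 * exp (-(1 / 2 * E)) := by
      rw [← exp_add, ← exp_add, ← exp_add]
      congr 1
      have : (K + 1) * κ * E = 1 / 2 * E := by rw [hκK]
      linarith
    have h3 : (2 + E) ^ 6 ≤ 2 ^ 6 * (1 + E) ^ 6 := by
      rw [← mul_pow]
      exact pow_le_pow_left₀ (by linarith) (by linarith) 6
    calc C * (2 + E) ^ 6 * exp (-E) * exp (K * (κ * E)) * exp (κ * E + 2)
        = C * (2 + E) ^ 6 * (exp (-E) * exp (K * (κ * E)) * exp (κ * E + 2)) := by ring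
      _ ≤ C * (2 ^ 6 * (1 + E) ^ 6) * (exp 2 * exp (-(1 / 2 * E))) := by rw [h2]; gcongr
      _ = C * 2 ^ 6 * exp 2 * (1 + E) ^ 6 * exp (-(1 / 2 * E)) := by ring
      _ ≤ 1 := hx4

lemma two_mul_div_le_log {x : ℝ} (hx : 0 ≤ x) : 2 * x / (x + 2) ≤ log (1 + x) :=
  Real.le_log_one_add_of_nonneg hx

lemma log_seven_bounds : 1.94591013 ≤ log 7 ∧ log 7 ≤ 1.94591017 := by
  have h1 := Real.log_two_gt_d9
  have h2 := Real.log_two_lt_d9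
  have h3 := Real.log_three_gt_d9
  have h4 := Real.log_three_lt_d9
  have h5 := Real.log_five_gt_d9
  have h6 := Real.log_five_lt_d9
  constructor
  · have h := two_mul_div_le_log (show (0 : ℝ) ≤ 1 / 2400 by norm_num)
    rw [show (1 + 1 / 2400 : ℝ) = 7 ^ 4 / (2 ^ 5 * 3 * 5 ^ 2) by norm_num,
      log_div (by norm_num) (by norm_num), log_mul (by norm_num) (by norm_num),
      log_mul (by norm_num) (by norm_num), log_pow, log_pow, log_pow] at h
    norm_num at h h1 h2 h3 h4 h5 h6 ⊢
    linarith
  · have h := two_mul_div_le_log (show (0 : ℝ) ≤ 1 / 224 by norm_num)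
    rw [show (1 + 1 / 224 : ℝ) = 3 ^ 2 * 5 ^ 2 / (2 ^ 5 * 7) by norm_num,
      log_div (by norm_num) (by norm_num), log_mul (by norm_num) (by norm_num),
      log_mul (by norm_num) (by norm_num), log_pow, log_pow, log_pow] at h
    norm_num at h h1 h2 h3 h4 h5 h6 ⊢
    linarith

lemma log_eleven_bounds : 2.3978951 ≤ log 11 ∧ log 11 ≤ 2.3978954 := by
  have h1 := Real.log_two_gt_d9
  have h2 := Real.log_two_lt_d9
  have h3 := Real.log_three_gt_d9
  have h4 := Real.log_three_lt_d9
  have h5 := Real.log_five_gt_d9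
  have h6 := Real.log_five_lt_d9
  have h7 := log_seven_bounds.1
  have h8 := log_seven_bounds.2
  constructor
  · have h := two_mul_div_le_log (show (0 : ℝ) ≤ 1 / 120 by norm_num)
    rw [show (1 + 1 / 120 : ℝ) = 11 ^ 2 / (2 ^ 3 * 3 * 5) by norm_num,
      log_div (by norm_num) (by norm_num), log_mul (by norm_num) (by norm_num),
      log_mul (by norm_num) (by norm_num), log_pow, log_pow] at h
    norm_num at h h1 h2 h3 h4 h5 h6 h7 h8 ⊢
    linarith
  · have h := two_mul_div_le_log (show (0 : ℝ) ≤ 1 / 440 by norm_num)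
    rw [show (1 + 1 / 440 : ℝ) = 3 ^ 2 * 7 ^ 2 / (2 ^ 3 * 5 * 11) by norm_num,
      log_div (by norm_num) (by norm_num), log_mul (by norm_num) (by norm_num),
      log_mul (by norm_num) (by norm_num), log_mul (by norm_num) (by norm_num),
      log_pow, log_pow, log_pow] at h
    norm_num at h h1 h2 h3 h4 h5 h6 h7 h8 ⊢
    linarith

lemma log_thirteen_bounds : 2.5649492 ≤ log 13 ∧ log 13 ≤ 2.5649495 := by
  have h1 := Real.log_two_gt_d9
  have h2 := Real.log_two_lt_d9
  have h3 := Real.log_three_gt_d9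
  have h4 := Real.log_three_lt_d9
  have h5 := Real.log_five_gt_d9
  have h6 := Real.log_five_lt_d9
  have h7 := log_seven_bounds.1
  have h8 := log_seven_bounds.2
  constructor
  · have h := two_mul_div_le_log (show (0 : ℝ) ≤ 1 / 168 by norm_num)
    rw [show (1 + 1 / 168 : ℝ) = 13 ^ 2 / (2 ^ 3 * 3 * 7) by norm_num,
      log_div (by norm_num) (by norm_num), log_mul (by norm_num) (by norm_num),
      log_mul (by norm_num) (by norm_num), log_pow, log_pow] at h
    norm_num at h h1 h2 h3 h4 h5 h6 h7 h8 ⊢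
    linarith
  · have h := two_mul_div_le_log (show (0 : ℝ) ≤ 1 / 195 by norm_num)
    rw [show (1 + 1 / 195 : ℝ) = 2 ^ 2 * 7 ^ 2 / (3 * 5 * 13) by norm_num,
      log_div (by norm_num) (by norm_num), log_mul (by norm_num) (by norm_num),
      log_mul (by norm_num) (by norm_num), log_mul (by norm_num) (by norm_num),
      log_pow, log_pow] at h
    norm_num at h h1 h2 h3 h4 h5 h6 h7 h8 ⊢
    linarith

lemma le_log_seventeen : 2.8332133 ≤ log 17 := by
  have h1 := Real.log_two_gt_d9
  have h3 := Real.log_three_gt_d9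
  have h := two_mul_div_le_log (show (0 : ℝ) ≤ 1 / 288 by norm_num)
  rw [show (1 + 1 / 288 : ℝ) = 17 ^ 2 / (2 ^ 5 * 3 ^ 2) by norm_num,
    log_div (by norm_num) (by norm_num), log_mul (by norm_num) (by norm_num),
    log_pow, log_pow, log_pow] at h
  norm_num at h h1 h3 ⊢
  linarith

lemma log_composites :
    log 4 = 2 * log 2 ∧ log 6 = log 2 + log 3 ∧ log 8 = 3 * log 2 ∧ log 9 = 2 * log 3 ∧
    log 10 = log 2 + log 5 ∧ log 12 = 2 * log 2 + log 3 ∧ log 14 = log 2 + log 7 ∧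
    log 15 = log 3 + log 5 ∧ log 16 = 4 * log 2 ∧ log 18 = log 2 + 2 * log 3 := by
  have h4 : log (2 ^ 2) = (2 : ℕ) * log 2 := by rw [Real.log_pow]
  have h8 : log (2 ^ 3) = (3 : ℕ) * log 2 := by rw [Real.log_pow]
  have h9 : log (3 ^ 2) = (2 : ℕ) * log 3 := by rw [Real.log_pow]
  have h16 : log (2 ^ 4) = (4 : ℕ) * log 2 := by rw [Real.log_pow]
  have h6 : log (2 * 3) = log 2 + log 3 := log_mul (by norm_num) (by norm_num)
  have h10 : log (2 * 5) = log 2 + log 5 := log_mul (by norm_num) (by norm_num)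
  have h12 : log (4 * 3) = log 4 + log 3 := log_mul (by norm_num) (by norm_num)
  have h14 : log (2 * 7) = log 2 + log 7 := log_mul (by norm_num) (by norm_num)
  have h15 : log (3 * 5) = log 3 + log 5 := log_mul (by norm_num) (by norm_num)
  have h18 : log (2 * 9) = log 2 + log 9 := log_mul (by norm_num) (by norm_num)
  norm_num at h4 h8 h9 h16 h6 h10 h12 h14 h15 h18
  refine ⟨h4, h6, h8, h9, h10, ?_, h14, h15, h16, ?_⟩ <;> linarith

lemma one_lt_sum_fordCoeff : 1 < ∑ j ∈ range 17, fordCoeff (j + 1) * (0.54263 : ℝ) ^ (j + 1) := by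
  obtain ⟨h4, h6, h8, h9, h10, h12, h14, h15, h16, h18⟩ := log_composites
  have h2 := Real.log_two_gt_d9
  have h3 := Real.log_three_gt_d9
  have h5 := Real.log_five_gt_d9
  have h7 := log_seven_bounds.1
  have h11 := log_eleven_bounds.1
  have h13 := log_thirteen_bounds.1
  have h17 := le_log_seventeen
  simp only [sum_range_succ, sum_range_zero, fordCoeff]
  norm_num [h4, h6, h8, h9, h10, h12, h14, h15, h16, h18]
  norm_num at h2 h3 h5 h7 h11 h13 h17
  linarith

lemma sum_fordCoeff_lt :
    ∑ j ∈ range 14, fordCoeff (j + 1) * (0.542595 : ℝ) ^ (j + 1) +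
      (log 16 + 0.542595 * (1 / 16 / (1 - 0.542595))) / (1 - 0.542595) * 0.542595 ^ 15 ≤
      1 - 0.000005 := by
  obtain ⟨h4, h6, h8, h9, h10, h12, h14, h15, h16, h18⟩ := log_composites
  have h2 := Real.log_two_lt_d9
  have h3 := Real.log_three_lt_d9
  have h5 := Real.log_five_lt_d9
  have h7 := log_seven_bounds.2
  have h11 := log_eleven_bounds.2
  have h13 := log_thirteen_bounds.2
  simp only [sum_range_succ, sum_range_zero, fordCoeff]
  norm_num [h4, h6, h8, h9, h10, h12, h14, h15, h16, h18]
  norm_num at h2 h3 h5 h7 h11 h13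
  linarith

lemma fordCoeff_le_log (k : ℕ) : fordCoeff (k + 1) ≤ log (k + 2) := by
  have hk : (0 : ℝ) ≤ k := Nat.cast_nonneg k
  have h1 := Real.log_le_sub_one_of_pos (show (0 : ℝ) < (k + 2) / (k + 1) by positivity)
  rw [Real.log_div (by positivity) (by positivity)] at h1
  have h2 : (k + 1 : ℝ) * ((k + 2) / (k + 1) - 1) = 1 := by field_simp; ring
  have h3 := mul_le_mul_of_nonneg_left h1 (show (0 : ℝ) ≤ k + 1 by positivity)
  unfold fordCoeff
  push_cast
  rw [show (k + 1 + 1 : ℝ) = k + 2 by ring]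
  linarith

lemma fordCoeff_tail_le (i : ℕ) : fordCoeff (14 + i + 1) ≤ log 16 + i * (1 / 16) := by
  have hi : (0 : ℝ) ≤ i := Nat.cast_nonneg i
  have h1 := fordCoeff_le_log (14 + i)
  have h2 := Real.log_le_sub_one_of_pos (show (0 : ℝ) < (16 + i) / 16 by positivity)
  rw [Real.log_div (by positivity) (by positivity)] at h2
  push_cast at h1
  rw [show (14 + i + 2 : ℝ) = 16 + i by ring] at h1
  linarith

lemma sum_affine_mul_pow_le {a b r : ℝ} (ha : 0 ≤ a) (hb : 0 ≤ b) (hr0 : 0 ≤ r) (hr1 : r < 1)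
    (n : ℕ) : ∑ i ∈ range n, (a + i * b) * r ^ i ≤ (a + r * (b / (1 - r))) / (1 - r) := by
  have h1 : 0 < 1 - r := by linarith
  have key : ∑ i ∈ range n, (a + i * b) * r ^ i =
      (a + r * (b / (1 - r))) / (1 - r) -
        ((a + r * (b / (1 - r))) / (1 - r) + n * (b / (1 - r))) * r ^ n := by
    induction n with
    | zero => simp
    | succ n ih =>
      rw [sum_range_succ, ih]
      push_cast
      field_simp
      ring
  rw [key]
  have : 0 ≤ ((a + r * (b / (1 - r))) / (1 - r) + n * (b / (1 - r))) * r ^ n := by positivity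
  linarith

lemma sum_fordCoeff_le (n : ℕ) :
    ∑ m ∈ range n, fordCoeff (m + 1) * (0.542595 : ℝ) ^ (m + 1) ≤ 1 - 0.000005 := by
  have h0 : ∑ m ∈ range n, fordCoeff (m + 1) * (0.542595 : ℝ) ^ (m + 1) ≤
      ∑ m ∈ range (14 + n), fordCoeff (m + 1) * (0.542595 : ℝ) ^ (m + 1) :=
    sum_le_sum_of_subset_of_nonneg (range_mono (by lia))
      fun m _ _ => mul_nonneg (fordCoeff_nonneg m) (by positivity)
  rw [sum_range_add] at h0
  have h1 : ∑ i ∈ range n, fordCoeff (14 + i + 1) * (0.542595 : ℝ) ^ (14 + i + 1) ≤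
      (∑ i ∈ range n, (log 16 + i * (1 / 16)) * (0.542595 : ℝ) ^ i) * 0.542595 ^ 15 := by
    rw [sum_mul]
    refine sum_le_sum fun i _ => ?_
    rw [show 14 + i + 1 = i + 15 by ring, pow_add, ← mul_assoc]
    have := fordCoeff_tail_le i
    rw [show 14 + i + 1 = i + 15 by ring] at this
    gcongr
  have h2 := sum_affine_mul_pow_le (log_nonneg (show (1 : ℝ) ≤ 16 by norm_num))
    (show (0 : ℝ) ≤ 1 / 16 by norm_num) (show (0 : ℝ) ≤ 0.542595 by norm_num) (by norm_num) n
  have h3 := mul_le_mul_of_nonneg_right h2 (show (0 : ℝ) ≤ 0.542595 ^ 15 by positivity)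
  linarith [sum_fordCoeff_lt]

lemma log_inv_decompose {u : ℝ} (hu : 0 < 1 + u) :
    log (625 / 1152 * (1 + u))⁻¹ = 7 * log 2 + 2 * log 3 - 4 * log 5 - log (1 + u) := by
  have h : log ((5 : ℝ) ^ 4 / (2 ^ 7 * 3 ^ 2)) = 4 * log 5 - (7 * log 2 + 2 * log 3) := by
    rw [log_div (by norm_num) (by norm_num), log_mul (by norm_num) (by norm_num), log_pow,
      log_pow, log_pow]
    norm_num
  rw [show (5 : ℝ) ^ 4 / (2 ^ 7 * 3 ^ 2) = 625 / 1152 by norm_num] at h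
  rw [log_inv, log_mul (by norm_num) hu.ne', h]
  ring

lemma le_log_inv : 1 / 1.6358 ≤ log (0.54263 : ℝ)⁻¹ := by
  have h2 := Real.log_two_gt_d9
  have h3 := Real.log_three_gt_d9
  have h5 := Real.log_five_lt_d9
  have h := log_inv_decompose (u := 0.54263 * 1152 / 625 - 1) (by norm_num)
  rw [show (625 / 1152 * (1 + (0.54263 * 1152 / 625 - 1)) : ℝ) = 0.54263 by norm_num] at h
  have h1 := Real.log_le_sub_one_of_pos
    (show (0 : ℝ) < 1 + (0.54263 * 1152 / 625 - 1) by norm_num)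
  rw [h]
  norm_num at h1 h2 h3 h5 ⊢
  linarith

lemma log_inv_le : log (0.542595 : ℝ)⁻¹ ≤ 1 / 1.6356 := by
  have h2 := Real.log_two_lt_d9
  have h3 := Real.log_three_lt_d9
  have h5 := Real.log_five_gt_d9
  have h := log_inv_decompose (u := 0.542595 * 1152 / 625 - 1) (by norm_num)
  rw [show (625 / 1152 * (1 + (0.542595 * 1152 / 625 - 1)) : ℝ) = 0.542595 by norm_num] at h
  have h1 := two_mul_div_le_log (show (0 : ℝ) ≤ 0.542595 * 1152 / 625 - 1 by norm_num)
  rw [h]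
  norm_num at h1 h2 h3 h5 ⊢
  linarith

lemma eventually_linear_le_sq (K : ℝ) {ε : ℝ} (hε : 0 < ε) :
    ∀ᶠ W : ℝ in atTop, K * (W + 1) ≤ ε * W ^ 2 := by
  filter_upwards [eventually_ge_atTop 1, eventually_ge_atTop (2 * |K| / ε)] with W h1 h2
  rw [div_le_iff₀ hε] at h2
  calc K * (W + 1) ≤ |K| * (W + 1) := by gcongr; exact le_abs_self K
    _ ≤ |K| * (2 * W) := by gcongr; linarith
    _ = 2 * |K| * W := by ring
    _ ≤ W * ε * W := by gcongr
    _ = ε * W ^ 2 := by ring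

theorem paleyMonoid_count_asymptotics :
    ∀ ε : ℝ, ε > 0 → ∃ x₀ : ℝ, ∀ x : ℝ, x ≥ x₀ →
      x / Real.log x *
          Real.exp ((0.8178 - ε) * Real.log (Real.log (Real.log x)) ^ 2)
        ≤ (Ncount x : ℝ) ∧
      (Ncount x : ℝ) ≤
        x / Real.log x *
          Real.exp ((0.8179 + ε) * Real.log (Real.log (Real.log x)) ^ 2) := by
  intro ε hε
  obtain ⟨K₁, hK₁⟩ := Ncount_le (by norm_num) (by norm_num) one_lt_sum_fordCoeff
  obtain ⟨K₂, hK₂⟩ := le_Ncount (by norm_num) (by norm_num) (by norm_num) sum_fordCoeff_le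
  have hl₁ := le_log_inv
  have hl₂ := log_inv_le
  have hl₀ : 0 < log (0.542595 : ℝ)⁻¹ := log_pos (by norm_num)
  have hc₁ : 1 / (2 * log (0.54263 : ℝ)⁻¹) ≤ 0.8179 := by
    rw [div_le_iff₀ (by linarith)]
    linarith
  have hc₂ : 0.8178 ≤ 1 / (2 * log (0.542595 : ℝ)⁻¹) := by
    rw [le_div_iff₀ (by linarith)]
    linarith
  have hW : Tendsto (fun x => log (log (log x))) atTop atTop :=
    tendsto_log_atTop.comp (tendsto_log_atTop.comp tendsto_log_atTop)
  rw [← eventually_atTop]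
  filter_upwards [hK₁, hK₂, hW.eventually (eventually_linear_le_sq K₁ hε),
    hW.eventually (eventually_linear_le_sq K₂ hε), eventually_ge_atTop 1]
    with x h₁ h₂ h₃ h₄ h₅
  have hx : 0 ≤ x / log x := div_nonneg (by linarith) (log_nonneg h₅)
  constructor
  · refine le_trans (mul_le_mul_of_nonneg_left (exp_le_exp.2 ?_) hx) h₂
    have := mul_le_mul_of_nonneg_right hc₂ (sq_nonneg (log (log (log x))))
    rw [one_div_mul_eq_div] at this
    linarith
  · refine h₁.trans (mul_le_mul_of_nonneg_left (exp_le_exp.2 ?_) hx)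
    have := mul_le_mul_of_nonneg_right hc₁ (sq_nonneg (log (log (log x))))
    rw [one_div_mul_eq_div] at this
    linarith
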